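/- Halász's Theorem for arithmetic progressions: For every κ > 0 there is a constant C = C(κ) > 0 such that for all f in the class C(κ), all natural numbers q ≥ 1 and a with gcd(a,q) = 1, and all real x ≥ max(q^4, C), one has |∑_{n ≤ x, n ≡ a (mod q)} f(n)| ≤ C · (1/φ(q)) · (x/log x) · ( ∫_{1/log x}^{1} ( max over Dirichlet characters χ mod q and |t| ≤ (log x)^κ of |F_χ(1+σ+it)/(1+σ+it)| ) dσ/σ + (log(q·log x))^κ ), where F_χ(s) = ∑_{n≥1} f(n)·χ(n)·n^{−s} is the twisted Dirichlet series and φ is Euler's totient function. -/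

import Mathlib

open Complex MeasureTheory
open scoped Classical

noncomputable section

/-- Membership of `f` in the class `C(κ)`, witnessed by `Λf`. -/
structure IsHalaszClass (κ : ℝ) (f : ℕ → ℂ) (Λf : ℕ → ℂ) : Prop where
  map_one : f 1 = 1
  mult : ∀ m n : ℕ, Nat.Coprime m n → f (m * n) = f m * f n
  supp : ∀ n : ℕ, ¬ IsPrimePow n → Λf n = 0
  bound : ∀ n : ℕ, 1 ≤ n → ‖Λf n‖ ≤ κ * ArithmeticFunction.vonMangoldt n
  conv : ∀ n : ℕ, 1 ≤ n →
    f n * (Real.log n : ℂ) = ∑ d ∈ n.divisors, Λf d * f (n / d)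
  abs_conv : ∀ σ : ℝ, 1 < σ → Summable (fun n : ℕ => ‖f n‖ / (n : ℝ) ^ σ)

/-- The Dirichlet series `F(s) = ∑ f(n) n^{-s}`. -/
def Fser (f : ℕ → ℂ) (s : ℂ) : ℂ := ∑' n : ℕ, f n / (n : ℂ) ^ s

/-- The twisted Dirichlet series `F_χ(s) = ∑ f(n) χ(n) n^{-s}`. -/
def FserChi {q : ℕ} (f : ℕ → ℂ) (χ : DirichletCharacter ℂ q) (s : ℂ) : ℂ :=
  ∑' n : ℕ, f n * χ (n : ZMod q) / (n : ℂ) ^ s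

namespace Halasz

section Sieve

open Finset Nat

/-- Squarefree integers up to `z` coprime to `q`. -/
def sieveSupport (q z : ℕ) : Finset ℕ :=
  (Finset.Icc 1 z).filter (fun d => Squarefree d ∧ Nat.Coprime d q)

lemma mem_sieveSupport {q z d : ℕ} :
    d ∈ sieveSupport q z ↔ (1 ≤ d ∧ d ≤ z) ∧ Squarefree d ∧ Nat.Coprime d q := by
  simp [sieveSupport]

lemma sieveSupport_of_dvd {q z d m : ℕ} (hm : m ∈ sieveSupport q z) (hd : d ∣ m) :
    d ∈ sieveSupport q z := by
  rw [mem_sieveSupport] at *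
  obtain ⟨⟨h1, h2⟩, h3, h4⟩ := hm
  exact ⟨⟨Nat.pos_of_dvd_of_pos hd h1, (Nat.le_of_dvd h1 hd).trans h2⟩,
    h3.squarefree_of_dvd hd, h4.coprime_dvd_left hd⟩

def sieveG (q z : ℕ) : ℝ := ∑ m ∈ sieveSupport q z, 1 / (m.totient : ℝ)

/-- Selberg's weights divided by `d`. -/
def sieveWeight (q z d : ℕ) : ℝ :=
  (ArithmeticFunction.moebius d : ℝ) *
    (∑ m ∈ (sieveSupport q z).filter (fun m => d ∣ m), 1 / (m.totient : ℝ)) / sieveG q z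

lemma sieveG_pos {q z : ℕ} (hz : 1 ≤ z) : 0 < sieveG q z := by
  apply Finset.sum_pos
  · intro m hm
    rw [mem_sieveSupport] at hm
    have : 0 < m.totient := Nat.totient_pos.2 hm.1.1
    positivity
  · exact ⟨1, mem_sieveSupport.2 ⟨⟨le_rfl, hz⟩, squarefree_one, by simp⟩⟩

lemma sieveWeight_one {q z : ℕ} (hz : 1 ≤ z) : sieveWeight q z 1 = 1 := by
  have := (sieveG_pos (q := q) hz).ne'
  simp only [sieveWeight, isUnit_one, IsUnit.dvd, Finset.filter_true, ArithmeticFunction.moebius_apply_one]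
  rw [← sieveG]
  field_simp
  norm_num

lemma abs_sieveWeight_le {q z d : ℕ} (hz : 1 ≤ z) : |sieveWeight q z d| ≤ 1 := by
  have hG := sieveG_pos (q := q) hz
  rw [sieveWeight, abs_div, abs_mul, abs_of_pos hG, div_le_one hG]
  have h1 : |(ArithmeticFunction.moebius d : ℝ)| ≤ 1 := by
    exact_mod_cast ArithmeticFunction.abs_moebius_le_one
  have h2 : |∑ m ∈ (sieveSupport q z).filter (fun m => d ∣ m), 1 / (m.totient : ℝ)| ≤ sieveG q z := by
    rw [abs_of_nonneg (Finset.sum_nonneg fun _ _ => by positivity)]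
    exact Finset.sum_le_sum_of_subset_of_nonneg (Finset.filter_subset _ _) (fun _ _ _ => by positivity)
  calc _ ≤ 1 * sieveG q z := mul_le_mul h1 h2 (abs_nonneg _) zero_le_one
    _ = _ := one_mul _

lemma sum_moebius_between {m l : ℕ} (hm : Squarefree m) (hl : l ∣ m) :
    ∑ d ∈ m.divisors.filter (fun d => l ∣ d), (ArithmeticFunction.moebius d : ℝ) =
      if l = m then (ArithmeticFunction.moebius l : ℝ) else 0 := by
  have hm0 : m ≠ 0 := hm.ne_zero
  have hl0 : l ≠ 0 := ne_zero_of_dvd_ne_zero hm0 hl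
  obtain ⟨k, rfl⟩ := hl
  have hk0 : k ≠ 0 := by rintro rfl; simp at hm0
  have hlk : l.Coprime k := Nat.coprime_of_squarefree_mul hm
  have h1 : (l * k).divisors.filter (fun d => l ∣ d) = k.divisors.image (fun e => l * e) := by
    ext d
    simp only [mem_filter, Nat.mem_divisors, mem_image]
    constructor
    · rintro ⟨⟨h, _⟩, e, rfl⟩
      exact ⟨e, ⟨Nat.dvd_of_mul_dvd_mul_left (Nat.pos_of_ne_zero hl0) h, hk0⟩, rfl⟩
    · rintro ⟨e, ⟨h, _⟩, rfl⟩
      exact ⟨⟨Nat.mul_dvd_mul_left l h, hm0⟩, Dvd.intro e rfl⟩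
  rw [h1, Finset.sum_image (fun a _ b _ h => Nat.eq_of_mul_eq_mul_left (Nat.pos_of_ne_zero hl0) h)]
  have h2 : ∀ e ∈ k.divisors, (ArithmeticFunction.moebius (l * e) : ℝ) =
      ArithmeticFunction.moebius l * ArithmeticFunction.moebius e := by
    intro e he
    have : l.Coprime e := hlk.coprime_dvd_right (Nat.dvd_of_mem_divisors he)
    rw [ArithmeticFunction.isMultiplicative_moebius.map_mul_of_coprime this]
    push_cast; rfl
  rw [Finset.sum_congr rfl h2, ← Finset.mul_sum]
  have h3 : ∑ e ∈ k.divisors, (ArithmeticFunction.moebius e : ℝ) = if k = 1 then 1 else 0 := by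
    have := congrArg (fun f => f k) ArithmeticFunction.coe_zeta_mul_moebius
    simp only [ArithmeticFunction.coe_zeta_mul_apply, ArithmeticFunction.one_apply] at this
    exact_mod_cast this
  rw [h3]
  by_cases hk : k = 1
  · simp [hk]
  · have : ¬ l = l * k := by
      intro h
      exact hk (Nat.eq_of_mul_eq_mul_left (Nat.pos_of_ne_zero hl0) (by rw [mul_one]; exact h.symm))
    simp [hk, this]

lemma sum_sieveWeight {q z l : ℕ} :
    ∑ d ∈ (sieveSupport q z).filter (fun d => l ∣ d), sieveWeight q z d =
      if l ∈ sieveSupport q z then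
        (ArithmeticFunction.moebius l : ℝ) / (l.totient * sieveG q z) else 0 := by
  have h1 : ∑ d ∈ (sieveSupport q z).filter (fun d => l ∣ d), sieveWeight q z d =
      ∑ m ∈ sieveSupport q z, (1 / (m.totient : ℝ)) / sieveG q z *
        ∑ d ∈ m.divisors.filter (fun d => l ∣ d), (ArithmeticFunction.moebius d : ℝ) := by
    simp only [sieveWeight, Finset.sum_filter, Finset.mul_sum, Finset.sum_div]
    have : ∀ m ∈ sieveSupport q z, ∑ d ∈ m.divisors, (1 / (m.totient : ℝ)) / sieveG q z *
        (if l ∣ d then (ArithmeticFunction.moebius d : ℝ) else 0) =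
        ∑ d ∈ sieveSupport q z, if d ∣ m then (1 / (m.totient : ℝ)) / sieveG q z *
        (if l ∣ d then (ArithmeticFunction.moebius d : ℝ) else 0) else 0 := by
      intro m hm
      rw [← Finset.sum_filter]
      apply Finset.sum_congr _ (fun _ _ => rfl)
      ext d
      simp only [Nat.mem_divisors, mem_filter]
      constructor
      · rintro ⟨h, _⟩
        exact ⟨sieveSupport_of_dvd hm h, h⟩
      · rintro ⟨_, h⟩
        exact ⟨h, Nat.pos_iff_ne_zero.1 (mem_sieveSupport.1 hm).1.1⟩
    rw [Finset.sum_congr rfl this, Finset.sum_comm]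
    apply Finset.sum_congr rfl
    intro d _
    by_cases h : l ∣ d
    · simp only [h, if_true]
      apply Finset.sum_congr rfl
      intro m _
      split_ifs
      · ring
      · simp
    · simp [h]
  rw [h1]
  have h2 : ∀ m ∈ sieveSupport q z, (1 / (m.totient : ℝ)) / sieveG q z *
        ∑ d ∈ m.divisors.filter (fun d => l ∣ d), (ArithmeticFunction.moebius d : ℝ) =
        if l = m then (ArithmeticFunction.moebius l : ℝ) / (l.totient * sieveG q z) else 0 := by
    intro m hm
    by_cases hl : l ∣ m
    · rw [sum_moebius_between (mem_sieveSupport.1 hm).2.1 hl]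
      split_ifs with h
      · subst h; rw [div_div, div_mul_eq_mul_div, one_mul]
      · simp
    · have : m.divisors.filter (fun d => l ∣ d) = ∅ := by
        apply Finset.filter_eq_empty_iff.2
        intro d hd h
        exact hl (h.trans (Nat.dvd_of_mem_divisors hd))
      rw [this]
      have : l ≠ m := by rintro rfl; exact hl dvd_rfl
      simp [this]
  rw [Finset.sum_congr rfl h2, Finset.sum_ite_eq]

lemma sieve_quadratic {q z : ℕ} (hz : 1 ≤ z) :
    ∑ d ∈ sieveSupport q z, ∑ e ∈ sieveSupport q z,
      sieveWeight q z d * sieveWeight q z e * (Nat.gcd d e : ℝ) = 1 / sieveG q z := by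
  have hG := (sieveG_pos (q := q) hz).ne'
  have h1 : ∀ d ∈ sieveSupport q z, ∀ e ∈ sieveSupport q z, (Nat.gcd d e : ℝ) =
      ∑ l ∈ Finset.Icc 1 z, if l ∣ d ∧ l ∣ e then (l.totient : ℝ) else 0 := by
    intro d hd e he
    rw [mem_sieveSupport] at hd
    have : (Nat.gcd d e : ℝ) = ∑ l ∈ (Nat.gcd d e).divisors, (l.totient : ℝ) := by
      exact_mod_cast (Nat.sum_totient _).symm
    rw [this, ← Finset.sum_filter]
    apply Finset.sum_congr _ (fun _ _ => rfl)
    ext l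
    simp only [Nat.mem_divisors, mem_filter, Finset.mem_Icc, Nat.dvd_gcd_iff]
    constructor
    · rintro ⟨h, h'⟩
      exact ⟨⟨Nat.pos_of_dvd_of_pos h.1 hd.1.1, (Nat.le_of_dvd hd.1.1 h.1).trans hd.1.2⟩, h⟩
    · rintro ⟨_, h⟩
      exact ⟨h, Nat.gcd_ne_zero_left (by omega)⟩
  have h2 : ∑ d ∈ sieveSupport q z, ∑ e ∈ sieveSupport q z,
      sieveWeight q z d * sieveWeight q z e * (Nat.gcd d e : ℝ) =
      ∑ l ∈ Finset.Icc 1 z, (l.totient : ℝ) *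
        (∑ d ∈ (sieveSupport q z).filter (fun d => l ∣ d), sieveWeight q z d) ^ 2 := by
    have : ∀ d ∈ sieveSupport q z, ∀ e ∈ sieveSupport q z,
      sieveWeight q z d * sieveWeight q z e * (Nat.gcd d e : ℝ) =
      ∑ l ∈ Finset.Icc 1 z, (l.totient : ℝ) * ((if l ∣ d then sieveWeight q z d else 0) *
        (if l ∣ e then sieveWeight q z e else 0)) := by
      intro d hd e he
      rw [h1 d hd e he, Finset.mul_sum]
      apply Finset.sum_congr rfl
      intro l _
      by_cases a : l ∣ d <;> by_cases b : l ∣ e <;> simp [a, b]; ring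
    rw [Finset.sum_congr rfl (fun d hd => Finset.sum_congr rfl (this d hd))]
    rw [Finset.sum_congr rfl (fun d _ => Finset.sum_comm), Finset.sum_comm]
    apply Finset.sum_congr rfl
    intro l _
    rw [sq, Finset.sum_mul_sum, Finset.mul_sum]
    simp only [Finset.sum_filter, Finset.mul_sum]
    apply Finset.sum_congr rfl
    intro d _
    by_cases a : l ∣ d
    · simp only [a, if_true]
      apply Finset.sum_congr rfl
      intro e _
      split_ifs <;> simp
    · simp [a]
  rw [h2]
  simp only [sum_sieveWeight]
  have h3 : ∀ l ∈ Finset.Icc 1 z, (l.totient : ℝ) * (if l ∈ sieveSupport q z then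
        (ArithmeticFunction.moebius l : ℝ) / (l.totient * sieveG q z) else 0) ^ 2 =
      if l ∈ sieveSupport q z then 1 / (l.totient : ℝ) / sieveG q z ^ 2 else 0 := by
    intro l _
    split_ifs with h
    · have hs : (ArithmeticFunction.moebius l : ℝ) ^ 2 = 1 := by
        exact_mod_cast ArithmeticFunction.moebius_sq_eq_one_of_squarefree (mem_sieveSupport.1 h).2.1
      have : (l.totient : ℝ) ≠ 0 := by
        exact_mod_cast (Nat.totient_pos.2 (mem_sieveSupport.1 h).1.1).ne'
      rw [div_pow, hs]
      field_simp
    · simp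
  rw [Finset.sum_congr rfl h3, ← Finset.sum_filter]
  have h4 : (Finset.Icc 1 z).filter (fun l => l ∈ sieveSupport q z) = sieveSupport q z := by
    ext l
    simp only [mem_filter, Finset.mem_Icc, mem_sieveSupport]
    tauto
  rw [h4, ← Finset.sum_div, ← sieveG]
  field_simp

lemma card_modEq_le (M H c r : ℕ) (hr : 0 < r) :
    |(((Finset.Ioc M (M + H)).filter (fun n => n ≡ c [MOD r])).card : ℝ) - H / r| ≤ 1 := by
  have h := Nat.Ioc_filter_modEq_card M (M + H) hr c
  have hr' : (0 : ℚ) < r := by exact_mod_cast hr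
  have hq : |(((Finset.Ioc M (M + H)).filter (fun n => n ≡ c [MOD r])).card : ℚ) - H / r| ≤ 1 := by
    set A : ℚ := ((M + H : ℕ) - c : ℚ) / r with hA
    set B : ℚ := (M - c : ℚ) / r with hB
    have hAB : A - B = H / r := by rw [hA, hB]; push_cast; field_simp; ring
    have hH : (0 : ℚ) ≤ H / r := by positivity
    have hle : ⌊B⌋ ≤ ⌊A⌋ := Int.floor_le_floor (by linarith)
    rw [max_eq_left (by linarith)] at h
    have h' : ((((Finset.Ioc M (M + H)).filter (fun n => n ≡ c [MOD r])).card : ℤ) : ℚ) = (⌊A⌋ : ℚ) - ⌊B⌋ := by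
      rw [← Int.cast_sub]
      exact_mod_cast h
    rw [Int.cast_natCast] at h'
    rw [h', ← hAB, abs_le]
    have := Int.floor_le A
    have := Int.lt_floor_add_one A
    have := Int.floor_le B
    have := Int.lt_floor_add_one B
    constructor <;> linarith
  have := (Rat.cast_le (K := ℝ)).2 hq
  push_cast at this
  exact this

lemma card_modEq_dvd_le (q b M H D : ℕ) (hq : 0 < q) (hD : 0 < D) (hDq : D.Coprime q) :
    |(((Finset.Ioc M (M + H)).filter (fun n => n ≡ b [MOD q] ∧ D ∣ n)).card : ℝ) - H / (q * D)| ≤ 1 := by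
  obtain ⟨c, hc1, hc2⟩ := Nat.chineseRemainder hDq.symm b 0
  have : (Finset.Ioc M (M + H)).filter (fun n => n ≡ b [MOD q] ∧ D ∣ n) =
      (Finset.Ioc M (M + H)).filter (fun n => n ≡ c [MOD (q * D)]) := by
    apply Finset.filter_congr
    intro n _
    rw [← Nat.modEq_and_modEq_iff_modEq_mul hDq.symm, ← Nat.modEq_zero_iff_dvd]
    exact ⟨fun h => ⟨h.1.trans hc1.symm, h.2.trans hc2.symm⟩,
      fun h => ⟨h.1.trans hc1, h.2.trans hc2⟩⟩
  rw [this]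
  have := card_modEq_le M H c (q * D) (Nat.mul_pos hq hD)
  push_cast at this
  exact this

end Sieve

section Sieve2

open Finset Nat

lemma sum_inv_le_div_totient {n : ℕ} (hn : n ≠ 0) (A : Finset ℕ)
    (hA : ∀ k ∈ A, k ∈ Nat.factoredNumbers n.primeFactors) :
    ∑ k ∈ A, 1 / (k : ℝ) ≤ n / n.totient := by
  let F : ℕ →* ℝ :=
    { toFun := fun k => if k = 0 then 0 else (k : ℝ)⁻¹
      map_one' := by simp
      map_mul' := by
        intro a b
        by_cases ha : a = 0
        · simp [ha]
        by_cases hb : b = 0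
        · simp [hb]
        simp [ha, hb, mul_comm] }
  have hF : ∀ k, F k = 1 / (k : ℝ) := by
    intro k
    change (if k = 0 then (0 : ℝ) else (k : ℝ)⁻¹) = 1 / (k : ℝ)
    split_ifs with h <;> simp [h]
  have h := (EulerProduct.summable_and_hasSum_factoredNumbers_prod_filter_prime_geometric (f := F)
    (by
      intro p hp
      rw [hF, Real.norm_of_nonneg (by positivity), div_lt_one (by exact_mod_cast hp.pos)]
      exact_mod_cast hp.one_lt) n.primeFactors).2
  have h1 : ∑ k ∈ A, 1 / (k : ℝ) ≤ ∏ p ∈ n.primeFactors with p.Prime, (1 - F p)⁻¹ := by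
    have h2 : ∑ k ∈ A, 1 / (k : ℝ) = ∑ k ∈ A.attach.image
        (fun k => (⟨k.1, hA k.1 k.2⟩ : Nat.factoredNumbers n.primeFactors)), F k.1 := by
      rw [Finset.sum_image (by
        intro a _ b _ hab
        exact Subtype.ext (by simpa using hab))]
      rw [← Finset.sum_attach]
      simp [hF]
    rw [h2]
    refine sum_le_hasSum _ (fun k _ => ?_) h
    rw [hF]; positivity
  refine h1.trans (le_of_eq ?_)
  have h3 : n.primeFactors.filter Nat.Prime = n.primeFactors :=
    Finset.filter_true_of_mem fun p hp => Nat.prime_of_mem_primeFactors hp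
  have h4 : (n.totient : ℝ) = n * ∏ p ∈ n.primeFactors, (1 - (p : ℝ)⁻¹) := by
    have := congrArg (fun r : ℚ => (r : ℝ)) (Nat.totient_eq_mul_prod_factors n)
    push_cast at this
    exact this
  have hn' : (n : ℝ) ≠ 0 := by exact_mod_cast hn
  rw [h3, Finset.prod_inv_distrib, h4, div_mul_eq_div_div, div_self hn', one_div]
  simp [hF]

lemma le_sieveG {q z : ℕ} (hq : 1 ≤ q) :
    (q.totient : ℝ) / q * Real.log (z + 1 : ℕ) ≤ sieveG q z := by
  have hφ : (0 : ℝ) < q.totient := by exact_mod_cast Nat.totient_pos.2 hq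
  have hq' : (0 : ℝ) < q := by exact_mod_cast hq
  set g : ℕ → ℕ := fun n => ∏ p ∈ n.primeFactors.filter (fun p => ¬ p ∣ q), p with hg
  have hg_dvd : ∀ n, g n ∣ n := fun n =>
    (Finset.prod_dvd_prod_of_subset _ _ _ (Finset.filter_subset _ _)).trans (Nat.prod_primeFactors_dvd n)
  have hg_pf : ∀ n, (g n).primeFactors = n.primeFactors.filter (fun p => ¬ p ∣ q) := fun n =>
    Nat.primeFactors_prod fun p hp => Nat.prime_of_mem_primeFactors (Finset.mem_filter.1 hp).1
  have hg_mem : ∀ n ∈ Finset.Icc 1 z, g n ∈ sieveSupport q z := by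
    intro n hn
    rw [Finset.mem_Icc] at hn
    have hpos : 0 < g n := Nat.pos_of_dvd_of_pos (hg_dvd n) hn.1
    refine mem_sieveSupport.2 ⟨⟨hpos, (Nat.le_of_dvd hn.1 (hg_dvd n)).trans hn.2⟩, ?_, ?_⟩
    · exact Finset.squarefree_prod_of_pairwise_isCoprime
        (by
          intro a ha b hb hab
          have ha' := Nat.prime_of_mem_primeFactors (Finset.mem_filter.1 ha).1
          have hb' := Nat.prime_of_mem_primeFactors (Finset.mem_filter.1 hb).1
          exact Nat.coprime_iff_isRelPrime.1 ((Nat.coprime_primes ha' hb').2 hab))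
        (fun p hp => (Nat.prime_of_mem_primeFactors (Finset.mem_filter.1 hp).1).prime.squarefree)
    · apply Nat.Coprime.prod_left
      intro p hp
      rw [Finset.mem_filter] at hp
      exact (Nat.Prime.coprime_iff_not_dvd (Nat.prime_of_mem_primeFactors hp.1)).2 hp.2
  have h1 : Real.log (z + 1 : ℕ) ≤ ∑ n ∈ Finset.Icc 1 z, 1 / (n : ℝ) := by
    have := log_add_one_le_harmonic z
    rw [harmonic_eq_sum_Icc] at this
    push_cast at this ⊢
    simpa using this
  have h2 : ∑ n ∈ Finset.Icc 1 z, 1 / (n : ℝ) ≤ q / q.totient * sieveG q z := by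
    rw [← Finset.sum_fiberwise_of_maps_to hg_mem, sieveG, Finset.mul_sum]
    apply Finset.sum_le_sum
    intro m hm
    rw [mem_sieveSupport] at hm
    have hm0 : m ≠ 0 := by omega
    have hm' : (0 : ℝ) < m := by exact_mod_cast hm.1.1
    have hmφ : (0 : ℝ) < m.totient := by exact_mod_cast Nat.totient_pos.2 hm.1.1
    have h3 : ∑ n ∈ (Finset.Icc 1 z).filter (fun n => g n = m), 1 / (n : ℝ) =
        1 / m * ∑ k ∈ ((Finset.Icc 1 z).filter (fun n => g n = m)).image (fun n => n / m), 1 / (k : ℝ) := by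
      rw [Finset.sum_image]
      · rw [Finset.mul_sum]
        apply Finset.sum_congr rfl
        intro n hn
        obtain ⟨k, hk⟩ : m ∣ n := (Finset.mem_filter.1 hn).2 ▸ hg_dvd n
        rw [hk, Nat.mul_div_cancel_left _ hm.1.1]
        push_cast
        rw [one_div_mul_one_div]
      · intro a ha b hb hab
        obtain ⟨k, hk⟩ : m ∣ a := (Finset.mem_filter.1 ha).2 ▸ hg_dvd a
        obtain ⟨l, hl⟩ : m ∣ b := (Finset.mem_filter.1 hb).2 ▸ hg_dvd b
        simp only [hk, hl, Nat.mul_div_cancel_left _ hm.1.1] at hab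
        rw [hk, hl, hab]
    have h4 := sum_inv_le_div_totient (n := m * q) (Nat.mul_ne_zero hm0 (by omega))
      (((Finset.Icc 1 z).filter (fun n => g n = m)).image (fun n => n / m)) (by
        intro k hk
        obtain ⟨n, hn, rfl⟩ := Finset.mem_image.1 hk
        rw [Finset.mem_filter, Finset.mem_Icc] at hn
        obtain ⟨k, hk⟩ : m ∣ n := hn.2 ▸ hg_dvd n
        have hk0 : k ≠ 0 := by rintro rfl; simp at hk; omega
        rw [hk, Nat.mul_div_cancel_left _ hm.1.1, Nat.mem_factoredNumbers]
        refine ⟨hk0, ?_⟩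
        intro p hp
        have hpp := Nat.prime_of_mem_primeFactorsList hp
        have hpk := Nat.dvd_of_mem_primeFactorsList hp
        rw [Nat.mem_primeFactors]
        refine ⟨hpp, ?_, Nat.mul_ne_zero hm0 (by omega)⟩
        by_cases hpq : p ∣ q
        · exact hpq.mul_left m
        · have : p ∈ (g n).primeFactors := by
            rw [hg_pf, Finset.mem_filter, Nat.mem_primeFactors]
            exact ⟨⟨hpp, hk ▸ hpk.mul_left m, by omega⟩, hpq⟩
          rw [hn.2] at this
          exact (Nat.dvd_of_mem_primeFactors this).mul_right q)
    rw [Nat.totient_mul hm.2.2] at h4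
    rw [h3]
    calc _ ≤ 1 / (m : ℝ) * ((m * q : ℕ) / (m.totient * q.totient : ℕ)) := by gcongr
      _ = _ := by push_cast; field_simp
  calc _ ≤ (q.totient : ℝ) / q * (q / q.totient * sieveG q z) := by gcongr; exact h1.trans h2
    _ = _ := by field_simp

/-- Upper bound sieve in arithmetic progressions. -/
theorem card_rough_modEq_le (q b M H z : ℕ) (hq : 1 ≤ q) (hz : 1 ≤ z) :
    (((Finset.Ioc M (M + H)).filter (fun n => n ≡ b [MOD q] ∧
      ∀ p : ℕ, p.Prime → p ∣ n → z < p)).card : ℝ) ≤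
      H / (q.totient * Real.log (z + 1 : ℕ)) + (z : ℝ) ^ 4 := by
  set S := sieveSupport q z with hS
  set lam : ℕ → ℝ := fun d => d * sieveWeight q z d with hlam
  have hG := sieveG_pos (q := q) hz
  have hq' : (0 : ℝ) < q := by exact_mod_cast hq
  have hφ : (0 : ℝ) < q.totient := by exact_mod_cast Nat.totient_pos.2 hq
  have hlog : 0 < Real.log (z + 1 : ℕ) := Real.log_pos (by push_cast; norm_cast; omega)
  set A := (Finset.Ioc M (M + H)).filter (fun n => n ≡ b [MOD q]) with hA
  have h1S : 1 ∈ S := mem_sieveSupport.2 ⟨⟨le_rfl, hz⟩, squarefree_one, by simp⟩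
  have h1 : (((Finset.Ioc M (M + H)).filter (fun n => n ≡ b [MOD q] ∧
      ∀ p : ℕ, p.Prime → p ∣ n → z < p)).card : ℝ) ≤
      ∑ n ∈ A, (∑ d ∈ S, if d ∣ n then lam d else 0) ^ 2 := by
    rw [← Finset.filter_filter, ← hA, Finset.card_eq_sum_ones, Finset.sum_filter]
    push_cast
    apply Finset.sum_le_sum
    intro n _
    split_ifs with h
    · have : ∑ d ∈ S, (if d ∣ n then lam d else 0) = lam 1 := by
        rw [Finset.sum_eq_single 1]
        · simp
        · intro d hd hd1
          rw [if_neg]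
          intro hdn
          have hd' := (mem_sieveSupport.1 hd)
          have := h d.minFac (Nat.minFac_prime hd1) ((Nat.minFac_dvd d).trans hdn)
          have := Nat.minFac_le hd'.1.1
          omega
        · exact fun h => absurd h1S h
      rw [this, hlam]
      simp [sieveWeight_one hz]
    · positivity
  have h2 : ∑ n ∈ A, (∑ d ∈ S, if d ∣ n then lam d else 0) ^ 2 =
      ∑ d ∈ S, ∑ e ∈ S, lam d * lam e *
        ((Finset.Ioc M (M + H)).filter (fun n => n ≡ b [MOD q] ∧ d.lcm e ∣ n)).card := by
    have : ∀ n ∈ A, (∑ d ∈ S, if d ∣ n then lam d else 0) ^ 2 =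
        ∑ d ∈ S, ∑ e ∈ S, lam d * lam e * if d.lcm e ∣ n then 1 else 0 := by
      intro n _
      rw [sq, Finset.sum_mul_sum]
      refine Finset.sum_congr rfl fun d _ => Finset.sum_congr rfl fun e _ => ?_
      by_cases a : d ∣ n <;> by_cases b : e ∣ n <;> simp [a, b, Nat.lcm_dvd_iff]
    rw [Finset.sum_congr rfl this, Finset.sum_comm]
    refine Finset.sum_congr rfl fun d _ => ?_
    rw [Finset.sum_comm]
    refine Finset.sum_congr rfl fun e _ => ?_
    rw [← Finset.mul_sum, ← Finset.filter_filter, ← hA, Finset.card_eq_sum_ones, Finset.sum_filter (s := A)]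
    push_cast
    rfl
  have h3 : ∀ d ∈ S, ∀ e ∈ S, lam d * lam e *
        (((Finset.Ioc M (M + H)).filter (fun n => n ≡ b [MOD q] ∧ d.lcm e ∣ n)).card : ℝ) ≤
      (H : ℝ) / q * (sieveWeight q z d * sieveWeight q z e * (Nat.gcd d e : ℝ)) + (z : ℝ) * z := by
    intro d hd e he
    rw [hS, mem_sieveSupport] at hd he
    have hd0 : (0 : ℝ) < d := by exact_mod_cast hd.1.1
    have he0 : (0 : ℝ) < e := by exact_mod_cast he.1.1
    have hL : 0 < d.lcm e := Nat.lcm_pos hd.1.1 he.1.1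
    have hL' : (0 : ℝ) < (d.lcm e : ℕ) := by exact_mod_cast hL
    have hc := card_modEq_dvd_le q b M H (d.lcm e) hq hL
      (Nat.Coprime.coprime_dvd_left (Nat.lcm_dvd_mul d e) (Nat.Coprime.mul_left hd.2.2 he.2.2))
    set c := (((Finset.Ioc M (M + H)).filter (fun n => n ≡ b [MOD q] ∧ d.lcm e ∣ n)).card : ℝ)
    have hlb : |lam d * lam e| ≤ z * z := by
      rw [hlam, abs_mul, abs_mul, abs_mul, Nat.abs_cast, Nat.abs_cast]
      have := abs_sieveWeight_le (q := q) (d := d) hz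
      have := abs_sieveWeight_le (q := q) (d := e) hz
      have h1 : (d : ℝ) ≤ z := by exact_mod_cast hd.1.2
      have h2 : (e : ℝ) ≤ z := by exact_mod_cast he.1.2
      calc _ ≤ ((z : ℝ) * 1) * (z * 1) := by gcongr
        _ = _ := by ring
    have hgl : (Nat.gcd d e : ℝ) * (d.lcm e : ℕ) = d * e := by exact_mod_cast Nat.gcd_mul_lcm d e
    have e1 : lam d * lam e * (H / (q * (d.lcm e : ℕ))) =
        (H : ℝ) / q * (sieveWeight q z d * sieveWeight q z e * (Nat.gcd d e : ℝ)) := by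
      simp only [hlam]
      field_simp
      linear_combination (-(sieveWeight q z d * sieveWeight q z e * H)) * hgl
    have e2 : lam d * lam e * (c - H / (q * (d.lcm e : ℕ))) ≤ z * z := by
      refine (le_abs_self _).trans ?_
      rw [abs_mul]
      calc _ ≤ ((z : ℝ) * z) * 1 := by gcongr
        _ = _ := by ring
    linarith [e1, e2, mul_sub (lam d * lam e) c (H / (q * (d.lcm e : ℕ)))]
  have hScard : (S.card : ℝ) ≤ z := by
    have : S.card ≤ z := by
      calc S.card ≤ (Finset.Icc 1 z).card := Finset.card_filter_le _ _
        _ = z := by simp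
    exact_mod_cast this
  have h4 : ∑ d ∈ S, ∑ e ∈ S, lam d * lam e *
        (((Finset.Ioc M (M + H)).filter (fun n => n ≡ b [MOD q] ∧ d.lcm e ∣ n)).card : ℝ) ≤
        (H : ℝ) / q * (1 / sieveG q z) + (z : ℝ) ^ 4 := by
    refine (Finset.sum_le_sum fun d hd => Finset.sum_le_sum (h3 d hd)).trans ?_
    simp only [Finset.sum_add_distrib, ← Finset.mul_sum, sieve_quadratic hz, hS]
    rw [← hS]
    simp only [Finset.sum_const, nsmul_eq_mul]
    have : (S.card : ℝ) * (S.card * ((z : ℝ) * z)) ≤ z * (z * (z * z)) := by gcongr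
    nlinarith
  rw [h2] at h1
  refine (h1.trans h4).trans ?_
  gcongr
  have h5 := le_sieveG (q := q) (z := z) hq
  rw [_root_.div_mul_div_comm, mul_one]
  refine div_le_div_of_nonneg_left (by positivity) (by positivity) ?_
  calc (q.totient : ℝ) * Real.log (z + 1 : ℕ) = q * ((q.totient : ℝ) / q * Real.log (z + 1 : ℕ)) := by
        field_simp
    _ ≤ _ := by gcongr

end Sieve2

section PrimeSums

open Finset
open ArithmeticFunction (vonMangoldt)

lemma sum_rpow_le {σ : ℝ} (hσ : 0 < σ) (N : ℕ) :
    ∑ n ∈ Finset.Icc 1 N, (n : ℝ) ^ (-1 - σ) ≤ 1 + 1 / σ := by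
  suffices h : ∀ N : ℕ, ∑ n ∈ Finset.Icc 1 (N + 1), (n : ℝ) ^ (-1 - σ) ≤
      1 + 1 / σ - ((N + 1 : ℕ) : ℝ) ^ (-σ) / σ by
    rcases N with _ | N
    · simp; positivity
    · have : (0 : ℝ) ≤ ((N + 1 : ℕ) : ℝ) ^ (-σ) / σ := by positivity
      linarith [h N]
  intro N
  induction N with
  | zero => simp
  | succ N ih =>
    rw [Finset.sum_Icc_succ_top (by omega)]
    refine (add_le_add_left ih _).trans ?_
    have hn : (0 : ℝ) < ((N + 1 : ℕ) : ℝ) := by positivity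
    have hn2 : (0 : ℝ) < ((N + 1 + 1 : ℕ) : ℝ) := by positivity
    have key : (1 + σ / ((N + 1 + 1 : ℕ) : ℝ)) * ((N + 1 + 1 : ℕ) : ℝ) ^ (-σ) ≤
        ((N + 1 : ℕ) : ℝ) ^ (-σ) := by
      rw [Real.rpow_def_of_pos hn2, Real.rpow_def_of_pos hn]
      have h1 := Real.add_one_le_exp (σ / ((N + 1 + 1 : ℕ) : ℝ))
      have h2 : Real.log ((N + 1 : ℕ) : ℝ) ≤ Real.log ((N + 1 + 1 : ℕ) : ℝ) - 1 / ((N + 1 + 1 : ℕ) : ℝ) := by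
        have := Real.log_le_sub_one_of_pos (div_pos hn hn2)
        rw [Real.log_div hn.ne' hn2.ne'] at this
        have h3 : ((N + 1 : ℕ) : ℝ) / ((N + 1 + 1 : ℕ) : ℝ) = 1 - 1 / ((N + 1 + 1 : ℕ) : ℝ) := by
          field_simp; push_cast; ring
        linarith
      calc _ ≤ Real.exp (σ / ((N + 1 + 1 : ℕ) : ℝ)) * Real.exp (Real.log ((N + 1 + 1 : ℕ) : ℝ) * -σ) := by
            gcongr; linarith
        _ = Real.exp (σ / ((N + 1 + 1 : ℕ) : ℝ) + Real.log ((N + 1 + 1 : ℕ) : ℝ) * -σ) := by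
            rw [Real.exp_add]
        _ ≤ _ := by
            apply Real.exp_le_exp.2
            have : σ * (1 / ((N + 1 + 1 : ℕ) : ℝ)) = σ / ((N + 1 + 1 : ℕ) : ℝ) := by ring
            nlinarith
    have e1 : ((N + 1 + 1 : ℕ) : ℝ) ^ (-1 - σ) = ((N + 1 + 1 : ℕ) : ℝ) ^ (-σ) / ((N + 1 + 1 : ℕ) : ℝ) := by
      rw [show -1 - σ = -σ - 1 by ring, Real.rpow_sub_one hn2.ne']
    rw [e1]
    have : ((N + 1 + 1 : ℕ) : ℝ) ^ (-σ) / ((N + 1 + 1 : ℕ) : ℝ) ≤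
        (((N + 1 : ℕ) : ℝ) ^ (-σ) - ((N + 1 + 1 : ℕ) : ℝ) ^ (-σ)) / σ := by
      rw [le_div_iff₀ hσ]
      have : (1 + σ / ((N + 1 + 1 : ℕ) : ℝ)) * ((N + 1 + 1 : ℕ) : ℝ) ^ (-σ) =
        ((N + 1 + 1 : ℕ) : ℝ) ^ (-σ) + ((N + 1 + 1 : ℕ) : ℝ) ^ (-σ) / ((N + 1 + 1 : ℕ) : ℝ) * σ := by ring
      linarith
    rw [sub_div] at this
    linarith

lemma prod_primes_le {σ : ℝ} (hσ : 0 < σ) (P : Finset ℕ) (hP : ∀ p ∈ P, p.Prime) :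
    ∏ p ∈ P, (1 - (p : ℝ) ^ (-1 - σ))⁻¹ ≤ 1 + 1 / σ := by
  let F : ℕ →* ℝ :=
    { toFun := fun k => (k : ℝ) ^ (-1 - σ)
      map_one' := by simp
      map_mul' := by
        intro a b
        push_cast
        rw [Real.mul_rpow (by positivity) (by positivity)] }
  have hF : ∀ k, F k = (k : ℝ) ^ (-1 - σ) := fun k => rfl
  have h := (EulerProduct.summable_and_hasSum_factoredNumbers_prod_filter_prime_geometric (f := F)
    (by
      intro p hp
      rw [hF, Real.norm_of_nonneg (by positivity)]
      exact Real.rpow_lt_one_of_one_lt_of_neg (by exact_mod_cast hp.one_lt) (by linarith)) P).2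
  rw [Finset.filter_true_of_mem hP] at h
  refine hasSum_le_of_sum_le h fun s => ?_
  set A := s.image (fun k : Nat.factoredNumbers P => (k : ℕ)) with hA
  have h1 : ∑ i ∈ s, F i = ∑ k ∈ A, F k := by
    rw [hA, Finset.sum_image (by intro a _ b _ hab; exact Subtype.ext hab)]
  rw [h1]
  refine le_trans ?_ (sum_rpow_le hσ (A.sup id))
  refine Finset.sum_le_sum_of_subset_of_nonneg ?_ (fun k _ _ => Real.rpow_nonneg k.cast_nonneg _)
  intro k hk
  obtain ⟨m, _, hm⟩ := Finset.mem_image.1 hk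
  rw [Finset.mem_Icc]
  exact ⟨Nat.pos_of_ne_zero (hm ▸ Nat.ne_zero_of_mem_factoredNumbers m.2),
    Finset.le_sup (f := id) hk⟩

lemma sum_primes_rpow_le {σ : ℝ} (hσ : 0 < σ) (P : Finset ℕ) (hP : ∀ p ∈ P, p.Prime) :
    ∑ p ∈ P, (p : ℝ) ^ (-1 - σ) ≤ Real.log (1 + 1 / σ) := by
  have hlt : ∀ p ∈ P, (p : ℝ) ^ (-1 - σ) < 1 := fun p hp =>
    Real.rpow_lt_one_of_one_lt_of_neg (by exact_mod_cast (hP p hp).one_lt) (by linarith)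
  have h1 : ∑ p ∈ P, (p : ℝ) ^ (-1 - σ) ≤ ∑ p ∈ P, Real.log (1 - (p : ℝ) ^ (-1 - σ))⁻¹ := by
    refine Finset.sum_le_sum fun p hp => ?_
    rw [Real.log_inv]
    have := Real.log_le_sub_one_of_pos (x := 1 - (p : ℝ) ^ (-1 - σ)) (by linarith [hlt p hp])
    linarith
  refine h1.trans ?_
  rw [← Real.log_prod (fun p hp => (inv_pos.2 (by linarith [hlt p hp])).ne')]
  exact Real.log_le_log (Finset.prod_pos fun p hp => inv_pos.2 (by linarith [hlt p hp]))
    (prod_primes_le hσ P hP)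

lemma sum_vonMangoldt_le (N : ℕ) : ∑ n ∈ Finset.Icc 1 N, vonMangoldt n ≤ 6 * N := by
  have h := Chebyshev.psi_le_const_mul_self (x := (N : ℝ)) (by positivity)
  rw [Chebyshev.psi_eq_sum_Icc, Nat.floor_natCast] at h
  have h4 : Real.log 4 ≤ 2 := by
    rw [show (4 : ℝ) = 2 ^ 2 by norm_num, Real.log_pow]
    have := Real.log_two_lt_d9
    push_cast; linarith
  calc _ ≤ ∑ n ∈ Finset.Icc 0 N, vonMangoldt n :=
        Finset.sum_le_sum_of_subset_of_nonneg (Finset.Icc_subset_Icc (by omega) le_rfl)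
          (fun _ _ _ => ArithmeticFunction.vonMangoldt_nonneg)
    _ ≤ _ := h
    _ ≤ _ := by gcongr; linarith

lemma sum_vonMangoldt_div_le {N : ℕ} (hN : 1 ≤ N) :
    ∑ n ∈ Finset.Icc 1 N, vonMangoldt n / n ≤ Real.log N + 6 := by
  have hN0 : (0 : ℝ) < N := by exact_mod_cast hN
  have h1 : ∑ n ∈ Finset.Icc 1 N, Real.log n = ∑ d ∈ Finset.Icc 1 N, vonMangoldt d * (N / d : ℕ) := by
    have : ∀ n ∈ Finset.Icc 1 N, Real.log n = ∑ d ∈ Finset.Icc 1 N, if d ∣ n then vonMangoldt d else 0 := by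
      intro n hn
      rw [Finset.mem_Icc] at hn
      rw [← ArithmeticFunction.vonMangoldt_sum, ← Finset.sum_filter]
      refine Finset.sum_congr ?_ fun _ _ => rfl
      ext d
      simp only [Nat.mem_divisors, mem_filter, Finset.mem_Icc]
      constructor
      · rintro ⟨h, _⟩
        exact ⟨⟨Nat.pos_of_dvd_of_pos h hn.1, (Nat.le_of_dvd hn.1 h).trans hn.2⟩, h⟩
      · rintro ⟨_, h⟩
        exact ⟨h, by omega⟩
    rw [Finset.sum_congr rfl this, Finset.sum_comm]
    refine Finset.sum_congr rfl fun d _ => ?_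
    rw [← Finset.sum_filter, Finset.sum_const, nsmul_eq_mul, mul_comm]
    congr 2
    exact Nat.Ioc_filter_dvd_card_eq_div N d
  have h2 : ∑ n ∈ Finset.Icc 1 N, Real.log n ≤ N * Real.log N := by
    calc _ ≤ ∑ n ∈ Finset.Icc 1 N, Real.log N := by
          refine Finset.sum_le_sum fun n hn => ?_
          rw [Finset.mem_Icc] at hn
          exact Real.log_le_log (by exact_mod_cast hn.1) (by exact_mod_cast hn.2)
      _ = _ := by simp
  have h3 : ∑ d ∈ Finset.Icc 1 N, vonMangoldt d * ((N : ℝ) / d - 1) ≤ N * Real.log N := by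
    refine le_trans (Finset.sum_le_sum fun d hd => ?_) (h1 ▸ h2)
    refine mul_le_mul_of_nonneg_left ?_ ArithmeticFunction.vonMangoldt_nonneg
    have := Nat.lt_floor_add_one ((N : ℝ) / d)
    rw [Nat.floor_div_natCast, Nat.floor_natCast] at this
    linarith
  have h4 : ∑ d ∈ Finset.Icc 1 N, vonMangoldt d * ((N : ℝ) / d - 1) =
      N * ∑ d ∈ Finset.Icc 1 N, vonMangoldt d / d - ∑ d ∈ Finset.Icc 1 N, vonMangoldt d := by
    rw [Finset.mul_sum, ← Finset.sum_sub_distrib]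
    refine Finset.sum_congr rfl fun d _ => by ring
  have h5 := sum_vonMangoldt_le N
  rw [h4] at h3
  have : (N : ℝ) * ∑ d ∈ Finset.Icc 1 N, vonMangoldt d / d ≤ N * (Real.log N + 6) := by linarith
  exact le_of_mul_le_mul_left this hN0

/-- Summation by parts in the form of a domination principle. -/
lemma sum_mul_le_of_partial_sums {a b w : ℕ → ℝ} (hw : ∀ n, 1 ≤ n → w (n + 1) ≤ w n)
    (hw0 : ∀ n, 1 ≤ n → 0 ≤ w n)
    (hab : ∀ N, 1 ≤ N → ∑ n ∈ Finset.Icc 1 N, a n ≤ ∑ n ∈ Finset.Icc 1 N, b n) (N : ℕ) :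
    ∑ n ∈ Finset.Icc 1 N, a n * w n ≤ ∑ n ∈ Finset.Icc 1 N, b n * w n := by
  rcases N with _ | N
  · simp
  suffices h : w (N + 1) * (∑ n ∈ Finset.Icc 1 (N + 1), b n - ∑ n ∈ Finset.Icc 1 (N + 1), a n) ≤
      ∑ n ∈ Finset.Icc 1 (N + 1), b n * w n - ∑ n ∈ Finset.Icc 1 (N + 1), a n * w n by
    have := mul_nonneg (hw0 (N + 1) (by omega)) (sub_nonneg.2 (hab (N + 1) (by omega)))
    linarith
  induction N with
  | zero => simp; linarith
  | succ N ih =>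
    have h1 := sub_nonneg.2 (hab (N + 1) (by omega))
    have h2 := mul_le_mul_of_nonneg_right (hw (N + 1) (by omega)) h1
    simp only [Finset.sum_Icc_succ_top (show 1 ≤ N + 1 + 1 by omega)]
    linarith

lemma sum_vonMangoldt_rpow_le {η : ℝ} (hη : 0 < η) (N : ℕ) :
    ∑ n ∈ Finset.Icc 1 N, vonMangoldt n * (n : ℝ) ^ (-1 - η) ≤ 8 + 2 / η := by
  set b : ℕ → ℝ := fun n => if n = 1 then 6 else Real.log n - Real.log (n - 1 : ℕ) with hb
  have hB : ∀ N, 1 ≤ N → ∑ n ∈ Finset.Icc 1 N, b n = Real.log N + 6 := by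
    intro N hN
    induction N, hN using Nat.le_induction with
    | base => simp [hb]
    | succ N hN ih =>
      rw [Finset.sum_Icc_succ_top (by omega), ih]
      simp only [hb]
      rw [if_neg (by omega), Nat.add_sub_cancel]
      ring
  have h1 := sum_mul_le_of_partial_sums (a := fun n => vonMangoldt n / n) (b := b)
    (w := fun n => (n : ℝ) ^ (-η))
    (fun n hn => Real.rpow_le_rpow_of_nonpos (by exact_mod_cast hn) (by push_cast; linarith) (by linarith))
    (fun n _ => by positivity)
    (fun N hN => (sum_vonMangoldt_div_le hN).trans (hB N hN).ge) N
  have h2 : ∀ n ∈ Finset.Icc 1 N, vonMangoldt n * (n : ℝ) ^ (-1 - η) = vonMangoldt n / n * (n : ℝ) ^ (-η) := by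
    intro n hn
    rw [Finset.mem_Icc] at hn
    have : (n : ℝ) ≠ 0 := by have := hn.1; positivity
    rw [show -1 - η = -η - 1 by ring, Real.rpow_sub_one this]
    ring
  rw [Finset.sum_congr rfl h2]
  refine h1.trans ?_
  have h3 : ∀ n ∈ Finset.Icc 1 N, b n * (n : ℝ) ^ (-η) ≤
      (if n = 1 then 6 else 0) + 2 * (n : ℝ) ^ (-1 - η) := by
    intro n hn
    rw [Finset.mem_Icc] at hn
    have hn0 : (0 : ℝ) < n := by exact_mod_cast hn.1
    by_cases h : n = 1
    · subst h; simp [hb]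
    · have hn2 : (2 : ℝ) ≤ n := by norm_cast; omega
      simp only [hb, h, if_false]
      rw [Nat.cast_sub hn.1, zero_add, show -1 - η = -η - 1 by ring, Real.rpow_sub_one hn0.ne', Nat.cast_one]
      have hl : Real.log n - Real.log ((n : ℝ) - 1) ≤ 2 / n := by
        rw [← Real.log_div hn0.ne' (by linarith)]
        refine (Real.log_le_sub_one_of_pos (div_pos hn0 (by linarith))).trans ?_
        rw [div_sub_one (by linarith), div_le_div_iff₀ (by linarith) hn0]
        linarith
      calc _ ≤ 2 / n * (n : ℝ) ^ (-η) := by gcongr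
        _ = _ := by ring
  refine (Finset.sum_le_sum h3).trans ?_
  rw [Finset.sum_add_distrib, ← Finset.mul_sum]
  have h4 : ∑ n ∈ Finset.Icc 1 N, (if n = 1 then (6 : ℝ) else 0) ≤ 6 := by
    rw [Finset.sum_ite_eq']
    split_ifs <;> norm_num
  have h5 := sum_rpow_le hη N
  have : 2 / η = 2 * (1 / η) := by ring
  linarith

lemma sum_primes_log_div_le {N : ℕ} (hN : 1 ≤ N) :
    ∑ p ∈ (Finset.Icc 1 N).filter Nat.Prime, Real.log p / p ≤ Real.log N + 6 := by
  refine le_trans ?_ (sum_vonMangoldt_div_le hN)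
  rw [Finset.sum_filter]
  refine Finset.sum_le_sum fun n _ => ?_
  split_ifs with h
  · rw [ArithmeticFunction.vonMangoldt_apply_prime h]
  · exact div_nonneg ArithmeticFunction.vonMangoldt_nonneg (by positivity)

/-- Upper bound in Mertens' second theorem. -/
lemma sum_primes_inv_le {N : ℕ} (hN : 2 ≤ N) :
    ∑ p ∈ (Finset.Icc 1 N).filter Nat.Prime, 1 / (p : ℝ) ≤ Real.log (Real.log N) + 13 := by
  have hN' : (2 : ℝ) ≤ N := by exact_mod_cast hN
  have hL : 0.69 < Real.log N :=
    lt_of_lt_of_le (by linarith [Real.log_two_gt_d9]) (Real.log_le_log (by norm_num) hN')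
  set L := Real.log N with hLdef
  have hLpos : 0 < L := by linarith
  set P := (Finset.Icc 1 N).filter Nat.Prime with hPdef
  have h1 := sum_primes_rpow_le (σ := 1 / L) (by positivity) P (fun p hp => (Finset.mem_filter.1 hp).2)
  have h2 : ∀ p ∈ P, 1 / (p : ℝ) ≤ (p : ℝ) ^ (-1 - 1 / L) + 1 / L * (Real.log p / p) := by
    intro p hp
    have hp0 : (0 : ℝ) < p := by exact_mod_cast (Finset.mem_filter.1 hp).2.pos
    rw [show -1 - 1 / L = -(1 / L) - 1 by ring, Real.rpow_sub_one hp0.ne', Real.rpow_def_of_pos hp0]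
    have := Real.add_one_le_exp (Real.log p * -(1 / L))
    have e : Real.exp (Real.log p * -(1 / L)) / p + 1 / L * (Real.log p / p) =
      (Real.exp (Real.log p * -(1 / L)) + Real.log p * (1 / L)) / p := by ring
    rw [e]
    gcongr
    linarith
  have h3 := Finset.sum_le_sum h2
  rw [Finset.sum_add_distrib, ← Finset.mul_sum] at h3
  have h4 := sum_primes_log_div_le (N := N) (by omega)
  have h5 : 1 / L * ∑ p ∈ P, Real.log p / p ≤ 1 / L * (L + 6) := by gcongr
  have h6 : 1 / L * (L + 6) ≤ 10 := by
    rw [one_div, inv_mul_le_iff₀ hLpos]; linarith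
  have h7 : Real.log (1 + 1 / (1 / L)) ≤ Real.log L + 1.5 := by
    rw [one_div_one_div]
    have : 1 + L = L * (1 + 1 / L) := by field_simp; ring
    rw [this, Real.log_mul hLpos.ne' (by positivity)]
    have := Real.log_le_sub_one_of_pos (x := 1 + 1 / L) (by positivity)
    have : 1 / L ≤ 1.5 := by rw [div_le_iff₀ hLpos]; linarith
    linarith
  linarith

lemma sum_large_primes_rpow_le {y : ℕ} {η : ℝ} (hη : 0 < η) (hη1 : η ≤ 1) (hy : 1 ≤ η * Real.log y)
    (P : Finset ℕ) (hP : ∀ p ∈ P, p.Prime ∧ y < p) :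
    ∑ p ∈ P, (p : ℝ) ^ (-1 - η) ≤ 10 := by
  have h1 : ∀ p ∈ P, (p : ℝ) ^ (-1 - η) ≤ η * (vonMangoldt p * (p : ℝ) ^ (-1 - η)) := by
    intro p hp
    obtain ⟨hpp, hyp⟩ := hP p hp
    rw [ArithmeticFunction.vonMangoldt_apply_prime hpp, ← mul_assoc]
    have hy0 : y ≠ 0 := by rintro rfl; simp at hy; linarith
    have : Real.log y ≤ Real.log p :=
      Real.log_le_log (by positivity) (by exact_mod_cast hyp.le)
    have : 1 ≤ η * Real.log p := hy.trans (by gcongr)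
    exact le_mul_of_one_le_left (by positivity) this
  refine (Finset.sum_le_sum h1).trans ?_
  rw [← Finset.mul_sum]
  have h2 : ∑ p ∈ P, vonMangoldt p * (p : ℝ) ^ (-1 - η) ≤ 8 + 2 / η := by
    refine le_trans ?_ (sum_vonMangoldt_rpow_le hη (P.sup id))
    refine Finset.sum_le_sum_of_subset_of_nonneg ?_
      (fun _ _ _ => mul_nonneg ArithmeticFunction.vonMangoldt_nonneg (by positivity))
    intro p hp
    rw [Finset.mem_Icc]
    exact ⟨(hP p hp).1.pos, Finset.le_sup (f := id) hp⟩
  calc _ ≤ η * (8 + 2 / η) := by gcongr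
    _ = 8 * η + 2 := by field_simp
    _ ≤ 10 := by linarith

lemma sum_vonMangoldt_minFac_le (N z : ℕ) (hN : 1 ≤ N) :
    ∑ n ∈ (Finset.Icc 1 N).filter (fun n => n.minFac ≤ z), vonMangoldt n ≤ z * Real.log N := by
  have hlogN : 0 ≤ Real.log N := Real.log_natCast_nonneg N
  set A := ((Finset.Icc 1 N).filter (fun n => n.minFac ≤ z)).filter IsPrimePow with hA
  have h1 : ∑ n ∈ (Finset.Icc 1 N).filter (fun n => n.minFac ≤ z), vonMangoldt n =
      ∑ n ∈ A, vonMangoldt n := by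
    rw [hA, Finset.sum_filter (p := IsPrimePow)]
    refine Finset.sum_congr rfl fun n _ => ?_
    split_ifs with h
    · rfl
    · exact ArithmeticFunction.vonMangoldt_eq_zero_iff.2 h
  have hmaps : ∀ n ∈ A, n.minFac ∈ Finset.Icc 1 z := by
    intro n hn
    rw [hA, Finset.mem_filter, Finset.mem_filter] at hn
    exact Finset.mem_Icc.2 ⟨Nat.minFac_pos n, hn.1.2⟩
  rw [h1, ← Finset.sum_fiberwise_of_maps_to hmaps]
  calc _ ≤ ∑ p ∈ Finset.Icc 1 z, Real.log N := by
        refine Finset.sum_le_sum fun p hp => ?_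
        by_cases hpp : p.Prime
        · have hsub : A.filter (fun n => n.minFac = p) ⊆ (Finset.Icc 1 (Nat.log p N)).image (fun k => p ^ k) := by
            intro n hn
            rw [Finset.mem_filter, hA, Finset.mem_filter, Finset.mem_filter, Finset.mem_Icc] at hn
            obtain ⟨⟨⟨⟨_, hnN⟩, _⟩, hpow⟩, hmin⟩ := hn
            obtain ⟨r, k, hr, hk, rfl⟩ := (isPrimePow_nat_iff _).1 hpow
            rw [Nat.Prime.pow_minFac hr hk.ne'] at hmin
            subst hmin
            exact Finset.mem_image.2 ⟨k, Finset.mem_Icc.2 ⟨hk, Nat.le_log_of_pow_le hr.one_lt hnN⟩, rfl⟩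
          calc _ ≤ ∑ n ∈ (Finset.Icc 1 (Nat.log p N)).image (fun k => p ^ k), vonMangoldt n :=
                Finset.sum_le_sum_of_subset_of_nonneg hsub (fun _ _ _ => ArithmeticFunction.vonMangoldt_nonneg)
            _ = ∑ k ∈ Finset.Icc 1 (Nat.log p N), Real.log p := by
                rw [Finset.sum_image (fun a _ b _ h => Nat.pow_right_injective hpp.two_le h)]
                refine Finset.sum_congr rfl fun k hk => ?_
                rw [ArithmeticFunction.vonMangoldt_apply_pow (by have := (Finset.mem_Icc.1 hk).1; omega),
                  ArithmeticFunction.vonMangoldt_apply_prime hpp]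
            _ = Real.log ((p ^ Nat.log p N : ℕ) : ℝ) := by
                push_cast
                rw [Real.log_pow]; simp
            _ ≤ _ := Real.log_le_log (by exact_mod_cast Nat.pow_pos hpp.pos)
                (by exact_mod_cast Nat.pow_log_le_self p (by omega))
        · have : A.filter (fun n => n.minFac = p) = ∅ := by
            refine Finset.filter_eq_empty_iff.2 fun n hn h => hpp ?_
            rw [hA, Finset.mem_filter] at hn
            rw [← h]
            exact Nat.minFac_prime hn.2.one_lt.ne'
          rw [this]; simpa using hlogN
    _ = _ := by simp

/-- Brun–Titchmarsh inequality for the von Mangoldt function. -/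
theorem sum_vonMangoldt_modEq_le (q b M H N : ℕ) (hq : 1 ≤ q) (hN : 1 ≤ N) (hMH : M + H ≤ N)
    (hH : q * (N : ℝ) ^ (1 / 2 : ℝ) ≤ H) :
    ∑ n ∈ (Finset.Ioc M (M + H)).filter (fun n => n ≡ b [MOD q]), vonMangoldt n ≤
      30 * (H / q.totient) := by
  have hN1 : (1 : ℝ) ≤ N := by exact_mod_cast hN
  have hN0 : (0 : ℝ) < N := by linarith
  have hlogN : 0 ≤ Real.log N := Real.log_nonneg hN1
  have hφ : (0 : ℝ) < q.totient := by exact_mod_cast Nat.totient_pos.2 hq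
  have hφq : (q.totient : ℝ) ≤ q := by exact_mod_cast Nat.totient_le q
  set z := ⌊(N : ℝ) ^ (1 / 20 : ℝ)⌋₊ with hz
  have hzN : (z : ℝ) ≤ (N : ℝ) ^ (1 / 20 : ℝ) := Nat.floor_le (by positivity)
  have hz1 : 1 ≤ z := Nat.le_floor (by push_cast; exact Real.one_le_rpow hN1 (by norm_num))
  have hlogz : Real.log N ≤ 20 * Real.log (z + 1 : ℕ) := by
    have : Real.log ((N : ℝ) ^ (1 / 20 : ℝ)) ≤ Real.log (z + 1 : ℕ) :=
      Real.log_le_log (by positivity) (by push_cast; exact (Nat.lt_floor_add_one _).le)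
    rw [Real.log_rpow hN0] at this
    linarith
  have hlz : 0 < Real.log (z + 1 : ℕ) := Real.log_pos (by push_cast; norm_cast; omega)
  have hsmall : Real.log N * (N : ℝ) ^ (1 / 5 : ℝ) ≤ 10 / 3 * (H / q.totient) := by
    have h1 := Real.log_le_rpow_div (x := (N : ℝ)) hN0.le (ε := 3 / 10) (by norm_num)
    calc _ ≤ (N : ℝ) ^ (3 / 10 : ℝ) / (3 / 10) * (N : ℝ) ^ (1 / 5 : ℝ) := by gcongr
      _ = 10 / 3 * ((N : ℝ) ^ (3 / 10 : ℝ) * (N : ℝ) ^ (1 / 5 : ℝ)) := by ring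
      _ = 10 / 3 * (N : ℝ) ^ (1 / 2 : ℝ) := by rw [← Real.rpow_add hN0]; norm_num
      _ ≤ 10 / 3 * (H / q.totient) := by
        gcongr
        rw [le_div_iff₀ hφ]
        calc _ ≤ (N : ℝ) ^ (1 / 2 : ℝ) * q := by gcongr
          _ ≤ _ := by linarith
  set A := (Finset.Ioc M (M + H)).filter (fun n => n ≡ b [MOD q]) with hA
  have hAN : ∀ n ∈ A, 1 ≤ n ∧ n ≤ N := by
    intro n hn
    have := Finset.mem_Ioc.1 (Finset.mem_filter.1 hn).1
    omega
  rw [← Finset.sum_filter_add_sum_filter_not A (fun n => n.minFac ≤ z)]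
  have h1 : ∑ n ∈ A.filter (fun n => n.minFac ≤ z), vonMangoldt n ≤ 10 / 3 * (H / q.totient) := by
    calc _ ≤ ∑ n ∈ (Finset.Icc 1 N).filter (fun n => n.minFac ≤ z), vonMangoldt n :=
          Finset.sum_le_sum_of_subset_of_nonneg
            (Finset.filter_subset_filter _ (fun n hn => Finset.mem_Icc.2 (hAN n hn)))
            (fun _ _ _ => ArithmeticFunction.vonMangoldt_nonneg)
      _ ≤ z * Real.log N := sum_vonMangoldt_minFac_le N z hN
      _ ≤ (N : ℝ) ^ (1 / 5 : ℝ) * Real.log N := by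
          gcongr
          exact hzN.trans (Real.rpow_le_rpow_of_exponent_le hN1 (by norm_num))
      _ ≤ _ := by rw [mul_comm]; exact hsmall
  have h2 : ∑ n ∈ A.filter (fun n => ¬ n.minFac ≤ z), vonMangoldt n ≤
      Real.log N * (H / (q.totient * Real.log (z + 1 : ℕ)) + (z : ℝ) ^ 4) := by
    calc _ ≤ ∑ n ∈ A.filter (fun n => ¬ n.minFac ≤ z), Real.log N := by
          refine Finset.sum_le_sum fun n hn => ?_
          have := hAN n (Finset.mem_filter.1 hn).1
          exact ArithmeticFunction.vonMangoldt_le_log.trans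
            (Real.log_le_log (by exact_mod_cast this.1) (by exact_mod_cast this.2))
      _ = Real.log N * (A.filter (fun n => ¬ n.minFac ≤ z)).card := by
          rw [Finset.sum_const, nsmul_eq_mul, mul_comm]
      _ ≤ _ := by
          gcongr
          refine le_trans ?_ (card_rough_modEq_le q b M H z hq hz1)
          norm_cast
          refine Finset.card_le_card fun n hn => ?_
          rw [Finset.mem_filter, hA, Finset.mem_filter] at hn
          refine Finset.mem_filter.2 ⟨hn.1.1, hn.1.2, fun p hp hpn => ?_⟩
          have := Nat.minFac_le_of_dvd hp.two_le hpn
          omega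
  have h3 : Real.log N * (H / (q.totient * Real.log (z + 1 : ℕ))) ≤ 20 * (H / q.totient) := by
    calc _ ≤ 20 * Real.log (z + 1 : ℕ) * (H / (q.totient * Real.log (z + 1 : ℕ))) := by gcongr
      _ = _ := by field_simp
  have h4 : Real.log N * (z : ℝ) ^ 4 ≤ 10 / 3 * (H / q.totient) := by
    refine le_trans ?_ hsmall
    gcongr
    calc (z : ℝ) ^ 4 ≤ ((N : ℝ) ^ (1 / 20 : ℝ)) ^ 4 := by gcongr
      _ = (N : ℝ) ^ (1 / 5 : ℝ) := by rw [← Real.rpow_mul_natCast hN0.le]; norm_num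
  have : (0 : ℝ) ≤ H / q.totient := by positivity
  rw [mul_add] at h2
  linarith

end PrimeSums

section SmoothRough

open Finset

/-- The largest divisor of `n` composed of primes exceeding `y`. -/
def rough (y n : ℕ) : ℕ := n.factorization.prod fun p k => if y < p then p ^ k else 1

/-- The largest divisor of `n` composed of primes at most `y`. -/
def smooth (y n : ℕ) : ℕ := n.factorization.prod fun p k => if y < p then 1 else p ^ k

lemma smooth_mul_rough (y : ℕ) {n : ℕ} (hn : n ≠ 0) : smooth y n * rough y n = n := by
  rw [smooth, rough, ← Finsupp.prod_mul]
  conv_rhs => rw [← Nat.prod_factorization_pow_eq_self hn]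
  refine Finsupp.prod_congr fun p _ => ?_
  split_ifs <;> simp

lemma rough_mul (y : ℕ) {m n : ℕ} (hm : m ≠ 0) (hn : n ≠ 0) :
    rough y (m * n) = rough y m * rough y n := by
  rw [rough, Nat.factorization_mul hm hn, Finsupp.prod_add_index']
  · rfl
  · intro p; simp
  · intro p a b; split_ifs <;> simp [pow_add]

lemma smooth_mul (y : ℕ) {m n : ℕ} (hm : m ≠ 0) (hn : n ≠ 0) :
    smooth y (m * n) = smooth y m * smooth y n := by
  rw [smooth, Nat.factorization_mul hm hn, Finsupp.prod_add_index']
  · rfl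
  · intro p; simp
  · intro p a b; split_ifs <;> simp [pow_add]

@[simp] lemma rough_one (y : ℕ) : rough y 1 = 1 := by simp [rough]

@[simp] lemma smooth_one (y : ℕ) : smooth y 1 = 1 := by simp [smooth]

lemma rough_pos (y n : ℕ) : 0 < rough y n := by
  rw [rough, Finsupp.prod]
  refine Finset.prod_pos fun p hp => ?_
  have := (Nat.prime_of_mem_primeFactors hp).pos
  split_ifs <;> positivity

lemma smooth_pos (y n : ℕ) : 0 < smooth y n := by
  rw [smooth, Finsupp.prod]
  refine Finset.prod_pos fun p hp => ?_
  have := (Nat.prime_of_mem_primeFactors hp).pos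
  split_ifs <;> positivity

lemma lt_of_dvd_rough {y n p : ℕ} (hp : p.Prime) (h : p ∣ rough y n) : y < p := by
  rw [rough, Finsupp.prod, Prime.dvd_finsetProd_iff hp.prime] at h
  obtain ⟨r, hr, hd⟩ := h
  split_ifs at hd with h'
  · rwa [(Nat.prime_dvd_prime_iff_eq hp (Nat.prime_of_mem_primeFactors hr)).1 (hp.dvd_of_dvd_pow hd)]
  · exact absurd hd hp.not_dvd_one

lemma le_of_dvd_smooth {y n p : ℕ} (hp : p.Prime) (h : p ∣ smooth y n) : p ≤ y := by
  rw [smooth, Finsupp.prod, Prime.dvd_finsetProd_iff hp.prime] at h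
  obtain ⟨r, hr, hd⟩ := h
  split_ifs at hd with h'
  · exact absurd hd hp.not_dvd_one
  · rw [(Nat.prime_dvd_prime_iff_eq hp (Nat.prime_of_mem_primeFactors hr)).1 (hp.dvd_of_dvd_pow hd)]
    omega

lemma coprime_smooth_rough (y n : ℕ) : (smooth y n).Coprime (rough y n) := by
  refine Nat.Coprime.symm (Nat.Coprime.symm (Nat.coprime_of_dvd fun p hp h1 h2 => ?_))
  have := le_of_dvd_smooth hp h1
  have := lt_of_dvd_rough hp h2
  omega

lemma smooth_succ (y n : ℕ) :
    smooth (y + 1) n = smooth y n * (y + 1) ^ (n.factorization (y + 1)) := by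
  have : (y + 1) ^ (n.factorization (y + 1)) =
      n.factorization.prod fun p k => if p = y + 1 then p ^ k else 1 := by
    rw [Finsupp.prod, Finset.prod_ite_eq']
    split_ifs with h
    · rfl
    · rw [Finsupp.notMem_support_iff.1 h, pow_zero]
  rw [this, smooth, smooth, ← Finsupp.prod_mul]
  refine Finsupp.prod_congr fun p _ => ?_
  rcases lt_trichotomy p (y + 1) with h | h | h
  · rw [if_neg (by omega), if_neg (by omega), if_neg (by omega), mul_one]
  · rw [if_neg (by omega), if_pos (by omega), if_pos h, one_mul]
  · rw [if_pos (by omega), if_pos (by omega), if_neg (by omega), mul_one]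

lemma smooth_zero (n : ℕ) : smooth 0 n = 1 := by
  rw [smooth, Finsupp.prod]
  refine Finset.prod_eq_one fun p hp => ?_
  rw [if_pos (Nat.prime_of_mem_primeFactors hp).pos]

lemma smooth_self {n : ℕ} (hn : n ≠ 0) : smooth n n = n := by
  conv_rhs => rw [← Nat.prod_factorization_pow_eq_self hn]
  refine Finsupp.prod_congr fun p hp => ?_
  rw [if_neg (not_lt.2 (Nat.le_of_dvd (Nat.pos_of_ne_zero hn) (Nat.dvd_of_mem_primeFactors hp)))]

lemma rough_prime_pow {y p : ℕ} (hp : p.Prime) (k : ℕ) :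
    rough y (p ^ k) = if y < p then p ^ k else 1 := by
  rw [rough, hp.factorization_pow, Finsupp.prod_single_index]
  simp

lemma smooth_prime_pow {y p : ℕ} (hp : p.Prime) (k : ℕ) :
    smooth y (p ^ k) = if y < p then 1 else p ^ k := by
  rw [smooth, hp.factorization_pow, Finsupp.prod_single_index]
  simp

/-- If `n > Z`, some prime `p` splits `n = b d` with `b ≤ Z < b p ^ e`. -/
lemma exists_smooth_split {n : ℕ} {Z : ℝ} (hZ : 1 ≤ Z) (hn : Z < n) :
    ∃ p : ℕ, p.Prime ∧ (smooth (p - 1) n : ℝ) ≤ Z ∧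
      Z < smooth (p - 1) n * (p : ℝ) ^ (n.factorization p) := by
  have hn0 : n ≠ 0 := by rintro rfl; simp at hn; linarith
  have hex : ∃ v, Z < smooth v n := ⟨n, by rwa [smooth_self hn0]⟩
  have hv := Nat.find_spec hex
  have hmin := fun m => Nat.find_min (m := m) hex
  set v := Nat.find hex
  have hv0 : v ≠ 0 := by
    intro h; rw [h, smooth_zero] at hv; push_cast at hv; linarith
  have h1 := not_lt.1 (hmin (v - 1) (by omega))
  have h2 : (smooth v n : ℝ) = smooth (v - 1) n * (v : ℝ) ^ (n.factorization v) := by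
    have := smooth_succ (v - 1) n
    rw [Nat.sub_add_cancel (by omega)] at this
    rw [this]; push_cast; rfl
  refine ⟨v, ?_, h1, h2 ▸ hv⟩
  by_contra hp
  rw [Nat.factorization_eq_zero_of_not_prime _ hp, pow_zero, mul_one] at h2
  linarith

end SmoothRough

section EulerBound

open Finset

/-- Nonnegative multiplicative functions with controlled growth. -/
structure IsShiu (A C₁ : ℝ) (g : ℕ → ℝ) : Prop where
  one : g 1 = 1
  nonneg : ∀ n, 0 ≤ g n
  mul : ∀ m n, Nat.Coprime m n → g (m * n) = g m * g n
  prime_pow : ∀ p k : ℕ, p.Prime → g (p ^ k) ≤ A ^ k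
  growth : ∀ n : ℕ, 1 ≤ n → g n ≤ C₁ * (n : ℝ) ^ (1 / 40 : ℝ)

lemma IsShiu.le_pow {A C₁ : ℝ} {g : ℕ → ℝ} (hg : IsShiu A C₁ g) (hA : 1 ≤ A) {d s m N : ℕ}
    (hd : d ≠ 0) (hdN : d ≤ N) (hs : ∀ p : ℕ, p.Prime → p ∣ d → s < p) (hN : N < (s + 1) ^ m) :
    g d ≤ A ^ m := by
  have h1 : ∀ d : ℕ, d ≠ 0 → g d ≤ A ^ (ArithmeticFunction.cardFactors d) := by
    intro d
    induction d using Nat.recOnPosPrimePosCoprime with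
    | prime_pow p k hp hk =>
      intro _
      rw [ArithmeticFunction.cardFactors_apply_prime_pow hp]
      exact hg.prime_pow p k hp
    | zero => simp
    | one => simp [hg.one]
    | coprime a b ha hb hab iha ihb =>
      intro _
      rw [hg.mul a b hab, ArithmeticFunction.cardFactors_mul (by omega) (by omega), pow_add]
      exact mul_le_mul (iha (by omega)) (ihb (by omega)) (hg.nonneg b) (by positivity)
  have h2 : (s + 1) ^ (ArithmeticFunction.cardFactors d) ≤ d := by
    rw [ArithmeticFunction.cardFactors_apply]
    conv_rhs => rw [← Nat.prod_primeFactorsList hd]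
    refine List.pow_card_le_prod _ _ fun p hp => ?_
    exact hs p (Nat.prime_of_mem_primeFactorsList hp) (Nat.dvd_of_mem_primeFactorsList hp)
  refine (h1 d hd).trans (pow_le_pow_right₀ hA ?_)
  by_contra hlt
  push Not at hlt
  have : (s + 1) ^ m ≤ (s + 1) ^ (ArithmeticFunction.cardFactors d) :=
    Nat.pow_le_pow_right (by omega) hlt.le
  omega

lemma IsShiu.sum_le {A C₁ : ℝ} {g : ℕ → ℝ} (hg : IsShiu A C₁ g) (hC : 0 ≤ C₁) {σ : ℝ} (hσ : 7 / 10 ≤ σ)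
    (P : Finset ℕ) (hP : ∀ p ∈ P, p.Prime) (S : Finset ℕ)
    (hS : ∀ n ∈ S, n ≠ 0 ∧ ∀ p : ℕ, p.Prime → p ∣ n → p ∈ P) :
    ∑ n ∈ S, g n * (n : ℝ) ^ (-σ) ≤ Real.exp (16 * C₁) * Real.exp (∑ p ∈ P, g p * (p : ℝ) ^ (-σ)) := by
  set F : ℕ → ℝ := fun n => g n * (n : ℝ) ^ (-σ) with hF
  have hF0 : ∀ n, 0 ≤ F n := fun n => mul_nonneg (hg.nonneg n) (by positivity)
  have hpk : ∀ p : ℕ, p.Prime → ∀ k : ℕ, F (p ^ k) ≤ C₁ * ((p : ℝ) ^ (-(27 / 40) : ℝ)) ^ k := by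
    intro p hp k
    have hp1 : (1 : ℝ) ≤ p := by exact_mod_cast hp.one_lt.le
    have hp0 : (0 : ℝ) < p := by linarith
    have h1 := hg.growth (p ^ k) (Nat.pow_pos hp.pos)
    have hpk1 : (1 : ℝ) ≤ ((p ^ k : ℕ) : ℝ) := by exact_mod_cast Nat.one_le_pow _ _ hp.pos
    calc F (p ^ k) ≤ C₁ * ((p ^ k : ℕ) : ℝ) ^ (1 / 40 : ℝ) * ((p ^ k : ℕ) : ℝ) ^ (-(7 / 10) : ℝ) := by
          simp only [hF]
          have : ((p ^ k : ℕ) : ℝ) ^ (-σ) ≤ ((p ^ k : ℕ) : ℝ) ^ (-(7 / 10) : ℝ) :=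
            Real.rpow_le_rpow_of_exponent_le hpk1 (by linarith)
          exact mul_le_mul h1 this (by positivity) (by positivity)
      _ = C₁ * ((p ^ k : ℕ) : ℝ) ^ (-(27 / 40) : ℝ) := by
          rw [mul_assoc, ← Real.rpow_add (by linarith)]; norm_num
      _ = _ := by
          push_cast
          rw [← Real.rpow_natCast, ← Real.rpow_mul hp0.le, mul_comm (k : ℝ), Real.rpow_mul hp0.le, Real.rpow_natCast]
  have hx : ∀ p : ℕ, p.Prime → (p : ℝ) ^ (-(27 / 40) : ℝ) ≤ 3 / 4 := by
    intro p hp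
    have hp2 : (2 : ℝ) ≤ p := by exact_mod_cast hp.two_le
    calc (p : ℝ) ^ (-(27 / 40) : ℝ) ≤ (2 : ℝ) ^ (-(27 / 40) : ℝ) :=
          Real.rpow_le_rpow_of_nonpos (by norm_num) hp2 (by norm_num)
      _ ≤ (2 : ℝ) ^ (-(1 / 2) : ℝ) := Real.rpow_le_rpow_of_exponent_le (by norm_num) (by norm_num)
      _ = (√2)⁻¹ := by rw [Real.rpow_neg (by norm_num), Real.sqrt_eq_rpow]
      _ ≤ 3 / 4 := by
          rw [inv_le_comm₀ (by positivity) (by norm_num)]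
          exact Real.le_sqrt_of_sq_le (by norm_num)
  have hgeom : ∀ p : ℕ, p.Prime → Summable (fun k : ℕ => C₁ * ((p : ℝ) ^ (-(27 / 40) : ℝ)) ^ k) := fun p hp =>
    (summable_geometric_of_lt_one (by positivity) ((hx p hp).trans_lt (by norm_num))).mul_left _
  have hsum : ∀ p : ℕ, p.Prime → Summable (fun k : ℕ => F (p ^ k)) := fun p hp =>
    Summable.of_nonneg_of_le (fun k => hF0 _) (hpk p hp) (hgeom p hp)
  have hE := (EulerProduct.summable_and_hasSum_factoredNumbers_prod_filter_prime_tsum (f := F)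
    (by simp [hF, hg.one]) (by
      intro m n hmn
      simp only [hF]
      rw [hg.mul m n hmn]
      push_cast
      rw [Real.mul_rpow (by positivity) (by positivity)]
      ring) (by
      intro p hp
      simp only [Real.norm_of_nonneg (hF0 _)]
      exact hsum p hp) P).2
  rw [Finset.filter_true_of_mem hP] at hE
  have h1 : ∑ n ∈ S, F n ≤ ∏ p ∈ P, ∑' k : ℕ, F (p ^ k) := by
    have hmem : ∀ n ∈ S, n ∈ Nat.factoredNumbers P := by
      intro n hn
      rw [Nat.mem_factoredNumbers]
      exact ⟨(hS n hn).1, fun p hp => (hS n hn).2 p (Nat.prime_of_mem_primeFactorsList hp)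
        (Nat.dvd_of_mem_primeFactorsList hp)⟩
    have : ∑ n ∈ S, F n = ∑ n ∈ S.attach.image
        (fun n => (⟨n.1, hmem n.1 n.2⟩ : Nat.factoredNumbers P)), F n.1 := by
      rw [Finset.sum_image (by
        intro a _ b _ hab
        exact Subtype.ext (by simpa using hab))]
      exact (Finset.sum_attach S F).symm
    rw [this]
    exact sum_le_hasSum _ (fun n _ => hF0 _) hE
  have h2 : ∀ p ∈ P, ∑' k : ℕ, F (p ^ k) ≤ Real.exp (g p * (p : ℝ) ^ (-σ) + 4 * C₁ * (p : ℝ) ^ (-1 - 7 / 20 : ℝ)) := by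
    intro p hp
    have hpp := hP p hp
    have hp0 : (0 : ℝ) < p := by exact_mod_cast hpp.pos
    rw [← (hsum p hpp).sum_add_tsum_nat_add 2]
    have h3 : ∑' k : ℕ, F (p ^ (k + 2)) ≤ 4 * C₁ * (p : ℝ) ^ (-1 - 7 / 20 : ℝ) := by
      have h4 : ∑' k : ℕ, F (p ^ (k + 2)) ≤ ∑' k : ℕ, C₁ * ((p : ℝ) ^ (-(27 / 40) : ℝ)) ^ (k + 2) :=
        Summable.tsum_le_tsum (fun k => hpk p hpp (k + 2)) ((summable_nat_add_iff 2).2 (hsum p hpp))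
          ((summable_nat_add_iff 2).2 (hgeom p hpp))
      refine h4.trans ?_
      simp_rw [pow_add, mul_comm (_ ^ _) (((p : ℝ) ^ (-(27 / 40) : ℝ)) ^ 2), ← mul_assoc]
      rw [tsum_mul_left, tsum_geometric_of_lt_one (by positivity) ((hx p hpp).trans_lt (by norm_num)),
        ← Real.rpow_mul_natCast hp0.le]
      have : (1 - (p : ℝ) ^ (-(27 / 40) : ℝ))⁻¹ ≤ 4 := by
        rw [inv_le_comm₀ (by linarith [hx p hpp]) (by norm_num)]
        linarith [hx p hpp]
      calc _ ≤ C₁ * (p : ℝ) ^ (-(27 / 40) * (2 : ℕ) : ℝ) * 4 := by gcongr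
        _ = _ := by norm_num; ring
    have h5 : ∑ k ∈ Finset.range 2, F (p ^ k) = 1 + g p * (p : ℝ) ^ (-σ) := by
      simp [Finset.sum_range_succ, hF, hg.one]
    rw [h5]
    have := Real.add_one_le_exp (g p * (p : ℝ) ^ (-σ) + 4 * C₁ * (p : ℝ) ^ (-1 - 7 / 20 : ℝ))
    linarith
  refine h1.trans ((Finset.prod_le_prod (fun p _ => tsum_nonneg fun k => hF0 _) h2).trans ?_)
  rw [← Real.exp_sum, ← Real.exp_add, Real.exp_le_exp, Finset.sum_add_distrib, ← Finset.mul_sum]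
  have h6 : ∑ p ∈ P, (p : ℝ) ^ (-1 - 7 / 20 : ℝ) ≤ 4 := by
    calc _ ≤ ∑ n ∈ Finset.Icc 1 (P.sup id), (n : ℝ) ^ (-1 - 7 / 20 : ℝ) := by
          refine Finset.sum_le_sum_of_subset_of_nonneg (fun p hp => ?_) (fun _ _ _ => by positivity)
          exact Finset.mem_Icc.2 ⟨(hP p hp).pos, Finset.le_sup (f := id) hp⟩
      _ ≤ 1 + 1 / (7 / 20) := sum_rpow_le (by norm_num) _
      _ ≤ 4 := by norm_num
  nlinarith

end EulerBound
section Shiu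

lemma card_modEq_rough_cofactor_le {q a M H N s b : ℕ} (hq : 1 ≤ q) (ha : a.Coprime q)
    (hN : 1 ≤ N) (hH : q * (N : ℝ) ^ (1 / 2 : ℝ) ≤ H) (hs : 1 ≤ s)
    (hsN : (s : ℝ) ≤ (N : ℝ) ^ (1 / 20 : ℝ)) (hb : 1 ≤ b) (hbN : (b : ℝ) ≤ (N : ℝ) ^ (1 / 4 : ℝ)) :
    (((Finset.Ioc M (M + H)).filter (fun n => n ≡ a [MOD q] ∧ b ∣ n ∧
      ∀ p : ℕ, p.Prime → p ∣ n / b → s < p)).card : ℝ) ≤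
      3 * (H / (q.totient * Real.log (s + 1 : ℕ))) / b := by
  have hφ : (0 : ℝ) < q.totient := by exact_mod_cast Nat.totient_pos.2 hq
  have hφq : (q.totient : ℝ) ≤ q := by exact_mod_cast Nat.totient_le q
  have hb0 : (0 : ℝ) < b := by exact_mod_cast hb
  have hN1 : (1 : ℝ) ≤ N := by exact_mod_cast hN
  have hN0 : (0 : ℝ) < N := by linarith
  have hs1 : (1 : ℝ) ≤ s := by exact_mod_cast hs
  have hlog : 0 < Real.log (s + 1 : ℕ) := Real.log_pos (by push_cast; linarith)
  set S := (Finset.Ioc M (M + H)).filter (fun n => n ≡ a [MOD q] ∧ b ∣ n ∧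
      ∀ p : ℕ, p.Prime → p ∣ n / b → s < p) with hS
  rcases S.eq_empty_or_nonempty with he | ⟨n₀, hn₀⟩
  · rw [he]; simp only [Finset.card_empty, Nat.cast_zero]; positivity
  have hn₀' := hn₀
  rw [hS, Finset.mem_filter] at hn₀'
  obtain ⟨-, h1, ⟨d₀, rfl⟩, -⟩ := hn₀'
  have hcop : (b * d₀).Coprime q := by
    rw [Nat.Coprime, h1.gcd_eq]; exact ha
  have hbq : b.Coprime q := hcop.coprime_mul_right
  obtain ⟨H', hH'⟩ : ∃ H', (M + H) / b = M / b + H' :=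
    ⟨(M + H) / b - M / b, by have := Nat.div_le_div_right (c := b) (show M ≤ M + H by omega); omega⟩
  have hcard : S.card ≤ ((Finset.Ioc (M / b) (M / b + H')).filter (fun n => n ≡ d₀ [MOD q] ∧
      ∀ p : ℕ, p.Prime → p ∣ n → s < p)).card := by
    refine Finset.card_le_card_of_injOn (fun n => n / b) ?_ ?_
    · intro n hn
      rw [hS, Finset.mem_coe, Finset.mem_filter, Finset.mem_Ioc] at hn
      obtain ⟨⟨hn1, hn2⟩, hn3, ⟨d, rfl⟩, hn4⟩ := hn
      rw [Nat.mul_div_cancel_left _ hb] at hn4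
      simp only [Finset.coe_filter, Finset.mem_Ioc, Set.mem_ofPred_eq, Nat.mul_div_cancel_left _ hb]
      refine ⟨⟨?_, ?_⟩, ?_, hn4⟩
      · rw [Nat.div_lt_iff_lt_mul hb]; linarith [mul_comm d b]
      · rw [← hH', Nat.le_div_iff_mul_le hb]; linarith [mul_comm d b]
      · refine Nat.ModEq.cancel_left_of_coprime (c := b) ?_ (hn3.trans h1.symm)
        rw [Nat.gcd_comm]; exact hbq
    · intro m hm n hn hmn
      rw [hS, Finset.mem_coe, Finset.mem_filter] at hm hn
      exact Nat.div_left_inj hm.2.2.1 hn.2.2.1 |>.1 hmn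
  have hH'le : (H' : ℝ) ≤ H / b + 1 := by
    have h2 : ((M / b + H' : ℕ) : ℝ) ≤ ((M + H : ℕ) : ℝ) / b := by
      rw [← hH']; exact Nat.cast_div_le
    have h3 : (M : ℝ) / b < ((M / b : ℕ) : ℝ) + 1 := by
      rw [div_lt_iff₀ hb0]
      have := Nat.lt_mul_div_succ M hb
      have h4 : (M : ℝ) < ((b * (M / b + 1) : ℕ) : ℝ) := by exact_mod_cast this
      push_cast at h4; linarith
    push_cast at h2
    rw [add_div] at h2
    linarith
  have hmain := card_rough_modEq_le q d₀ (M / b) H' s hq hs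
  have hX : (N : ℝ) ^ (1 / 4 : ℝ) * q ≤ H / b := by
    rw [le_div_iff₀ hb0]
    calc (N : ℝ) ^ (1 / 4 : ℝ) * q * b ≤ (N : ℝ) ^ (1 / 4 : ℝ) * q * (N : ℝ) ^ (1 / 4 : ℝ) := by gcongr
      _ = q * ((N : ℝ) ^ (1 / 4 : ℝ) * (N : ℝ) ^ (1 / 4 : ℝ)) := by ring
      _ = q * (N : ℝ) ^ (1 / 2 : ℝ) := by rw [← Real.rpow_add hN0]; norm_num
      _ ≤ H := hH
  have hq1 : (1 : ℝ) ≤ q := by exact_mod_cast hq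
  have hone : (1 : ℝ) ≤ H / b := by
    have : (1 : ℝ) ≤ (N : ℝ) ^ (1 / 4 : ℝ) := Real.one_le_rpow hN1 (by norm_num)
    nlinarith
  have hs4 : (s : ℝ) ^ 4 ≤ H / b / (q.totient * Real.log (s + 1 : ℕ)) := by
    rw [le_div_iff₀ (by positivity)]
    have hl : Real.log (s + 1 : ℕ) ≤ s := by
      have := Real.log_le_sub_one_of_pos (x := ((s + 1 : ℕ) : ℝ)) (by positivity)
      push_cast at this ⊢; linarith
    calc (s : ℝ) ^ 4 * (q.totient * Real.log (s + 1 : ℕ)) ≤ (s : ℝ) ^ 4 * (q * s) := by gcongr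
      _ = (s : ℝ) ^ 5 * q := by ring
      _ ≤ ((N : ℝ) ^ (1 / 20 : ℝ)) ^ 5 * q := by gcongr
      _ = (N : ℝ) ^ (1 / 4 : ℝ) * q := by
          rw [← Real.rpow_mul_natCast hN0.le]; norm_num
      _ ≤ _ := hX
  calc (S.card : ℝ) ≤ _ := by exact_mod_cast hcard
    _ ≤ _ := hmain
    _ ≤ (H / b + H / b) / (q.totient * Real.log (s + 1 : ℕ)) + H / b / (q.totient * Real.log (s + 1 : ℕ)) := by
        gcongr; linarith
    _ = _ := by field_simp; ring

/-- Integers with a prescribed set of possible smooth parts, the cofactor being free of small primes. -/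
lemma IsShiu.sum_block_le {A C₁ : ℝ} {g : ℕ → ℝ} (hg : IsShiu A C₁ g) (hA : 1 ≤ A)
    {q a M H N s m : ℕ} (hq : 1 ≤ q) (ha : a.Coprime q)
    (hN : 1 ≤ N) (hMH : M + H ≤ N) (hH : q * (N : ℝ) ^ (1 / 2 : ℝ) ≤ H) (hs : 1 ≤ s)
    (hsN : (s : ℝ) ≤ (N : ℝ) ^ (1 / 20 : ℝ)) (hm : N < (s + 1) ^ m)
    (T S : Finset ℕ) (hT : ∀ b ∈ T, 1 ≤ b ∧ (b : ℝ) ≤ (N : ℝ) ^ (1 / 4 : ℝ))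
    (hS : ∀ n ∈ S, n ∈ Finset.Ioc M (M + H) ∧ n ≡ a [MOD q] ∧
      ∃ b ∈ T, b ∣ n ∧ b.Coprime (n / b) ∧ ∀ p : ℕ, p.Prime → p ∣ n / b → s < p) :
    ∑ n ∈ S, g n ≤ A ^ m * (3 * (H / (q.totient * Real.log (s + 1 : ℕ)))) * ∑ b ∈ T, g b / b := by
  set U : ℕ → Finset ℕ := fun b => (Finset.Ioc M (M + H)).filter (fun n => n ≡ a [MOD q] ∧ b ∣ n ∧
      ∀ p : ℕ, p.Prime → p ∣ n / b → s < p) with hU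
  have hpt : ∀ n ∈ S, g n ≤ ∑ b ∈ T, if n ∈ U b then g b * A ^ m else 0 := by
    intro n hn
    obtain ⟨h1, h2, b, hb, ⟨d, rfl⟩, h4, h5⟩ := hS n hn
    have hb1 : 0 < b := (hT b hb).1
    have hmem : b * d ∈ U b := by
      simp only [hU, Finset.mem_filter]
      exact ⟨h1, h2, ⟨d, rfl⟩, h5⟩
    rw [Nat.mul_div_cancel_left _ hb1] at h4 h5
    rw [Finset.mem_Ioc] at h1
    have hd0 : d ≠ 0 := by rintro rfl; omega
    have hdN : d ≤ N := (Nat.le_mul_of_pos_left d hb1).trans (by omega)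
    calc g (b * d) = g b * g d := hg.mul _ _ h4
      _ ≤ g b * A ^ m := mul_le_mul_of_nonneg_left (hg.le_pow hA hd0 hdN h5 hm) (hg.nonneg b)
      _ = if b * d ∈ U b then g b * A ^ m else 0 := by rw [if_pos hmem]
      _ ≤ _ := Finset.single_le_sum (f := fun b' => if b * d ∈ U b' then g b' * A ^ m else 0)
          (fun b' _ => by have := hg.nonneg b'; split_ifs <;> positivity) hb
  calc ∑ n ∈ S, g n ≤ ∑ n ∈ S, ∑ b ∈ T, if n ∈ U b then g b * A ^ m else 0 := Finset.sum_le_sum hpt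
    _ = ∑ b ∈ T, ((S.filter (· ∈ U b)).card : ℝ) * (g b * A ^ m) := by
        rw [Finset.sum_comm]
        refine Finset.sum_congr rfl fun b _ => ?_
        rw [← Finset.sum_filter, Finset.sum_const, nsmul_eq_mul]
    _ ≤ ∑ b ∈ T, (3 * (H / (q.totient * Real.log (s + 1 : ℕ))) / b) * (g b * A ^ m) := by
        refine Finset.sum_le_sum fun b hb => ?_
        have := hg.nonneg b
        refine mul_le_mul_of_nonneg_right ?_ (by positivity)
        refine le_trans ?_ (card_modEq_rough_cofactor_le (M := M) hq ha hN hH hs hsN (hT b hb).1 (hT b hb).2)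
        exact_mod_cast Finset.card_le_card fun n hn => (Finset.mem_filter.1 hn).2
    _ = _ := by
        rw [Finset.mul_sum]
        exact Finset.sum_congr rfl fun b _ => by ring


lemma card_modEq_dvd_le_two_mul {q a M H N D : ℕ} (hq : 1 ≤ q) (ha : a.Coprime q)
    (hH : q * (N : ℝ) ^ (1 / 2 : ℝ) ≤ H) (hD : 1 ≤ D) (hDN : (D : ℝ) ≤ (N : ℝ) ^ (1 / 2 : ℝ)) :
    (((Finset.Ioc M (M + H)).filter (fun n => n ≡ a [MOD q] ∧ D ∣ n)).card : ℝ) ≤ 2 * (H / (q * D)) := by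
  have hq0 : (0 : ℝ) < q := by exact_mod_cast hq
  have hD0 : (0 : ℝ) < D := by exact_mod_cast hD
  by_cases hDq : D.Coprime q
  · have h1 := (abs_le.1 (card_modEq_dvd_le q a M H D hq hD hDq)).2
    have h2 : (1 : ℝ) ≤ H / (q * D) := by
      rw [le_div_iff₀ (by positivity)]
      calc 1 * ((q : ℝ) * D) ≤ q * (N : ℝ) ^ (1 / 2 : ℝ) := by rw [one_mul]; gcongr
        _ ≤ _ := hH
    linarith
  · have : (Finset.Ioc M (M + H)).filter (fun n => n ≡ a [MOD q] ∧ D ∣ n) = ∅ := by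
      refine Finset.filter_eq_empty_iff.2 fun n _ ⟨h1, h2⟩ => hDq ?_
      have : n.Coprime q := by rw [Nat.Coprime, h1.gcd_eq]; exact ha
      exact Nat.Coprime.coprime_dvd_left h2 this
    rw [this]; simp only [Finset.card_empty, Nat.cast_zero]; positivity

/-- Rankin's trick. -/
lemma IsShiu.rankin {A C₁ : ℝ} {g : ℕ → ℝ} (hg : IsShiu A C₁ g) (hC : 0 ≤ C₁) {N w : ℕ} (hN : 1 ≤ N)
    (hw : 1 ≤ w) (hwN : w ≤ N)
    {ε B : ℝ} (hε : 0 ≤ ε) (hε' : ε ≤ 3 / 10) (hB : ε * Real.log w ≤ B)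
    (T : Finset ℕ) (hT : ∀ b ∈ T, (N : ℝ) ^ (1 / 8 : ℝ) < b ∧ ∀ p : ℕ, p.Prime → p ∣ b → p ≤ w) :
    ∑ b ∈ T, g b / b ≤ (N : ℝ) ^ (-(ε / 8)) * (Real.exp (16 * C₁ + A * Real.exp B * (B + 2)) *
      Real.exp (∑ p ∈ (Finset.Icc 1 N).filter Nat.Prime, g p / p)) := by
  have hN1 : (1 : ℝ) ≤ N := by exact_mod_cast hN
  have hN0 : (0 : ℝ) < N := by linarith
  have hA : 0 ≤ A := by
    have := (hg.nonneg (2 ^ 1)).trans (hg.prime_pow 2 1 Nat.prime_two); simpa using this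
  set P := (Finset.Icc 1 w).filter Nat.Prime with hP
  have h1 : ∑ b ∈ T, g b / b ≤ (N : ℝ) ^ (-(ε / 8)) * ∑ b ∈ T, g b * (b : ℝ) ^ (-(1 - ε)) := by
    rw [Finset.mul_sum]
    refine Finset.sum_le_sum fun b hb => ?_
    have hNb := (hT b hb).1
    have hb0 : (0 : ℝ) < b := lt_of_le_of_lt (by positivity) hNb
    have h2 : (N : ℝ) ^ (ε / 8) ≤ (b : ℝ) ^ ε := by
      calc (N : ℝ) ^ (ε / 8) = ((N : ℝ) ^ (1 / 8 : ℝ)) ^ ε := by rw [← Real.rpow_mul hN0.le]; ring_nf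
        _ ≤ _ := Real.rpow_le_rpow (by positivity) hNb.le hε
    have h3 : (b : ℝ) ^ (-(1 - ε)) = (b : ℝ)⁻¹ * (b : ℝ) ^ ε := by
      rw [← Real.rpow_neg_one, ← Real.rpow_add hb0]; ring_nf
    rw [h3, Real.rpow_neg hN0.le]
    have h4 : 0 < (N : ℝ) ^ (ε / 8) := by positivity
    have h5 : 1 ≤ ((N : ℝ) ^ (ε / 8))⁻¹ * (b : ℝ) ^ ε := by
      rw [inv_mul_eq_div, one_le_div h4]; exact h2
    have := hg.nonneg b
    calc g b / b = g b * (b : ℝ)⁻¹ * 1 := by ring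
      _ ≤ g b * (b : ℝ)⁻¹ * (((N : ℝ) ^ (ε / 8))⁻¹ * (b : ℝ) ^ ε) := by gcongr
      _ = _ := by ring
  have h6 := hg.sum_le hC (σ := 1 - ε) (by linarith) P (fun p hp => (Finset.mem_filter.1 hp).2) T (fun b hb => by
    have hb0 : (0 : ℝ) < b := lt_of_le_of_lt (by positivity) (hT b hb).1
    refine ⟨by rintro rfl; simp at hb0, fun p hp hpb => ?_⟩
    exact Finset.mem_filter.2 ⟨Finset.mem_Icc.2 ⟨hp.pos, (hT b hb).2 p hp hpb⟩, hp⟩)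
  have h7 : ∑ p ∈ P, g p * (p : ℝ) ^ (-(1 - ε)) ≤
      ∑ p ∈ (Finset.Icc 1 N).filter Nat.Prime, g p / p + A * Real.exp B * (B + 2) := by
    have h8 : ∀ p ∈ P, g p * (p : ℝ) ^ (-(1 - ε)) ≤ g p / p + A * Real.exp B * ε * (Real.log p / p) := by
      intro p hp
      rw [hP, Finset.mem_filter, Finset.mem_Icc] at hp
      have hp0 : (0 : ℝ) < p := by exact_mod_cast hp.2.pos
      have hlp : 0 ≤ Real.log p := Real.log_natCast_nonneg p
      have hlw : Real.log p ≤ Real.log w := Real.log_le_log hp0 (by exact_mod_cast hp.1.2)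
      have hu : ε * Real.log p ≤ B := (mul_le_mul_of_nonneg_left hlw hε).trans hB
      have hgp : g p ≤ A := by simpa using hg.prime_pow p 1 hp.2
      have hg0 := hg.nonneg p
      have h3 : (p : ℝ) ^ (-(1 - ε)) = (p : ℝ)⁻¹ * Real.exp (ε * Real.log p) := by
        rw [show -(1 - ε) = -1 + ε by ring, Real.rpow_add hp0, Real.rpow_neg_one, Real.rpow_def_of_pos hp0 ε]
        ring_nf
      have h9 : Real.exp (ε * Real.log p) ≤ 1 + ε * Real.log p * Real.exp B := by
        have h10 := Real.add_one_le_exp (-(ε * Real.log p))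
        have h11 : Real.exp (ε * Real.log p) ≤ Real.exp B := Real.exp_le_exp.2 hu
        have h12 : Real.exp (ε * Real.log p) * Real.exp (-(ε * Real.log p)) = 1 := by
          rw [← Real.exp_add]; simp
        have h13 : 0 ≤ ε * Real.log p := by positivity
        nlinarith [Real.exp_pos (ε * Real.log p)]
      rw [h3]
      calc g p * ((p : ℝ)⁻¹ * Real.exp (ε * Real.log p)) ≤
            g p * ((p : ℝ)⁻¹ * (1 + ε * Real.log p * Real.exp B)) := by gcongr
        _ = g p / p + g p * (Real.exp B * ε * (Real.log p / p)) := by ring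
        _ ≤ g p / p + A * (Real.exp B * ε * (Real.log p / p)) := by gcongr
        _ = _ := by ring
    refine (Finset.sum_le_sum h8).trans ?_
    rw [Finset.sum_add_distrib, ← Finset.mul_sum]
    have h14 := sum_primes_log_div_le hw
    have h15 : ε * (Real.log w + 6) ≤ B + 2 := by linarith
    have h16 : ∑ p ∈ P, g p / p ≤ ∑ p ∈ (Finset.Icc 1 N).filter Nat.Prime, g p / p := by
      refine Finset.sum_le_sum_of_subset_of_nonneg ?_ fun p _ _ => div_nonneg (hg.nonneg p) (by positivity)
      exact Finset.filter_subset_filter _ (Finset.Icc_subset_Icc_right hwN)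
    have h17 : A * Real.exp B * ε * ∑ p ∈ P, Real.log p / p ≤ A * Real.exp B * (B + 2) := by
      rw [mul_assoc]
      refine mul_le_mul_of_nonneg_left ?_ (by positivity)
      exact (mul_le_mul_of_nonneg_left h14 hε).trans h15
    linarith
  refine h1.trans (mul_le_mul_of_nonneg_left (h6.trans ?_) (by positivity))
  rw [← Real.exp_add, ← Real.exp_add, Real.exp_le_exp]
  linarith

lemma isShiu_one : IsShiu 1 1 (fun _ => 1) where
  one := rfl
  nonneg _ := by norm_num
  mul _ _ _ := by norm_num
  prime_pow _ _ _ := by norm_num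
  growth n hn := by
    rw [one_mul]
    exact Real.one_le_rpow (by exact_mod_cast hn) (by norm_num)

end Shiu
section Shiu

variable {A C₁ : ℝ} {g : ℕ → ℝ} {q a M H N : ℕ}

lemma div_mul_rpow_le (hq : 1 ≤ q) (hN : 2 ≤ N) :
    (H : ℝ) / q * (N : ℝ) ^ (-(1 / 80) : ℝ) ≤ 80 * (H / (q.totient * Real.log N)) := by
  have hφ : (0 : ℝ) < q.totient := by exact_mod_cast Nat.totient_pos.2 hq
  have hφq : (q.totient : ℝ) ≤ q := by exact_mod_cast Nat.totient_le q
  have hN2 : (2 : ℝ) ≤ N := by exact_mod_cast hN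
  have hL : 0 < Real.log N := Real.log_pos (by linarith)
  have h1 := Real.log_le_rpow_div (x := (N : ℝ)) (by linarith) (ε := 1 / 80) (by norm_num)
  have h2 : 0 < (N : ℝ) ^ (1 / 80 : ℝ) := by positivity
  rw [Real.rpow_neg (by linarith), ← div_eq_mul_inv, div_div]
  calc (H : ℝ) / (q * (N : ℝ) ^ (1 / 80 : ℝ)) ≤ H / (q.totient * (Real.log N / 80)) := by
        gcongr; linarith
    _ = _ := by field_simp

/-- Sums over a sparse set are negligible. -/
lemma IsShiu.sum_le_of_card_le (hg : IsShiu A C₁ g) (hC : 0 ≤ C₁) (hq : 1 ≤ q) (hN : 2 ≤ N)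
    (hMH : M + H ≤ N) {S : Finset ℕ} (hS : S ⊆ Finset.Ioc M (M + H)) {K : ℝ} (hK : 0 ≤ K)
    (hcard : (S.card : ℝ) ≤ K * (H / q * (N : ℝ) ^ (-(3 / 80) : ℝ))) :
    ∑ n ∈ S, g n ≤ 80 * C₁ * K * (H / (q.totient * Real.log N)) := by
  have hN0 : (0 : ℝ) < N := by exact_mod_cast (by omega : 0 < N)
  calc ∑ n ∈ S, g n ≤ ∑ n ∈ S, C₁ * (N : ℝ) ^ (1 / 40 : ℝ) := by
        refine Finset.sum_le_sum fun n hn => ?_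
        have := Finset.mem_Ioc.1 (hS hn)
        refine (hg.growth n (by omega)).trans ?_
        have : (n : ℝ) ≤ N := by exact_mod_cast (by omega : n ≤ N)
        gcongr
    _ = S.card * (C₁ * (N : ℝ) ^ (1 / 40 : ℝ)) := by simp
    _ ≤ K * (H / q * (N : ℝ) ^ (-(3 / 80) : ℝ)) * (C₁ * (N : ℝ) ^ (1 / 40 : ℝ)) := by gcongr
    _ = C₁ * K * (H / q * ((N : ℝ) ^ (-(3 / 80) : ℝ) * (N : ℝ) ^ (1 / 40 : ℝ))) := by ring
    _ = C₁ * K * (H / q * (N : ℝ) ^ (-(1 / 80) : ℝ)) := by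
        rw [← Real.rpow_add hN0]; norm_num
    _ ≤ C₁ * K * (80 * (H / (q.totient * Real.log N))) :=
        mul_le_mul_of_nonneg_left (div_mul_rpow_le hq hN) (by positivity)
    _ = _ := by ring

lemma card_small_le (hq : 1 ≤ q) (hN : 2 ≤ N) (hH : q * (N : ℝ) ^ (1 / 2 : ℝ) ≤ H)
    {S : Finset ℕ} (hS : S ⊆ Finset.Ioc M (M + H)) (hS' : ∀ n ∈ S, (n : ℝ) ≤ (N : ℝ) ^ (1 / 4 : ℝ)) :
    (S.card : ℝ) ≤ 1 * (H / q * (N : ℝ) ^ (-(3 / 80) : ℝ)) := by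
  have hN1 : (1 : ℝ) ≤ N := by exact_mod_cast (by omega : 1 ≤ N)
  have hq0 : (0 : ℝ) < q := by exact_mod_cast hq
  have h1 : S.card ≤ ⌊(N : ℝ) ^ (1 / 4 : ℝ)⌋₊ := by
    rw [← Nat.add_sub_cancel ⌊(N : ℝ) ^ (1 / 4 : ℝ)⌋₊ 1, ← Nat.card_Icc]
    refine Finset.card_le_card fun n hn => Finset.mem_Icc.2 ⟨?_, Nat.le_floor (hS' n hn)⟩
    have := Finset.mem_Ioc.1 (hS hn); omega
  calc (S.card : ℝ) ≤ (N : ℝ) ^ (1 / 4 : ℝ) :=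
        (by exact_mod_cast h1 : (S.card : ℝ) ≤ (⌊(N : ℝ) ^ (1 / 4 : ℝ)⌋₊ : ℝ)).trans (Nat.floor_le (by positivity))
    _ ≤ (N : ℝ) ^ (1 / 2 + -(3 / 80) : ℝ) := Real.rpow_le_rpow_of_exponent_le hN1 (by norm_num)
    _ = (N : ℝ) ^ (1 / 2 : ℝ) * (N : ℝ) ^ (-(3 / 80) : ℝ) := Real.rpow_add (by linarith) _ _
    _ ≤ H / q * (N : ℝ) ^ (-(3 / 80) : ℝ) := by
        gcongr; rw [le_div_iff₀ hq0]; linarith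
    _ = _ := by ring

lemma card_biUnion_dvd_le (hq : 1 ≤ q) (ha : a.Coprime q) (hH : q * (N : ℝ) ^ (1 / 2 : ℝ) ≤ H)
    (T S : Finset ℕ) (hT : ∀ D ∈ T, 1 ≤ D ∧ (D : ℝ) ≤ (N : ℝ) ^ (1 / 2 : ℝ))
    (hS : ∀ n ∈ S, n ∈ Finset.Ioc M (M + H) ∧ n ≡ a [MOD q] ∧ ∃ D ∈ T, D ∣ n) :
    (S.card : ℝ) ≤ 2 * (H / q) * ∑ D ∈ T, (D : ℝ)⁻¹ := by
  have h1 : S ⊆ T.biUnion fun D => (Finset.Ioc M (M + H)).filter (fun n => n ≡ a [MOD q] ∧ D ∣ n) := by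
    intro n hn
    obtain ⟨h1, h2, D, hD, h3⟩ := hS n hn
    exact Finset.mem_biUnion.2 ⟨D, hD, Finset.mem_filter.2 ⟨h1, h2, h3⟩⟩
  have h2 := (Finset.card_le_card h1).trans Finset.card_biUnion_le
  calc (S.card : ℝ) ≤ ∑ D ∈ T, (((Finset.Ioc M (M + H)).filter (fun n => n ≡ a [MOD q] ∧ D ∣ n)).card : ℝ) := by
        exact_mod_cast h2
    _ ≤ ∑ D ∈ T, 2 * (H / (q * (D : ℝ))) :=
        Finset.sum_le_sum fun D hD => card_modEq_dvd_le_two_mul hq ha hH (hT D hD).1 (hT D hD).2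
    _ = _ := by
        rw [Finset.mul_sum]
        exact Finset.sum_congr rfl fun D _ => by rw [← div_div]; ring

lemma card_large_power_le (hq : 1 ≤ q) (ha : a.Coprime q) (hN : 2 ≤ N)
    (hH : q * (N : ℝ) ^ (1 / 2 : ℝ) ≤ H) {S : Finset ℕ}
    (hS : ∀ n ∈ S, n ∈ Finset.Ioc M (M + H) ∧ n ≡ a [MOD q] ∧
      ∃ p e : ℕ, p.Prime ∧ (p : ℝ) ≤ (N : ℝ) ^ (1 / 20 : ℝ) ∧ (N : ℝ) ^ (1 / 8 : ℝ) < (p : ℝ) ^ e ∧ p ^ e ∣ n) :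
    (S.card : ℝ) ≤ 2 * (H / q * (N : ℝ) ^ (-(3 / 80) : ℝ)) := by
  have hN1 : (1 : ℝ) ≤ N := by exact_mod_cast (by omega : 1 ≤ N)
  have hN0 : (0 : ℝ) < N := by linarith
  set z := ⌊(N : ℝ) ^ (1 / 20 : ℝ)⌋₊ with hz
  have hex : ∀ p : ℕ, p.Prime → ∃ j : ℕ, (N : ℝ) ^ (1 / 8 : ℝ) < (p : ℝ) ^ j := fun p hp =>
    pow_unbounded_of_one_lt _ (by exact_mod_cast hp.one_lt)
  set J : ℕ → ℕ := fun p => if hp : p.Prime then p ^ Nat.find (hex p hp) else 0 with hJ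
  have hJp : ∀ p (hp : p.Prime), J p = p ^ Nat.find (hex p hp) := fun p hp => by simp only [hJ, dif_pos hp]
  have hJ1 : ∀ p : ℕ, p.Prime → (N : ℝ) ^ (1 / 8 : ℝ) < J p := fun p hp => by
    rw [hJp p hp]; push_cast; exact Nat.find_spec (hex p hp)
  set T := ((Finset.Icc 1 z).filter Nat.Prime).image J with hT
  have h1 := card_biUnion_dvd_le hq ha hH T S (fun D hD => by
    rw [hT, Finset.mem_image] at hD
    obtain ⟨p, hp, rfl⟩ := hD
    rw [Finset.mem_filter, Finset.mem_Icc] at hp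
    have hp0 : (0 : ℝ) < p := by exact_mod_cast hp.2.pos
    have hpz : (p : ℝ) ≤ (N : ℝ) ^ (1 / 20 : ℝ) := (Nat.le_floor_iff (by positivity)).1 hp.1.2
    refine ⟨by rw [hJp p hp.2]; exact Nat.pow_pos hp.2.pos, ?_⟩
    rw [hJp p hp.2]
    rcases hk : Nat.find (hex p hp.2) with _ | k
    · simp; exact Real.one_le_rpow hN1 (by norm_num)
    · have h2 := not_lt.1 (Nat.find_min (hex p hp.2) (m := k) (by omega))
      push_cast
      calc (p : ℝ) ^ (k + 1) = (p : ℝ) ^ k * p := pow_succ _ _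
        _ ≤ (N : ℝ) ^ (1 / 8 : ℝ) * (N : ℝ) ^ (1 / 20 : ℝ) := by gcongr
        _ = (N : ℝ) ^ (1 / 8 + 1 / 20 : ℝ) := (Real.rpow_add hN0 _ _).symm
        _ ≤ _ := Real.rpow_le_rpow_of_exponent_le hN1 (by norm_num)) (fun n hn => by
    obtain ⟨h2, h3, p, e, hp, h4, h5, h6⟩ := hS n hn
    refine ⟨h2, h3, J p, ?_, ?_⟩
    · exact Finset.mem_image_of_mem _ (Finset.mem_filter.2 ⟨Finset.mem_Icc.2 ⟨hp.pos, Nat.le_floor h4⟩, hp⟩)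
    · rw [hJp p hp]
      exact (pow_dvd_pow p (Nat.find_min' (hex p hp) h5)).trans h6)
  have h2 : ∑ D ∈ T, (D : ℝ)⁻¹ ≤ (N : ℝ) ^ (-(3 / 80) : ℝ) := by
    calc ∑ D ∈ T, (D : ℝ)⁻¹ ≤ ∑ D ∈ T, (N : ℝ) ^ (-(1 / 8) : ℝ) := by
          refine Finset.sum_le_sum fun D hD => ?_
          rw [hT, Finset.mem_image] at hD
          obtain ⟨p, hp, rfl⟩ := hD
          rw [Real.rpow_neg hN0.le]
          exact inv_anti₀ (by positivity) (hJ1 p (Finset.mem_filter.1 hp).2).le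
      _ = T.card * (N : ℝ) ^ (-(1 / 8) : ℝ) := by simp
      _ ≤ (N : ℝ) ^ (1 / 20 : ℝ) * (N : ℝ) ^ (-(1 / 8) : ℝ) := by
          gcongr
          have h3 : T.card ≤ z := Finset.card_image_le.trans ((Finset.card_filter_le _ _).trans (by simp))
          exact (by exact_mod_cast h3 : (T.card : ℝ) ≤ (z : ℝ)).trans (Nat.floor_le (by positivity))
      _ = (N : ℝ) ^ (1 / 20 + -(1 / 8) : ℝ) := (Real.rpow_add hN0 _ _).symm
      _ ≤ _ := Real.rpow_le_rpow_of_exponent_le hN1 (by norm_num)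
  calc (S.card : ℝ) ≤ _ := h1
    _ ≤ 2 * (H / q) * (N : ℝ) ^ (-(3 / 80) : ℝ) := by gcongr
    _ = _ := by ring

lemma card_large_smooth_le (hq : 1 ≤ q) (ha : a.Coprime q) (hN : 2 ≤ N)
    (hH : q * (N : ℝ) ^ (1 / 2 : ℝ) ≤ H) {S : Finset ℕ} {v : ℕ} 
    (hS : ∀ n ∈ S, n ∈ Finset.Ioc M (M + H) ∧ n ≡ a [MOD q] ∧
      ∃ b : ℕ, b ∣ n ∧ (N : ℝ) ^ (1 / 8 : ℝ) < b ∧ (b : ℝ) ≤ (N : ℝ) ^ (1 / 4 : ℝ) ∧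
        ∀ p : ℕ, p.Prime → p ∣ b → p ≤ v) :
    (S.card : ℝ) ≤ (2 * Real.exp (16 + v)) * (H / q * (N : ℝ) ^ (-(3 / 80) : ℝ)) := by
  have hN1 : (1 : ℝ) ≤ N := by exact_mod_cast (by omega : 1 ≤ N)
  have hN0 : (0 : ℝ) < N := by linarith
  set T := (Finset.Icc 1 N).filter fun b : ℕ => (N : ℝ) ^ (1 / 8 : ℝ) < b ∧ (b : ℝ) ≤ (N : ℝ) ^ (1 / 4 : ℝ) ∧
        ∀ p : ℕ, p.Prime → p ∣ b → p ≤ v with hT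
  have h1 := card_biUnion_dvd_le hq ha hH T S (fun D hD => by
    rw [hT, Finset.mem_filter, Finset.mem_Icc] at hD
    exact ⟨hD.1.1, hD.2.2.1.trans (Real.rpow_le_rpow_of_exponent_le hN1 (by norm_num))⟩) (fun n hn => by
    obtain ⟨h2, h3, b, h4, h5, h6, h7⟩ := hS n hn
    refine ⟨h2, h3, b, ?_, h4⟩
    have hb0 : (0 : ℝ) < b := lt_of_le_of_lt (by positivity) h5
    have hbN : (b : ℝ) ≤ N := h6.trans (by
      conv_rhs => rw [← Real.rpow_one (N : ℝ)]
      exact Real.rpow_le_rpow_of_exponent_le hN1 (by norm_num))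
    rw [hT, Finset.mem_filter, Finset.mem_Icc]
    exact ⟨⟨by exact_mod_cast hb0, by exact_mod_cast hbN⟩, h5, h6, h7⟩)
  have h2 : ∑ D ∈ T, (D : ℝ)⁻¹ ≤ (N : ℝ) ^ (-(3 / 80) : ℝ) * Real.exp (16 + v) := by
    have h3 := isShiu_one.sum_le (by norm_num) (σ := 7 / 10) le_rfl ((Finset.Icc 1 v).filter Nat.Prime)
      (fun p hp => (Finset.mem_filter.1 hp).2) T (fun b hb => by
        rw [hT, Finset.mem_filter, Finset.mem_Icc] at hb
        refine ⟨by omega, fun p hp hpb => Finset.mem_filter.2 ⟨Finset.mem_Icc.2 ⟨hp.pos, hb.2.2.2 p hp hpb⟩, hp⟩⟩)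
    have h4 : ∑ p ∈ (Finset.Icc 1 v).filter Nat.Prime, 1 * (p : ℝ) ^ (-(7 / 10) : ℝ) ≤ v := by
      calc _ ≤ ∑ p ∈ (Finset.Icc 1 v).filter Nat.Prime, (1 : ℝ) := by
            refine Finset.sum_le_sum fun p hp => ?_
            rw [one_mul]
            have : (1 : ℝ) ≤ p := by exact_mod_cast (Finset.mem_filter.1 hp).2.pos
            exact Real.rpow_le_one_of_one_le_of_nonpos this (by norm_num)
        _ ≤ v := by
            have := Finset.card_filter_le (Finset.Icc 1 v) Nat.Prime
            rw [Nat.card_Icc, Nat.add_sub_cancel] at this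
            simp only [Finset.sum_const, nsmul_eq_mul, mul_one]
            exact_mod_cast this
    calc ∑ D ∈ T, (D : ℝ)⁻¹ ≤ ∑ D ∈ T, (N : ℝ) ^ (-(3 / 80) : ℝ) * (1 * (D : ℝ) ^ (-(7 / 10) : ℝ)) := by
          refine Finset.sum_le_sum fun D hD => ?_
          rw [hT, Finset.mem_filter, Finset.mem_Icc] at hD
          have hD0 : (0 : ℝ) < D := by exact_mod_cast hD.1.1
          calc (D : ℝ)⁻¹ = (D : ℝ) ^ (-(3 / 10) : ℝ) * (D : ℝ) ^ (-(7 / 10) : ℝ) := by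
                rw [← Real.rpow_add hD0, ← Real.rpow_neg_one]; norm_num
            _ ≤ ((N : ℝ) ^ (1 / 8 : ℝ)) ^ (-(3 / 10) : ℝ) * (D : ℝ) ^ (-(7 / 10) : ℝ) := by
                exact mul_le_mul_of_nonneg_right
                  (Real.rpow_le_rpow_of_nonpos (by positivity) hD.2.1.le (by norm_num)) (by positivity)
            _ = _ := by rw [← Real.rpow_mul hN0.le]; norm_num
      _ ≤ (N : ℝ) ^ (-(3 / 80) : ℝ) * Real.exp (16 + v) := by
          rw [← Finset.mul_sum]
          refine mul_le_mul_of_nonneg_left (h3.trans ?_) (by positivity)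
          rw [← Real.exp_add, Real.exp_le_exp]; linarith
  calc (S.card : ℝ) ≤ _ := h1
    _ ≤ 2 * (H / q) * ((N : ℝ) ^ (-(3 / 80) : ℝ) * Real.exp (16 + v)) := by gcongr
    _ = _ := by ring

lemma lt_succ_floor_rpow_pow {m : ℕ} (hm : m ≠ 0) : N < (⌊(N : ℝ) ^ (1 / m : ℝ)⌋₊ + 1) ^ m := by
  have h1 : (N : ℝ) ^ (1 / m : ℝ) < (⌊(N : ℝ) ^ (1 / m : ℝ)⌋₊ : ℝ) + 1 := Nat.lt_floor_add_one _
  have h2 : (N : ℝ) < ((⌊(N : ℝ) ^ (1 / m : ℝ)⌋₊ : ℝ) + 1) ^ m := by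
    calc (N : ℝ) = ((N : ℝ) ^ (1 / m : ℝ)) ^ m := by
          rw [← Real.rpow_mul_natCast (by positivity), one_div_mul_cancel (by exact_mod_cast hm), Real.rpow_one]
      _ < _ := by gcongr
  exact_mod_cast h2

lemma div_le_log_succ_floor_rpow (hN : 1 ≤ N) {m : ℕ} :
    Real.log N / m ≤ Real.log (⌊(N : ℝ) ^ (1 / m : ℝ)⌋₊ + 1 : ℕ) := by
  have hN0 : (0 : ℝ) < N := by exact_mod_cast hN
  have h1 : (N : ℝ) ^ (1 / m : ℝ) < (⌊(N : ℝ) ^ (1 / m : ℝ)⌋₊ : ℝ) + 1 := Nat.lt_floor_add_one _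
  have h2 := Real.log_le_log (by positivity) h1.le
  rw [Real.log_rpow hN0] at h2
  push_cast
  calc Real.log N / m = 1 / m * Real.log N := by ring
    _ ≤ _ := h2

lemma one_le_floor_rpow (hN : 1 ≤ N) {c : ℝ} (hc : 0 ≤ c) : 1 ≤ ⌊(N : ℝ) ^ c⌋₊ :=
  Nat.le_floor (by push_cast; exact Real.one_le_rpow (by exact_mod_cast hN) hc)

lemma le_floor_rpow_of_pow_le {p m : ℕ} (hm : m ≠ 0) (h : p ^ m ≤ N) : p ≤ ⌊(N : ℝ) ^ (1 / m : ℝ)⌋₊ := by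
  refine Nat.le_floor ?_
  have h1 : (p : ℝ) ^ m ≤ N := by exact_mod_cast h
  calc (p : ℝ) = ((p : ℝ) ^ m) ^ (1 / m : ℝ) := by
        rw [one_div, Real.pow_rpow_inv_natCast (by positivity) hm]
    _ ≤ _ := Real.rpow_le_rpow (by positivity) h1 (by positivity)

lemma floor_rpow_lt_of_lt_pow {p m : ℕ} (hm : m ≠ 0) (h : N < p ^ m) : ⌊(N : ℝ) ^ (1 / m : ℝ)⌋₊ < p := by
  rw [Nat.floor_lt (by positivity)]
  have h1 : (N : ℝ) < (p : ℝ) ^ m := by exact_mod_cast h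
  calc (N : ℝ) ^ (1 / m : ℝ) < ((p : ℝ) ^ m) ^ (1 / m : ℝ) :=
        Real.rpow_lt_rpow (by positivity) h1 (by positivity)
    _ = p := by rw [one_div, Real.pow_rpow_inv_natCast (by positivity) hm]

lemma IsShiu.sum_large_cofactor_le (hg : IsShiu A C₁ g) (hA : 1 ≤ A) (hC : 0 ≤ C₁) (hq : 1 ≤ q) (ha : a.Coprime q)
    (hN : 2 ≤ N) (hMH : M + H ≤ N) (hH : q * (N : ℝ) ^ (1 / 2 : ℝ) ≤ H) {S : Finset ℕ}
    (hS : ∀ n ∈ S, n ∈ Finset.Ioc M (M + H) ∧ n ≡ a [MOD q] ∧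
      ∃ b : ℕ, b ∣ n ∧ (b : ℝ) ≤ (N : ℝ) ^ (1 / 4 : ℝ) ∧ b.Coprime (n / b) ∧
        ∀ p : ℕ, p.Prime → p ∣ n / b → (N : ℝ) ^ (1 / 20 : ℝ) < p) :
    ∑ n ∈ S, g n ≤ 60 * A ^ 20 * Real.exp (16 * C₁) * (H / (q.totient * Real.log N) *
      Real.exp (∑ p ∈ (Finset.Icc 1 N).filter Nat.Prime, g p / p)) := by
  have hφ : (0 : ℝ) < q.totient := by exact_mod_cast Nat.totient_pos.2 hq
  have hN2 : (2 : ℝ) ≤ N := by exact_mod_cast hN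
  have hN1 : (1 : ℝ) ≤ N := by linarith
  have hL : 0 < Real.log N := Real.log_pos (by linarith)
  have hNN : (N : ℝ) ^ (1 / 4 : ℝ) ≤ N := by
    conv_rhs => rw [← Real.rpow_one (N : ℝ)]
    exact Real.rpow_le_rpow_of_exponent_le hN1 (by norm_num)
  set s := ⌊(N : ℝ) ^ (1 / 20 : ℝ)⌋₊ with hs
  set T := (Finset.Icc 1 N).filter fun b : ℕ => (b : ℝ) ≤ (N : ℝ) ^ (1 / 4 : ℝ) with hT
  have hpow := lt_succ_floor_rpow_pow (N := N) (m := 20) (by norm_num)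
  have hlog := div_le_log_succ_floor_rpow (N := N) (m := 20) (by omega)
  push_cast at hpow hlog
  have h1 := hg.sum_block_le hA hq ha (M := M) (by omega) hMH hH (s := s) (one_le_floor_rpow (by omega) (by norm_num))
    (Nat.floor_le (by positivity)) (m := 20) hpow T S
    (fun b hb => by rw [hT, Finset.mem_filter, Finset.mem_Icc] at hb; exact ⟨hb.1.1, hb.2⟩)
    (fun n hn => by
      obtain ⟨h2, h3, b, h4, h5, h6, h7⟩ := hS n hn
      refine ⟨h2, h3, b, ?_, h4, h6, fun p hp hpd => (Nat.floor_lt (by positivity)).2 (h7 p hp hpd)⟩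
      rw [hT, Finset.mem_filter, Finset.mem_Icc]
      have hn0 : n ≠ 0 := by have := Finset.mem_Ioc.1 h2; omega
      exact ⟨⟨Nat.pos_of_dvd_of_pos h4 (by omega), by exact_mod_cast h5.trans hNN⟩, h5⟩)
  have h2 := hg.sum_le hC (σ := 1) (by norm_num) ((Finset.Icc 1 N).filter Nat.Prime)
    (fun p hp => (Finset.mem_filter.1 hp).2) T (fun b hb => by
      rw [hT, Finset.mem_filter, Finset.mem_Icc] at hb
      exact ⟨by omega, fun p hp hpb => Finset.mem_filter.2
        ⟨Finset.mem_Icc.2 ⟨hp.pos, (Nat.le_of_dvd (by omega) hpb).trans hb.1.2⟩, hp⟩⟩)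
  clear hpow
  simp only [Real.rpow_neg_one, ← div_eq_mul_inv] at h2
  refine h1.trans ?_
  have hT0 : 0 ≤ ∑ b ∈ T, g b / b := Finset.sum_nonneg fun b _ => div_nonneg (hg.nonneg b) (by positivity)
  have hA0 : 0 ≤ A := by linarith
  rw [← hs] at hlog
  clear_value s T
  have h3 : (H : ℝ) / (q.totient * Real.log (s + 1 : ℕ)) ≤ 20 * (H / (q.totient * Real.log N)) := by
    calc (H : ℝ) / (q.totient * Real.log (s + 1 : ℕ)) ≤ H / (q.totient * (Real.log N / 20)) := by
          push_cast; gcongr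
      _ = _ := by field_simp
  calc _ ≤ A ^ 20 * (3 * (20 * (H / (q.totient * Real.log N)))) * (Real.exp (16 * C₁) *
      Real.exp (∑ p ∈ (Finset.Icc 1 N).filter Nat.Prime, g p / p)) := by gcongr
    _ = _ := by ring

lemma IsShiu.sum_rankin_le (hg : IsShiu A C₁ g) (hA : 1 ≤ A) (hC : 0 ≤ C₁) (hq : 1 ≤ q) (ha : a.Coprime q)
    (hN : 2 ≤ N) (hMH : M + H ≤ N) (hH : q * (N : ℝ) ^ (1 / 2 : ℝ) ≤ H) {S : Finset ℕ}
    {r : ℕ} (hr : 20 ≤ r) {B : ℝ} (hB : 0 ≤ B) (hrB : B * r ≤ 3 / 10 * Real.log N)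
    (hS : ∀ n ∈ S, n ∈ Finset.Ioc M (M + H) ∧ n ≡ a [MOD q] ∧
      ∃ b : ℕ, b ∣ n ∧ (N : ℝ) ^ (1 / 8 : ℝ) < b ∧ (b : ℝ) ≤ (N : ℝ) ^ (1 / 4 : ℝ) ∧ b.Coprime (n / b) ∧
        (∀ p : ℕ, p.Prime → p ∣ b → p ^ r ≤ N) ∧ ∀ p : ℕ, p.Prime → p ∣ n / b → N < p ^ (r + 1)) :
    ∑ n ∈ S, g n ≤ 3 * A ^ (r + 1) * (r + 1) * Real.exp (-(B * r / 8)) *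
      Real.exp (16 * C₁ + A * Real.exp B * (B + 2)) * (H / (q.totient * Real.log N) *
      Real.exp (∑ p ∈ (Finset.Icc 1 N).filter Nat.Prime, g p / p)) := by
  have hφ : (0 : ℝ) < q.totient := by exact_mod_cast Nat.totient_pos.2 hq
  have hN2 : (2 : ℝ) ≤ N := by exact_mod_cast hN
  have hN1 : (1 : ℝ) ≤ N := by linarith
  have hN0 : (0 : ℝ) < N := by linarith
  have hL : 0 < Real.log N := Real.log_pos (by linarith)
  have hr0 : (0 : ℝ) < r := by exact_mod_cast (by omega : 0 < r)
  have hNN : (N : ℝ) ^ (1 / 4 : ℝ) ≤ N := by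
    conv_rhs => rw [← Real.rpow_one (N : ℝ)]
    exact Real.rpow_le_rpow_of_exponent_le hN1 (by norm_num)
  set w := ⌊(N : ℝ) ^ (1 / r : ℝ)⌋₊ with hw
  set s := ⌊(N : ℝ) ^ (1 / (r + 1 : ℕ) : ℝ)⌋₊ with hs
  set T := (Finset.Icc 1 N).filter fun b : ℕ => (N : ℝ) ^ (1 / 8 : ℝ) < b ∧ (b : ℝ) ≤ (N : ℝ) ^ (1 / 4 : ℝ) ∧
    ∀ p : ℕ, p.Prime → p ∣ b → p ^ r ≤ N with hT
  have hw1 : 1 ≤ w := one_le_floor_rpow (by omega) (by positivity)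
  have hwle : (w : ℝ) ≤ (N : ℝ) ^ (1 / r : ℝ) := Nat.floor_le (by positivity)
  have hr20 : (20 : ℝ) ≤ r := by exact_mod_cast hr
  have hlog := div_le_log_succ_floor_rpow (N := N) (m := r + 1) (by omega)
  have h1 := hg.sum_block_le hA hq ha (M := M) (by omega) hMH hH (s := s)
    (one_le_floor_rpow (by omega) (by positivity))
    ((Nat.floor_le (by positivity)).trans (by
      refine Real.rpow_le_rpow_of_exponent_le hN1 (one_div_le_one_div_of_le (by norm_num) ?_)
      push_cast; linarith)) (m := r + 1)
    (lt_succ_floor_rpow_pow (by omega)) T S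
    (fun b hb => by rw [hT, Finset.mem_filter, Finset.mem_Icc] at hb; exact ⟨hb.1.1, hb.2.2.1⟩)
    (fun n hn => by
      obtain ⟨h2, h3, b, h4, h5, h6, h7, h8, h9⟩ := hS n hn
      refine ⟨h2, h3, b, ?_, h4, h7, fun p hp hpd => floor_rpow_lt_of_lt_pow (by omega) (h9 p hp hpd)⟩
      rw [hT, Finset.mem_filter, Finset.mem_Icc]
      have hn0 : n ≠ 0 := by have := Finset.mem_Ioc.1 h2; omega
      exact ⟨⟨Nat.pos_of_dvd_of_pos h4 (by omega), by exact_mod_cast h6.trans hNN⟩, h5, h6, h8⟩)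
  have hlw : Real.log w ≤ Real.log N / r := by
    have := Real.log_le_log (by exact_mod_cast hw1) hwle
    rw [Real.log_rpow hN0] at this
    calc _ ≤ _ := this
      _ = _ := by ring
  have h2 := hg.rankin hC (N := N) (w := w) (by omega) hw1 (by
    have : (w : ℝ) ≤ N := hwle.trans (by
      conv_rhs => rw [← Real.rpow_one (N : ℝ)]
      refine Real.rpow_le_rpow_of_exponent_le hN1 ?_
      rw [div_le_one hr0]; linarith)
    exact_mod_cast this) (ε := B * r / Real.log N) (B := B) (by positivity)
    (by rw [div_le_iff₀ hL]; exact hrB) (by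
      calc B * r / Real.log N * Real.log w ≤ B * r / Real.log N * (Real.log N / r) := by gcongr
        _ = B := by field_simp) T (fun b hb => by
      rw [hT, Finset.mem_filter, Finset.mem_Icc] at hb
      exact ⟨hb.2.1, fun p hp hpb => le_floor_rpow_of_pow_le (by omega) (hb.2.2.2 p hp hpb)⟩)
  have h4 : (N : ℝ) ^ (-(B * r / Real.log N / 8)) = Real.exp (-(B * r / 8)) := by
    rw [Real.rpow_def_of_pos hN0]; congr 1; field_simp
  rw [h4] at h2
  refine h1.trans ?_
  have hT0 : 0 ≤ ∑ b ∈ T, g b / b := Finset.sum_nonneg fun b _ => div_nonneg (hg.nonneg b) (by positivity)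
  have hA0 : 0 ≤ A := by linarith
  rw [← hs] at hlog
  clear_value s T
  have h3 : (H : ℝ) / (q.totient * Real.log (s + 1 : ℕ)) ≤ (r + 1) * (H / (q.totient * Real.log N)) := by
    calc (H : ℝ) / (q.totient * Real.log (s + 1 : ℕ)) ≤ H / (q.totient * (Real.log N / (r + 1 : ℕ))) := by
          gcongr
      _ = _ := by push_cast; field_simp
  calc _ ≤ A ^ (r + 1) * (3 * ((r + 1) * (H / (q.totient * Real.log N)))) * (Real.exp (-(B * r / 8)) *
      (Real.exp (16 * C₁ + A * Real.exp B * (B + 2)) *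
      Real.exp (∑ p ∈ (Finset.Icc 1 N).filter Nat.Prime, g p / p))) := by gcongr
    _ = _ := by ring

lemma sum_union_le_add {f : ℕ → ℝ} (hf : ∀ n, 0 ≤ f n) (S T : Finset ℕ) :
    ∑ n ∈ S ∪ T, f n ≤ ∑ n ∈ S, f n + ∑ n ∈ T, f n := by
  rw [← Finset.sum_union_inter]
  linarith [Finset.sum_nonneg fun n (_ : n ∈ S ∩ T) => hf n]

lemma sum_biUnion_le_sum {f : ℕ → ℝ} (hf : ∀ n, 0 ≤ f n) (I : Finset ℕ) (U : ℕ → Finset ℕ) :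
    ∑ n ∈ I.biUnion U, f n ≤ ∑ i ∈ I, ∑ n ∈ U i, f n := by
  induction I using Finset.induction_on with
  | empty => simp
  | insert i I hi ih =>
    rw [Finset.biUnion_insert, Finset.sum_insert hi]
    exact (sum_union_le_add hf _ _).trans (by linarith)

lemma sum_rankin_weights_le (hA : 1 ≤ A) (I : Finset ℕ) :
    ∑ r ∈ I, A ^ (r + 1) * (r + 1) * Real.exp (-(8 * Real.log (4 * A) * r / 8)) ≤ 2 * A := by
  have hA0 : 0 < A := by linarith
  have h1 : ∀ r : ℕ, A ^ (r + 1) * (r + 1) * Real.exp (-(8 * Real.log (4 * A) * r / 8)) ≤ A * (1 / 2) ^ r := by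
    intro r
    have h2 : Real.exp (-(8 * Real.log (4 * A) * r / 8)) = ((4 * A) ^ r)⁻¹ := by
      rw [show -(8 * Real.log (4 * A) * r / 8) = -(r * Real.log (4 * A)) by ring, Real.exp_neg, mul_comm (r : ℝ),
        Real.exp_mul, Real.exp_log (by positivity), Real.rpow_natCast]
    have h3 : (r : ℝ) + 1 ≤ 2 ^ r := by
      exact_mod_cast Nat.lt_two_pow_self (n := r)
    rw [h2, mul_pow, pow_succ]
    calc A ^ r * A * (r + 1) * ((4 : ℝ) ^ r * A ^ r)⁻¹ = A * ((r + 1) * ((4 : ℝ) ^ r)⁻¹) := by field_simp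
      _ ≤ A * (2 ^ r * ((4 : ℝ) ^ r)⁻¹) := by gcongr
      _ = A * (1 / 2) ^ r := by
          rw [← inv_pow, ← mul_pow]; norm_num
  calc _ ≤ ∑ r ∈ I, A * (1 / 2 : ℝ) ^ r := Finset.sum_le_sum fun r _ => h1 r
    _ = A * ∑ r ∈ I, (1 / 2 : ℝ) ^ r := by rw [Finset.mul_sum]
    _ ≤ A * 2 := by
        refine mul_le_mul_of_nonneg_left ?_ hA0.le
        exact sum_le_hasSum _ (fun _ _ => by positivity) hasSum_geometric_two
    _ = _ := mul_comm _ _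

/-- Shiu's theorem: short sums of a nonnegative multiplicative function in a progression. -/
theorem shiu (A C₁ : ℝ) (hA : 1 ≤ A) (hC : 0 ≤ C₁) : ∃ C : ℝ, 0 < C ∧ ∀ g, IsShiu A C₁ g →
    ∀ q a M H N : ℕ, 1 ≤ q → a.Coprime q → 2 ≤ N → M + H ≤ N → q * (N : ℝ) ^ (1 / 2 : ℝ) ≤ H →
    ∑ n ∈ (Finset.Ioc M (M + H)).filter (fun n => n ≡ a [MOD q]), g n ≤ C * (H / (q.totient * Real.log N) *
      Real.exp (∑ p ∈ (Finset.Icc 1 N).filter Nat.Prime, g p / p)) := by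
  set B := 8 * Real.log (4 * A) with hB
  have hB0 : 0 ≤ B := by
    have := Real.log_nonneg (x := 4 * A) (by linarith); positivity
  set v := ⌈Real.exp (4 * B)⌉₊ with hv
  refine ⟨80 * C₁ * 1 + 80 * C₁ * 2 + 80 * C₁ * (2 * Real.exp (16 + v)) + 60 * A ^ 20 * Real.exp (16 * C₁) +
    3 * (2 * A) * Real.exp (16 * C₁ + A * Real.exp B * (B + 2)), by positivity, ?_⟩
  intro g hg q a M H N hq ha hN hMH hH
  set Q := (H : ℝ) / (q.totient * Real.log N) with hQ
  set E := Real.exp (∑ p ∈ (Finset.Icc 1 N).filter Nat.Prime, g p / p) with hE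
  have hN2 : (2 : ℝ) ≤ N := by exact_mod_cast hN
  have hN0 : (0 : ℝ) < N := by linarith
  have hL : 0 < Real.log N := Real.log_pos (by linarith)
  have hE1 : 1 ≤ E := Real.one_le_exp (Finset.sum_nonneg fun p _ => div_nonneg (hg.nonneg p) (by positivity))
  have hQ0 : 0 ≤ Q := by positivity
  have hQE : Q ≤ Q * E := le_mul_of_one_le_right hQ0 hE1
  set S := (Finset.Ioc M (M + H)).filter (fun n => n ≡ a [MOD q]) with hS
  have hSI : S ⊆ Finset.Ioc M (M + H) := Finset.filter_subset _ _
  have hSm : ∀ n ∈ S, n ∈ Finset.Ioc M (M + H) ∧ n ≡ a [MOD q] := fun n hn => Finset.mem_filter.1 hn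
  set S₁ := S.filter fun n : ℕ => (n : ℝ) ≤ (N : ℝ) ^ (1 / 4 : ℝ) with hS₁
  set S₂ := S.filter fun n : ℕ => ∃ p e : ℕ, p.Prime ∧ (p : ℝ) ≤ (N : ℝ) ^ (1 / 20 : ℝ) ∧
    (N : ℝ) ^ (1 / 8 : ℝ) < (p : ℝ) ^ e ∧ p ^ e ∣ n with hS₂
  set S₃ := S.filter fun n : ℕ => ∃ b : ℕ, b ∣ n ∧ (N : ℝ) ^ (1 / 8 : ℝ) < b ∧ (b : ℝ) ≤ (N : ℝ) ^ (1 / 4 : ℝ) ∧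
        ∀ p : ℕ, p.Prime → p ∣ b → p ≤ v with hS₃
  set S₄ := S.filter fun n : ℕ => ∃ b : ℕ, b ∣ n ∧ (b : ℝ) ≤ (N : ℝ) ^ (1 / 4 : ℝ) ∧ b.Coprime (n / b) ∧
        ∀ p : ℕ, p.Prime → p ∣ n / b → (N : ℝ) ^ (1 / 20 : ℝ) < p with hS₄
  set U : ℕ → Finset ℕ := fun r => S.filter fun n : ℕ =>
      ∃ b : ℕ, b ∣ n ∧ (N : ℝ) ^ (1 / 8 : ℝ) < b ∧ (b : ℝ) ≤ (N : ℝ) ^ (1 / 4 : ℝ) ∧ b.Coprime (n / b) ∧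
        (∀ p : ℕ, p.Prime → p ∣ b → p ^ r ≤ N) ∧ ∀ p : ℕ, p.Prime → p ∣ n / b → N < p ^ (r + 1) with hU
  set I := (Finset.Icc 20 N).filter fun r : ℕ => B * r ≤ 3 / 10 * Real.log N with hI
  have hcover : S ⊆ (((S₁ ∪ S₂) ∪ S₃) ∪ S₄) ∪ I.biUnion U := by
    intro n hn
    have hn0 : n ≠ 0 := by have := Finset.mem_Ioc.1 (hSI hn); omega
    have hnN : n ≤ N := by have := Finset.mem_Ioc.1 (hSI hn); omega
    by_cases h1 : (n : ℝ) ≤ (N : ℝ) ^ (1 / 4 : ℝ)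
    · simp only [Finset.mem_union]
      exact Or.inl (Or.inl (Or.inl (Or.inl (Finset.mem_filter.2 ⟨hn, h1⟩))))
    obtain ⟨p, hp, hb, hbp⟩ := exists_smooth_split (Real.one_le_rpow (by linarith) (by norm_num)) (not_le.1 h1)
    set b := smooth (p - 1) n with hbdef
    have hbd : b * rough (p - 1) n = n := smooth_mul_rough _ hn0
    have hbpos : 0 < b := smooth_pos _ _
    have hdiv : n / b = rough (p - 1) n := by
      conv_lhs => rw [← hbd]
      exact Nat.mul_div_cancel_left _ hbpos
    have hbn : b ∣ n := ⟨_, hbd.symm⟩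
    have hcop : b.Coprime (n / b) := by rw [hdiv]; exact coprime_smooth_rough _ _
    have hpd : ∀ l : ℕ, l.Prime → l ∣ n / b → p ≤ l := fun l hl hld => by
      rw [hdiv] at hld
      have := lt_of_dvd_rough hl hld; omega
    have hpb : ∀ l : ℕ, l.Prime → l ∣ b → l ≤ p := fun l hl hld => by
      have := le_of_dvd_smooth hl hld; omega
    have hp0 : (0 : ℝ) < p := by exact_mod_cast hp.pos
    by_cases h2 : (N : ℝ) ^ (1 / 20 : ℝ) < p
    · simp only [Finset.mem_union]
      refine Or.inl (Or.inr (Finset.mem_filter.2 ⟨hn, b, hbn, hb, hcop, fun l hl hld => h2.trans_le ?_⟩))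
      exact_mod_cast hpd l hl hld
    rw [not_lt] at h2
    by_cases h3 : (b : ℝ) ≤ (N : ℝ) ^ (1 / 8 : ℝ)
    · simp only [Finset.mem_union]
      refine Or.inl (Or.inl (Or.inl (Or.inr (Finset.mem_filter.2 ⟨hn, p, _, hp, h2, ?_, Nat.ordProj_dvd n p⟩))))
      have h4 : (N : ℝ) ^ (1 / 4 : ℝ) < (N : ℝ) ^ (1 / 8 : ℝ) * (p : ℝ) ^ (n.factorization p) :=
        hbp.trans_le (by gcongr)
      have h5 : (N : ℝ) ^ (1 / 4 : ℝ) = (N : ℝ) ^ (1 / 8 : ℝ) * (N : ℝ) ^ (1 / 8 : ℝ) := by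
        rw [← Real.rpow_add hN0]; norm_num
      rw [h5] at h4
      exact lt_of_mul_lt_mul_left h4 (by positivity)
    rw [not_le] at h3
    set r := Nat.log p N with hr
    have hr1 : p ^ r ≤ N := Nat.pow_log_le_self p (by omega)
    have hr2 : N < p ^ (r + 1) := Nat.lt_pow_succ_log_self hp.one_lt N
    by_cases h6 : B * r ≤ 3 / 10 * Real.log N
    · rw [Finset.mem_union]
      right
      refine Finset.mem_biUnion.2 ⟨r, Finset.mem_filter.2 ⟨Finset.mem_Icc.2 ⟨?_, Nat.log_le_self p N⟩, h6⟩,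
        Finset.mem_filter.2 ⟨hn, b, hbn, h3, hb, hcop, fun l hl hlb => ?_, fun l hl hld => ?_⟩⟩
      · refine Nat.le_log_of_pow_le hp.one_lt ?_
        have : (p : ℝ) ^ 20 ≤ (N : ℝ) := by
          calc (p : ℝ) ^ 20 ≤ ((N : ℝ) ^ (1 / 20 : ℝ)) ^ 20 := by gcongr
            _ = (N : ℝ) := by rw [← Real.rpow_mul_natCast hN0.le]; norm_num
        exact_mod_cast this
      · exact (Nat.pow_le_pow_left (hpb l hl hlb) r).trans hr1
      · exact hr2.trans_le (Nat.pow_le_pow_left (hpd l hl hld) _)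
    · simp only [Finset.mem_union]
      refine Or.inl (Or.inl (Or.inr (Finset.mem_filter.2 ⟨hn, b, hbn, h3, hb, fun l hl hlb =>
        (hpb l hl hlb).trans ?_⟩)))
      have h7 : (r : ℝ) * Real.log p ≤ Real.log N := by
        rw [← Real.log_pow]
        exact Real.log_le_log (by positivity) (by exact_mod_cast hr1)
      have hr0 : (0 : ℝ) < r := by
        rcases Nat.eq_zero_or_pos r with h0 | h0
        · rw [h0] at h6; simp at h6; linarith
        · exact_mod_cast h0
      have h8 : Real.log p ≤ 4 * B := by
        by_contra h9
        rw [not_le] at h9 h6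
        have := mul_lt_mul_of_pos_left h9 hr0
        linarith
      have h9 : (p : ℝ) ≤ v := by
        calc (p : ℝ) = Real.exp (Real.log p) := (Real.exp_log hp0).symm
          _ ≤ Real.exp (4 * B) := Real.exp_le_exp.2 h8
          _ ≤ v := Nat.le_ceil _
      exact_mod_cast h9
  have b₁ := hg.sum_le_of_card_le hC hq hN hMH (S := S₁) ((Finset.filter_subset _ _).trans hSI) zero_le_one
    (card_small_le hq hN hH ((Finset.filter_subset _ _).trans hSI) fun n hn => (Finset.mem_filter.1 hn).2)
  have b₂ := hg.sum_le_of_card_le hC hq hN hMH (S := S₂) ((Finset.filter_subset _ _).trans hSI) zero_le_two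
    (card_large_power_le hq ha hN hH fun n hn =>
      ⟨(hSm n (Finset.mem_filter.1 hn).1).1, (hSm n (Finset.mem_filter.1 hn).1).2, (Finset.mem_filter.1 hn).2⟩)
  have b₃ := hg.sum_le_of_card_le hC hq hN hMH (S := S₃) ((Finset.filter_subset _ _).trans hSI) (by positivity)
    (card_large_smooth_le (v := v) hq ha hN hH fun n hn =>
      ⟨(hSm n (Finset.mem_filter.1 hn).1).1, (hSm n (Finset.mem_filter.1 hn).1).2, (Finset.mem_filter.1 hn).2⟩)
  have b₄ := hg.sum_large_cofactor_le hA hC hq ha hN hMH hH (S := S₄) fun n hn =>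
      ⟨(hSm n (Finset.mem_filter.1 hn).1).1, (hSm n (Finset.mem_filter.1 hn).1).2, (Finset.mem_filter.1 hn).2⟩
  have b₅ : ∑ n ∈ I.biUnion U, g n ≤ 3 * (2 * A) * Real.exp (16 * C₁ + A * Real.exp B * (B + 2)) * (Q * E) := by
    calc ∑ n ∈ I.biUnion U, g n ≤ ∑ r ∈ I, ∑ n ∈ U r, g n := sum_biUnion_le_sum hg.nonneg I U
      _ ≤ ∑ r ∈ I, 3 * A ^ (r + 1) * (r + 1) * Real.exp (-(B * r / 8)) *
            Real.exp (16 * C₁ + A * Real.exp B * (B + 2)) * (Q * E) := by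
          refine Finset.sum_le_sum fun r hr => ?_
          rw [hI, Finset.mem_filter, Finset.mem_Icc] at hr
          exact hg.sum_rankin_le hA hC hq ha hN hMH hH hr.1.1 hB0 hr.2 fun n hn =>
            ⟨(hSm n (Finset.mem_filter.1 hn).1).1, (hSm n (Finset.mem_filter.1 hn).1).2, (Finset.mem_filter.1 hn).2⟩
      _ = 3 * (∑ r ∈ I, A ^ (r + 1) * (r + 1) * Real.exp (-(B * r / 8))) *
            Real.exp (16 * C₁ + A * Real.exp B * (B + 2)) * (Q * E) := by
          rw [Finset.mul_sum, Finset.sum_mul, Finset.sum_mul]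
          exact Finset.sum_congr rfl fun r _ => by ring
      _ ≤ _ := by
          have := sum_rankin_weights_le hA I
          gcongr
  have hsum : ∑ n ∈ S, g n ≤ ∑ n ∈ S₁, g n + ∑ n ∈ S₂, g n + ∑ n ∈ S₃, g n + ∑ n ∈ S₄, g n +
      ∑ n ∈ I.biUnion U, g n := by
    refine (Finset.sum_le_sum_of_subset_of_nonneg hcover fun n _ _ => hg.nonneg n).trans ?_
    have u1 := sum_union_le_add hg.nonneg (((S₁ ∪ S₂) ∪ S₃) ∪ S₄) (I.biUnion U)
    have u2 := sum_union_le_add hg.nonneg ((S₁ ∪ S₂) ∪ S₃) S₄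
    have u3 := sum_union_le_add hg.nonneg (S₁ ∪ S₂) S₃
    have u4 := sum_union_le_add hg.nonneg S₁ S₂
    linarith
  have c₁ : 80 * C₁ * 1 * Q ≤ 80 * C₁ * 1 * (Q * E) := by gcongr
  have c₂ : 80 * C₁ * 2 * Q ≤ 80 * C₁ * 2 * (Q * E) := by gcongr
  have c₃ : 80 * C₁ * (2 * Real.exp (16 + v)) * Q ≤ 80 * C₁ * (2 * Real.exp (16 + v)) * (Q * E) := by gcongr
  calc _ ≤ _ := hsum
    _ ≤ 80 * C₁ * 1 * (Q * E) + 80 * C₁ * 2 * (Q * E) + 80 * C₁ * (2 * Real.exp (16 + v)) * (Q * E) +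
      60 * A ^ 20 * Real.exp (16 * C₁) * (Q * E) +
      3 * (2 * A) * Real.exp (16 * C₁ + A * Real.exp B * (B + 2)) * (Q * E) := by linarith
    _ = _ := by ring

end Shiu
section Class

variable {κ : ℝ} {f Λf : ℕ → ℂ}

lemma norm_prime_pow_rec (hf : IsHalaszClass κ f Λf) {p : ℕ} (hp : p.Prime) (k : ℕ) :
    k * ‖f (p ^ k)‖ ≤ κ * ∑ j ∈ Finset.range k, ‖f (p ^ j)‖ := by
  rcases Nat.eq_zero_or_pos k with rfl | hk
  · simp
  have hlp : 0 < Real.log p := Real.log_pos (by exact_mod_cast hp.one_lt)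
  have h1 := hf.conv (p ^ k) (Nat.pow_pos hp.pos)
  have h2 : ‖f (p ^ k) * (Real.log (p ^ k : ℕ) : ℂ)‖ = Real.log p * (k * ‖f (p ^ k)‖) := by
    rw [norm_mul, Complex.norm_real, Real.norm_of_nonneg (Real.log_natCast_nonneg _)]
    push_cast; rw [Real.log_pow]; ring
  have h3 : ‖∑ d ∈ (p ^ k).divisors, Λf d * f (p ^ k / d)‖ ≤
      Real.log p * (κ * ∑ j ∈ Finset.range k, ‖f (p ^ j)‖) := by
    rw [Nat.divisors_prime_pow hp, Finset.sum_map, ← Finset.sum_flip]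
    refine (norm_sum_le _ _).trans ?_
    rw [Finset.sum_range_succ, Finset.mul_sum, Finset.mul_sum]
    simp only [Function.Embedding.coeFn_mk]
    have h4 : Λf (p ^ (k - k)) = 0 := hf.supp _ (by simpa using not_isPrimePow_one)
    rw [h4, zero_mul, norm_zero, add_zero]
    refine Finset.sum_le_sum fun j hj => ?_
    have hj' := Finset.mem_range.1 hj
    rw [norm_mul, Nat.pow_div (by omega) hp.pos, Nat.sub_sub_self hj'.le]
    have h5 := hf.bound (p ^ (k - j)) (Nat.pow_pos hp.pos)
    rw [ArithmeticFunction.vonMangoldt_apply_pow (by omega), ArithmeticFunction.vonMangoldt_apply_prime hp] at h5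
    calc _ ≤ κ * Real.log p * ‖f (p ^ j)‖ := by gcongr
      _ = _ := by ring
  rw [← h1, h2] at h3
  exact le_of_mul_le_mul_left h3 hlp

lemma norm_prime_pow_le_of_rec {u : ℕ → ℝ} (hκ : 0 < κ)
    (hrec : ∀ k : ℕ, k * u k ≤ κ * ∑ j ∈ Finset.range k, u j) {θ C : ℝ} (hθ : 1 < θ) (hC : 0 ≤ C) {k₀ : ℕ}
    (hk₀ : κ ≤ (k₀ + 1) * (θ - 1)) (hsmall : ∀ k ≤ k₀, u k ≤ C * θ ^ k) (k : ℕ) : u k ≤ C * θ ^ k := by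
  induction k using Nat.strong_induction_on with
  | _ k ih =>
    rcases le_or_gt k k₀ with hk | hk
    · exact hsmall k hk
    have hk0 : (0 : ℝ) < k := by exact_mod_cast (by omega : 0 < k)
    have h1 : ∑ j ∈ Finset.range k, u j ≤ C * ((θ ^ k - 1) / (θ - 1)) := by
      rw [← geom_sum_eq hθ.ne', Finset.mul_sum]
      exact Finset.sum_le_sum fun j hj => ih j (Finset.mem_range.1 hj)
    have h2 : (k : ℝ) * u k ≤ k * (C * θ ^ k) := by
      calc (k : ℝ) * u k ≤ κ * ∑ j ∈ Finset.range k, u j := hrec k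
        _ ≤ κ * (C * ((θ ^ k - 1) / (θ - 1))) := by gcongr
        _ ≤ κ * (C * (θ ^ k / (θ - 1))) := by
            have : 0 < θ - 1 := by linarith
            gcongr; linarith
        _ = (κ / (θ - 1)) * (C * θ ^ k) := by ring
        _ ≤ k * (C * θ ^ k) := by
            have h3 : κ / (θ - 1) ≤ k := by
              rw [div_le_iff₀ (by linarith)]
              have : ((k₀ : ℝ) + 1) ≤ k := by exact_mod_cast hk
              nlinarith
            gcongr
    exact le_of_mul_le_mul_left h2 hk0

lemma norm_prime_pow_le (hκ : 0 < κ) (hf : IsHalaszClass κ f Λf) {p : ℕ} (hp : p.Prime) (k : ℕ) :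
    ‖f (p ^ k)‖ ≤ (1 + κ) ^ k := by
  have := norm_prime_pow_le_of_rec (u := fun k => ‖f (p ^ k)‖) hκ (norm_prime_pow_rec hf hp) (θ := 1 + κ) (C := 1)
    (by linarith) zero_le_one (k₀ := 0) (by simp) (fun k hk => by
      obtain rfl : k = 0 := by omega
      simp [hf.map_one]) k
  simpa using this

lemma norm_prime_le (hκ : 0 < κ) (hf : IsHalaszClass κ f Λf) {p : ℕ} (hp : p.Prime) : ‖f p‖ ≤ κ := by
  have := norm_prime_pow_rec hf hp 1
  simpa [hf.map_one] using this

lemma exists_norm_prime_pow_le_geom (hκ : 0 < κ) {θ : ℝ} (hθ : 1 < θ) : ∃ C : ℝ, 1 ≤ C ∧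
    ∀ f Λf : ℕ → ℂ, IsHalaszClass κ f Λf → ∀ p k : ℕ, p.Prime → ‖f (p ^ k)‖ ≤ C * θ ^ k := by
  obtain ⟨k₀, hk₀⟩ := exists_nat_ge (κ / (θ - 1))
  refine ⟨(1 + κ) ^ k₀, one_le_pow₀ (by linarith), fun f Λf hf p k hp => ?_⟩
  refine norm_prime_pow_le_of_rec (u := fun k => ‖f (p ^ k)‖) hκ (norm_prime_pow_rec hf hp) hθ (by positivity)
    (k₀ := k₀) ?_ (fun k hk => ?_) k
  · rw [div_le_iff₀ (by linarith)] at hk₀; nlinarith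
  · calc ‖f (p ^ k)‖ ≤ (1 + κ) ^ k := norm_prime_pow_le hκ hf hp k
      _ ≤ (1 + κ) ^ k₀ := pow_le_pow_right₀ (by linarith) hk
      _ ≤ (1 + κ) ^ k₀ * θ ^ k := le_mul_of_one_le_right (by positivity) (one_le_pow₀ hθ.le)

lemma exists_norm_le_rpow (hκ : 0 < κ) {ε : ℝ} (hε : 0 < ε) : ∃ C : ℝ, 1 ≤ C ∧
    ∀ f Λf : ℕ → ℂ, IsHalaszClass κ f Λf → ∀ n : ℕ, 1 ≤ n → ‖f n‖ ≤ C * (n : ℝ) ^ ε := by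
  obtain ⟨C, hC1, hC⟩ := exists_norm_prime_pow_le_geom hκ (θ := (2 : ℝ) ^ ε) (Real.one_lt_rpow (by norm_num) hε)
  obtain ⟨P, hP⟩ := exists_nat_ge ((1 + κ) ^ (1 / ε))
  refine ⟨C ^ P, one_le_pow₀ hC1, fun f Λf hf n hn => ?_⟩
  have hn0 : n ≠ 0 := by omega
  have hC0 : 0 < C := by linarith
  have h1 : ∀ p k : ℕ, p.Prime → ‖f (p ^ k)‖ ≤ (if p < P then C else 1) * ((p ^ k : ℕ) : ℝ) ^ ε := by
    intro p k hp
    have hp0 : (0 : ℝ) < p := by exact_mod_cast hp.pos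
    have h2 : ((p ^ k : ℕ) : ℝ) ^ ε = ((p : ℝ) ^ ε) ^ k := by
      push_cast
      rw [← Real.rpow_natCast, ← Real.rpow_mul hp0.le, mul_comm, Real.rpow_mul hp0.le, Real.rpow_natCast]
    rw [h2]
    split_ifs with h
    · refine (hC f Λf hf p k hp).trans ?_
      have : (2 : ℝ) ≤ p := by exact_mod_cast hp.two_le
      gcongr
    · rw [one_mul]
      refine (norm_prime_pow_le hκ hf hp k).trans ?_
      have h3 : (1 + κ) ^ (1 / ε) ≤ (p : ℝ) := hP.trans (by exact_mod_cast not_lt.1 h)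
      have h4 : 1 + κ ≤ (p : ℝ) ^ ε := by
        calc 1 + κ = ((1 + κ) ^ (1 / ε)) ^ ε := by
              rw [← Real.rpow_mul (by linarith), one_div_mul_cancel hε.ne', Real.rpow_one]
          _ ≤ _ := Real.rpow_le_rpow (by positivity) h3 hε.le
      gcongr
  have h5 : f n = n.factorization.prod fun p k => f (p ^ k) :=
    Nat.multiplicative_factorization f (fun x y h => hf.mult x y h) hf.map_one hn0
  rw [h5, Finsupp.prod, norm_prod]
  calc ∏ p ∈ n.factorization.support, ‖f (p ^ n.factorization p)‖ ≤
      ∏ p ∈ n.factorization.support, (if p < P then C else 1) * ((p ^ n.factorization p : ℕ) : ℝ) ^ ε :=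
        Finset.prod_le_prod (fun _ _ => norm_nonneg _) fun p hp => h1 p _ (Nat.prime_of_mem_primeFactors hp)
    _ = (∏ p ∈ n.factorization.support, if p < P then C else 1) * (n : ℝ) ^ ε := by
        rw [Finset.prod_mul_distrib, Real.finsetProd_rpow _ _ (fun _ _ => by positivity)]
        congr 2
        rw [← Nat.cast_prod]
        exact_mod_cast Nat.prod_factorization_pow_eq_self hn0
    _ ≤ C ^ P * (n : ℝ) ^ ε := by
        gcongr
        rw [← Finset.prod_filter, Finset.prod_const]
        refine pow_le_pow_right₀ hC1 ?_
        calc _ ≤ (Finset.range P).card := Finset.card_le_card fun p hp => by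
              rw [Finset.mem_filter] at hp; exact Finset.mem_range.2 hp.2
          _ = P := Finset.card_range P

/-- `|f|` weighted by powers of the smooth and rough parts. -/
def twist (f : ℕ → ℂ) (y : ℕ) (γ γ' : ℝ) (n : ℕ) : ℝ :=
  ‖f n‖ * ((smooth y n : ℝ) ^ γ * (rough y n : ℝ) ^ (-γ'))

lemma exists_isShiu_twist (hκ : 0 < κ) : ∃ C₁ : ℝ, 0 ≤ C₁ ∧ ∀ f Λf : ℕ → ℂ, IsHalaszClass κ f Λf →
    ∀ (y : ℕ) (γ γ' : ℝ), 0 ≤ γ → γ ≤ 1 / 80 → γ * Real.log y ≤ 2 → 0 ≤ γ' →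
    IsShiu ((1 + κ) * Real.exp 2) C₁ (twist f y γ γ') := by
  obtain ⟨C, hC1, hC⟩ := exists_norm_le_rpow hκ (ε := 1 / 80) (by norm_num)
  refine ⟨C, by linarith, fun f Λf hf y γ γ' hγ hγ' hγy hγ'0 => ?_⟩
  have hr : ∀ n : ℕ, (rough y n : ℝ) ^ (-γ') ≤ 1 := fun n =>
    Real.rpow_le_one_of_one_le_of_nonpos (by exact_mod_cast rough_pos y n) (by linarith)
  refine ⟨by simp [twist, hf.map_one], fun n => by unfold twist; positivity, ?_, ?_, ?_⟩
  · intro m n hmn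
    unfold twist
    rcases Nat.eq_zero_or_pos m with rfl | hm
    · rw [Nat.coprime_zero_left] at hmn; subst hmn; simp [hf.map_one]
    rcases Nat.eq_zero_or_pos n with rfl | hn
    · rw [Nat.coprime_zero_right] at hmn; subst hmn; simp [hf.map_one]
    rw [hf.mult m n hmn, smooth_mul y hm.ne' hn.ne', rough_mul y hm.ne' hn.ne', norm_mul]
    push_cast
    rw [Real.mul_rpow (by positivity) (by positivity), Real.mul_rpow (by positivity) (by positivity)]
    ring
  · intro p k hp
    have hp0 : (0 : ℝ) < p := by exact_mod_cast hp.pos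
    have h1 : (smooth y (p ^ k) : ℝ) ^ γ ≤ Real.exp 2 ^ k := by
      rw [smooth_prime_pow hp]
      split_ifs with h
      · simp; exact one_le_pow₀ (Real.one_le_exp (by norm_num))
      · push_cast
        rw [← Real.rpow_natCast, ← Real.rpow_mul hp0.le, mul_comm, Real.rpow_mul hp0.le, Real.rpow_natCast]
        have : (p : ℝ) ^ γ ≤ Real.exp 2 := by
          rw [Real.rpow_def_of_pos hp0, Real.exp_le_exp, mul_comm]
          refine le_trans ?_ hγy
          gcongr
          omega
        gcongr
    unfold twist
    rw [mul_pow]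
    calc _ ≤ (1 + κ) ^ k * (Real.exp 2 ^ k * 1) := by
          gcongr
          · exact norm_prime_pow_le hκ hf hp k
          · exact hr _
      _ = _ := by ring
  · intro n hn
    have h1 : (smooth y n : ℝ) ^ γ ≤ (n : ℝ) ^ (1 / 80 : ℝ) := by
      have h2 : smooth y n ≤ n := Nat.le_of_dvd hn ⟨_, (smooth_mul_rough y (by omega)).symm⟩
      calc (smooth y n : ℝ) ^ γ ≤ (n : ℝ) ^ γ := by gcongr
        _ ≤ _ := Real.rpow_le_rpow_of_exponent_le (by exact_mod_cast hn) hγ'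
    unfold twist
    calc _ ≤ C * (n : ℝ) ^ (1 / 80 : ℝ) * ((n : ℝ) ^ (1 / 80 : ℝ) * 1) := by
          gcongr
          · exact hC f Λf hf n hn
          · exact hr _
      _ = C * (n : ℝ) ^ (1 / 40 : ℝ) := by
          rw [mul_one, mul_assoc, ← Real.rpow_add (by exact_mod_cast hn)]; norm_num

end Class
section TwistSums

open ArithmeticFunction (vonMangoldt)

variable {κ : ℝ} {f Λf : ℕ → ℂ}

lemma twist_prime_le_of_le (hκ : 0 < κ) (hf : IsHalaszClass κ f Λf) {y p : ℕ} (hp : p.Prime) {γ γ' : ℝ}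
    (hγ : 0 ≤ γ) (hγy : γ * Real.log y ≤ 1) (hpy : p ≤ y) :
    twist f y γ γ' p ≤ κ * (1 + 2 * γ * Real.log p) := by
  have hp0 : (0 : ℝ) < p := by exact_mod_cast hp.pos
  have h1 := smooth_prime_pow (y := y) hp 1
  have h2 := rough_prime_pow (y := y) hp 1
  rw [pow_one, if_neg (not_lt.2 hpy)] at h1 h2
  unfold twist
  rw [h1, h2, Nat.cast_one, Real.one_rpow, mul_one]
  have hl0 : 0 ≤ γ * Real.log p := mul_nonneg hγ (Real.log_natCast_nonneg p)
  have hl1 : γ * Real.log p ≤ 1 := le_trans (by gcongr) hγy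
  have h3 : (p : ℝ) ^ γ ≤ 1 + 2 * γ * Real.log p := by
    rw [Real.rpow_def_of_pos hp0, mul_comm]
    have := Real.abs_exp_sub_one_le (x := γ * Real.log p) (by rw [abs_of_nonneg hl0]; exact hl1)
    rw [abs_of_nonneg hl0] at this
    linarith [le_abs_self (Real.exp (γ * Real.log p) - 1)]
  gcongr
  exact norm_prime_le hκ hf hp

lemma twist_prime_of_lt {y p : ℕ} (hp : p.Prime) {γ γ' : ℝ} (hpy : y < p) :
    twist f y γ γ' p = ‖f p‖ * (p : ℝ) ^ (-γ') := by
  have h1 := smooth_prime_pow (y := y) hp 1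
  have h2 := rough_prime_pow (y := y) hp 1
  rw [pow_one, if_pos hpy] at h1 h2
  unfold twist
  rw [h1, h2, Nat.cast_one, Real.one_rpow, one_mul]

lemma sum_twist_prime_le (hκ : 0 < κ) (hf : IsHalaszClass κ f Λf) {y : ℕ} (hy : 80 ≤ Real.log y) (N : ℕ) :
    ∑ p ∈ (Finset.Icc 1 N).filter Nat.Prime, twist f y (1 / Real.log y) (1 / Real.log y) p / p ≤
      κ * (Real.log (Real.log y) + 26) := by
  set η := 1 / Real.log y with hη
  have hη0 : 0 < η := by positivity
  have hη1 : η * Real.log y = 1 := by rw [hη]; field_simp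
  have hηs : η ≤ 1 / 80 := one_div_le_one_div_of_le (by norm_num) hy
  have hy2 : 2 ≤ y := by
    by_contra h
    interval_cases y <;> norm_num at hy
  rw [← Finset.sum_filter_add_sum_filter_not _ (fun p => p ≤ y)]
  have h1 : ∑ p ∈ ((Finset.Icc 1 N).filter Nat.Prime).filter (fun p => p ≤ y), twist f y η η p / p ≤
      κ * (Real.log (Real.log y) + 16) := by
    calc _ ≤ ∑ p ∈ ((Finset.Icc 1 N).filter Nat.Prime).filter (fun p => p ≤ y),
          κ * (1 / p + 2 * η * (Real.log p / p)) := Finset.sum_le_sum fun p hp => by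
            simp only [Finset.mem_filter] at hp
            have := twist_prime_le_of_le (γ' := η) hκ hf hp.1.2 hη0.le hη1.le hp.2
            calc _ ≤ κ * (1 + 2 * η * Real.log p) / p := by gcongr
              _ = _ := by ring
      _ ≤ ∑ p ∈ (Finset.Icc 1 y).filter Nat.Prime, κ * (1 / p + 2 * η * (Real.log p / p)) := by
          refine Finset.sum_le_sum_of_subset_of_nonneg (fun p hp => ?_) fun p _ _ => ?_
          · simp only [Finset.mem_filter, Finset.mem_Icc] at hp ⊢
            exact ⟨⟨hp.1.1.1, hp.2⟩, hp.1.2⟩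
          · have := Real.log_natCast_nonneg p; positivity
      _ = κ * (∑ p ∈ (Finset.Icc 1 y).filter Nat.Prime, 1 / (p : ℝ) +
            2 * η * ∑ p ∈ (Finset.Icc 1 y).filter Nat.Prime, Real.log p / p) := by
          rw [← Finset.mul_sum, Finset.sum_add_distrib, Finset.mul_sum]
      _ ≤ κ * ((Real.log (Real.log y) + 13) + 2 * η * (Real.log y + 6)) := by
          gcongr
          · exact sum_primes_inv_le hy2
          · exact sum_primes_log_div_le (by omega)
      _ ≤ _ := mul_le_mul_of_nonneg_left (by nlinarith) hκ.le
  have h2 : ∑ p ∈ ((Finset.Icc 1 N).filter Nat.Prime).filter (fun p => ¬ p ≤ y), twist f y η η p / p ≤ κ * 10 := by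
    calc _ ≤ ∑ p ∈ ((Finset.Icc 1 N).filter Nat.Prime).filter (fun p => ¬ p ≤ y), κ * (p : ℝ) ^ (-1 - η) :=
          Finset.sum_le_sum fun p hp => by
            simp only [Finset.mem_filter] at hp
            have hp0 : (0 : ℝ) < p := by exact_mod_cast hp.1.2.pos
            rw [twist_prime_of_lt hp.1.2 (not_le.1 hp.2), mul_div_assoc]
            have : (p : ℝ) ^ (-1 - η) = (p : ℝ) ^ (-η) / p := by
              rw [← Real.rpow_sub_one hp0.ne']; ring_nf
            rw [this]
            gcongr
            exact norm_prime_le hκ hf hp.1.2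
      _ ≤ _ := by
          rw [← Finset.mul_sum]
          gcongr
          refine sum_large_primes_rpow_le hη0 (by linarith) hη1.ge _ fun p hp => ?_
          simp only [Finset.mem_filter] at hp
          exact ⟨hp.1.2, not_le.1 hp.2⟩
  linarith

lemma exp_sum_twist_prime_le (hκ : 0 < κ) (hf : IsHalaszClass κ f Λf) {y : ℕ} (hy : 80 ≤ Real.log y) (N : ℕ) :
    Real.exp (∑ p ∈ (Finset.Icc 1 N).filter Nat.Prime, twist f y (1 / Real.log y) (1 / Real.log y) p / p) ≤
      Real.exp (26 * κ) * Real.log y ^ κ := by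
  rw [Real.rpow_def_of_pos (by linarith), ← Real.exp_add, Real.exp_le_exp]
  linarith [sum_twist_prime_le hκ hf hy N]

lemma exists_sum_twist_modEq_le (hκ : 0 < κ) : ∃ C : ℝ, 0 < C ∧ ∀ f Λf : ℕ → ℂ, IsHalaszClass κ f Λf →
    ∀ y : ℕ, 80 ≤ Real.log y → ∀ q a M H N : ℕ, 1 ≤ q → a.Coprime q → 2 ≤ N → M + H ≤ N →
    q * (N : ℝ) ^ (1 / 2 : ℝ) ≤ H →
    ∑ n ∈ (Finset.Ioc M (M + H)).filter (fun n => n ≡ a [MOD q]), twist f y (1 / Real.log y) (1 / Real.log y) n ≤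
      C * (H / (q.totient * Real.log N) * Real.log y ^ κ) := by
  obtain ⟨C₁, hC₁, hS⟩ := exists_isShiu_twist hκ
  have hA : 1 ≤ (1 + κ) * Real.exp 2 := one_le_mul_of_one_le_of_one_le (by linarith) (Real.one_le_exp (by norm_num))
  obtain ⟨C, hC, hsh⟩ := shiu _ C₁ hA hC₁
  refine ⟨C * Real.exp (26 * κ), by positivity, fun f Λf hf y hy q a M H N hq ha hN hMH hH => ?_⟩
  have hη : 1 / Real.log y ≤ 1 / 80 := one_div_le_one_div_of_le (by norm_num) hy
  have hη' : 1 / Real.log y * Real.log y = 1 := one_div_mul_cancel (by linarith)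
  refine (hsh _ (hS f Λf hf y _ _ (by positivity) hη (by linarith) (by positivity)) q a M H N hq ha hN hMH hH).trans ?_
  have hN0 := Real.log_natCast_nonneg N
  calc _ ≤ C * (H / (q.totient * Real.log N) * (Real.exp (26 * κ) * Real.log y ^ κ)) := by
        gcongr; exact exp_sum_twist_prime_le hκ hf hy N
    _ = _ := by ring

lemma exists_sum_twist_div_le (hκ : 0 < κ) : ∃ C : ℝ, 0 < C ∧ ∀ f Λf : ℕ → ℂ, IsHalaszClass κ f Λf →
    ∀ y : ℕ, 80 ≤ Real.log y → ∀ N : ℕ,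
    ∑ n ∈ Finset.Icc 1 N, twist f y (1 / Real.log y) (1 / Real.log y) n / n ≤ C * Real.log y ^ κ := by
  obtain ⟨C₁, hC₁, hS⟩ := exists_isShiu_twist hκ
  refine ⟨Real.exp (16 * C₁) * Real.exp (26 * κ), by positivity, fun f Λf hf y hy N => ?_⟩
  have hη : 1 / Real.log y ≤ 1 / 80 := one_div_le_one_div_of_le (by norm_num) hy
  have hη' : 1 / Real.log y * Real.log y = 1 := one_div_mul_cancel (by linarith)
  have := (hS f Λf hf y (1 / Real.log y) (1 / Real.log y) (by positivity) hη (by linarith) (by positivity)).sum_le hC₁ (σ := 1) (by norm_num)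
    ((Finset.Icc 1 N).filter Nat.Prime) (by simp) (Finset.Icc 1 N) (fun n hn => by
      have hn := Finset.mem_Icc.1 hn
      refine ⟨by omega, fun p hp hpn => ?_⟩
      have := Nat.le_of_dvd (by omega) hpn
      simp only [Finset.mem_filter, Finset.mem_Icc]
      exact ⟨⟨hp.one_le, by omega⟩, hp⟩)
  simp only [Real.rpow_neg_one, ← div_eq_mul_inv] at this
  refine this.trans ?_
  rw [mul_assoc]
  gcongr
  exact exp_sum_twist_prime_le hκ hf hy N

lemma exists_sum_norm_modEq_le (hκ : 0 < κ) : ∃ C : ℝ, 0 < C ∧ ∀ f Λf : ℕ → ℂ, IsHalaszClass κ f Λf →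
    ∀ q a M H N : ℕ, 1 ≤ q → a.Coprime q → 2 ≤ N → M + H ≤ N → q * (N : ℝ) ^ (1 / 2 : ℝ) ≤ H →
    ∑ n ∈ (Finset.Ioc M (M + H)).filter (fun n => n ≡ a [MOD q]), ‖f n‖ ≤
      C * (H / (q.totient * Real.log N) * Real.log N ^ κ) := by
  obtain ⟨C₁, hC₁, hS⟩ := exists_isShiu_twist hκ
  have hA : 1 ≤ (1 + κ) * Real.exp 2 := one_le_mul_of_one_le_of_one_le (by linarith) (Real.one_le_exp (by norm_num))
  obtain ⟨C, hC, hsh⟩ := shiu _ C₁ hA hC₁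
  refine ⟨C * Real.exp (13 * κ), by positivity, fun f Λf hf q a M H N hq ha hN hMH hH => ?_⟩
  have h0 : twist f 0 0 0 = fun n => ‖f n‖ := by ext n; simp [twist]
  have h1 := hS f Λf hf 0 0 0 le_rfl (by norm_num) (by simp) le_rfl
  rw [h0] at h1
  refine (hsh _ h1 q a M H N hq ha hN hMH hH).trans ?_
  have hN0 := Real.log_natCast_nonneg N
  have hN1 : 0 < Real.log N := Real.log_pos (by exact_mod_cast hN)
  calc _ ≤ C * (H / (q.totient * Real.log N) * (Real.exp (13 * κ) * Real.log N ^ κ)) := by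
        gcongr
        rw [Real.rpow_def_of_pos hN1, ← Real.exp_add, Real.exp_le_exp]
        calc _ ≤ ∑ p ∈ (Finset.Icc 1 N).filter Nat.Prime, κ * (1 / (p : ℝ)) := by
              refine Finset.sum_le_sum fun p hp => ?_
              rw [mul_one_div]
              gcongr
              exact norm_prime_le hκ hf (Finset.mem_filter.1 hp).2
          _ ≤ κ * (Real.log (Real.log N) + 13) := by
              rw [← Finset.mul_sum]; gcongr; exact sum_primes_inv_le hN
          _ = _ := by ring
    _ = _ := by ring

end TwistSums
section Convolution

open ArithmeticFunction (vonMangoldt)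

variable {κ : ℝ} {f Λf : ℕ → ℂ}

lemma mul_sqrt_le_of_sq_le {q N : ℕ} (h : q ^ 2 ≤ N) : q * (N : ℝ) ^ (1 / 2 : ℝ) ≤ N := by
  have h1 : (q : ℝ) ^ 2 ≤ N := by exact_mod_cast h
  rw [← Real.sqrt_eq_rpow]
  calc q * √(N : ℝ) ≤ √(N : ℝ) * √(N : ℝ) := by
        gcongr; exact Real.le_sqrt_of_sq_le h1
    _ = N := Real.mul_self_sqrt (by positivity)

lemma sum_mul_modEq_le (g : ℕ → ℝ) (hg : ∀ n, 0 ≤ g n) {q a m N : ℕ} (ha : a.Coprime q) {B : ℝ} (hB : 0 ≤ B)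
    (h : ∀ b : ℕ, b.Coprime q → ∑ n ∈ (Finset.Ioc 0 N).filter (fun n => n ≡ b [MOD q]), g n ≤ B) :
    ∑ n ∈ (Finset.Ioc 0 N).filter (fun n => n * m ≡ a [MOD q]), g n ≤ B := by
  by_cases hex : ∃ b, b * m ≡ a [MOD q]
  · obtain ⟨b, hb⟩ := hex
    have hbm : (b * m).Coprime q := by
      rw [Nat.coprime_iff_gcd_eq_one, hb.gcd_eq]; exact ha
    refine le_trans (Finset.sum_le_sum_of_subset_of_nonneg (fun n hn => ?_) fun _ _ _ => hg _)
      (h b (Nat.Coprime.coprime_mul_right hbm))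
    simp only [Finset.mem_filter] at hn ⊢
    exact ⟨hn.1, Nat.ModEq.cancel_right_of_coprime
      (Nat.coprime_comm.1 (Nat.Coprime.coprime_mul_left hbm)) (hn.2.trans hb.symm)⟩
  · rw [Finset.filter_false_of_mem fun n _ hn => hex ⟨n, hn⟩]
    simpa using hB

lemma sum_divisorsAntidiagonal_modEq_le (G : ℕ → ℕ → ℝ) (hG : ∀ d m, 0 ≤ G d m) (q a X : ℕ) :
    ∑ n ∈ (Finset.Icc 1 X).filter (fun n => n ≡ a [MOD q]), ∑ p ∈ n.divisorsAntidiagonal, G p.1 p.2 ≤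
      (∑ m ∈ Finset.Icc 1 X.sqrt, ∑ d ∈ (Finset.Ioc 0 (X / m)).filter (fun d => d * m ≡ a [MOD q]), G d m) +
      ∑ d ∈ Finset.Icc 1 X.sqrt, ∑ m ∈ (Finset.Ioc 0 (X / d)).filter (fun m => m * d ≡ a [MOD q]), G d m := by
  have hle : ∀ n ∈ (Finset.Icc 1 X).filter (fun n => n ≡ a [MOD q]), ∑ p ∈ n.divisorsAntidiagonal, G p.1 p.2 ≤
      (∑ m ∈ Finset.Icc 1 X.sqrt, ∑ d ∈ (Finset.Ioc 0 (X / m)).filter (fun d => d * m ≡ a [MOD q]),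
        if d * m = n then G d m else 0) +
      ∑ d ∈ Finset.Icc 1 X.sqrt, ∑ m ∈ (Finset.Ioc 0 (X / d)).filter (fun m => m * d ≡ a [MOD q]),
        if d * m = n then G d m else 0 := by
    intro n hn
    simp only [Finset.mem_filter, Finset.mem_Icc] at hn
    rw [← Finset.sum_filter_add_sum_filter_not _ (fun p : ℕ × ℕ => p.2 ≤ X.sqrt)]
    refine add_le_add ?_ ?_
    · rw [Finset.sum_sigma', ← Finset.sum_filter]
      set e : ℕ × ℕ → (_ : ℕ) × ℕ := fun p => ⟨p.2, p.1⟩ with he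
      rw [← Finset.sum_image (g := e) (f := fun z => G z.2 z.1) fun p _ p' _ h => by
        simp only [he, Sigma.mk.injEq, heq_eq_eq] at h; exact Prod.ext h.2 h.1]
      refine Finset.sum_le_sum_of_subset_of_nonneg (fun z hz => ?_) fun _ _ _ => hG _ _
      obtain ⟨p, hp, rfl⟩ := Finset.mem_image.1 hz
      simp only [Finset.mem_filter, Nat.mem_divisorsAntidiagonal] at hp
      obtain ⟨⟨hpn, hn0⟩, hps⟩ := hp
      have h2 : 0 < p.2 := Nat.pos_of_ne_zero fun h => hn0 (by rw [← hpn, h, mul_zero])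
      have h1 : 0 < p.1 := Nat.pos_of_ne_zero fun h => hn0 (by rw [← hpn, h, zero_mul])
      simp only [he, Finset.mem_filter, Finset.mem_sigma, Finset.mem_Icc, Finset.mem_Ioc, Nat.le_div_iff_mul_le h2, hpn]
      exact ⟨⟨⟨h2, hps⟩, ⟨h1, hn.1.2⟩, hn.2⟩, trivial⟩
    · rw [Finset.sum_sigma', ← Finset.sum_filter]
      set e : ℕ × ℕ → (_ : ℕ) × ℕ := fun p => ⟨p.1, p.2⟩ with he
      rw [← Finset.sum_image (g := e) (f := fun z => G z.1 z.2) fun p _ p' _ h => by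
        simp only [he, Sigma.mk.injEq, heq_eq_eq] at h; exact Prod.ext h.1 h.2]
      refine Finset.sum_le_sum_of_subset_of_nonneg (fun z hz => ?_) fun _ _ _ => hG _ _
      obtain ⟨p, hp, rfl⟩ := Finset.mem_image.1 hz
      simp only [Finset.mem_filter, Nat.mem_divisorsAntidiagonal] at hp
      obtain ⟨⟨hpn, hn0⟩, hps⟩ := hp
      have h2 : 0 < p.2 := Nat.pos_of_ne_zero fun h => hn0 (by rw [← hpn, h, mul_zero])
      have h1 : 0 < p.1 := Nat.pos_of_ne_zero fun h => hn0 (by rw [← hpn, h, zero_mul])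
      have hps1 : p.1 ≤ X.sqrt := by
        by_contra hlt
        have := Nat.sqrt_lt'.1 (Nat.lt_succ_self X.sqrt)
        have h3 : X.sqrt.succ * X.sqrt.succ ≤ p.1 * p.2 := Nat.mul_le_mul (by omega) (by omega)
        rw [hpn] at h3
        rw [sq] at this
        omega
      simp only [he, Finset.mem_filter, Finset.mem_sigma, Finset.mem_Icc, Finset.mem_Ioc, Nat.le_div_iff_mul_le h1,
        mul_comm p.2 p.1, hpn]
      exact ⟨⟨⟨h1, hps1⟩, ⟨h2, hn.1.2⟩, hn.2⟩, trivial⟩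
  refine (Finset.sum_le_sum hle).trans ?_
  rw [Finset.sum_add_distrib]
  refine add_le_add ?_ ?_
  · rw [Finset.sum_comm]
    refine Finset.sum_le_sum fun m _ => ?_
    rw [Finset.sum_comm]
    refine Finset.sum_le_sum fun d _ => ?_
    rw [Finset.sum_ite_eq]
    split_ifs <;> simp [hG]
  · rw [Finset.sum_comm]
    refine Finset.sum_le_sum fun m _ => ?_
    rw [Finset.sum_comm]
    refine Finset.sum_le_sum fun d _ => ?_
    rw [Finset.sum_ite_eq]
    split_ifs <;> simp [hG]

/-- The convolution of `Λ` with the twisted weights of `f`. -/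
def convTwist (f : ℕ → ℂ) (y n : ℕ) : ℝ :=
  ∑ p ∈ n.divisorsAntidiagonal, vonMangoldt p.1 * twist f y (1 / Real.log y) (1 / Real.log y) p.2

lemma twist_nonneg (f : ℕ → ℂ) (y : ℕ) (γ γ' : ℝ) (n : ℕ) : 0 ≤ twist f y γ γ' n := by
  unfold twist; positivity

lemma convTwist_nonneg (f : ℕ → ℂ) (y n : ℕ) : 0 ≤ convTwist f y n :=
  Finset.sum_nonneg fun _ _ => mul_nonneg ArithmeticFunction.vonMangoldt_nonneg (twist_nonneg ..)

lemma log_le_four_mul_log_sqrt {X : ℕ} (hX : 16 ≤ X) : Real.log X ≤ 4 * Real.log X.sqrt := by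
  have h4 : 4 ≤ X.sqrt := Nat.le_sqrt.2 (by omega)
  have h1 : X ≤ X.sqrt ^ 4 := by
    have := Nat.sqrt_lt'.1 (Nat.lt_succ_self X.sqrt)
    have h2 : X.sqrt.succ ^ 2 ≤ X.sqrt ^ 4 := by
      rw [show 4 = 2 * 2 by norm_num, pow_mul]
      exact Nat.pow_le_pow_left (by rw [Nat.succ_eq_add_one]; nlinarith) 2
    omega
  have h2 : Real.log X ≤ Real.log ((X.sqrt : ℝ) ^ 4) :=
    Real.log_le_log (by exact_mod_cast (by omega : 0 < X)) (by exact_mod_cast h1)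
  rwa [Real.log_pow] at h2

lemma exists_sum_convTwist_modEq_le (hκ : 0 < κ) : ∃ C : ℝ, 0 < C ∧ ∀ f Λf : ℕ → ℂ, IsHalaszClass κ f Λf →
    ∀ y : ℕ, 80 ≤ Real.log y → ∀ q a X : ℕ, 1 ≤ q → a.Coprime q → 16 ≤ X → q ^ 4 ≤ X →
    ∑ n ∈ (Finset.Icc 1 X).filter (fun n => n ≡ a [MOD q]), convTwist f y n ≤
      C * (X / q.totient * Real.log y ^ κ) := by
  obtain ⟨C₁, hC₁, h₁⟩ := exists_sum_twist_modEq_le hκ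
  obtain ⟨C₂, hC₂, h₂⟩ := exists_sum_twist_div_le hκ
  refine ⟨30 * C₂ + 16 * C₁, by positivity, fun f Λf hf y hy q a X hq ha hX hqX => ?_⟩
  set h := twist f y (1 / Real.log y) (1 / Real.log y) with hh
  have hh0 : ∀ n, 0 ≤ h n := twist_nonneg f y _ _
  have hq0 : (0 : ℝ) < q.totient := by exact_mod_cast Nat.totient_pos.2 hq
  have hX0 : (0 : ℝ) < X := by exact_mod_cast (by omega : 0 < X)
  have hlX : 2 ≤ Real.log X := by
    rw [Real.le_log_iff_exp_le hX0]
    have := Real.exp_one_lt_d9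
    have h16 : (16 : ℝ) ≤ X := by exact_mod_cast hX
    rw [show (2 : ℝ) = 1 + 1 by norm_num, Real.exp_add]
    nlinarith [Real.exp_pos 1]
  have hqR : q ^ 2 ≤ X.sqrt := Nat.le_sqrt.2 (by rw [← pow_add]; exact hqX)
  have hR4 : 4 ≤ X.sqrt := Nat.le_sqrt.2 (by omega)
  have hdiv : ∀ m ∈ Finset.Icc 1 X.sqrt, X.sqrt ≤ X / m := fun m hm => by
    rw [Finset.mem_Icc] at hm
    rw [Nat.le_div_iff_mul_le (by omega)]
    exact (Nat.mul_le_mul_left _ hm.2).trans (Nat.sqrt_le X)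
  refine (sum_divisorsAntidiagonal_modEq_le (fun d m => vonMangoldt d * h m)
    (fun d m => mul_nonneg ArithmeticFunction.vonMangoldt_nonneg (hh0 m)) q a X).trans ?_
  have hb1 : ∑ m ∈ Finset.Icc 1 X.sqrt, ∑ d ∈ (Finset.Ioc 0 (X / m)).filter (fun d => d * m ≡ a [MOD q]),
      vonMangoldt d * h m ≤ 30 * C₂ * (X / q.totient * Real.log y ^ κ) := by
    calc _ ≤ ∑ m ∈ Finset.Icc 1 X.sqrt, 30 * (X / q.totient) * (h m / m) := by
          refine Finset.sum_le_sum fun m hm => ?_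
          have hd := hdiv m hm
          rw [← Finset.sum_mul]
          calc _ ≤ 30 * ((X / m : ℕ) / q.totient : ℝ) * h m := by
                refine mul_le_mul_of_nonneg_right ?_ (hh0 m)
                refine sum_mul_modEq_le _ (fun _ => ArithmeticFunction.vonMangoldt_nonneg) ha (by positivity) fun b _ => ?_
                have := sum_vonMangoldt_modEq_le q b 0 (X / m) (X / m) hq (by omega) (by omega)
                  (mul_sqrt_le_of_sq_le (hqR.trans hd))
                simpa using this
            _ ≤ 30 * (((X : ℝ) / m) / q.totient) * h m := by
                have := hh0 m
                gcongr; exact Nat.cast_div_le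
            _ = _ := by ring
      _ ≤ 30 * (X / q.totient) * (C₂ * Real.log y ^ κ) := by
          rw [← Finset.mul_sum]
          gcongr
          exact h₂ f Λf hf y hy _
      _ = _ := by ring
  have hb2 : ∑ d ∈ Finset.Icc 1 X.sqrt, ∑ m ∈ (Finset.Ioc 0 (X / d)).filter (fun m => m * d ≡ a [MOD q]),
      vonMangoldt d * h m ≤ 16 * C₁ * (X / q.totient * Real.log y ^ κ) := by
    calc _ ≤ ∑ d ∈ Finset.Icc 1 X.sqrt, 4 * C₁ * (X / q.totient * Real.log y ^ κ) / Real.log X * (vonMangoldt d / d) := by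
          refine Finset.sum_le_sum fun d hm => ?_
          have hd := hdiv d hm
          rw [← Finset.mul_sum]
          have hlog : Real.log X ≤ 4 * Real.log (X / d : ℕ) := by
            refine (log_le_four_mul_log_sqrt hX).trans ?_
            have : (0 : ℝ) < X.sqrt := by exact_mod_cast (by omega : 0 < X.sqrt)
            gcongr
          have hlp : 0 < Real.log (X / d : ℕ) := by linarith
          calc _ ≤ vonMangoldt d * (C₁ * ((X / d : ℕ) / (q.totient * Real.log (X / d : ℕ)) * Real.log y ^ κ)) := by
                refine mul_le_mul_of_nonneg_left ?_ ArithmeticFunction.vonMangoldt_nonneg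
                refine sum_mul_modEq_le _ hh0 ha (by positivity) fun b hb => ?_
                have := h₁ f Λf hf y hy q b 0 (X / d) (X / d) hq hb (by omega) (by omega)
                  (mul_sqrt_le_of_sq_le (hqR.trans hd))
                rwa [zero_add] at this
            _ ≤ vonMangoldt d * (C₁ * (((X : ℝ) / d) / (q.totient * (Real.log X / 4)) * Real.log y ^ κ)) := by
                have := ArithmeticFunction.vonMangoldt_nonneg (n := d)
                gcongr
                · exact Nat.cast_div_le
                · linarith
            _ = _ := by field_simp
      _ ≤ 4 * C₁ * (X / q.totient * Real.log y ^ κ) / Real.log X * (4 * Real.log X) := by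
          rw [← Finset.mul_sum]
          gcongr
          refine (sum_vonMangoldt_div_le (by omega)).trans ?_
          have : Real.log X.sqrt ≤ Real.log X :=
            Real.log_le_log (by exact_mod_cast (by omega : 0 < X.sqrt)) (by exact_mod_cast Nat.sqrt_le_self X)
          linarith
      _ = _ := by field_simp; ring
  linarith

lemma exists_convTwist_le (hκ : 0 < κ) : ∃ C : ℝ, 0 < C ∧ ∀ f Λf : ℕ → ℂ, IsHalaszClass κ f Λf →
    ∀ y : ℕ, 80 ≤ Real.log y → ∀ n : ℕ, 1 ≤ n → convTwist f y n ≤ C * (n : ℝ) ^ (1 / 20 : ℝ) := by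
  obtain ⟨C₁, hC₁, hS⟩ := exists_isShiu_twist hκ
  refine ⟨40 * C₁ + 1, by positivity, fun f Λf hf y hy n hn => ?_⟩
  have hη : 1 / Real.log y ≤ 1 / 80 := one_div_le_one_div_of_le (by norm_num) hy
  have hη' : 1 / Real.log y * Real.log y = 1 := one_div_mul_cancel (by linarith)
  have hsh := hS f Λf hf y (1 / Real.log y) (1 / Real.log y) (by positivity) hη (by linarith) (by positivity)
  have hn0 : (0 : ℝ) < n := by exact_mod_cast hn
  unfold convTwist
  calc _ ≤ ∑ p ∈ n.divisorsAntidiagonal, vonMangoldt p.1 * (C₁ * (n : ℝ) ^ (1 / 40 : ℝ)) := by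
        refine Finset.sum_le_sum fun p hp => mul_le_mul_of_nonneg_left ?_ ArithmeticFunction.vonMangoldt_nonneg
        rw [Nat.mem_divisorsAntidiagonal] at hp
        have h2 : 0 < p.2 := Nat.pos_of_ne_zero fun h => hp.2 (by rw [← hp.1, h, mul_zero])
        refine (hsh.growth p.2 h2).trans ?_
        have : p.2 ≤ n := Nat.le_of_dvd hn ⟨p.1, by rw [mul_comm]; exact hp.1.symm⟩
        gcongr
    _ = Real.log n * (C₁ * (n : ℝ) ^ (1 / 40 : ℝ)) := by
        rw [← Finset.sum_mul, Nat.sum_divisorsAntidiagonal (fun d _ => vonMangoldt d), ArithmeticFunction.vonMangoldt_sum]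
    _ ≤ ((n : ℝ) ^ (1 / 40 : ℝ) / (1 / 40)) * (C₁ * (n : ℝ) ^ (1 / 40 : ℝ)) := by
        gcongr
        exact Real.log_le_rpow_div hn0.le (by norm_num)
    _ = 40 * C₁ * (n : ℝ) ^ (1 / 20 : ℝ) := by
        rw [show (1 / 20 : ℝ) = 1 / 40 + 1 / 40 by norm_num, Real.rpow_add hn0]; ring
    _ ≤ _ := by gcongr; linarith

lemma exists_sum_convTwist_div_log_le (hκ : 0 < κ) : ∃ C : ℝ, 0 < C ∧ ∀ f Λf : ℕ → ℂ, IsHalaszClass κ f Λf →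
    ∀ y : ℕ, 80 ≤ Real.log y → ∀ q a X : ℕ, 1 ≤ q → a.Coprime q → 16 ≤ X → q ^ 4 ≤ X →
    ∑ n ∈ (Finset.Icc 1 X).filter (fun n => n ≡ a [MOD q]), min 1 (1 / Real.log n) * convTwist f y n ≤
      C * (X / (q.totient * Real.log X) * Real.log y ^ κ) := by
  obtain ⟨C₁, hC₁, h₁⟩ := exists_sum_convTwist_modEq_le hκ
  obtain ⟨C₂, hC₂, h₂⟩ := exists_convTwist_le hκ
  refine ⟨100 * C₂ + 4 * C₁, by positivity, fun f Λf hf y hy q a X hq ha hX hqX => ?_⟩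
  have hq0 : (0 : ℝ) < q.totient := by exact_mod_cast Nat.totient_pos.2 hq
  have hX1 : (1 : ℝ) ≤ X := by exact_mod_cast (by omega : 1 ≤ X)
  have hX0 : (0 : ℝ) < X := by linarith
  have hR4 : 4 ≤ X.sqrt := Nat.le_sqrt.2 (by omega)
  have hlR := log_le_four_mul_log_sqrt hX
  have hl : 0 < Real.log X := Real.log_pos (by exact_mod_cast (by omega : 1 < X))
  have hpt : ∀ n ∈ (Finset.Icc 1 X).filter (fun n => n ≡ a [MOD q]), min 1 (1 / Real.log n) * convTwist f y n ≤
      (if n ≤ X.sqrt then C₂ * (X : ℝ) ^ (1 / 40 : ℝ) else 0) + 4 / Real.log X * convTwist f y n := by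
    intro n hn
    simp only [Finset.mem_filter, Finset.mem_Icc] at hn
    have hc := convTwist_nonneg f y n
    split_ifs with hns
    · calc _ ≤ 1 * convTwist f y n := by gcongr; exact min_le_left _ _
        _ ≤ C₂ * (n : ℝ) ^ (1 / 20 : ℝ) := by rw [one_mul]; exact h₂ f Λf hf y hy n hn.1.1
        _ ≤ C₂ * ((X : ℝ) ^ (1 / 2 : ℝ)) ^ (1 / 20 : ℝ) := by
            gcongr
            rw [← Real.sqrt_eq_rpow]
            exact (by exact_mod_cast hns : (n : ℝ) ≤ X.sqrt).trans Real.nat_sqrt_le_real_sqrt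
        _ = C₂ * (X : ℝ) ^ (1 / 40 : ℝ) := by rw [← Real.rpow_mul hX0.le]; norm_num
        _ ≤ _ := le_add_of_nonneg_right (by positivity)
    · rw [zero_add]
      gcongr
      refine (min_le_right _ _).trans ?_
      rw [div_le_div_iff₀ _ hl]
      · have : Real.log X.sqrt ≤ Real.log n :=
          Real.log_le_log (by exact_mod_cast (by omega : 0 < X.sqrt)) (by exact_mod_cast (by omega : X.sqrt ≤ n))
        linarith
      · exact Real.log_pos (by exact_mod_cast (by omega : 1 < n))
  refine (Finset.sum_le_sum hpt).trans ?_
  rw [Finset.sum_add_distrib, ← Finset.mul_sum]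
  have hb1 : ∑ n ∈ (Finset.Icc 1 X).filter (fun n => n ≡ a [MOD q]),
      (if n ≤ X.sqrt then C₂ * (X : ℝ) ^ (1 / 40 : ℝ) else 0) ≤
      100 * C₂ * (X / (q.totient * Real.log X) * Real.log y ^ κ) := by
    have hφ : (q.totient : ℝ) ≤ (X : ℝ) ^ (1 / 4 : ℝ) := by
      have h1 : (q : ℝ) ^ 4 ≤ X := by exact_mod_cast hqX
      have h2 : (q.totient : ℝ) ≤ q := by exact_mod_cast Nat.totient_le q
      have h3 : (q : ℝ) = ((q : ℝ) ^ 4) ^ (1 / 4 : ℝ) := by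
        rw [← Real.rpow_natCast, ← Real.rpow_mul (by positivity)]; norm_num
      rw [h3] at h2
      exact h2.trans (by gcongr)
    have hlX : Real.log X ≤ 10 * (X : ℝ) ^ (1 / 10 : ℝ) := by
      have := Real.log_le_rpow_div hX0.le (ε := 1 / 10) (by norm_num)
      linarith
    have hly : 1 ≤ Real.log y ^ κ := Real.one_le_rpow (by linarith) hκ.le
    calc _ ≤ ∑ n ∈ Finset.Icc 1 X.sqrt, C₂ * (X : ℝ) ^ (1 / 40 : ℝ) := by
          rw [← Finset.sum_filter]
          refine Finset.sum_le_sum_of_subset_of_nonneg (fun n hn => ?_) fun _ _ _ => by positivity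
          simp only [Finset.mem_filter, Finset.mem_Icc] at hn ⊢
          exact ⟨hn.1.1.1, hn.2⟩
      _ = X.sqrt * (C₂ * (X : ℝ) ^ (1 / 40 : ℝ)) := by simp
      _ ≤ (X : ℝ) ^ (1 / 2 : ℝ) * (C₂ * (X : ℝ) ^ (1 / 40 : ℝ)) := by
          gcongr
          rw [← Real.sqrt_eq_rpow]
          exact Real.nat_sqrt_le_real_sqrt
      _ = C₂ * (X / ((X : ℝ) ^ (1 / 4 : ℝ) * (X : ℝ) ^ (9 / 40 : ℝ))) := by
          rw [← Real.rpow_add hX0]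
          nth_rewrite 3 [← Real.rpow_one (X : ℝ)]
          rw [← Real.rpow_sub hX0, mul_left_comm, ← Real.rpow_add hX0]; norm_num
      _ ≤ C₂ * (X / (q.totient * (Real.log X / 10))) := by
          gcongr
          have : (X : ℝ) ^ (1 / 10 : ℝ) ≤ (X : ℝ) ^ (9 / 40 : ℝ) :=
            Real.rpow_le_rpow_of_exponent_le hX1 (by norm_num)
          linarith
      _ = 10 * C₂ * (X / (q.totient * Real.log X) * 1) := by field_simp
      _ ≤ _ := by gcongr; norm_num
  have hb2 := h₁ f Λf hf y hy q a X hq ha hX hqX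
  calc _ ≤ 100 * C₂ * (X / (q.totient * Real.log X) * Real.log y ^ κ) +
        4 / Real.log X * (C₁ * (X / q.totient * Real.log y ^ κ)) := by gcongr
    _ = _ := by field_simp

end Convolution
section Decomposition

open ArithmeticFunction (vonMangoldt)

variable {κ : ℝ} {f Λf : ℕ → ℂ}

/-- The restriction of `Λf` to integers without prime factors `≤ y`. -/
def largePart (Λf : ℕ → ℂ) (y d : ℕ) : ℂ := if y < d.minFac then Λf d else 0

lemma largePart_ne_zero (hf : IsHalaszClass κ f Λf) {y d : ℕ} (h : largePart Λf y d ≠ 0) :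
    ∃ p k : ℕ, p.Prime ∧ y < p ∧ 0 < k ∧ d = p ^ k := by
  unfold largePart at h
  split_ifs at h with hy
  · have hpp : IsPrimePow d := by by_contra h'; exact h (hf.supp d h')
    obtain ⟨p, k, hp, hk, rfl⟩ := hpp
    rw [hp.nat_prime.pow_minFac hk.ne'] at hy
    exact ⟨p, k, hp.nat_prime, hy, hk, rfl⟩
  · exact absurd rfl h

lemma norm_largePart_le (hκ : 0 < κ) (hf : IsHalaszClass κ f Λf) (y : ℕ) {d : ℕ} (hd : 1 ≤ d) :
    ‖largePart Λf y d‖ ≤ κ * vonMangoldt d := by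
  unfold largePart
  split_ifs
  · exact hf.bound d hd
  · rw [norm_zero]; exact mul_nonneg hκ.le ArithmeticFunction.vonMangoldt_nonneg

lemma rough_mul_of_largePart_ne_zero (hf : IsHalaszClass κ f Λf) {y d m : ℕ} (h : largePart Λf y d ≠ 0)
    (hm : m ≠ 0) : rough y (d * m) = d * rough y m := by
  obtain ⟨p, k, hp, hyp, hk, rfl⟩ := largePart_ne_zero hf h
  rw [rough_mul y (Nat.pow_pos hp.pos).ne' hm, rough_prime_pow hp, if_pos hyp]

lemma mul_log_rough_eq (hf : IsHalaszClass κ f Λf) (y : ℕ) {n : ℕ} (hn : 1 ≤ n) :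
    f n * (Real.log (rough y n) : ℂ) = ∑ p ∈ n.divisorsAntidiagonal, largePart Λf y p.1 * f p.2 := by
  have hn0 : n ≠ 0 := by omega
  set r := rough y n with hr
  set s := smooth y n with hs
  have hsr : s * r = n := smooth_mul_rough y hn0
  have hcop : Nat.Coprime s r := coprime_smooth_rough ..
  have hr0 : 0 < r := rough_pos y n
  have hs0 : 0 < s := smooth_pos y n
  have h1 : f n = f s * f r := by rw [← hsr, hf.mult s r hcop]
  rw [h1, mul_assoc, hf.conv r hr0, Nat.sum_divisorsAntidiagonal (fun d m => largePart Λf y d * f m), Finset.mul_sum]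
  have hsub : r.divisors ⊆ n.divisors := Nat.divisors_subset_of_dvd hn0 ⟨s, by rw [mul_comm]; exact hsr.symm⟩
  symm
  rw [← Finset.sum_subset hsub]
  · refine Finset.sum_congr rfl fun d hd => ?_
    have hdr := Nat.dvd_of_mem_divisors hd
    have hd0 : 0 < d := Nat.pos_of_dvd_of_pos hdr hr0
    have h2 : n / d = s * (r / d) := by rw [← hsr, Nat.mul_div_assoc _ hdr]
    have h3 : largePart Λf y d = Λf d := by
      unfold largePart
      split_ifs with h
      · rfl
      · by_cases hd1 : d = 1
        · rw [hd1, hf.supp 1 (by simpa using not_isPrimePow_one)]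
        · exact absurd (lt_of_dvd_rough (Nat.minFac_prime hd1) ((Nat.minFac_dvd d).trans hdr)) h
    rw [h2, h3, hf.mult s (r / d) (Nat.Coprime.coprime_dvd_right (Nat.div_dvd_of_dvd hdr) hcop)]
    ring
  · intro d hd hdr
    by_contra hne
    have hl : largePart Λf y d ≠ 0 := fun h => hne (by rw [h, zero_mul])
    obtain ⟨p, k, hp, hyp, hk, rfl⟩ := largePart_ne_zero hf hl
    refine hdr (Nat.mem_divisors.2 ⟨?_, hr0.ne'⟩)
    have hdn := Nat.dvd_of_mem_divisors hd
    rw [← hsr] at hdn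
    refine Nat.Coprime.dvd_of_dvd_mul_left ?_ hdn
    refine Nat.Coprime.pow_left k ((Nat.Prime.coprime_iff_not_dvd hp).2 fun hps => ?_)
    exact absurd (le_of_dvd_smooth hp hps) (by omega)

lemma continuous_rpow_neg_add {n : ℕ} (hn : n ≠ 0) (γ : ℝ) :
    Continuous fun α : ℝ => (((n : ℝ) ^ (-(γ + α)) : ℝ) : ℂ) := by
  have : Continuous fun α : ℝ => (n : ℝ) ^ (-(γ + α)) :=
    Continuous.rpow continuous_const (by fun_prop) fun _ => Or.inl (by exact_mod_cast hn)
  exact Complex.continuous_ofReal.comp this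

lemma ne_zero_of_mem_divisorsAntidiagonal {n : ℕ} {p : ℕ × ℕ} (hp : p ∈ n.divisorsAntidiagonal) :
    p.1 ≠ 0 ∧ p.2 ≠ 0 := by
  rw [Nat.mem_divisorsAntidiagonal] at hp
  constructor <;> rintro h <;> exact hp.2 (by rw [← hp.1, h]; simp)

/-- One application of the logarithmic convolution identity, weighted by powers of the rough part. -/
def roughConv (f Λf : ℕ → ℂ) (y n : ℕ) (γ γ' : ℝ) : ℂ :=
  ∑ p ∈ n.divisorsAntidiagonal, largePart Λf y p.1 * ((p.1 : ℝ) ^ (-γ) : ℝ) *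
    (f p.2 * ((rough y p.2 : ℝ) ^ (-γ') : ℝ))

lemma roughConv_self (hf : IsHalaszClass κ f Λf) (y : ℕ) {n : ℕ} (hn : 1 ≤ n) (γ : ℝ) :
    roughConv f Λf y n γ γ = f n * ((Real.log (rough y n) * (rough y n : ℝ) ^ (-γ) : ℝ) : ℂ) := by
  rw [Complex.ofReal_mul, ← mul_assoc, mul_log_rough_eq hf y hn, Finset.sum_mul]
  refine Finset.sum_congr rfl fun p hp => ?_
  by_cases hl : largePart Λf y p.1 = 0
  · simp [hl]
  have h0 := ne_zero_of_mem_divisorsAntidiagonal hp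
  rw [← (Nat.mem_divisorsAntidiagonal.1 hp).1, rough_mul_of_largePart_ne_zero hf hl h0.2]
  push_cast
  rw [Real.mul_rpow (by positivity) (by positivity)]
  push_cast
  ring

lemma integral_log_mul_rpow {r : ℝ} (hr : 0 < r) (γ η : ℝ) :
    ∫ α in (0 : ℝ)..η, Real.log r * r ^ (-(γ + α)) = r ^ (-γ) - r ^ (-(γ + η)) := by
  have hd : ∀ α : ℝ, HasDerivAt (fun α : ℝ => -(r ^ (-(γ + α)))) (Real.log r * r ^ (-(γ + α))) α := by
    intro α
    have h1 : HasDerivAt (fun α : ℝ => -(γ + α)) (-1) α := ((hasDerivAt_id α).const_add γ).neg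
    have h2 := (h1.const_rpow hr).neg
    exact h2.congr_deriv (by ring)
  rw [intervalIntegral.integral_eq_sub_of_hasDerivAt fun α _ => hd α]
  · simp; ring
  · refine Continuous.intervalIntegrable ?_ _ _
    exact continuous_const.mul (Continuous.rpow continuous_const (by fun_prop) fun _ => Or.inl hr.ne')

lemma mul_rough_rpow_eq (hf : IsHalaszClass κ f Λf) (y : ℕ) {n : ℕ} (hn : 1 ≤ n) (γ η : ℝ) :
    f n * ((rough y n : ℝ) ^ (-γ) : ℝ) = f n * ((rough y n : ℝ) ^ (-(γ + η)) : ℝ) +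
      ∫ α in (0 : ℝ)..η, roughConv f Λf y n (γ + α) (γ + α) := by
  simp_rw [roughConv_self hf y hn]
  rw [intervalIntegral.integral_const_mul, intervalIntegral.integral_ofReal,
    integral_log_mul_rpow (by exact_mod_cast rough_pos y n), Complex.ofReal_sub]
  ring

lemma continuous_roughConv (f Λf : ℕ → ℂ) (y n : ℕ) (γ γ' : ℝ) :
    Continuous fun α : ℝ => roughConv f Λf y n (γ + α) (γ' + α) := by
  unfold roughConv
  refine continuous_finsetSum _ fun p hp => ?_
  have h0 := ne_zero_of_mem_divisorsAntidiagonal hp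
  exact (continuous_const.mul (continuous_rpow_neg_add h0.1 γ)).mul
    (continuous_const.mul (continuous_rpow_neg_add (rough_pos y p.2).ne' γ'))

/-- The bilinear main term. -/
def bilinear (f Λf : ℕ → ℂ) (y : ℕ) (w : ℕ → ℝ) (S : Finset ℕ) (α β : ℝ) : ℂ :=
  ∑ n ∈ S, (w n : ℂ) * ∑ p ∈ n.divisorsAntidiagonal, largePart Λf y p.1 * ((p.1 : ℝ) ^ (-α) : ℝ) *
    roughConv f Λf y p.2 (α + β) (α + β)

lemma sum_weight_eq (hf : IsHalaszClass κ f Λf) (y : ℕ) (w : ℕ → ℝ) {S : Finset ℕ} (hS : ∀ n ∈ S, 1 ≤ n) (η : ℝ) :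
    ∑ n ∈ S, (w n : ℂ) * f n = ∑ n ∈ S, (w n : ℂ) * (f n * ((rough y n : ℝ) ^ (-η) : ℝ)) +
      ∑ n ∈ S, (w n : ℂ) * (∫ α in (0 : ℝ)..η, roughConv f Λf y n α (η + α)) +
      ∫ α in (0 : ℝ)..η, ∫ β in (0 : ℝ)..η, bilinear f Λf y w S α β := by
  set J : ℕ → ℝ → ℂ := fun m α => ∫ β in (0 : ℝ)..η, roughConv f Λf y m (α + β) (α + β) with hJ
  have hJe : ∀ m, 1 ≤ m → ∀ α, J m α = f m * ((rough y m : ℝ) ^ (-(0 + α)) : ℝ) -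
      f m * ((rough y m : ℝ) ^ (-(η + α)) : ℝ) := fun m hm α => by
    have := mul_rough_rpow_eq hf y hm α η
    rw [zero_add, this, add_comm η α]; ring
  have hJc : ∀ m, 1 ≤ m → Continuous (J m) := fun m hm => by
    rw [funext (hJe m hm)]
    have h0 := (rough_pos y m).ne'
    exact (continuous_const.mul (continuous_rpow_neg_add h0 0)).sub (continuous_const.mul (continuous_rpow_neg_add h0 η))
  have hT : ∀ α, ∫ β in (0 : ℝ)..η, bilinear f Λf y w S α β = ∑ n ∈ S, (w n : ℂ) * ∑ p ∈ n.divisorsAntidiagonal,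
      largePart Λf y p.1 * ((p.1 : ℝ) ^ (-α) : ℝ) * J p.2 α := by
    intro α
    unfold bilinear
    have hc : ∀ m, Continuous fun β => roughConv f Λf y m (α + β) (α + β) := fun m => continuous_roughConv f Λf y m α α
    rw [intervalIntegral.integral_finsetSum]
    · refine Finset.sum_congr rfl fun n _ => ?_
      rw [intervalIntegral.integral_const_mul, intervalIntegral.integral_finsetSum]
      · simp_rw [intervalIntegral.integral_const_mul, hJ]
      · exact fun p _ => (continuous_const.mul (hc p.2)).intervalIntegrable _ _
    · exact fun n _ => Continuous.intervalIntegrable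
        (continuous_const.mul (continuous_finsetSum _ fun p _ => continuous_const.mul (hc p.2))) _ _
  have hcp : ∀ n : ℕ, ∀ p ∈ n.divisorsAntidiagonal, Continuous fun α : ℝ =>
      largePart Λf y p.1 * ((p.1 : ℝ) ^ (-α) : ℝ) * J p.2 α := fun n p hp => by
    have h0 := ne_zero_of_mem_divisorsAntidiagonal hp
    have h1 := continuous_rpow_neg_add h0.1 0
    simp only [zero_add] at h1
    exact (continuous_const.mul h1).mul (hJc p.2 (by omega))
  simp_rw [hT]
  have hcs : ∀ n : ℕ, Continuous fun α : ℝ => ∑ p ∈ n.divisorsAntidiagonal,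
      largePart Λf y p.1 * ((p.1 : ℝ) ^ (-α) : ℝ) * J p.2 α := fun n => continuous_finsetSum _ fun p hp => hcp n p hp
  rw [intervalIntegral.integral_finsetSum fun n _ => Continuous.intervalIntegrable
      (u := fun α => (w n : ℂ) * ∑ p ∈ n.divisorsAntidiagonal, largePart Λf y p.1 * ((p.1 : ℝ) ^ (-α) : ℝ) * J p.2 α)
      (continuous_const.mul (hcs n)) _ _, ← Finset.sum_add_distrib, ← Finset.sum_add_distrib]
  refine Finset.sum_congr rfl fun n hn => ?_
  rw [intervalIntegral.integral_const_mul, ← mul_add, ← mul_add]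
  congr 1
  have h1 := mul_rough_rpow_eq hf y (hS n hn) 0 η
  rw [neg_zero, Real.rpow_zero, ofReal_one, mul_one, zero_add] at h1
  refine h1.trans ?_
  rw [add_assoc]
  congr 1
  have hc2 := continuous_roughConv f Λf y n 0 η
  simp only [zero_add] at hc2 ⊢
  rw [← intervalIntegral.integral_add (hc2.intervalIntegrable _ _)
    ((hcs n).intervalIntegrable _ _)]
  congr 1
  ext α
  unfold roughConv
  rw [← Finset.sum_add_distrib]
  refine Finset.sum_congr rfl fun p hp => ?_
  rw [hJe p.2 (by have := ne_zero_of_mem_divisorsAntidiagonal hp; omega), zero_add]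
  ring

lemma norm_sum_twist_rough_le (f : ℕ → ℂ) (y : ℕ) {w : ℕ → ℝ} (hw0 : ∀ n, 0 ≤ w n) (hw1 : ∀ n, w n ≤ 1) (S : Finset ℕ)
    {η : ℝ} (hη : 0 ≤ η) :
    ‖∑ n ∈ S, (w n : ℂ) * (f n * ((rough y n : ℝ) ^ (-η) : ℝ))‖ ≤ ∑ n ∈ S, twist f y η η n := by
  refine norm_sum_le_of_le _ fun n _ => ?_
  unfold twist
  rw [norm_mul, norm_mul, Complex.norm_real, Complex.norm_real, Real.norm_of_nonneg (hw0 n),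
    Real.norm_of_nonneg (by positivity)]
  have h1 : (1 : ℝ) ≤ (smooth y n : ℝ) ^ η := Real.one_le_rpow (by exact_mod_cast smooth_pos y n) hη
  calc _ ≤ 1 * (‖f n‖ * (1 * (rough y n : ℝ) ^ (-η))) :=
        mul_le_mul (hw1 n) (by rw [one_mul]) (by positivity) zero_le_one
    _ ≤ _ := by rw [one_mul]; gcongr

lemma integral_rpow_neg_le {n : ℕ} (hn : 1 ≤ n) {η : ℝ} (hη : 0 ≤ η) (hη1 : η ≤ 1) (hn1 : n ≠ 1) :
    ∫ α in (0 : ℝ)..η, (n : ℝ) ^ (-α) ≤ min 1 (1 / Real.log n) := by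
  have hn0 : (0 : ℝ) < n := by exact_mod_cast hn
  have hc : Continuous fun α : ℝ => (n : ℝ) ^ (-α) :=
    Continuous.rpow continuous_const (by fun_prop) fun _ => Or.inl hn0.ne'
  refine le_min ?_ ?_
  · calc _ ≤ ∫ α in (0 : ℝ)..η, (1 : ℝ) := by
          refine intervalIntegral.integral_mono_on hη (hc.intervalIntegrable _ _) (by simp) fun α hα => ?_
          exact Real.rpow_le_one_of_one_le_of_nonpos (by exact_mod_cast hn) (by linarith [hα.1])
      _ ≤ 1 := by simpa using hη1
  · have hl : 0 < Real.log n := Real.log_pos (by exact_mod_cast (by omega : 1 < n))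
    rw [le_div_iff₀ hl, ← intervalIntegral.integral_mul_const]
    have := integral_log_mul_rpow hn0 0 η
    simp only [zero_add, neg_zero, Real.rpow_zero] at this
    simp_rw [mul_comm _ (Real.log n)]
    rw [this]
    linarith [Real.rpow_nonneg hn0.le (-η)]

lemma norm_roughConv_le (hκ : 0 < κ) (hf : IsHalaszClass κ f Λf) {y n : ℕ} {α : ℝ} (hαη : α ≤ 1 / Real.log y) :
    ‖roughConv f Λf y n α (1 / Real.log y + α)‖ ≤ κ * convTwist f y n * (n : ℝ) ^ (-α) := by
  unfold roughConv convTwist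
  rw [mul_assoc, Finset.sum_mul, Finset.mul_sum]
  refine norm_sum_le_of_le _ fun p hp => ?_
  have h0 := ne_zero_of_mem_divisorsAntidiagonal hp
  by_cases hl : largePart Λf y p.1 = 0
  · rw [hl, zero_mul, zero_mul, norm_zero]
    exact mul_nonneg hκ.le (mul_nonneg (mul_nonneg ArithmeticFunction.vonMangoldt_nonneg (twist_nonneg ..)) (by positivity))
  have hn' := (Nat.mem_divisorsAntidiagonal.1 hp).1
  have hr := rough_mul_of_largePart_ne_zero hf hl h0.2
  have hs := smooth_mul_rough y h0.2
  rw [norm_mul, norm_mul, norm_mul, Complex.norm_real, Complex.norm_real, Real.norm_of_nonneg (by positivity),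
    Real.norm_of_nonneg (by positivity)]
  have hp1 : (0 : ℝ) < p.1 := by exact_mod_cast Nat.pos_of_ne_zero h0.1
  have hrp : (0 : ℝ) < rough y p.2 := by exact_mod_cast rough_pos y p.2
  have hsp : (1 : ℝ) ≤ smooth y p.2 := by exact_mod_cast smooth_pos y p.2
  have hsp0 : (0 : ℝ) < smooth y p.2 := by linarith
  have hnn : (n : ℝ) ^ (-α) = (p.1 : ℝ) ^ (-α) * ((smooth y p.2 : ℝ) ^ (-α) * (rough y p.2 : ℝ) ^ (-α)) := by
    rw [← Real.mul_rpow hsp0.le hrp.le, ← Real.mul_rpow hp1.le (by positivity), ← hn']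
    congr 1
    exact_mod_cast congrArg (p.1 * ·) hs.symm
  have h1 : 1 ≤ (smooth y p.2 : ℝ) ^ (1 / Real.log y) * (smooth y p.2 : ℝ) ^ (-α) := by
    rw [← Real.rpow_add hsp0]
    exact Real.one_le_rpow hsp (by linarith)
  have h2 := norm_largePart_le hκ hf y (Nat.pos_of_ne_zero h0.1)
  have h3 : (rough y p.2 : ℝ) ^ (-(1 / Real.log y + α)) =
      (rough y p.2 : ℝ) ^ (-(1 / Real.log y)) * (rough y p.2 : ℝ) ^ (-α) := by
    rw [← Real.rpow_add hrp]; ring_nf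
  have h4 : 0 ≤ κ * vonMangoldt p.1 := mul_nonneg hκ.le ArithmeticFunction.vonMangoldt_nonneg
  calc _ ≤ κ * vonMangoldt p.1 * (p.1 : ℝ) ^ (-α) * (‖f p.2‖ * (1 * (rough y p.2 : ℝ) ^ (-(1 / Real.log y + α)))) := by
        rw [one_mul]; gcongr
    _ ≤ κ * vonMangoldt p.1 * (p.1 : ℝ) ^ (-α) * (‖f p.2‖ * (((smooth y p.2 : ℝ) ^ (1 / Real.log y) *
          (smooth y p.2 : ℝ) ^ (-α)) * (rough y p.2 : ℝ) ^ (-(1 / Real.log y + α)))) := by gcongr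
    _ = _ := by rw [hnn, h3]; unfold twist; ring

lemma norm_sum_integral_roughConv_le (hκ : 0 < κ) (hf : IsHalaszClass κ f Λf) {y : ℕ} (hy : 1 ≤ Real.log y)
    {w : ℕ → ℝ} (hw0 : ∀ n, 0 ≤ w n) (hw1 : ∀ n, w n ≤ 1) {S : Finset ℕ} (hS : ∀ n ∈ S, 1 ≤ n) :
    ‖∑ n ∈ S, (w n : ℂ) * (∫ α in (0 : ℝ)..(1 / Real.log y), roughConv f Λf y n α (1 / Real.log y + α))‖ ≤
      κ * ∑ n ∈ S, min 1 (1 / Real.log n) * convTwist f y n := by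
  rw [Finset.mul_sum]
  refine norm_sum_le_of_le _ fun n hn => ?_
  have hη0 : 0 ≤ 1 / Real.log y := by positivity
  have hη1 : 1 / Real.log y ≤ 1 := by rw [div_le_one (by linarith)]; exact hy
  have hn1 := hS n hn
  have hn0 : (0 : ℝ) < n := by exact_mod_cast hn1
  have hc0 := convTwist_nonneg f y n
  have hc : Continuous fun α : ℝ => (n : ℝ) ^ (-α) :=
    Continuous.rpow continuous_const (by fun_prop) fun _ => Or.inl hn0.ne'
  rw [norm_mul, Complex.norm_real, Real.norm_of_nonneg (hw0 n)]
  have h1 : ‖∫ α in (0 : ℝ)..(1 / Real.log y), roughConv f Λf y n α (1 / Real.log y + α)‖ ≤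
      κ * convTwist f y n * ∫ α in (0 : ℝ)..(1 / Real.log y), (n : ℝ) ^ (-α) := by
    rw [← intervalIntegral.integral_const_mul]
    refine intervalIntegral.norm_integral_le_of_norm_le hη0 (ae_of_all _ fun α hα => ?_)
      ((continuous_const.mul hc).intervalIntegrable _ _)
    exact norm_roughConv_le hκ hf hα.2
  by_cases hn2 : n = 1
  · have h0 : convTwist f y n = 0 := by subst hn2; simp [convTwist]
    rw [h0] at h1 ⊢
    rw [mul_zero, zero_mul] at h1
    rw [le_antisymm h1 (norm_nonneg _)]; simp
  · calc _ ≤ 1 * (κ * convTwist f y n * min 1 (1 / Real.log n)) := by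
          gcongr
          · exact hw1 n
          · refine h1.trans ?_
            gcongr
            exact integral_rpow_neg_le hn1 hη0 hη1 hn2
      _ = _ := by ring

end Decomposition
section Smoothing

open ArithmeticFunction (vonMangoldt)

variable {κ : ℝ} {f Λf : ℕ → ℂ}

/-- A piecewise logarithmic weight, equal to `1` when `log n ≤ L` and to `0` when `log n ≥ L + δ`. -/
def weight (L δ : ℝ) (n : ℕ) : ℝ := (max (L + δ - Real.log n) 0 - max (L - Real.log n) 0) / δ

lemma weight_nonneg (L : ℝ) {δ : ℝ} (hδ : 0 < δ) (n : ℕ) : 0 ≤ weight L δ n :=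
  div_nonneg (sub_nonneg.2 (max_le_max (by linarith) le_rfl)) hδ.le

lemma weight_le_one (L : ℝ) {δ : ℝ} (hδ : 0 < δ) (n : ℕ) : weight L δ n ≤ 1 := by
  unfold weight
  rw [div_le_one hδ, sub_le_iff_le_add]
  refine max_le ?_ (by positivity)
  linarith [le_max_left (L - Real.log n) 0]

lemma weight_eq_one {L δ : ℝ} (hδ : 0 < δ) {n : ℕ} (h : Real.log n ≤ L) : weight L δ n = 1 := by
  unfold weight
  rw [max_eq_left (by linarith), max_eq_left (by linarith)]
  field_simp
  ring

lemma weight_eq_zero {L δ : ℝ} (hδ : 0 < δ) {n : ℕ} (h : L + δ ≤ Real.log n) : weight L δ n = 0 := by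
  unfold weight
  rw [max_eq_right (by linarith), max_eq_right (by linarith)]
  simp

lemma exists_log_large (κ : ℝ) : ∃ C : ℝ, 0 < C ∧ ∀ x : ℝ, C ≤ x →
    Real.exp 54 ≤ Real.log x ∧ 8 * Real.log x ^ κ ≤ x ^ (1 / 8 : ℝ) := by
  have h1 := Real.tendsto_log_atTop.eventually_ge_atTop (Real.exp 54)
  have h2 := (isLittleO_log_rpow_rpow_atTop κ (s := 1 / 8) (by norm_num)).bound (c := 1 / 8) (by norm_num)
  obtain ⟨C, hC⟩ := Filter.eventually_atTop.1 (h1.and h2)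
  refine ⟨max C 1, by positivity, fun x hx => ?_⟩
  obtain ⟨h3, h4⟩ := hC x ((le_max_left _ _).trans hx)
  have hx1 : 1 ≤ x := (le_max_right _ _).trans hx
  refine ⟨h3, ?_⟩
  have hl : 0 ≤ Real.log x := Real.log_nonneg hx1
  rw [Real.norm_of_nonneg (by positivity), Real.norm_of_nonneg (by positivity)] at h4
  linarith

/-- The smoothness threshold. -/
def thr (κ : ℝ) (q : ℕ) (L : ℝ) : ℕ := ⌈((q : ℝ) * L) ^ (2 * κ + 3)⌉₊

lemma log_thr_bounds (hκ : 0 < κ) {q : ℕ} (hq : 1 ≤ q) {L : ℝ} (hL : Real.exp 54 ≤ L) :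
    160 ≤ Real.log (thr κ q L) ∧ Real.log (thr κ q L) ≤ (2 * κ + 4) * Real.log (q * L) ∧
      54 ≤ Real.log (q * L) := by
  have hL0 : 0 < L := (Real.exp_pos _).trans_le hL
  have hq1 : (1 : ℝ) ≤ q := by exact_mod_cast hq
  have hqL : Real.exp 54 ≤ q * L := hL.trans (le_mul_of_one_le_left hL0.le hq1)
  have hqL0 : 0 < (q : ℝ) * L := by positivity
  have hl : 54 ≤ Real.log (q * L) := (Real.le_log_iff_exp_le hqL0).2 hqL
  have h1 : ((q : ℝ) * L) ^ (2 * κ + 3) ≤ thr κ q L := Nat.le_ceil _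
  have hp : 0 < ((q : ℝ) * L) ^ (2 * κ + 3) := by positivity
  have hle := Real.log_le_log hp h1
  rw [Real.log_rpow hqL0] at hle
  refine ⟨by nlinarith, ?_, hl⟩
  have h2 : (thr κ q L : ℝ) ≤ ((q : ℝ) * L) ^ (2 * κ + 3) * (q * L) := by
    have h3 : (thr κ q L : ℝ) < ((q : ℝ) * L) ^ (2 * κ + 3) + 1 := Nat.ceil_lt_add_one hp.le
    have h5 : 2 ≤ (q : ℝ) * L := by linarith [Real.add_one_le_exp (54 : ℝ)]
    have h4 : 1 ≤ ((q : ℝ) * L) ^ (2 * κ + 3) := Real.one_le_rpow (by linarith) (by linarith)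
    nlinarith
  have h3 := Real.log_le_log (hp.trans_le h1) h2
  rw [Real.log_mul hp.ne' hqL0.ne', Real.log_rpow hqL0] at h3
  linarith

/-- The integers in the progression over which the smoothed sum extends. -/
def progr (q a : ℕ) (x δ : ℝ) : Finset ℕ :=
  (Finset.Icc 1 ⌊x * Real.exp δ⌋₊).filter (fun n => n ≡ a [MOD q])

lemma norm_sum_le_norm_sum_weight (f : ℕ → ℂ) (q a : ℕ) {x δ : ℝ} (hx0 : 0 < x) (hδ0 : 0 < δ) :
    ‖∑ n ∈ (Finset.Icc 1 ⌊x⌋₊).filter (fun n => n ≡ a [MOD q]), f n‖ ≤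
      ‖∑ n ∈ progr q a x δ, (weight (Real.log x) δ n : ℂ) * f n‖ +
        ∑ n ∈ (Finset.Ioc ⌊x⌋₊ (⌊x⌋₊ + (⌊x * Real.exp δ⌋₊ - ⌊x⌋₊))).filter (fun n => n ≡ a [MOD q]), ‖f n‖ := by
  set L := Real.log x
  set X := ⌊x * Real.exp δ⌋₊ with hX
  have hfX : ⌊x⌋₊ ≤ X := Nat.floor_le_floor (le_mul_of_one_le_right hx0.le (Real.one_le_exp hδ0.le))
  have hx1X : (⌊x⌋₊ : ℝ) ≤ x := Nat.floor_le hx0.le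
  have hsplit : ∑ n ∈ progr q a x δ, (weight L δ n : ℂ) * f n =
      ∑ n ∈ (Finset.Icc 1 ⌊x⌋₊).filter (fun n => n ≡ a [MOD q]), f n +
      ∑ n ∈ (Finset.Ioc ⌊x⌋₊ X).filter (fun n => n ≡ a [MOD q]), (weight L δ n : ℂ) * f n := by
    have hun : progr q a x δ = (Finset.Icc 1 ⌊x⌋₊).filter (fun n => n ≡ a [MOD q]) ∪
        (Finset.Ioc ⌊x⌋₊ X).filter (fun n => n ≡ a [MOD q]) := by
      ext n
      simp only [progr, Finset.mem_union, Finset.mem_filter, Finset.mem_Icc, Finset.mem_Ioc, ← hX]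
      constructor
      · rintro ⟨⟨h1, h2⟩, h3⟩
        rcases le_or_gt n ⌊x⌋₊ with h | h
        · exact Or.inl ⟨⟨h1, h⟩, h3⟩
        · exact Or.inr ⟨⟨h, h2⟩, h3⟩
      · rintro (⟨⟨h1, h2⟩, h3⟩ | ⟨⟨h1, h2⟩, h3⟩)
        · exact ⟨⟨h1, by omega⟩, h3⟩
        · exact ⟨⟨by omega, h2⟩, h3⟩
    rw [hun, Finset.sum_union]
    · congr 1
      refine Finset.sum_congr rfl fun n hn => ?_
      simp only [Finset.mem_filter, Finset.mem_Icc] at hn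
      have hn0 : (0 : ℝ) < n := by exact_mod_cast hn.1.1
      rw [weight_eq_one hδ0, ofReal_one, one_mul]
      exact Real.log_le_log hn0 (le_trans (by exact_mod_cast hn.1.2) hx1X)
    · rw [Finset.disjoint_left]
      intro n hn hn'
      simp only [Finset.mem_filter, Finset.mem_Icc, Finset.mem_Ioc] at hn hn'
      omega
  rw [Nat.add_sub_cancel' hfX]
  have h1 : ‖∑ n ∈ (Finset.Ioc ⌊x⌋₊ X).filter (fun n => n ≡ a [MOD q]), (weight L δ n : ℂ) * f n‖ ≤
      ∑ n ∈ (Finset.Ioc ⌊x⌋₊ X).filter (fun n => n ≡ a [MOD q]), ‖f n‖ := by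
    refine norm_sum_le_of_le _ fun n _ => ?_
    rw [norm_mul, Complex.norm_real, Real.norm_of_nonneg (weight_nonneg L hδ0 n)]
    exact mul_le_of_le_one_left (norm_nonneg _) (weight_le_one L hδ0 n)
  rw [← sub_eq_iff_eq_add] at hsplit
  rw [← hsplit]
  exact (norm_sub_le _ _).trans (by gcongr)

set_option maxHeartbeats 1000000 in
lemma exists_norm_sum_le_bilinear (hκ : 0 < κ) : ∃ C : ℝ, 0 < C ∧ ∀ f Λf : ℕ → ℂ, IsHalaszClass κ f Λf →
    ∀ q a : ℕ, 1 ≤ q → a.Coprime q → ∀ x : ℝ, (q : ℝ) ^ 4 ≤ x → Real.exp 54 ≤ Real.log x →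
    8 * Real.log x ^ κ ≤ x ^ (1 / 8 : ℝ) → ∀ η : ℝ, η = 1 / Real.log (thr κ q (Real.log x)) →
    ‖∑ n ∈ (Finset.Icc 1 ⌊x⌋₊).filter (fun n => n ≡ a [MOD q]), f n‖ ≤
      C * (1 / q.totient * (x / Real.log x) * Real.log (q * Real.log x) ^ κ) +
      ‖∫ α in (0 : ℝ)..η, ∫ β in (0 : ℝ)..η, bilinear f Λf (thr κ q (Real.log x))
        (weight (Real.log x) (1 / Real.log x ^ κ)) (progr q a x (1 / Real.log x ^ κ)) α β‖ := by
  obtain ⟨C₁, hC₁, h₁⟩ := exists_sum_twist_modEq_le hκ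
  obtain ⟨C₂, hC₂, h₂⟩ := exists_sum_convTwist_div_log_le hκ
  obtain ⟨C₃, hC₃, h₃⟩ := exists_sum_norm_modEq_le hκ
  refine ⟨3 * (C₁ + κ * C₂) * (2 * κ + 4) ^ κ + C₃ * 3 * 2 ^ κ, by positivity, ?_⟩
  rintro f Λf hf q a hq ha x hqx hL hLκ η rfl
  obtain ⟨hy, hy', hlq⟩ := log_thr_bounds hκ hq hL
  set y := thr κ q (Real.log x) with hyd
  set L := Real.log x with hLd
  set δ := 1 / L ^ κ with hδ
  set X := ⌊x * Real.exp δ⌋₊ with hX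
  have hL28 : 28 ≤ L := by linarith [Real.add_one_le_exp (54 : ℝ)]
  have hq1 : (1 : ℝ) ≤ q := by exact_mod_cast hq
  have hq0 : (0 : ℝ) < q.totient := by exact_mod_cast Nat.totient_pos.2 hq
  have hx1 : 1 ≤ x := le_trans (one_le_pow₀ hq1) hqx
  have hx0 : 0 < x := by linarith
  have hLκ1 : 1 ≤ L ^ κ := Real.one_le_rpow (by linarith) hκ.le
  have hδ0 : 0 < δ := by positivity
  have hδ1 : δ ≤ 1 := by rw [hδ, div_le_one (by linarith)]; exact hLκ1
  have hxpow : ∀ s : ℝ, 0 < x ^ s := fun s => by positivity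
  have hx8 : 8 ≤ x ^ (1 / 8 : ℝ) := by linarith
  have hx78 : 8 * x ^ (7 / 8 : ℝ) ≤ x * δ := by
    have h : x = x ^ (7 / 8 : ℝ) * x ^ (1 / 8 : ℝ) := by rw [← Real.rpow_add hx0]; norm_num
    rw [hδ, mul_one_div, le_div_iff₀ (by linarith)]
    nth_rewrite 2 [h]
    nlinarith [hxpow (7 / 8)]
  have hx34 : 8 * x ^ (3 / 4 : ℝ) ≤ x ^ (7 / 8 : ℝ) := by
    have h : x ^ (7 / 8 : ℝ) = x ^ (3 / 4 : ℝ) * x ^ (1 / 8 : ℝ) := by rw [← Real.rpow_add hx0]; norm_num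
    rw [h]; nlinarith [hxpow (3 / 4)]
  have hx34' : 1 ≤ x ^ (3 / 4 : ℝ) := Real.one_le_rpow hx1 (by norm_num)
  have hexp1 : 1 + δ ≤ Real.exp δ := by linarith [Real.add_one_le_exp δ]
  have hexp2 : Real.exp δ ≤ 1 + 2 * δ := by
    have := Real.abs_exp_sub_one_le (x := δ) (by rw [abs_of_pos hδ0]; exact hδ1)
    rw [abs_of_pos hδ0] at this
    linarith [le_abs_self (Real.exp δ - 1)]
  have hX1 : (X : ℝ) ≤ x * Real.exp δ := Nat.floor_le (by positivity)
  have hX2 : x * Real.exp δ < X + 1 := Nat.lt_floor_add_one _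
  have hX3x : (X : ℝ) ≤ 3 * x := by nlinarith
  have hxX : x ≤ X := by nlinarith
  have hx1X : (⌊x⌋₊ : ℝ) ≤ x := Nat.floor_le hx0.le
  have hx2X : x < ⌊x⌋₊ + 1 := Nat.lt_floor_add_one _
  have hfX : ⌊x⌋₊ ≤ X := Nat.floor_le_floor (by nlinarith)
  have hX16 : (16 : ℝ) ≤ X := by nlinarith
  have hX16' : 16 ≤ X := by exact_mod_cast hX16
  have hqX : q ^ 4 ≤ X := by
    have : (q : ℝ) ^ 4 ≤ X := hqx.trans hxX
    exact_mod_cast this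
  have hLX : L ≤ Real.log X := Real.log_le_log hx0 hxX
  have hLX2 : Real.log X ≤ 2 * L := by
    have h1 := Real.log_le_log (by linarith) hX3x
    rw [Real.log_mul (by norm_num) hx0.ne'] at h1
    have := Real.log_le_sub_one_of_pos (show (0 : ℝ) < 3 by norm_num)
    linarith
  have hlyκ : Real.log y ^ κ ≤ (2 * κ + 4) ^ κ * Real.log (q * L) ^ κ := by
    rw [← Real.mul_rpow (by linarith) (by linarith)]
    gcongr
  have hq12 : q ^ 2 ≤ X := le_trans (Nat.pow_le_pow_right hq (by norm_num)) hqX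
  have huns := norm_sum_le_norm_sum_weight f q a hx0 hδ0
  rw [← hLd, ← hX] at huns
  have hxe : x + x * δ ≤ x * Real.exp δ := by nlinarith
  have hxe2 : x * Real.exp δ ≤ x + 2 * (x * δ) := by nlinarith
  have hprogr : progr q a x δ = (Finset.Icc 1 X).filter (fun n => n ≡ a [MOD q]) := rfl
  clear_value y
  clear_value X
  have hE3 : ∑ n ∈ (Finset.Ioc ⌊x⌋₊ (⌊x⌋₊ + (X - ⌊x⌋₊))).filter (fun n => n ≡ a [MOD q]), ‖f n‖ ≤
      C₃ * 3 * 2 ^ κ * (1 / q.totient * (x / L) * Real.log (q * L) ^ κ) := by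
    have hH : ((X - ⌊x⌋₊ : ℕ) : ℝ) = X - ⌊x⌋₊ := Nat.cast_sub hfX
    have hq4 : (q : ℝ) ≤ x ^ (1 / 4 : ℝ) := by
      have h3 : (q : ℝ) = ((q : ℝ) ^ 4) ^ (1 / 4 : ℝ) := by
        rw [← Real.rpow_natCast, ← Real.rpow_mul (by positivity)]; norm_num
      rw [h3]; gcongr
    have hX12 : (X : ℝ) ^ (1 / 2 : ℝ) ≤ 2 * x ^ (1 / 2 : ℝ) := by
      calc (X : ℝ) ^ (1 / 2 : ℝ) ≤ ((2 : ℝ) ^ (2 : ℝ) * x) ^ (1 / 2 : ℝ) := by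
            gcongr; norm_num; linarith
        _ = _ := by rw [Real.mul_rpow (by positivity) hx0.le, ← Real.rpow_mul (by norm_num)]; norm_num
    have hHq : q * (X : ℝ) ^ (1 / 2 : ℝ) ≤ ((X - ⌊x⌋₊ : ℕ) : ℝ) := by
      calc q * (X : ℝ) ^ (1 / 2 : ℝ) ≤ x ^ (1 / 4 : ℝ) * (2 * x ^ (1 / 2 : ℝ)) := by gcongr
        _ = 2 * x ^ (3 / 4 : ℝ) := by rw [mul_left_comm, ← Real.rpow_add hx0]; norm_num
        _ ≤ _ := by rw [hH]; linarith
    refine (h₃ f Λf hf q a ⌊x⌋₊ (X - ⌊x⌋₊) X hq ha (by omega) (by omega) hHq).trans ?_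
    have hH3 : ((X - ⌊x⌋₊ : ℕ) : ℝ) ≤ 3 * (x * δ) := by rw [hH]; linarith
    have hone : 1 ≤ Real.log (q * L) ^ κ := Real.one_le_rpow (by linarith) hκ.le
    calc _ ≤ C₃ * (3 * (x * δ) / (q.totient * L) * (2 * L) ^ κ) := by
          have : 0 ≤ Real.log X := by linarith
          gcongr
      _ = C₃ * 3 * 2 ^ κ * (1 / q.totient * (x / L) * 1) := by
          rw [Real.mul_rpow (by norm_num) (by linarith), hδ]; field_simp
      _ ≤ _ := by gcongr
  have hmain := sum_weight_eq hf y (weight L δ) (S := progr q a x δ) (fun n hn => by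
    simp only [progr, Finset.mem_filter, Finset.mem_Icc] at hn; exact hn.1.1) (1 / Real.log y)
  have hE1 := norm_sum_twist_rough_le f y (weight_nonneg L hδ0) (weight_le_one L hδ0) (progr q a x δ)
    (η := 1 / Real.log y) (by positivity)
  have hE2 := norm_sum_integral_roughConv_le hκ hf (y := y) (by linarith) (weight_nonneg L hδ0) (weight_le_one L hδ0)
    (S := progr q a x δ) (fun n hn => by
      simp only [progr, Finset.mem_filter, Finset.mem_Icc] at hn; exact hn.1.1)
  have hE1' := h₁ f Λf hf y (by linarith) q a 0 X X hq ha (by omega) (by omega) (mul_sqrt_le_of_sq_le hq12)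
  have hE2' := h₂ f Λf hf y (by linarith) q a X hq ha hX16' hqX
  have hcomm : X / (q.totient * Real.log X) * Real.log y ^ κ ≤
      3 * (2 * κ + 4) ^ κ * (1 / q.totient * (x / L) * Real.log (q * L) ^ κ) := by
    calc _ ≤ (3 * x) / (q.totient * L) * ((2 * κ + 4) ^ κ * Real.log (q * L) ^ κ) := by
          have : 0 ≤ Real.log (q * L) := by linarith
          have : 0 ≤ Real.log y := by linarith
          gcongr
      _ = _ := by field_simp
  rw [zero_add] at hE1'
  have hIoc : Finset.Ioc 0 X = Finset.Icc 1 X := rfl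
  rw [hIoc] at hE1'
  rw [← hprogr] at hE1' hE2'
  have hE1'' : ‖∑ n ∈ progr q a x δ, (weight L δ n : ℂ) * (f n * ((rough y n : ℝ) ^ (-(1 / Real.log y)) : ℝ))‖ ≤
      C₁ * (X / (q.totient * Real.log X) * Real.log y ^ κ) := hE1.trans hE1'
  have hE2'' := hE2.trans (mul_le_mul_of_nonneg_left hE2' hκ.le)
  calc _ ≤ _ := huns
    _ ≤ (C₁ * (X / (q.totient * Real.log X) * Real.log y ^ κ) +
        κ * (C₂ * (X / (q.totient * Real.log X) * Real.log y ^ κ)) + _) +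
        C₃ * 3 * 2 ^ κ * (1 / q.totient * (x / L) * Real.log (q * L) ^ κ) := by
          refine add_le_add ?_ hE3
          rw [hmain]
          exact (norm_add₃_le).trans (add_le_add (add_le_add hE1'' hE2'') le_rfl)
    _ ≤ _ := by
      have h1 := mul_le_mul_of_nonneg_left hcomm (show 0 ≤ C₁ + κ * C₂ by positivity)
      linarith

end Smoothing
section Exponential

open LSeries Filter
open scoped LSeries.notation

/-- A Dirichlet series satisfying the logarithmic convolution identity is the exponential of the
Dirichlet series of its logarithmic coefficients. -/
lemma LSeries_eq_exp {u v : ℕ → ℂ} (hu1 : u 1 = 1) (hv1 : v 1 = 0) (hu : abscissaOfAbsConv u ≤ 1)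
    (hv : abscissaOfAbsConv v ≤ 1) (huv : ∀ n : ℕ, n ≠ 0 → logMul u n = (logMul v ⍟ u) n) {s : ℂ} (hs : 1 < s.re) :
    LSeries u s = cexp (LSeries v s) := by
  have habs : ∀ {w : ℕ → ℂ}, abscissaOfAbsConv w ≤ 1 → ∀ {z : ℂ}, 1 < z.re → abscissaOfAbsConv w < z.re :=
    fun hw z hz => hw.trans_lt (by exact_mod_cast hz)
  set U : Set ℂ := {z | 1 < z.re} with hU
  have hUo : IsOpen U := isOpen_lt continuous_const continuous_re
  have hUc : IsPreconnected U := (convex_halfSpace_re_gt 1).isPreconnected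
  set G : ℂ → ℂ := fun z => LSeries u z * cexp (-LSeries v z) with hG
  have hd : ∀ z ∈ U, HasDerivAt G 0 z := by
    intro z hz
    have h1 := LSeries_hasDerivAt (habs hu hz)
    have h2 := (LSeries_hasDerivAt (habs hv hz)).neg.cexp
    refine (h1.mul h2).congr_deriv ?_
    rw [LSeries_congr (g := logMul v ⍟ u) (fun {n} hn => huv n hn) z,
      LSeries_convolution (by rw [abscissaOfAbsConv_logMul]; exact habs hv hz) (habs hu hz)]
    simp only [Pi.neg_apply]
    ring
  have hconst : ∀ z ∈ U, G z = G s := fun z hz =>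
    hUo.is_const_of_deriv_eq_zero hUc (fun w hw => (hd w hw).differentiableAt.differentiableWithinAt)
      (fun w hw => (hd w hw).deriv) hz hs
  have hlt : ∀ {w : ℕ → ℂ}, abscissaOfAbsConv w ≤ 1 → abscissaOfAbsConv w < ⊤ := fun hw =>
    hw.trans_lt (EReal.coe_lt_top 1)
  have hlim : Tendsto (fun x : ℝ => G x) atTop (nhds 1) := by
    have h2 := (LSeries.tendsto_atTop (hlt hu)).mul (LSeries.tendsto_atTop (hlt hv)).neg.cexp
    simpa [hu1, hv1] using h2
  have hlim2 : Tendsto (fun x : ℝ => G x) atTop (nhds (G s)) := by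
    refine tendsto_const_nhds.congr' ?_
    filter_upwards [eventually_gt_atTop 1] with x hx
    exact (hconst x (by simpa [hU] using hx)).symm
  have h1 := tendsto_nhds_unique hlim2 hlim
  simp only [hG, Complex.exp_neg] at h1
  rwa [mul_inv_eq_one₀ (Complex.exp_ne_zero _)] at h1

end Exponential
section TwistedSeries

open LSeries Filter
open scoped LSeries.notation
open ArithmeticFunction (vonMangoldt)

variable {κ : ℝ} {f Λf : ℕ → ℂ} {q : ℕ}

/-- The coefficients of `F_χ`, multiplied by a power of the smooth part. -/
def charCoef (f : ℕ → ℂ) (χ : DirichletCharacter ℂ q) (y : ℕ) (γ : ℝ) (n : ℕ) : ℂ :=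
  f n * χ n * ((smooth y n : ℝ) ^ γ : ℝ)

/-- The logarithmic coefficients corresponding to `charCoef`. -/
def logCoef (Λf : ℕ → ℂ) (χ : DirichletCharacter ℂ q) (y : ℕ) (γ : ℝ) (n : ℕ) : ℂ :=
  Λf n / (Real.log n : ℂ) * χ n * ((smooth y n : ℝ) ^ γ : ℝ)

lemma norm_charCoef_le (f : ℕ → ℂ) (χ : DirichletCharacter ℂ q) (y : ℕ) (γ : ℝ) (n : ℕ) :
    ‖charCoef f χ y γ n‖ ≤ ‖f n‖ * (smooth y n : ℝ) ^ γ := by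
  unfold charCoef
  rw [norm_mul, norm_mul, Complex.norm_real, Real.norm_of_nonneg (by positivity)]
  gcongr
  exact mul_le_of_le_one_right (norm_nonneg _) (DirichletCharacter.norm_le_one χ _)

lemma lambda_one (hf : IsHalaszClass κ f Λf) : Λf 1 = 0 := hf.supp 1 not_isPrimePow_one

lemma logMul_charCoef (hf : IsHalaszClass κ f Λf) (χ : DirichletCharacter ℂ q) (y : ℕ) (γ : ℝ) {n : ℕ} (hn : n ≠ 0) :
    logMul (charCoef f χ y γ) n = (logMul (logCoef Λf χ y γ) ⍟ charCoef f χ y γ) n := by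
  rw [LSeries.convolution_def]
  simp only [logMul, charCoef, logCoef]
  rw [← natCast_log]
  calc _ = f n * (Real.log n : ℂ) * (χ n * ((smooth y n : ℝ) ^ γ : ℝ)) := by ring
    _ = _ := by
      rw [hf.conv n (Nat.one_le_iff_ne_zero.2 hn), ← Nat.sum_divisorsAntidiagonal (fun d m => Λf d * f m), Finset.sum_mul]
      refine Finset.sum_congr rfl fun p hp => ?_
      have h0 := ne_zero_of_mem_divisorsAntidiagonal hp
      rw [← (Nat.mem_divisorsAntidiagonal.1 hp).1, smooth_mul y h0.1 h0.2, ← natCast_log]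
      push_cast
      rw [map_mul, Real.mul_rpow (by positivity) (by positivity)]
      rcases eq_or_ne p.1 1 with h1 | h1
      · simp [h1, lambda_one hf]
      · have hl : (Real.log p.1 : ℂ) ≠ 0 := by
          rw [Ne, Complex.ofReal_eq_zero]
          exact (Real.log_pos (by exact_mod_cast (by omega : 1 < p.1))).ne'
        rw [natCast_log] at hl
        push_cast
        field_simp

lemma geom_sum_Icc_two_le {r : ℝ} (h0 : 0 ≤ r) (h1 : r ≤ 3 / 4) (N : ℕ) : ∑ k ∈ Finset.Icc 2 N, r ^ k ≤ 4 * r ^ 2 := by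
  have h := geom_sum_Ico_le_of_lt_one (m := 2) (n := N + 1) h0 (by linarith)
  have e : Finset.Icc 2 N = Finset.Ico 2 (N + 1) := by ext; simp
  rw [e]
  refine h.trans ?_
  rw [div_le_iff₀ (by linarith)]
  nlinarith [sq_nonneg r]

/-- The sum of `n ^ (-39/40)` over proper prime powers is bounded. -/
lemma sum_primePow_rpow_le (N : ℕ) :
    ∑ n ∈ (Finset.Icc 1 N).filter (fun n => IsPrimePow n ∧ ¬ n.Prime), (n : ℝ) ^ (-(39 / 40) : ℝ) ≤ 9 := by
  set P := (Finset.Icc 1 N).filter Nat.Prime with hP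
  have hsub : (Finset.Icc 1 N).filter (fun n => IsPrimePow n ∧ ¬ n.Prime) ⊆
      P.biUnion fun p => (Finset.Icc 2 N).biUnion fun k => {p ^ k} := by
    intro n hn
    simp only [Finset.mem_filter, Finset.mem_Icc] at hn
    obtain ⟨⟨h1, h2⟩, h3, h4⟩ := hn
    obtain ⟨p, k, hp, hk, rfl⟩ := h3
    have hp' := hp.nat_prime
    have hk1 : k ≠ 1 := by rintro rfl; exact h4 (by simpa using hp')
    simp only [Finset.mem_biUnion, Finset.mem_singleton, hP, Finset.mem_filter, Finset.mem_Icc]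
    exact ⟨p, ⟨⟨hp'.one_lt.le, (Nat.le_self_pow hk.ne' p).trans h2⟩, hp'⟩, k, ⟨by omega,
      (Nat.lt_pow_self hp'.one_lt).le.trans h2⟩, rfl⟩
  have hnn : ∀ n : ℕ, 0 ≤ (n : ℝ) ^ (-(39 / 40) : ℝ) := fun n => by positivity
  calc _ ≤ _ := Finset.sum_le_sum_of_subset_of_nonneg hsub fun n _ _ => hnn n
    _ ≤ ∑ p ∈ P, ∑ k ∈ Finset.Icc 2 N, ∑ n ∈ ({p ^ k} : Finset ℕ), (n : ℝ) ^ (-(39 / 40) : ℝ) :=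
      (sum_biUnion_le_sum hnn _ _).trans (Finset.sum_le_sum fun p _ => sum_biUnion_le_sum hnn _ _)
    _ = ∑ p ∈ P, ∑ k ∈ Finset.Icc 2 N, ((p : ℝ) ^ (-(39 / 40) : ℝ)) ^ k := by
      refine Finset.sum_congr rfl fun p _ => Finset.sum_congr rfl fun k _ => ?_
      rw [Finset.sum_singleton, Nat.cast_pow, ← Real.rpow_natCast, ← Real.rpow_mul (by positivity),
        ← Real.rpow_natCast, ← Real.rpow_mul (by positivity), mul_comm]
    _ ≤ ∑ p ∈ P, 4 * (p : ℝ) ^ (-1 - 19 / 20 : ℝ) := by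
      refine Finset.sum_le_sum fun p hp => ?_
      have hp2 : (2 : ℝ) ≤ p := by exact_mod_cast (Finset.mem_filter.1 hp).2.two_le
      refine (geom_sum_Icc_two_le (by positivity) ?_ N).trans ?_
      · calc (p : ℝ) ^ (-(39 / 40) : ℝ) ≤ (2 : ℝ) ^ (-(39 / 40) : ℝ) :=
              Real.rpow_le_rpow_of_nonpos (by norm_num) hp2 (by norm_num)
          _ ≤ (2 : ℝ) ^ (-(1 / 2) : ℝ) := Real.rpow_le_rpow_of_exponent_le (by norm_num) (by norm_num)
          _ ≤ 3 / 4 := by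
            rw [Real.rpow_neg (by norm_num), ← Real.sqrt_eq_rpow]
            rw [inv_le_comm₀ (by positivity) (by norm_num)]
            exact Real.le_sqrt_of_sq_le (by norm_num)
      · rw [← Real.rpow_natCast, ← Real.rpow_mul (by positivity)]
        norm_num
    _ ≤ 4 * ∑ n ∈ Finset.Icc 1 N, (n : ℝ) ^ (-1 - 19 / 20 : ℝ) := by
      rw [Finset.mul_sum]
      exact Finset.sum_le_sum_of_subset_of_nonneg (Finset.filter_subset _ _) fun n _ _ => by positivity
    _ ≤ _ := by
      have := sum_rpow_le (σ := 19 / 20) (by norm_num) N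
      norm_num at this ⊢
      linarith

/-- The excess of the twisted logarithmic coefficients over the untwisted ones. -/
def excess (y : ℕ) (γ : ℝ) (n : ℕ) : ℝ := vonMangoldt n / Real.log n * ((smooth y n : ℝ) ^ γ - 1)

lemma excess_nonneg (y : ℕ) {γ : ℝ} (hγ : 0 ≤ γ) (n : ℕ) : 0 ≤ excess y γ n := by
  refine mul_nonneg (div_nonneg ArithmeticFunction.vonMangoldt_nonneg (Real.log_natCast_nonneg n)) (sub_nonneg.2 ?_)
  exact Real.one_le_rpow (by exact_mod_cast smooth_pos y n) hγ

lemma vonMangoldt_div_log_le_one (n : ℕ) : vonMangoldt n / Real.log n ≤ 1 :=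
  div_le_one_of_le₀ ArithmeticFunction.vonMangoldt_le_log (Real.log_natCast_nonneg n)

lemma rpow_sub_one_le {z γ : ℝ} (hz : 0 < z) (h0 : 0 ≤ γ * Real.log z) (h : γ * Real.log z ≤ 2) :
    z ^ γ - 1 ≤ 8 * (γ * Real.log z) := by
  rw [Real.rpow_def_of_pos hz, mul_comm]
  set u := γ * Real.log z
  have h1 := Real.add_one_le_exp (-u)
  have h2 : Real.exp u ≤ 8 := by
    refine (Real.exp_le_exp.2 h).trans ?_
    have := Real.exp_one_lt_d9
    rw [show (2 : ℝ) = 1 + 1 by norm_num, Real.exp_add]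
    nlinarith [Real.exp_pos 1]
  have h3 : Real.exp u * Real.exp (-u) = 1 := by rw [← Real.exp_add]; simp
  nlinarith [Real.exp_pos u]

lemma excess_le {y : ℕ} {γ : ℝ} (hγ : 0 ≤ γ) (hγ' : γ ≤ 1 / 40) (hγy : γ * Real.log y ≤ 2) {n : ℕ} (hn : 1 ≤ n) :
    excess y γ n * (n : ℝ)⁻¹ ≤ 8 * γ * (if n ≤ y then vonMangoldt n / n else 0) +
      (if IsPrimePow n ∧ ¬ n.Prime then (n : ℝ) ^ (-(39 / 40) : ℝ) else 0) := by
  have hn0 : (0 : ℝ) < n := by exact_mod_cast hn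
  have hΛ : 0 ≤ vonMangoldt n := ArithmeticFunction.vonMangoldt_nonneg
  have hb0 : (0 : ℝ) < smooth y n := by exact_mod_cast smooth_pos y n
  have hbn : (smooth y n : ℝ) ≤ n := by
    exact_mod_cast Nat.le_of_dvd hn ⟨_, (smooth_mul_rough y (by omega)).symm⟩
  have hl0 := Real.log_natCast_nonneg n
  have h2nd : (0 : ℝ) ≤ if IsPrimePow n ∧ ¬ n.Prime then (n : ℝ) ^ (-(39 / 40) : ℝ) else 0 := by
    split_ifs <;> positivity
  have hpn : (smooth y n : ℝ) ^ γ ≤ (n : ℝ) ^ γ := by gcongr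
  unfold excess
  rcases le_or_gt n y with h | h
  · rw [if_pos h]
    have hny : Real.log n ≤ Real.log y := Real.log_le_log hn0 (by exact_mod_cast h)
    have h1 := rpow_sub_one_le hn0 (mul_nonneg hγ hl0) ((mul_le_mul_of_nonneg_left hny hγ).trans hγy)
    have h2 : vonMangoldt n / Real.log n * ((smooth y n : ℝ) ^ γ - 1) ≤ 8 * γ * vonMangoldt n := by
      rcases hl0.eq_or_lt with hl | hl
      · rw [← hl]; simp; positivity
      · rw [div_mul_eq_mul_div, div_le_iff₀ hl]
        calc _ ≤ vonMangoldt n * (8 * (γ * Real.log n)) := by gcongr; linarith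
          _ = _ := by ring
    calc _ ≤ 8 * γ * vonMangoldt n * (n : ℝ)⁻¹ := by gcongr
      _ = 8 * γ * (vonMangoldt n / n) := by ring
      _ ≤ _ := by linarith
  · rw [if_neg (by omega), mul_zero, zero_add]
    by_cases hpp : IsPrimePow n
    · by_cases hp : n.Prime
      · have : smooth y n = 1 := by
          have := smooth_prime_pow (y := y) hp 1
          rwa [pow_one, if_pos h] at this
        rw [this]
        simpa using h2nd
      · rw [if_pos ⟨hpp, hp⟩]
        calc _ ≤ 1 * (n : ℝ) ^ γ * (n : ℝ)⁻¹ := by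
              gcongr
              · exact sub_nonneg.2 (Real.one_le_rpow (by exact_mod_cast smooth_pos y n) hγ)
              · exact vonMangoldt_div_log_le_one n
              · linarith
          _ = (n : ℝ) ^ (γ + -1) := by rw [one_mul, Real.rpow_add hn0, Real.rpow_neg_one]
          _ ≤ _ := Real.rpow_le_rpow_of_exponent_le (by exact_mod_cast hn) (by linarith)
    · rw [ArithmeticFunction.vonMangoldt_eq_zero_iff.2 hpp]
      simpa using h2nd

lemma sum_excess_le {y : ℕ} {γ : ℝ} (hγ : 0 ≤ γ) (hγ' : γ ≤ 1 / 40) (hγy : γ * Real.log y ≤ 2) (N : ℕ) :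
    ∑ n ∈ Finset.Icc 1 N, excess y γ n * (n : ℝ)⁻¹ ≤ 27 := by
  have h1 := Finset.sum_le_sum fun n (hn : n ∈ Finset.Icc 1 N) => excess_le hγ hγ' hγy (Finset.mem_Icc.1 hn).1
  refine h1.trans ?_
  rw [Finset.sum_add_distrib, ← Finset.mul_sum, ← Finset.sum_filter, ← Finset.sum_filter]
  have h2 := sum_primePow_rpow_le N
  have h3 : ∑ n ∈ (Finset.Icc 1 N).filter (fun n => n ≤ y), vonMangoldt n / n ≤ Real.log y + 6 := by
    have hnn : ∀ n : ℕ, 0 ≤ vonMangoldt n / n := fun n =>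
      div_nonneg ArithmeticFunction.vonMangoldt_nonneg (by positivity)
    have hy0 := Real.log_natCast_nonneg y
    rcases Nat.eq_zero_or_pos y with rfl | hy
    · rw [Finset.sum_eq_zero]
      · linarith
      · intro n hn
        simp only [Finset.mem_filter, Finset.mem_Icc] at hn
        omega
    · refine le_trans (Finset.sum_le_sum_of_subset_of_nonneg (t := Finset.Icc 1 y) ?_ fun n _ _ => hnn n)
        (sum_vonMangoldt_div_le hy)
      intro n hn
      simp only [Finset.mem_filter, Finset.mem_Icc] at hn ⊢
      omega
  have h4 := mul_le_mul_of_nonneg_left h3 (show 0 ≤ 8 * γ by positivity)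
  nlinarith

lemma summable_of_sum_Icc_le {g : ℕ → ℝ} {c : ℝ} (h0 : ∀ n, 0 ≤ g n) (hg0 : g 0 = 0)
    (h : ∀ N, ∑ n ∈ Finset.Icc 1 N, g n ≤ c) : Summable g ∧ ∑' n, g n ≤ c := by
  have hr : ∀ N, ∑ n ∈ Finset.range N, g n ≤ c := by
    intro N
    refine le_trans ?_ (h N)
    rw [← Finset.sum_sdiff (s₁ := (Finset.range N).filter (fun n => n = 0)) (Finset.filter_subset _ _),
      Finset.sum_eq_zero (s := (Finset.range N).filter (fun n => n = 0)), add_zero]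
    · refine Finset.sum_le_sum_of_subset_of_nonneg ?_ fun n _ _ => h0 n
      intro n hn
      simp only [Finset.mem_sdiff, Finset.mem_range, Finset.mem_filter, not_and] at hn
      have := hn.2 hn.1
      rw [Finset.mem_Icc]; omega
    · intro n hn
      rw [(Finset.mem_filter.1 hn).2, hg0]
  exact ⟨summable_of_sum_range_le h0 hr, Real.tsum_le_of_sum_range_le h0 hr⟩

lemma summable_excess {y : ℕ} {γ : ℝ} (hγ : 0 ≤ γ) (hγ' : γ ≤ 1 / 40) (hγy : γ * Real.log y ≤ 2) :
    Summable (fun n : ℕ => excess y γ n * (n : ℝ)⁻¹) ∧ ∑' n : ℕ, excess y γ n * (n : ℝ)⁻¹ ≤ 27 :=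
  summable_of_sum_Icc_le (fun n => mul_nonneg (excess_nonneg y hγ n) (by positivity)) (by simp)
    (sum_excess_le hγ hγ' hγy)

lemma smooth_prime_rpow_le {y p : ℕ} (hp : p.Prime) {γ : ℝ} (hγ : 0 ≤ γ) (hγy : γ * Real.log y ≤ 2) :
    (smooth y p : ℝ) ^ γ ≤ Real.exp 2 := by
  have h := smooth_prime_pow (y := y) hp 1
  rw [pow_one] at h
  rw [h]
  split_ifs with h1
  · simp
  · have hp0 : (0 : ℝ) < p := by exact_mod_cast hp.pos
    rw [Real.rpow_def_of_pos hp0, mul_comm, Real.exp_le_exp]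
    exact (mul_le_mul_of_nonneg_left (Real.log_le_log hp0 (by exact_mod_cast not_lt.1 h1)) hγ).trans hγy

lemma exists_sum_norm_le (hκ : 0 < κ) : ∃ C : ℝ, 0 < C ∧ ∀ f Λf : ℕ → ℂ, IsHalaszClass κ f Λf →
    ∀ (y : ℕ) (γ B : ℝ), 0 ≤ γ → γ ≤ 1 / 80 → γ * Real.log y ≤ 2 →
    (∀ p : ℕ, p.Prime → (smooth y p : ℝ) ^ γ ≤ B) → ∀ σ : ℝ, 0 < σ →
    Summable (fun n : ℕ => ‖f n‖ * (smooth y n : ℝ) ^ γ * (n : ℝ) ^ (-(1 + σ))) ∧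
    ∑' n : ℕ, ‖f n‖ * (smooth y n : ℝ) ^ γ * (n : ℝ) ^ (-(1 + σ)) ≤ C * (1 + 1 / σ) ^ (κ * B) := by
  obtain ⟨C₁, hC₁, h⟩ := exists_isShiu_twist hκ
  refine ⟨Real.exp (16 * C₁), Real.exp_pos _, fun f Λf hf y γ B hγ hγ' hγy hB σ hσ => ?_⟩
  have hB0 : 0 ≤ B := le_trans (by positivity) (hB 2 Nat.prime_two)
  refine summable_of_sum_Icc_le (fun n => by positivity) (by rw [Nat.cast_zero, Real.zero_rpow (by linarith), mul_zero])
    fun N => ?_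
  set P := (Finset.Icc 1 N).filter Nat.Prime with hP
  have hPp : ∀ p ∈ P, p.Prime := fun p hp => (Finset.mem_filter.1 hp).2
  have h1 := (h f Λf hf y γ 0 hγ hγ' hγy le_rfl).sum_le hC₁ (σ := 1 + σ) (by linarith) P hPp (Finset.Icc 1 N)
    (fun n hn => by
      rw [Finset.mem_Icc] at hn
      refine ⟨by omega, fun p hp hpn => ?_⟩
      rw [hP, Finset.mem_filter, Finset.mem_Icc]
      exact ⟨⟨hp.one_lt.le, (Nat.le_of_dvd hn.1 hpn).trans hn.2⟩, hp⟩)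
  have ht : ∀ n, twist f y γ 0 n = ‖f n‖ * (smooth y n : ℝ) ^ γ := fun n => by simp [twist]
  simp_rw [ht] at h1
  refine h1.trans (mul_le_mul_of_nonneg_left ?_ (Real.exp_pos _).le)
  rw [Real.rpow_def_of_pos (by positivity), Real.exp_le_exp, mul_comm _ (κ * B)]
  calc _ ≤ ∑ p ∈ P, κ * B * (p : ℝ) ^ (-1 - σ) := by
        refine Finset.sum_le_sum fun p hp => ?_
        rw [show -(1 + σ) = -1 - σ by ring]
        gcongr
        · exact norm_prime_le hκ hf (hPp p hp)
        · exact hB p (hPp p hp)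
    _ ≤ _ := by
        rw [← Finset.mul_sum]
        exact mul_le_mul_of_nonneg_left (sum_primes_rpow_le hσ P hPp) (by positivity)

lemma norm_term_eq_rpow (u : ℕ → ℂ) {s : ℂ} (hs : 1 < s.re) (n : ℕ) : ‖term u s n‖ = ‖u n‖ * (n : ℝ) ^ (-s.re) := by
  rcases eq_or_ne n 0 with rfl | hn
  · simp [Real.zero_rpow (show -s.re ≠ 0 by linarith)]
  · rw [LSeries.norm_term_eq, if_neg hn, Real.rpow_neg (by positivity), div_eq_mul_inv]

lemma LSeriesSummable_charCoef (hκ : 0 < κ) (hf : IsHalaszClass κ f Λf) (χ : DirichletCharacter ℂ q) {y : ℕ} {γ : ℝ}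
    (hγ : 0 ≤ γ) (hγ' : γ ≤ 1 / 80) (hγy : γ * Real.log y ≤ 2) {s : ℂ} (hs : 1 < s.re) :
    LSeriesSummable (charCoef f χ y γ) s := by
  obtain ⟨C, -, h⟩ := exists_sum_norm_le hκ
  have h1 := (h f Λf hf y γ _ hγ hγ' hγy (fun p hp => smooth_prime_rpow_le hp hγ hγy) (s.re - 1) (by linarith)).1
  refine Summable.of_norm_bounded h1 fun n => ?_
  rw [norm_term_eq_rpow _ hs, show -(1 + (s.re - 1)) = -s.re by ring]
  gcongr
  exact norm_charCoef_le ..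

lemma norm_logCoef_sub_le (hf : IsHalaszClass κ f Λf) (χ : DirichletCharacter ℂ q) (y : ℕ) {γ : ℝ} (hγ : 0 ≤ γ)
    (n : ℕ) (hn : 1 ≤ n) : ‖logCoef Λf χ y γ n - logCoef Λf χ y 0 n‖ ≤ κ * excess y γ n := by
  have hb : (1 : ℝ) ≤ (smooth y n : ℝ) ^ γ := Real.one_le_rpow (by exact_mod_cast smooth_pos y n) hγ
  have e : logCoef Λf χ y γ n - logCoef Λf χ y 0 n =
      Λf n / (Real.log n : ℂ) * χ n * (((smooth y n : ℝ) ^ γ - 1 : ℝ) : ℂ) := by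
    simp only [logCoef, Real.rpow_zero, Complex.ofReal_sub, Complex.ofReal_one]
    ring
  rw [e, norm_mul, norm_mul, norm_div, Complex.norm_real, Complex.norm_real,
    Real.norm_of_nonneg (Real.log_natCast_nonneg n), Real.norm_of_nonneg (sub_nonneg.2 hb)]
  unfold excess
  have hl := Real.log_natCast_nonneg n
  calc _ ≤ (κ * vonMangoldt n / Real.log n) * 1 * ((smooth y n : ℝ) ^ γ - 1) := by
        refine mul_le_mul_of_nonneg_right ?_ (by linarith)
        refine mul_le_mul (div_le_div_of_nonneg_right (hf.bound n hn) hl) (DirichletCharacter.norm_le_one χ _)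
          (norm_nonneg _) ?_
        exact div_nonneg (le_trans (norm_nonneg _) (hf.bound n hn)) hl
    _ = _ := by ring

lemma norm_logCoef_zero_le (hf : IsHalaszClass κ f Λf) (χ : DirichletCharacter ℂ q) (y : ℕ)
    (n : ℕ) (hn : 1 ≤ n) : ‖logCoef Λf χ y 0 n‖ ≤ κ * (vonMangoldt n / Real.log n) := by
  have hl := Real.log_natCast_nonneg n
  simp only [logCoef, Real.rpow_zero, Complex.ofReal_one, mul_one]
  rw [norm_mul, norm_div, Complex.norm_real, Real.norm_of_nonneg hl, ← mul_div_assoc]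
  exact mul_le_of_le_one_right (by positivity) (DirichletCharacter.norm_le_one χ _) |>.trans
    (div_le_div_of_nonneg_right (hf.bound n hn) hl)

lemma LSeriesSummable_logCoef_zero (hκ : 0 < κ) (hf : IsHalaszClass κ f Λf) (χ : DirichletCharacter ℂ q) (y : ℕ)
    {s : ℂ} (hs : 1 < s.re) : LSeriesSummable (logCoef Λf χ y 0) s := by
  refine LSeriesSummable_of_le_const_mul_rpow (x := 1) hs ⟨κ, fun n hn => ?_⟩
  rw [sub_self, Real.rpow_zero]
  exact (norm_logCoef_zero_le hf χ y n (by omega)).trans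
    (mul_le_mul_of_nonneg_left (vonMangoldt_div_log_le_one n) hκ.le)

lemma norm_term_logCoef_sub_le (hf : IsHalaszClass κ f Λf) (χ : DirichletCharacter ℂ q) {y : ℕ} {γ : ℝ}
    (hγ : 0 ≤ γ) {s : ℂ} (hs : 1 < s.re) (n : ℕ) :
    ‖term (logCoef Λf χ y γ - logCoef Λf χ y 0) s n‖ ≤ κ * (excess y γ n * (n : ℝ)⁻¹) := by
  rcases eq_or_ne n 0 with rfl | hn
  · simp
  · have hn1 := Nat.one_le_iff_ne_zero.2 hn
    rw [norm_term_eq_rpow _ hs, ← mul_assoc, ← Real.rpow_neg_one]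
    have h := norm_logCoef_sub_le hf χ y hγ n hn1
    have h0 := (norm_nonneg _).trans h
    gcongr
    · exact h
    · exact_mod_cast hn1

lemma LSeriesSummable_logCoef_sub (hf : IsHalaszClass κ f Λf) (χ : DirichletCharacter ℂ q) {y : ℕ} {γ : ℝ}
    (hγ : 0 ≤ γ) (hγ' : γ ≤ 1 / 40) (hγy : γ * Real.log y ≤ 2) {s : ℂ} (hs : 1 < s.re) :
    LSeriesSummable (logCoef Λf χ y γ - logCoef Λf χ y 0) s :=
  Summable.of_norm_bounded ((summable_excess hγ hγ' hγy).1.mul_left κ)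
    (norm_term_logCoef_sub_le hf χ hγ hs)

lemma LSeriesSummable_logCoef (hκ : 0 < κ) (hf : IsHalaszClass κ f Λf) (χ : DirichletCharacter ℂ q) {y : ℕ} {γ : ℝ}
    (hγ : 0 ≤ γ) (hγ' : γ ≤ 1 / 40) (hγy : γ * Real.log y ≤ 2) {s : ℂ} (hs : 1 < s.re) :
    LSeriesSummable (logCoef Λf χ y γ) s := by
  have := (LSeriesSummable_logCoef_sub hf χ hγ hγ' hγy hs).add (LSeriesSummable_logCoef_zero hκ hf χ y hs)
  rwa [sub_add_cancel] at this

lemma LSeries_charCoef_eq_exp (hκ : 0 < κ) (hf : IsHalaszClass κ f Λf) (χ : DirichletCharacter ℂ q) {y : ℕ} {γ : ℝ}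
    (hγ : 0 ≤ γ) (hγ' : γ ≤ 1 / 80) (hγy : γ * Real.log y ≤ 2) {s : ℂ} (hs : 1 < s.re) :
    LSeries (charCoef f χ y γ) s = cexp (LSeries (logCoef Λf χ y γ) s) := by
  refine LSeries_eq_exp ?_ ?_ ?_ ?_ (fun n hn => logMul_charCoef hf χ y γ hn) hs
  · simp [charCoef, hf.map_one]
  · simp [logCoef, lambda_one hf]
  · refine abscissaOfAbsConv_le_of_forall_lt_LSeriesSummable' fun t ht => ?_
    exact LSeriesSummable_charCoef hκ hf χ hγ hγ' hγy (by exact_mod_cast ht)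
  · refine abscissaOfAbsConv_le_of_forall_lt_LSeriesSummable' fun t ht => ?_
    exact LSeriesSummable_logCoef hκ hf χ hγ (by linarith) hγy (by exact_mod_cast ht)

lemma FserChi_eq_LSeries (f : ℕ → ℂ) (χ : DirichletCharacter ℂ q) (y : ℕ) {s : ℂ} (hs : 1 < s.re) :
    FserChi f χ s = LSeries (charCoef f χ y 0) s := by
  refine tsum_congr fun n => ?_
  rcases eq_or_ne n 0 with rfl | hn
  · have : s ≠ 0 := by rintro rfl; norm_num at hs
    simp [Complex.zero_cpow this]
  · rw [term_of_ne_zero hn]; simp [charCoef]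

/-- Twisting by a small power of the smooth part changes the series by a bounded factor. -/
lemma norm_LSeries_charCoef_le (hκ : 0 < κ) (hf : IsHalaszClass κ f Λf) (χ : DirichletCharacter ℂ q) {y : ℕ} {γ : ℝ}
    (hγ : 0 ≤ γ) (hγ' : γ ≤ 1 / 80) (hγy : γ * Real.log y ≤ 2) {s : ℂ} (hs : 1 < s.re) :
    ‖LSeries (charCoef f χ y γ) s‖ ≤ Real.exp (27 * κ) * ‖FserChi f χ s‖ := by
  have hγ40 : γ ≤ 1 / 40 := by linarith
  rw [FserChi_eq_LSeries f χ y hs, LSeries_charCoef_eq_exp hκ hf χ hγ hγ' hγy hs,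
    LSeries_charCoef_eq_exp hκ hf χ le_rfl (by norm_num) (by simp) hs, Complex.norm_exp, Complex.norm_exp,
    ← Real.exp_add, Real.exp_le_exp, ← sub_le_iff_le_add, ← Complex.sub_re,
    ← LSeries_sub (LSeriesSummable_logCoef hκ hf χ hγ hγ40 hγy hs) (LSeriesSummable_logCoef_zero hκ hf χ y hs)]
  refine (Complex.re_le_norm _).trans ?_
  refine (norm_tsum_le_tsum_norm (LSeriesSummable_logCoef_sub hf χ hγ hγ40 hγy hs).norm).trans ?_
  have h := summable_excess hγ hγ40 hγy
  refine (Summable.tsum_le_tsum (norm_term_logCoef_sub_le hf χ hγ hs)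
    (LSeriesSummable_logCoef_sub hf χ hγ hγ40 hγy hs).norm (h.1.mul_left κ)).trans ?_
  rw [tsum_mul_left, mul_comm 27 κ]
  exact mul_le_mul_of_nonneg_left h.2 hκ.le

lemma exists_norm_FserChi_le (hκ : 0 < κ) : ∃ C : ℝ, 0 < C ∧ ∀ f Λf : ℕ → ℂ, IsHalaszClass κ f Λf →
    ∀ (q : ℕ) (χ : DirichletCharacter ℂ q) (s : ℂ), 1 < s.re → ‖FserChi f χ s‖ ≤ C * (1 + 1 / (s.re - 1)) ^ κ := by
  obtain ⟨C, hC, h⟩ := exists_sum_norm_le hκ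
  refine ⟨C, hC, fun f Λf hf q χ s hs => ?_⟩
  have h1 := h f Λf hf 0 0 1 le_rfl (by norm_num) (by simp) (fun p _ => by simp) (s.re - 1) (by linarith)
  rw [mul_one] at h1
  refine le_trans ?_ h1.2
  have hle : ∀ n, ‖term (charCoef f χ 0 0) s n‖ ≤ ‖f n‖ * (smooth 0 n : ℝ) ^ (0 : ℝ) * (n : ℝ) ^ (-(1 + (s.re - 1))) := by
    intro n
    rw [norm_term_eq_rpow _ hs, show -(1 + (s.re - 1)) = -s.re by ring]
    gcongr
    exact norm_charCoef_le ..
  rw [FserChi_eq_LSeries f χ 0 hs]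
  have hs' : Summable fun n => ‖term (charCoef f χ 0 0) s n‖ := Summable.of_nonneg_of_le (fun _ => norm_nonneg _) hle h1.1
  exact (norm_tsum_le_tsum_norm hs').trans (hs'.tsum_le_tsum hle h1.1)

end TwistedSeries
section LowerBound
open LSeries
open ArithmeticFunction (vonMangoldt)

lemma sum_inv_mul_log_sq_le (N : ℕ) :
    ∑ n ∈ Finset.Icc 1 (N + 1), 1 / ((n : ℝ) * Real.log (n + 1) ^ 2) ≤ 6 - 2 / Real.log (N + 2) := by
  have hlog2 := Real.log_two_gt_d9
  induction N with
  | zero =>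
    have h : (1 : ℝ) / Real.log 2 ≤ 1.45 := by
      rw [div_le_iff₀ (by linarith)]; linarith
    have h0 : 0 ≤ (1 : ℝ) / Real.log 2 := by positivity
    have e1 : (1 : ℝ) / (1 * Real.log (1 + 1) ^ 2) = (1 / Real.log 2) ^ 2 := by
      rw [one_mul, one_add_one_eq_two, one_div_pow]
    have e2 : (2 : ℝ) / Real.log 2 = 2 * (1 / Real.log 2) := by ring
    simp only [zero_add, Finset.Icc_self, Finset.sum_singleton, Nat.cast_one, Nat.cast_zero, e1, e2]
    nlinarith
  | succ N ih =>
    rw [Finset.sum_Icc_succ_top (by omega)]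
    have hN : (0 : ℝ) ≤ N := Nat.cast_nonneg N
    set u := Real.log ((N : ℝ) + 2) with hu
    set v := Real.log ((N : ℝ) + 3) with hv
    have hu0 : 0 < u := Real.log_pos (by linarith)
    have huv : 1 / ((N : ℝ) + 3) ≤ v - u := by
      have h := Real.one_sub_inv_le_log_of_pos (x := ((N : ℝ) + 3) / (N + 2)) (by positivity)
      rw [Real.log_div (by positivity) (by positivity)] at h
      refine le_trans (le_of_eq ?_) h
      field_simp
      ring
    have hv0 : 0 < v := by have : (0 : ℝ) < 1 / ((N : ℝ) + 3) := by positivity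
                           linarith
    have huv' : u ≤ v := by have : (0 : ℝ) < 1 / ((N : ℝ) + 3) := by positivity
                            linarith
    have key : 1 / (((N : ℝ) + 2) * v ^ 2) ≤ 2 / u - 2 / v := by
      have e : 2 / u - 2 / v = 2 * (v - u) / (u * v) := by field_simp
      rw [e, div_le_div_iff₀ (by positivity) (by positivity)]
      have h1 : 1 ≤ 2 * (v - u) * (N + 2) := by
        have h3 : 1 ≤ (v - u) * (N + 3) := by rwa [div_le_iff₀ (by positivity)] at huv
        have h4 : 0 ≤ v - u := by linarith
        nlinarith
      calc 1 * (u * v) ≤ 1 * (v * v) := by nlinarith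
        _ ≤ (2 * (v - u) * (N + 2)) * (v * v) := by gcongr
        _ = _ := by ring
    push_cast
    rw [show (N : ℝ) + 1 + 1 = N + 2 by ring, show (N : ℝ) + 1 + 2 = N + 3 by ring, show (N : ℝ) + 2 + 1 = N + 3 by ring]
    linarith

lemma sum_vonMangoldt_div_log_sq_le (N : ℕ) :
    ∑ n ∈ Finset.Icc 1 N, vonMangoldt n / ((n : ℝ) * Real.log n ^ 2) ≤ 144 := by
  have hw0 : ∀ n : ℕ, 1 ≤ n → 0 < (n : ℝ) * Real.log (n + 1) ^ 2 := fun n hn => by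
    have h : (1 : ℝ) ≤ n := by exact_mod_cast hn
    have : 0 < Real.log ((n : ℝ) + 1) := Real.log_pos (by linarith)
    positivity
  have h1 : ∑ n ∈ Finset.Icc 1 N, vonMangoldt n * (1 / ((n : ℝ) * Real.log (n + 1) ^ 2)) ≤
      ∑ n ∈ Finset.Icc 1 N, 6 * (1 / ((n : ℝ) * Real.log (n + 1) ^ 2)) := by
    refine sum_mul_le_of_partial_sums (a := fun n => vonMangoldt n) (b := fun _ => 6) (fun n hn => ?_)
      (fun n hn => (one_div_pos.2 (hw0 n hn)).le) (fun M _ => ?_) N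
    · refine one_div_le_one_div_of_le (hw0 n hn) ?_
      have h : (1 : ℝ) ≤ n := by exact_mod_cast hn
      have h0 : 0 ≤ Real.log ((n : ℝ) + 1) := Real.log_nonneg (by linarith)
      push_cast
      gcongr <;> linarith
    · refine (sum_vonMangoldt_le M).trans (le_of_eq ?_)
      simp [mul_comm]
  have h2 : ∑ n ∈ Finset.Icc 1 N, 6 * (1 / ((n : ℝ) * Real.log (n + 1) ^ 2)) ≤ 36 := by
    rw [← Finset.mul_sum]
    rcases Nat.eq_zero_or_pos N with rfl | hN
    · simp
    · obtain ⟨M, rfl⟩ := Nat.exists_eq_add_of_le' hN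
      have := sum_inv_mul_log_sq_le M
      have h0 : 0 ≤ 2 / Real.log ((M : ℝ) + 2) := by
        have : 0 ≤ Real.log ((M : ℝ) + 2) := Real.log_nonneg (by linarith [Nat.cast_nonneg (α := ℝ) M])
        positivity
      linarith
  have h3 : ∑ n ∈ Finset.Icc 1 N, vonMangoldt n / ((n : ℝ) * Real.log n ^ 2) ≤
      4 * ∑ n ∈ Finset.Icc 1 N, vonMangoldt n * (1 / ((n : ℝ) * Real.log (n + 1) ^ 2)) := by
    rw [Finset.mul_sum]
    refine Finset.sum_le_sum fun n hn => ?_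
    have hn1 := (Finset.mem_Icc.1 hn).1
    rcases hn1.eq_or_lt with rfl | hn2
    · simp
    · have hn2' : (2 : ℝ) ≤ n := by exact_mod_cast hn2
      have hl : 0 < Real.log n := Real.log_pos (by linarith)
      have hle : Real.log ((n : ℝ) + 1) ≤ 2 * Real.log n := by
        rw [← Real.log_rpow (by linarith)] 
        refine Real.log_le_log (by linarith) ?_
        rw [Real.rpow_two]; nlinarith
      have hl1 : 0 ≤ Real.log ((n : ℝ) + 1) := Real.log_nonneg (by linarith)
      have hk : 1 / ((n : ℝ) * Real.log n ^ 2) ≤ 4 * (1 / ((n : ℝ) * Real.log (n + 1) ^ 2)) := by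
        rw [← mul_div_assoc, mul_one, div_le_div_iff₀ (by positivity) (hw0 n hn1)]
        have : Real.log ((n : ℝ) + 1) ^ 2 ≤ (2 * Real.log n) ^ 2 := pow_le_pow_left₀ hl1 hle 2
        nlinarith
      calc _ = vonMangoldt n * (1 / ((n : ℝ) * Real.log n ^ 2)) := by rw [mul_one_div]
        _ ≤ vonMangoldt n * (4 * (1 / ((n : ℝ) * Real.log (n + 1) ^ 2))) :=
          mul_le_mul_of_nonneg_left hk ArithmeticFunction.vonMangoldt_nonneg
        _ = _ := by ring
  linarith

lemma norm_integral_cexp_mul_I_le {c : ℝ} (hc : 0 < c) :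
    ‖∫ t in (-1 : ℝ)..1, cexp ((-c * I : ℂ) * t)‖ ≤ 2 / c := by
  have hne : (-c * I : ℂ) ≠ 0 := by simp [hc.ne']
  rw [integral_exp_mul_complex hne, norm_div]
  have h1 : ‖(-c * I : ℂ)‖ = c := by simp [abs_of_pos hc]
  rw [h1]
  gcongr
  refine (norm_sub_le _ _).trans ?_
  rw [Complex.norm_exp, Complex.norm_exp]
  simp
  norm_num

variable {κ : ℝ} {f Λf : ℕ → ℂ} {q : ℕ}

lemma continuousOn_LSeries {u : ℕ → ℂ} (h : ∀ s : ℂ, 1 < s.re → LSeriesSummable u s) :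
    ContinuousOn (LSeries u) {s | 1 < s.re} := by
  have h1 : abscissaOfAbsConv u ≤ 1 :=
    abscissaOfAbsConv_le_of_forall_lt_LSeriesSummable' fun t ht => h _ (by exact_mod_cast ht)
  refine (LSeries_differentiableOn u).continuousOn.mono fun s hs => lt_of_le_of_lt h1 ?_
  exact_mod_cast hs

lemma continuousOn_FserChi (hκ : 0 < κ) (hf : IsHalaszClass κ f Λf) (χ : DirichletCharacter ℂ q) :
    ContinuousOn (FserChi f χ) {s | 1 < s.re} :=
  (continuousOn_LSeries fun _ hs => LSeriesSummable_charCoef hκ hf χ (y := 0) le_rfl (by norm_num) (by simp) hs).congr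
    fun _ hs => FserChi_eq_LSeries f χ 0 hs

lemma norm_integral_LSeries_logCoef_le (hκ : 0 < κ) (hf : IsHalaszClass κ f Λf) (χ : DirichletCharacter ℂ q)
    {σ : ℝ} (hσ : 0 < σ) :
    ‖∫ t in (-1 : ℝ)..1, LSeries (logCoef Λf χ 0 0) (1 + (σ : ℂ) + (t : ℂ) * I)‖ ≤ 288 * κ := by
  set u := logCoef Λf χ 0 0 with hu
  have hre : ∀ t : ℝ, (1 + (σ : ℂ) + (t : ℂ) * I).re = 1 + σ := fun t => by simp
  have hre1 : ∀ t : ℝ, 1 < (1 + (σ : ℂ) + (t : ℂ) * I).re := fun t => by rw [hre]; linarith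
  have hcont : Continuous fun t : ℝ => (1 + (σ : ℂ) + (t : ℂ) * I) := by fun_prop
  have hbn : ∀ (n : ℕ) (t : ℝ), ‖term u (1 + (σ : ℂ) + (t : ℂ) * I) n‖ = ‖u n‖ * (n : ℝ) ^ (-(1 + σ)) := fun n t => by
    rw [norm_term_eq_rpow _ (hre1 t), hre]
  have hsum : Summable fun n : ℕ => ‖u n‖ * (n : ℝ) ^ (-(1 + σ)) := by
    have := (LSeriesSummable_logCoef_zero hκ hf χ 0 (hre1 0)).norm
    exact this.congr fun n => hbn n 0
  have hterm : ∀ (n : ℕ), 1 ≤ n → ∀ t : ℝ, term u (1 + (σ : ℂ) + (t : ℂ) * I) n =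
      (u n * (n : ℂ) ^ (-(1 + σ : ℂ))) * cexp ((-(Real.log n : ℝ) * I : ℂ) * t) := by
    intro n hn t
    have hn0 : (n : ℂ) ≠ 0 := by exact_mod_cast (by omega : n ≠ 0)
    rw [term_of_ne_zero (by omega), div_eq_mul_inv, ← Complex.cpow_neg, mul_assoc]
    congr 1
    rw [neg_add, Complex.cpow_add _ _ hn0]
    congr 1
    rw [Complex.cpow_def_of_ne_zero hn0, Complex.natCast_log]
    congr 1
    ring
  have hH := intervalIntegral.hasSum_integral_of_dominated_convergence (a := -1) (b := 1) (μ := volume)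
    (F := fun (n : ℕ) (t : ℝ) => term u (1 + (σ : ℂ) + (t : ℂ) * I) n)
    (f := fun t : ℝ => LSeries u (1 + (σ : ℂ) + (t : ℂ) * I))
    (fun (n : ℕ) (_ : ℝ) => ‖u n‖ * (n : ℝ) ^ (-(1 + σ))) (fun n => ?_) (fun n => ?_) (.of_forall fun t _ => hsum)
    intervalIntegrable_const (.of_forall fun t _ => ?_)
  · have hle : ∀ n : ℕ, ‖∫ t in (-1 : ℝ)..1, term u (1 + (σ : ℂ) + (t : ℂ) * I) n‖ ≤
        2 * κ * (vonMangoldt n / ((n : ℝ) * Real.log n ^ 2)) := by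
      intro n
      rcases Nat.lt_or_ge n 2 with h2 | h2
      · have hz : ∀ t : ℝ, term u (1 + (σ : ℂ) + (t : ℂ) * I) n = 0 := by
          intro t
          interval_cases n
          · simp
          · simp [hu, logCoef]
        simp only [hz, intervalIntegral.integral_zero, norm_zero]
        have : 0 ≤ vonMangoldt n := ArithmeticFunction.vonMangoldt_nonneg
        positivity
      · have hn1 : 1 ≤ n := by omega
        have h2' : (2 : ℝ) ≤ n := by exact_mod_cast h2
        have hl : 0 < Real.log n := Real.log_pos (by linarith)
        have hΛ : 0 ≤ vonMangoldt n := ArithmeticFunction.vonMangoldt_nonneg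
        simp only [hterm n hn1]
        rw [intervalIntegral.integral_const_mul, norm_mul, norm_mul]
        have hp : ‖(n : ℂ) ^ (-(1 + σ : ℂ))‖ ≤ 1 / n := by
          rw [Complex.norm_natCast_cpow_of_pos (by omega), one_div, ← Real.rpow_neg_one]
          refine Real.rpow_le_rpow_of_exponent_le (by linarith) ?_
          simp; linarith
        calc _ ≤ (κ * (vonMangoldt n / Real.log n)) * (1 / n) * (2 / Real.log n) := by
              refine mul_le_mul (mul_le_mul (norm_logCoef_zero_le hf χ 0 n hn1) hp (norm_nonneg _) (by positivity))
                (norm_integral_cexp_mul_I_le hl) (norm_nonneg _) (by positivity)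
          _ = _ := by field_simp
    obtain ⟨hs1, hs2⟩ := summable_of_sum_Icc_le (g := fun n : ℕ => 2 * κ * (vonMangoldt n / ((n : ℝ) * Real.log n ^ 2)))
      (c := 288 * κ) (fun n => by
        have : 0 ≤ vonMangoldt n := ArithmeticFunction.vonMangoldt_nonneg
        positivity) (by simp) (fun N => by
        rw [← Finset.mul_sum]; nlinarith [sum_vonMangoldt_div_log_sq_le N])
    rw [← hH.tsum_eq]
    have hs : Summable fun n : ℕ => ‖∫ t in (-1 : ℝ)..1, term u (1 + (σ : ℂ) + (t : ℂ) * I) n‖ :=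
      Summable.of_nonneg_of_le (fun _ => norm_nonneg _) hle hs1
    exact (norm_tsum_le_tsum_norm hs).trans ((hs.tsum_le_tsum hle hs1).trans hs2)
  · refine Continuous.aestronglyMeasurable ?_
    rcases Nat.eq_zero_or_pos n with rfl | hn
    · simp only [term_zero]; fun_prop
    · simp only [hterm n hn]; fun_prop
  · exact .of_forall fun t _ => (hbn n t).le
  · exact (Summable.of_norm (hsum.congr fun n => (hbn n t).symm)).hasSum

/-- Every twisted series is bounded below somewhere on each short vertical segment. -/
lemma exists_exp_le_norm_FserChi (hκ : 0 < κ) (hf : IsHalaszClass κ f Λf) (χ : DirichletCharacter ℂ q)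
    {σ : ℝ} (hσ : 0 < σ) :
    ∃ t : ℝ, |t| ≤ 1 ∧ Real.exp (-(144 * κ + 1)) ≤ ‖FserChi f χ (1 + (σ : ℂ) + (t : ℂ) * I)‖ := by
  have hre1 : ∀ t : ℝ, 1 < (1 + (σ : ℂ) + (t : ℂ) * I).re := fun t => by simp; linarith
  by_contra! hcon
  have hlt : ∀ t ∈ Set.Icc (-1 : ℝ) 1, (LSeries (logCoef Λf χ 0 0) (1 + (σ : ℂ) + (t : ℂ) * I)).re ≤ -(144 * κ + 1) := by
    intro t ht
    have h := hcon t (abs_le.2 ht)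
    rw [FserChi_eq_LSeries f χ 0 (hre1 t), LSeries_charCoef_eq_exp hκ hf χ le_rfl (by norm_num) (by simp) (hre1 t),
      Complex.norm_exp, Real.exp_lt_exp] at h
    exact h.le
  have hc : Continuous fun t : ℝ => LSeries (logCoef Λf χ 0 0) (1 + (σ : ℂ) + (t : ℂ) * I) :=
    (continuousOn_LSeries fun s hs => LSeriesSummable_logCoef_zero hκ hf χ 0 hs).comp_continuous
      (by fun_prop) hre1
  have h1 := intervalIntegral.integral_mono_on (μ := volume) (a := (-1 : ℝ)) (b := 1) (by norm_num)
    ((Complex.continuous_re.comp hc).intervalIntegrable _ _) intervalIntegrable_const hlt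
  have h2 : ∫ t in (-1 : ℝ)..1, (LSeries (logCoef Λf χ 0 0) (1 + (σ : ℂ) + (t : ℂ) * I)).re =
      (∫ t in (-1 : ℝ)..1, LSeries (logCoef Λf χ 0 0) (1 + (σ : ℂ) + (t : ℂ) * I)).re :=
    Complex.reCLM.intervalIntegral_comp_comm (hc.intervalIntegrable _ _)
  simp only [Function.comp_apply] at h1
  rw [h2, intervalIntegral.integral_const, smul_eq_mul] at h1
  have h3 := norm_integral_LSeries_logCoef_le hκ hf χ hσ
  have h4 := (abs_le.1 (Complex.abs_re_le_norm (∫ t in (-1 : ℝ)..1, LSeries (logCoef Λf χ 0 0) (1 + (σ : ℂ) + (t : ℂ) * I)))).1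
  linarith

end LowerBound
section Maximum

variable {κ : ℝ} {f Λf : ℕ → ℂ} {q : ℕ}

/-- The maximum of `|F_χ(s) / s|` over all characters and the segment `Re s = 1 + σ`, `|Im s| ≤ T`. -/
def maxF (f : ℕ → ℂ) (q : ℕ) (T σ : ℝ) : ℝ :=
  ⨆ p : DirichletCharacter ℂ q × {t : ℝ // |t| ≤ T},
    ‖FserChi f p.1 (1 + (σ : ℂ) + ((p.2 : ℝ) : ℂ) * I) / (1 + (σ : ℂ) + ((p.2 : ℝ) : ℂ) * I)‖

lemma one_add_re (σ t : ℝ) : (1 + (σ : ℂ) + (t : ℂ) * I).re = 1 + σ := by simp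

lemma one_le_norm_one_add {σ : ℝ} (hσ : 0 < σ) (t : ℝ) : 1 ≤ ‖1 + (σ : ℂ) + (t : ℂ) * I‖ := by
  have h := Complex.re_le_norm (1 + (σ : ℂ) + (t : ℂ) * I)
  rw [one_add_re] at h
  linarith

lemma exists_norm_FserChi_div_le (hκ : 0 < κ) : ∃ C : ℝ, 0 < C ∧ ∀ f Λf : ℕ → ℂ, IsHalaszClass κ f Λf →
    ∀ (q : ℕ) (χ : DirichletCharacter ℂ q) (σ t : ℝ), 0 < σ →
    ‖FserChi f χ (1 + (σ : ℂ) + (t : ℂ) * I) / (1 + (σ : ℂ) + (t : ℂ) * I)‖ ≤ C * (1 + 1 / σ) ^ κ := by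
  obtain ⟨C, hC, h⟩ := exists_norm_FserChi_le hκ
  refine ⟨C, hC, fun f Λf hf q χ σ t hσ => ?_⟩
  have h1 := h f Λf hf q χ (1 + (σ : ℂ) + (t : ℂ) * I) (by rw [one_add_re]; linarith)
  rw [one_add_re, add_sub_cancel_left] at h1
  rw [norm_div]
  exact (div_le_self (norm_nonneg _) (one_le_norm_one_add hσ t)).trans h1

lemma bddAbove_maxF (hκ : 0 < κ) (hf : IsHalaszClass κ f Λf) (T : ℝ) {σ : ℝ} (hσ : 0 < σ) :
    BddAbove (Set.range fun p : DirichletCharacter ℂ q × {t : ℝ // |t| ≤ T} =>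
      ‖FserChi f p.1 (1 + (σ : ℂ) + ((p.2 : ℝ) : ℂ) * I) / (1 + (σ : ℂ) + ((p.2 : ℝ) : ℂ) * I)‖) := by
  obtain ⟨C, _, h⟩ := exists_norm_FserChi_div_le hκ
  refine ⟨C * (1 + 1 / σ) ^ κ, ?_⟩
  rintro _ ⟨p, rfl⟩
  exact h f Λf hf q p.1 σ p.2 hσ

lemma norm_FserChi_div_le_maxF (hκ : 0 < κ) (hf : IsHalaszClass κ f Λf) (χ : DirichletCharacter ℂ q)
    {T σ t : ℝ} (hσ : 0 < σ) (ht : |t| ≤ T) :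
    ‖FserChi f χ (1 + (σ : ℂ) + (t : ℂ) * I) / (1 + (σ : ℂ) + (t : ℂ) * I)‖ ≤ maxF f q T σ :=
  le_ciSup (bddAbove_maxF hκ hf T hσ) (χ, ⟨t, ht⟩)

lemma maxF_nonneg (f : ℕ → ℂ) (q : ℕ) (T σ : ℝ) : 0 ≤ maxF f q T σ :=
  Real.iSup_nonneg fun _ => norm_nonneg _

lemma exp_le_maxF (hκ : 0 < κ) (hf : IsHalaszClass κ f Λf) (q : ℕ) {T σ : ℝ} (hσ : 0 < σ) (hσ1 : σ ≤ 1)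
    (hT : 1 ≤ T) : Real.exp (-(144 * κ + 1)) / 3 ≤ maxF f q T σ := by
  obtain ⟨t, ht, h⟩ := exists_exp_le_norm_FserChi hκ hf (1 : DirichletCharacter ℂ q) hσ
  refine le_trans ?_ (norm_FserChi_div_le_maxF hκ hf 1 hσ (ht.trans hT))
  rw [norm_div]
  have h3 : ‖1 + (σ : ℂ) + (t : ℂ) * I‖ ≤ 3 := by
    calc _ ≤ ‖(1 : ℂ)‖ + ‖(σ : ℂ)‖ + ‖(t : ℂ) * I‖ := norm_add₃_le
      _ ≤ 1 + 1 + 1 := by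
        rw [norm_mul, Complex.norm_I, mul_one, Complex.norm_real, Complex.norm_real, norm_one,
          Real.norm_eq_abs, Real.norm_eq_abs, abs_of_pos hσ]
        gcongr
      _ = 3 := by norm_num
  have h0 := one_le_norm_one_add hσ t
  exact div_le_div₀ (norm_nonneg _) h (by linarith) h3

lemma intervalIntegrable_maxF_div (hκ : 0 < κ) (hf : IsHalaszClass κ f Λf) (q : ℕ) {T σ₀ : ℝ} (hσ : 0 < σ₀)
    (hσ1 : σ₀ ≤ 1) (hT : 0 ≤ T) : IntervalIntegrable (fun σ => maxF f q T σ / σ) volume σ₀ 1 := by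
  obtain ⟨C, hC, h⟩ := exists_norm_FserChi_div_le hκ
  have hpos : ∀ σ, 0 < max σ₀ σ := fun σ => lt_max_of_lt_left hσ
  have hlsc : LowerSemicontinuous fun σ => maxF f q T (max σ₀ σ) := by
    refine lowerSemicontinuous_ciSup (fun σ => bddAbove_maxF hκ hf T (hpos σ)) fun p => ?_
    refine Continuous.lowerSemicontinuous ?_
    have hre : ∀ σ : ℝ, 1 < (1 + ((max σ₀ σ : ℝ) : ℂ) + ((p.2 : ℝ) : ℂ) * I).re := fun σ => by
      rw [one_add_re]; linarith [hpos σ]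
    refine Continuous.norm (Continuous.div ?_ (by fun_prop) fun σ h0 => ?_)
    · exact (continuousOn_FserChi hκ hf p.1).comp_continuous (by fun_prop) hre
    · have := hre σ
      rw [h0] at this
      norm_num at this
  have hmeas : Measurable fun σ => maxF f q T (max σ₀ σ) / σ := hlsc.measurable.div measurable_id
  have hne : Nonempty (DirichletCharacter ℂ q × {t : ℝ // |t| ≤ T}) := ⟨(1, ⟨0, by simpa using hT⟩)⟩
  have hint : IntervalIntegrable (fun σ => maxF f q T (max σ₀ σ) / σ) volume σ₀ 1 := by
    rw [intervalIntegrable_iff_integrableOn_Ioc_of_le hσ1]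
    refine Measure.integrableOn_of_bounded (M := C * (1 + 1 / σ₀) ^ κ / σ₀) (by simp)
      hmeas.aestronglyMeasurable ?_
    refine (ae_restrict_iff' measurableSet_Ioc).2 (.of_forall fun σ hs => ?_)
    have hs0 : 0 < σ := hσ.trans hs.1
    rw [norm_div, Real.norm_of_nonneg (maxF_nonneg _ _ _ _), Real.norm_of_nonneg hs0.le, max_eq_right hs.1.le]
    refine div_le_div₀ (by positivity) ?_ hσ hs.1.le
    refine ciSup_le fun p => (h f Λf hf q p.1 σ p.2 hs0).trans ?_
    have := hs.1.le
    gcongr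
  refine hint.congr ?_
  rw [Set.uIoc_of_le hσ1]
  intro σ hs
  simp only [max_eq_right hs.1.le]

end Maximum
section FourierKernels
open Filter Topology FourierTransform

lemma integral_cexp_mul_eq_of_fourier {h g : ℝ → ℂ} (hc : Continuous h) (hi : Integrable h) (hg : Integrable g)
    (hfg : ∀ t : ℝ, ∫ v : ℝ, cexp (-(t * v : ℝ) * I) * h v = g t) (v : ℝ) :
    ∫ t : ℝ, cexp ((t * v : ℝ) * I) * g t = 2 * Real.pi * h v := by
  have hpi : (2 * Real.pi) ≠ 0 := by positivity
  have hF : 𝓕 h = fun ξ : ℝ => g (2 * Real.pi * ξ) := by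
    ext ξ
    rw [Real.fourier_real_eq_integral_exp_smul, ← hfg]
    refine integral_congr_ae (.of_forall fun u => ?_)
    simp only [smul_eq_mul]
    congr 2
    push_cast
    ring
  have hgi : Integrable (𝓕 h) := by
    rw [hF]
    exact hg.comp_mul_left' hpi
  have h1 := congrFun (hc.fourierInv_fourier_eq hi hgi) v
  rw [Real.fourierInv_eq', hF] at h1
  have h2 : ∫ ξ : ℝ, cexp (((2 * Real.pi * inner ℝ ξ v : ℝ) : ℂ) * I) • g (2 * Real.pi * ξ) =
      ∫ ξ : ℝ, (fun t : ℝ => cexp ((t * v : ℝ) * I) * g t) (2 * Real.pi * ξ) := by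
    refine integral_congr_ae (.of_forall fun u => ?_)
    simp only [smul_eq_mul]
    congr 3
    simp
    ring
  rw [h2, Measure.integral_comp_mul_left (fun t : ℝ => cexp ((t * v : ℝ) * I) * g t)] at h1
  rw [← h1, abs_of_pos (by positivity)]
  rw [Complex.real_smul, ← mul_assoc]
  have : (2 * (Real.pi : ℂ)) * (((2 * Real.pi)⁻¹ : ℝ) : ℂ) = 1 := by
    push_cast
    exact mul_inv_cancel₀ (by exact_mod_cast hpi)
  rw [this, one_mul]

lemma integrable_div_one_add_sq {T : ℝ} (hT : 0 < T) : Integrable fun t : ℝ => 1 / (1 + (t / T) ^ 2) := by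
  have := integrable_inv_one_add_sq.comp_div hT.ne'
  simpa [one_div] using this

lemma integral_cexp_mul_exp_neg_abs (t : ℝ) :
    ∫ v : ℝ, cexp (-(t * v : ℝ) * I) * (Real.exp (-|v|) : ℂ) = 2 / (1 + (t : ℂ) ^ 2) := by
  have e1 : ∀ v ∈ Set.Ioi (0 : ℝ), cexp (-(t * v : ℝ) * I) * (Real.exp (-|v|) : ℂ) = cexp ((-1 - t * I) * v) := by
    intro v hv
    rw [abs_of_pos hv, Complex.ofReal_exp, ← Complex.exp_add]
    congr 1; push_cast; ring
  have e2 : ∀ v ∈ Set.Iic (0 : ℝ), cexp (-(t * v : ℝ) * I) * (Real.exp (-|v|) : ℂ) = cexp ((1 - t * I) * v) := by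
    intro v hv
    rw [abs_of_nonpos hv, Complex.ofReal_exp, ← Complex.exp_add]
    congr 1; push_cast; ring
  have r1 : (-1 - t * I : ℂ).re < 0 := by simp
  have r2 : 0 < (1 - t * I : ℂ).re := by simp
  have i1 := (integrableOn_congr_fun e1 measurableSet_Ioi).2 (integrableOn_exp_mul_complex_Ioi r1 0)
  have i2 := (integrableOn_congr_fun e2 measurableSet_Iic).2 (integrableOn_exp_mul_complex_Iic r2 0)
  rw [← intervalIntegral.integral_Iic_add_Ioi i2 i1, setIntegral_congr_fun measurableSet_Ioi e1,
    setIntegral_congr_fun measurableSet_Iic e2, integral_exp_mul_complex_Ioi r1, integral_exp_mul_complex_Iic r2]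
  have n1 : (-1 - t * I : ℂ) ≠ 0 := fun h => by rw [h] at r1; simp at r1
  have n2 : (1 - t * I : ℂ) ≠ 0 := fun h => by rw [h] at r2; simp at r2
  have n3 : (1 + (t : ℂ) ^ 2) ≠ 0 := by
    have : (0 : ℝ) < 1 + t ^ 2 := by positivity
    exact_mod_cast this.ne'
  simp only [Complex.ofReal_zero, mul_zero, Complex.exp_zero]
  field_simp
  ring_nf
  rw [Complex.I_sq]
  ring

lemma integrable_exp_neg_abs : Integrable fun v : ℝ => (Real.exp (-|v|) : ℂ) := by
  suffices h : Integrable fun v : ℝ => Real.exp (-|v|) from h.ofReal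
  have i1 : IntegrableOn (fun v : ℝ => Real.exp (-|v|)) (Set.Ioi 0) :=
    (integrableOn_congr_fun (fun v hv => by simp only [abs_of_pos (Set.mem_Ioi.1 hv), neg_mul, one_mul]) measurableSet_Ioi).2
      (exp_neg_integrableOn_Ioi 0 one_pos)
  have i2 : IntegrableOn (fun v : ℝ => Real.exp (-|v|)) (Set.Iic 0) :=
    (integrableOn_congr_fun (fun v hv => by simp only [abs_of_nonpos (Set.mem_Iic.1 hv), neg_neg]) measurableSet_Iic).2
      (integrableOn_exp_Iic 0)
  rw [← integrableOn_univ, ← Set.Iic_union_Ioi (a := (0 : ℝ))]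
  exact i2.union i1

/-- The Fourier transform of the kernel `1 / (1 + (t / T)²)`. -/
lemma integral_cexp_div_one_add_sq {T : ℝ} (hT : 0 < T) (v : ℝ) :
    ∫ t : ℝ, cexp ((t * v : ℝ) * I) * ((1 / (1 + (t / T) ^ 2) : ℝ) : ℂ) = (Real.pi * T * Real.exp (-(T * |v|)) : ℝ) := by
  have hint : Integrable fun t : ℝ => (2 / (1 + (t : ℂ) ^ 2)) := by
    have := (integrable_inv_one_add_sq.const_mul 2).ofReal (𝕜 := ℂ)
    refine this.congr (.of_forall fun t => ?_)
    simp [div_eq_mul_inv]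
  have h := integral_cexp_mul_eq_of_fourier (h := fun v : ℝ => (Real.exp (-|v|) : ℂ)) (by fun_prop) integrable_exp_neg_abs hint
    integral_cexp_mul_exp_neg_abs (T * v)
  have h2 := Measure.integral_comp_div (fun t : ℝ => cexp ((t * (T * v) : ℝ) * I) * (2 / (1 + (t : ℂ) ^ 2))) T
  rw [h, abs_of_pos hT, abs_mul, abs_of_pos hT] at h2
  have h3 : ∫ t : ℝ, cexp ((t / T * (T * v) : ℝ) * I) * (2 / (1 + ((t / T : ℝ) : ℂ) ^ 2)) =
      2 * ∫ t : ℝ, cexp ((t * v : ℝ) * I) * ((1 / (1 + (t / T) ^ 2) : ℝ) : ℂ) := by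
    rw [← integral_const_mul]
    refine integral_congr_ae (.of_forall fun t => ?_)
    have : t / T * (T * v) = t * v := by field_simp
    simp only [this]
    push_cast
    ring
  rw [h3] at h2
  refine mul_left_cancel₀ (two_ne_zero (α := ℂ)) (h2.trans ?_)
  rw [Complex.real_smul]
  push_cast
  ring

lemma mul_exp_neg_le {c v : ℝ} (hc : 0 < c) : v * Real.exp (-c * v) ≤ 2 / c * Real.exp (-(c / 2) * v) := by
  have h : c / 2 * v ≤ Real.exp (c / 2 * v) := by linarith [Real.add_one_le_exp (c / 2 * v)]
  have h1 : v ≤ 2 / c * Real.exp (c / 2 * v) := by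
    calc v = 2 / c * (c / 2 * v) := by field_simp
      _ ≤ _ := by gcongr
  calc _ ≤ 2 / c * Real.exp (c / 2 * v) * Real.exp (-c * v) := by gcongr
    _ = _ := by rw [mul_assoc, ← Real.exp_add]; ring_nf

lemma integrableOn_mul_exp {c : ℝ} (hc : 0 < c) : IntegrableOn (fun v : ℝ => v * Real.exp (-c * v)) (Set.Ioi 0) := by
  refine Integrable.mono' ((exp_neg_integrableOn_Ioi 0 (half_pos hc)).const_mul (2 / c))
    (by fun_prop) ?_
  refine (ae_restrict_iff' measurableSet_Ioi).2 (.of_forall fun v hv => ?_)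
  rw [Real.norm_of_nonneg (mul_nonneg (Set.mem_Ioi.1 hv).le (Real.exp_pos _).le)]
  exact mul_exp_neg_le hc

lemma integral_mul_cexp_Ioi {z : ℂ} (hz : 0 < z.re) :
    ∫ v in Set.Ioi (0 : ℝ), (v : ℂ) * cexp (-z * v) = 1 / z ^ 2 := by
  have hz0 : z ≠ 0 := fun h => by simp [h] at hz
  have hnorm : ∀ v : ℝ, ‖cexp (-z * v)‖ = Real.exp (-z.re * v) := fun v => by
    rw [Complex.norm_exp]; simp
  have hder : ∀ v ∈ Set.Ici (0 : ℝ), HasDerivAt (fun v : ℝ => -((v : ℂ) / z + 1 / z ^ 2) * cexp (-z * v))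
      ((v : ℂ) * cexp (-z * v)) v := by
    intro v _
    have h1 : HasDerivAt (fun v : ℝ => (v : ℂ)) 1 v := Complex.ofRealCLM.hasDerivAt
    have h2 : HasDerivAt (fun v : ℝ => cexp (-z * v)) (cexp (-z * v) * (-z * 1)) v := (h1.const_mul (-z)).cexp
    have h3 : HasDerivAt (fun v : ℝ => -((v : ℂ) / z + 1 / z ^ 2)) (-(1 / z)) v := ((h1.div_const z).add_const _).neg
    refine (h3.mul h2).congr_deriv ?_
    field_simp
    ring
  have hint : IntegrableOn (fun v : ℝ => (v : ℂ) * cexp (-z * v)) (Set.Ioi 0) := by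
    refine Integrable.mono' (integrableOn_mul_exp hz) (by fun_prop) ?_
    refine (ae_restrict_iff' measurableSet_Ioi).2 (.of_forall fun v hv => ?_)
    rw [norm_mul, hnorm, Complex.norm_real, Real.norm_of_nonneg (Set.mem_Ioi.1 hv).le]
  have hlim : Tendsto (fun v : ℝ => -((v : ℂ) / z + 1 / z ^ 2) * cexp (-z * v)) atTop (𝓝 0) := by
    have hexp : ∀ b : ℝ, 0 < b → Tendsto (fun v : ℝ => Real.exp (-b * v)) atTop (𝓝 0) := fun b hb => by
      refine Real.tendsto_exp_atBot.comp ?_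
      exact tendsto_id.const_mul_atTop_of_neg (neg_lt_zero.2 hb)
    have hg : Tendsto (fun v : ℝ => 1 / ‖z‖ * (2 / z.re * Real.exp (-(z.re / 2) * v)) + 1 / ‖z‖ ^ 2 * Real.exp (-z.re * v))
        atTop (𝓝 0) := by
      have := (((hexp _ (half_pos hz)).const_mul (2 / z.re)).const_mul (1 / ‖z‖)).add ((hexp _ hz).const_mul (1 / ‖z‖ ^ 2))
      simpa using this
    refine squeeze_zero_norm' ?_ hg
    filter_upwards [eventually_ge_atTop 0] with v hv
    rw [norm_mul, norm_neg, hnorm]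
    calc _ ≤ (‖(v : ℂ) / z‖ + ‖1 / z ^ 2‖) * Real.exp (-z.re * v) := by gcongr; exact norm_add_le _ _
      _ = 1 / ‖z‖ * (v * Real.exp (-z.re * v)) + 1 / ‖z‖ ^ 2 * Real.exp (-z.re * v) := by
        rw [norm_div, norm_div, norm_one, norm_pow, Complex.norm_real, Real.norm_of_nonneg hv]; ring
      _ ≤ _ := by
        have := mul_exp_neg_le (v := v) hz
        gcongr
  rw [integral_Ioi_of_hasDerivAt_of_tendsto' hder hint hlim]
  simp

lemma integrable_one_div_sq {c : ℝ} (hc : 0 < c) : Integrable fun t : ℝ => 1 / ((c : ℂ) + t * I) ^ 2 := by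
  have hne : ∀ t : ℝ, ((c : ℂ) + t * I) ≠ 0 := fun t h => by
    have := congrArg Complex.re h; simp at this; linarith
  refine Integrable.mono' ((integrable_div_one_add_sq hc).const_mul (1 / c ^ 2)) ?_ (.of_forall fun t => ?_)
  · refine Continuous.aestronglyMeasurable ?_
    exact continuous_const.div (by fun_prop) fun t => pow_ne_zero 2 (hne t)
  · rw [norm_div, norm_one, norm_pow, ← Complex.normSq_eq_norm_sq, Complex.normSq_add_mul_I]
    refine le_of_eq ?_
    field_simp

/-- Perron's formula with the kernel `1 / s²`. -/
lemma integral_cexp_div_sq {c : ℝ} (hc : 0 < c) (v : ℝ) :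
    ∫ t : ℝ, cexp (((c : ℂ) + t * I) * v) / ((c : ℂ) + t * I) ^ 2 = (2 * Real.pi * max v 0 : ℝ) := by
  set h : ℝ → ℂ := fun v => ((max v 0 * Real.exp (-c * v) : ℝ) : ℂ) with hh
  have hind : ∀ g : ℝ → ℂ, (fun v => g v * h v) = (Set.Ioi (0 : ℝ)).indicator fun v => g v * (v * Real.exp (-c * v) : ℝ) := by
    intro g
    ext v
    by_cases hv : 0 < v
    · rw [Set.indicator_of_mem (Set.mem_Ioi.2 hv)]
      simp only [hh, max_eq_left hv.le]
    · rw [Set.indicator_of_notMem (show v ∉ Set.Ioi 0 from hv)]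
      simp [hh, max_eq_right (not_lt.1 hv)]
  have hcont : Continuous h := by
    refine Complex.continuous_ofReal.comp ?_
    fun_prop
  have hint : Integrable h := by
    have h1 := hind fun _ => 1
    simp only [one_mul] at h1
    have h2 : (fun v => h v) = h := rfl
    rw [← h2, h1, integrable_indicator_iff measurableSet_Ioi]
    exact Integrable.ofReal (integrableOn_mul_exp hc)
  have hfg : ∀ t : ℝ, ∫ v : ℝ, cexp (-(t * v : ℝ) * I) * h v = 1 / ((c : ℂ) + t * I) ^ 2 := by
    intro t
    rw [hind, integral_indicator measurableSet_Ioi, ← integral_mul_cexp_Ioi (z := (c : ℂ) + t * I) (by simpa using hc)]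
    refine setIntegral_congr_fun measurableSet_Ioi fun v _ => ?_
    rw [Complex.ofReal_mul v, Complex.ofReal_exp, mul_left_comm, ← Complex.exp_add]
    congr 2
    push_cast
    ring
  have key := integral_cexp_mul_eq_of_fourier hcont hint (integrable_one_div_sq hc) hfg v
  have h3 : ∫ t : ℝ, cexp (((c : ℂ) + t * I) * v) / ((c : ℂ) + t * I) ^ 2 =
      cexp (c * v) * ∫ t : ℝ, cexp ((t * v : ℝ) * I) * (1 / ((c : ℂ) + t * I) ^ 2) := by
    rw [← integral_const_mul]
    refine integral_congr_ae (.of_forall fun t => ?_)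
    simp only
    rw [mul_one_div, ← mul_div_assoc, ← Complex.exp_add]
    congr 2
    push_cast
    ring
  rw [h3, key]
  simp only [hh]
  have : cexp (c * v) * cexp (-c * v) = 1 := by rw [← Complex.exp_add]; simp
  push_cast
  linear_combination (2 * Real.pi * ((max v 0 : ℝ) : ℂ)) * this

end FourierKernels
section LargeSieve
open ArithmeticFunction (vonMangoldt)
open ComplexConjugate

lemma char_inv_eq_conj {q : ℕ} [NeZero q] (χ : DirichletCharacter ℂ q) {a : ZMod q} (ha : IsUnit a) :
    χ a⁻¹ = conj (χ a) := by
  have h1 : χ a⁻¹ * χ a = 1 := by rw [← map_mul, ZMod.inv_mul_of_unit a ha, map_one]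
  have h2 : ‖χ a‖ = 1 := by
    obtain ⟨u, rfl⟩ := ha
    exact DirichletCharacter.unit_norm_eq_one χ u
  rw [← Complex.inv_eq_conj h2]
  exact eq_inv_of_mul_eq_one_left h1

lemma norm_sum_char_mul_conj_le {q : ℕ} [NeZero q] (a b : ZMod q) :
    ‖∑ χ : DirichletCharacter ℂ q, χ a * conj (χ b)‖ ≤ if b = a then (q.totient : ℝ) else 0 := by
  by_cases hb : IsUnit b
  · have h := DirichletCharacter.sum_char_inv_mul_char_eq ℂ hb a
    have h1 : ∑ χ : DirichletCharacter ℂ q, χ a * conj (χ b) = ∑ χ : DirichletCharacter ℂ q, χ b⁻¹ * χ a :=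
      Finset.sum_congr rfl fun χ _ => by rw [char_inv_eq_conj χ hb, mul_comm]
    rw [h1, h]
    split_ifs <;> simp
  · have h1 : ∑ χ : DirichletCharacter ℂ q, χ a * conj (χ b) = 0 :=
      Finset.sum_eq_zero fun χ _ => by rw [χ.map_nonunit hb, map_zero, mul_zero]
    rw [h1, norm_zero]
    split_ifs <;> simp

/-- The finite Dirichlet polynomial `∑ c(d) χ(d) d^{-it}`, written with exponentials. -/
def charPoly {q : ℕ} (c : ℕ → ℂ) (D : Finset ℕ) (χ : DirichletCharacter ℂ q) (t : ℝ) : ℂ :=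
  ∑ d ∈ D, c d * χ d * cexp (-(t * Real.log d : ℝ) * I)

lemma continuous_charPoly {q : ℕ} (c : ℕ → ℂ) (D : Finset ℕ) (χ : DirichletCharacter ℂ q) :
    Continuous (charPoly c D χ) := by
  unfold charPoly
  fun_prop

lemma norm_charPoly_le {q : ℕ} (c : ℕ → ℂ) (D : Finset ℕ) (χ : DirichletCharacter ℂ q) (t : ℝ) :
    ‖charPoly c D χ t‖ ≤ ∑ d ∈ D, ‖c d‖ := by
  refine (norm_sum_le _ _).trans (Finset.sum_le_sum fun d _ => ?_)
  have h : ‖cexp (-(t * Real.log d : ℝ) * I)‖ = 1 := by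
    rw [← Complex.ofReal_neg, Complex.norm_exp_ofReal_mul_I]
  rw [norm_mul, norm_mul, h, mul_one]
  exact mul_le_of_le_one_right (norm_nonneg _) (DirichletCharacter.norm_le_one χ _)

lemma integrable_norm_charPoly_sq {q : ℕ} (c : ℕ → ℂ) (D : Finset ℕ) (χ : DirichletCharacter ℂ q) {T : ℝ} (hT : 0 < T) :
    Integrable fun t : ℝ => ‖charPoly c D χ t‖ ^ 2 * (1 / (1 + (t / T) ^ 2)) := by
  refine (integrable_div_one_add_sq hT).bdd_mul (c := (∑ d ∈ D, ‖c d‖) ^ 2) ?_ (.of_forall fun t => ?_)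
  · exact ((continuous_charPoly c D χ).norm.pow 2).aestronglyMeasurable
  · rw [norm_pow, norm_norm]
    exact pow_le_pow_left₀ (norm_nonneg _) (norm_charPoly_le c D χ t) 2

lemma integral_norm_charPoly_sq {q : ℕ} (c : ℕ → ℂ) (D : Finset ℕ) (χ : DirichletCharacter ℂ q) {T : ℝ} (hT : 0 < T) :
    ((∫ t : ℝ, ‖charPoly c D χ t‖ ^ 2 * (1 / (1 + (t / T) ^ 2)) : ℝ) : ℂ) =
      ∑ d ∈ D, ∑ e ∈ D, c d * conj (c e) * (χ d * conj (χ e)) *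
        (Real.pi * T * Real.exp (-(T * |Real.log e - Real.log d|)) : ℝ) := by
  have hpt : ∀ t : ℝ, ((‖charPoly c D χ t‖ ^ 2 * (1 / (1 + (t / T) ^ 2)) : ℝ) : ℂ) =
      ∑ d ∈ D, ∑ e ∈ D, c d * conj (c e) * (χ d * conj (χ e)) *
        (cexp ((t * (Real.log e - Real.log d) : ℝ) * I) * ((1 / (1 + (t / T) ^ 2) : ℝ) : ℂ)) := by
    intro t
    rw [Complex.ofReal_mul, Complex.ofReal_pow, ← Complex.mul_conj', charPoly, map_sum, Finset.sum_mul_sum, Finset.sum_mul]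
    refine Finset.sum_congr rfl fun d _ => ?_
    rw [Finset.sum_mul]
    refine Finset.sum_congr rfl fun e _ => ?_
    have he : conj (cexp (-(t * Real.log e : ℝ) * I)) = cexp ((t * Real.log e : ℝ) * I) := by
      rw [← Complex.exp_conj, map_mul, map_neg, Complex.conj_ofReal, Complex.conj_I]
      congr 1; ring
    rw [map_mul, map_mul, he]
    have h2 : cexp ((t * (Real.log e - Real.log d) : ℝ) * I) =
        cexp (-(t * Real.log d : ℝ) * I) * cexp ((t * Real.log e : ℝ) * I) := by
      rw [← Complex.exp_add, mul_sub, Complex.ofReal_sub]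
      congr 1; ring
    rw [h2]
    ring
  have hi : ∀ d e : ℕ, Integrable fun t : ℝ => c d * conj (c e) * (χ d * conj (χ e)) *
        (cexp ((t * (Real.log e - Real.log d) : ℝ) * I) * ((1 / (1 + (t / T) ^ 2) : ℝ) : ℂ)) := by
    intro d e
    refine Integrable.const_mul ?_ _
    refine (integrable_div_one_add_sq hT).ofReal.bdd_mul (c := 1) (by fun_prop) (.of_forall fun t => ?_)
    rw [Complex.norm_exp_ofReal_mul_I]
  rw [← integral_complex_ofReal]
  have h1 : ∫ t : ℝ, ((‖charPoly c D χ t‖ ^ 2 * (1 / (1 + (t / T) ^ 2)) : ℝ) : ℂ) =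
      ∫ t : ℝ, ∑ d ∈ D, ∑ e ∈ D, c d * conj (c e) * (χ d * conj (χ e)) *
        (cexp ((t * (Real.log e - Real.log d) : ℝ) * I) * ((1 / (1 + (t / T) ^ 2) : ℝ) : ℂ)) :=
    integral_congr_ae (.of_forall hpt)
  refine h1.trans ?_
  rw [integral_finsetSum _ fun d _ => integrable_finsetSum _ fun e _ => hi d e]
  refine Finset.sum_congr rfl fun d _ => ?_
  rw [integral_finsetSum _ fun e _ => hi d e]
  refine Finset.sum_congr rfl fun e _ => ?_
  rw [integral_const_mul, integral_cexp_div_one_add_sq hT]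

/-- A hybrid mean value bound for Dirichlet polynomials over all characters modulo `q`. -/
lemma sum_integral_norm_charPoly_sq_le {q : ℕ} [NeZero q] (c : ℕ → ℂ) (D : Finset ℕ) {T : ℝ} (hT : 0 < T) :
    ∑ χ : DirichletCharacter ℂ q, ∫ t : ℝ, ‖charPoly c D χ t‖ ^ 2 * (1 / (1 + (t / T) ^ 2)) ≤
      q.totient * (Real.pi * T) * ∑ d ∈ D, ∑ e ∈ D.filter (fun e => e ≡ d [MOD q]),
        ‖c d‖ * ‖c e‖ * Real.exp (-(T * |Real.log e - Real.log d|)) := by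
  have h0 : ((∑ χ : DirichletCharacter ℂ q, ∫ t : ℝ, ‖charPoly c D χ t‖ ^ 2 * (1 / (1 + (t / T) ^ 2)) : ℝ) : ℂ) =
      ∑ d ∈ D, ∑ e ∈ D, c d * conj (c e) * (∑ χ : DirichletCharacter ℂ q, χ d * conj (χ e)) *
        (Real.pi * T * Real.exp (-(T * |Real.log e - Real.log d|)) : ℝ) := by
    rw [Complex.ofReal_sum]
    simp only [integral_norm_charPoly_sq c D _ hT]
    rw [Finset.sum_comm]
    refine Finset.sum_congr rfl fun d _ => ?_
    rw [Finset.sum_comm]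
    refine Finset.sum_congr rfl fun e _ => ?_
    rw [Finset.mul_sum, Finset.sum_mul]
  have h1 := congrArg norm h0
  rw [Complex.norm_real] at h1
  refine (Real.le_norm_self _).trans (h1.le.trans ?_)
  rw [Finset.mul_sum]
  refine (norm_sum_le _ _).trans (Finset.sum_le_sum fun d _ => (norm_sum_le _ _).trans ?_)
  rw [Finset.mul_sum, Finset.sum_filter]
  refine Finset.sum_le_sum fun e _ => ?_
  have hE : 0 ≤ Real.pi * T * Real.exp (-(T * |Real.log e - Real.log d|)) := by positivity
  rw [norm_mul, norm_mul, norm_mul, Complex.norm_real, Real.norm_of_nonneg hE, RCLike.norm_conj]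
  have h2 := norm_sum_char_mul_conj_le (q := q) (d : ZMod q) (e : ZMod q)
  simp only [ZMod.natCast_eq_natCast_iff] at h2
  calc _ ≤ ‖c d‖ * ‖c e‖ * (if e ≡ d [MOD q] then (q.totient : ℝ) else 0) *
        (Real.pi * T * Real.exp (-(T * |Real.log e - Real.log d|))) := by gcongr
    _ = _ := by split_ifs <;> ring
    
end LargeSieve
section PrimeShells
open ArithmeticFunction (vonMangoldt)

lemma sum_vonMangoldt_shell_le {q b : ℕ} {T D : ℝ} (hq : 1 ≤ q) (hT : 2 ≤ T) (hD : ((q : ℝ) * T) ^ 2 ≤ D) (U : Finset ℕ)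
    (hU : ∀ e ∈ U, e ≡ b [MOD q] ∧ D ≤ e ∧ (e : ℝ) < D * Real.exp (1 / T)) :
    ∑ e ∈ U, vonMangoldt e ≤ 90 * (D / (T * q.totient)) := by
  have hq1 : (1 : ℝ) ≤ q := by exact_mod_cast hq
  have hT0 : 0 < T := by linarith
  have hqT : T ≤ q * T := by nlinarith
  have hTD : T ≤ D := by nlinarith
  have hD0 : 0 < D := by linarith
  set M := ⌈D⌉₊ - 1 with hM
  set H := ⌈2 * D / T⌉₊ with hH
  have hceil : 1 ≤ ⌈D⌉₊ := Nat.one_le_iff_ne_zero.2 (Nat.ceil_pos.2 hD0).ne'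
  have hMD : (M : ℝ) + 1 = ⌈D⌉₊ := by
    rw [hM, Nat.cast_sub hceil]; simp
  have hM1 : (M : ℝ) < D := by linarith [Nat.ceil_lt_add_one hD0.le]
  have hDM : D ≤ M + 1 := by linarith [Nat.le_ceil D]
  have hDT : 1 ≤ D / T := by rwa [le_div_iff₀ hT0, one_mul]
  have e2 : 2 * D / T = 2 * (D / T) := by ring
  have hH1 : (H : ℝ) ≤ 3 * (D / T) := by
    have := Nat.ceil_lt_add_one (a := 2 * D / T) (by positivity)
    linarith
  have hH2 : 2 * (D / T) ≤ H := by rw [← e2]; exact Nat.le_ceil _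
  have hexp : Real.exp (1 / T) ≤ 1 + 2 / T := by
    have h1 : |1 / T| ≤ 1 := by
      rw [abs_of_pos (by positivity), div_le_one hT0]; linarith
    have h2 := Real.abs_exp_sub_one_le h1
    rw [abs_of_pos (show 0 < 1 / T by positivity)] at h2
    have h3 := (abs_le.1 h2).2
    have : 2 / T = 2 * (1 / T) := by ring
    linarith
  have hsub : U ⊆ (Finset.Ioc M (M + H)).filter (fun e => e ≡ b [MOD q]) := by
    intro e he
    obtain ⟨h1, h2, h3⟩ := hU e he
    refine Finset.mem_filter.2 ⟨Finset.mem_Ioc.2 ⟨?_, ?_⟩, h1⟩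
    · have : (M : ℝ) < e := by linarith
      exact_mod_cast this
    · have h4 : D * Real.exp (1 / T) ≤ D + 2 * (D / T) := by
        calc _ ≤ D * (1 + 2 / T) := by gcongr
          _ = _ := by ring
      have : (e : ℝ) < M + H + 1 := by linarith
      have h5 : e < M + H + 1 := by exact_mod_cast this
      omega
  have hDT2 : D / T ≤ D / 2 := by gcongr
  have hN : ((M + H : ℕ) : ℝ) ≤ 4 * D := by push_cast; linarith
  have hN1 : 1 ≤ M + H := by
    have h0 : (0 : ℝ) < H := by linarith
    have : 0 < H := by exact_mod_cast h0
    omega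
  have hsq : (q : ℝ) * ((M + H : ℕ) : ℝ) ^ (1 / 2 : ℝ) ≤ H := by
    rw [← Real.sqrt_eq_rpow]
    have h1 : (q : ℝ) * T ≤ Real.sqrt D := Real.le_sqrt_of_sq_le hD
    have h2 : Real.sqrt ((M + H : ℕ) : ℝ) ≤ 2 * Real.sqrt D := by
      refine (Real.sqrt_le_sqrt hN).trans (le_of_eq ?_)
      rw [Real.sqrt_mul (by norm_num), show (4 : ℝ) = 2 ^ 2 by norm_num, Real.sqrt_sq (by norm_num)]
    have h3 : (q : ℝ) * (2 * Real.sqrt D) ≤ 2 * (D / T) := by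
      rw [← mul_div_assoc, le_div_iff₀ hT0]
      nlinarith [Real.sq_sqrt hD0.le, Real.sqrt_nonneg D]
    calc _ ≤ (q : ℝ) * (2 * Real.sqrt D) := by gcongr
      _ ≤ _ := h3.trans hH2
  have hφ : (0 : ℝ) < q.totient := by exact_mod_cast Nat.totient_pos.2 hq
  calc _ ≤ ∑ e ∈ (Finset.Ioc M (M + H)).filter (fun e => e ≡ b [MOD q]), vonMangoldt e :=
        Finset.sum_le_sum_of_subset_of_nonneg hsub fun _ _ _ => ArithmeticFunction.vonMangoldt_nonneg
    _ ≤ 30 * (H / q.totient) := sum_vonMangoldt_modEq_le q b M H (M + H) hq hN1 le_rfl hsq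
    _ ≤ 30 * (3 * (D / T) / q.totient) := by gcongr
    _ = _ := by field_simp; ring

lemma sum_exp_neg_half_le (s : Finset ℕ) : ∑ j ∈ s, Real.exp (-(j / 2 : ℝ)) ≤ 3 := by
  have hr : Real.exp (-(1 / 2 : ℝ)) ≤ 2 / 3 := by
    rw [Real.exp_neg, inv_le_comm₀ (Real.exp_pos _) (by norm_num)]
    linarith [Real.add_one_le_exp (1 / 2 : ℝ)]
  have e : ∀ j : ℕ, Real.exp (-(j / 2 : ℝ)) = Real.exp (-(1 / 2 : ℝ)) ^ j := fun j => by
    rw [← Real.exp_nat_mul]; ring_nf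
  calc _ ≤ ∑ j ∈ s, (2 / 3 : ℝ) ^ j := Finset.sum_le_sum fun j _ => by
        rw [e]; exact pow_le_pow_left₀ (Real.exp_pos _).le hr j
    _ ≤ ∑' j : ℕ, (2 / 3 : ℝ) ^ j :=
      (summable_geometric_of_lt_one (by norm_num) (by norm_num)).sum_le_tsum s fun _ _ => by positivity
    _ = 3 := by rw [tsum_geometric_of_lt_one (by norm_num) (by norm_num)]; norm_num

/-- Primes in a progression beyond `d`, weighted by `(d / e)^T`. -/
lemma sum_vonMangoldt_mul_exp_le {q b d : ℕ} {T : ℝ} (hq : 1 ≤ q) (hT : 2 ≤ T) (hd : ((q : ℝ) * T) ^ 2 ≤ d) (U : Finset ℕ)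
    (hU : ∀ e ∈ U, e ≡ b [MOD q] ∧ d ≤ e) :
    ∑ e ∈ U, vonMangoldt e * Real.exp (-(T * (Real.log e - Real.log d))) ≤ 270 * (d / (T * q.totient)) := by
  have hT0 : 0 < T := by linarith
  have hq1 : (1 : ℝ) ≤ q := by exact_mod_cast hq
  have hd0 : (0 : ℝ) < d := lt_of_lt_of_le (by positivity) hd
  have hφ : (0 : ℝ) < q.totient := by exact_mod_cast Nat.totient_pos.2 hq
  set j : ℕ → ℕ := fun e => ⌊T * (Real.log e - Real.log d)⌋₊ with hj
  have hlog : ∀ e ∈ U, 0 ≤ T * (Real.log e - Real.log d) := fun e he => by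
    have : Real.log d ≤ Real.log e := Real.log_le_log hd0 (by exact_mod_cast (hU e he).2)
    exact mul_nonneg hT0.le (by linarith)
  have hshell : ∀ i : ℕ, ∑ e ∈ U.filter (fun e => j e = i), vonMangoldt e ≤
      90 * (d * Real.exp (i / T) / (T * q.totient)) := by
    intro i
    refine sum_vonMangoldt_shell_le hq hT (b := b) ?_ _ fun e he => ?_
    · have : (1 : ℝ) ≤ Real.exp (i / T) := Real.one_le_exp (by positivity)
      nlinarith
    · obtain ⟨heU, hei⟩ := Finset.mem_filter.1 he
      have he0 : (0 : ℝ) < e := lt_of_lt_of_le hd0 (by exact_mod_cast (hU e heU).2)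
      have h1 : (i : ℝ) ≤ T * (Real.log e - Real.log d) := by rw [← hei]; exact Nat.floor_le (hlog e heU)
      have h2 : T * (Real.log e - Real.log d) < i + 1 := by rw [← hei]; exact Nat.lt_floor_add_one _
      have h1' : (i : ℝ) / T ≤ Real.log e - Real.log d := by rw [div_le_iff₀ hT0]; linarith
      have h2' : Real.log e - Real.log d < i / T + 1 / T := by
        rw [← add_div, lt_div_iff₀ hT0]; linarith
      refine ⟨(hU e heU).1, ?_, ?_⟩
      · calc (d : ℝ) * Real.exp (i / T) = Real.exp (Real.log d + i / T) := by rw [Real.exp_add, Real.exp_log hd0]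
          _ ≤ Real.exp (Real.log e) := Real.exp_le_exp.2 (by linarith)
          _ = e := Real.exp_log he0
      · calc (e : ℝ) = Real.exp (Real.log e) := (Real.exp_log he0).symm
          _ < Real.exp (Real.log d + i / T + 1 / T) := Real.exp_lt_exp.2 (by linarith)
          _ = _ := by rw [Real.exp_add, Real.exp_add, Real.exp_log hd0]
  rw [← Finset.sum_fiberwise_of_maps_to (s := U) (t := U.image j) (g := j) fun e he => Finset.mem_image_of_mem j he]
  calc _ ≤ ∑ i ∈ U.image j, 90 * (d / (T * q.totient)) * Real.exp (-(i / 2 : ℝ)) := by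
        refine Finset.sum_le_sum fun i _ => ?_
        calc _ ≤ ∑ e ∈ U.filter (fun e => j e = i), vonMangoldt e * Real.exp (-i) := by
              refine Finset.sum_le_sum fun e he => ?_
              obtain ⟨heU, hei⟩ := Finset.mem_filter.1 he
              refine mul_le_mul_of_nonneg_left ?_ ArithmeticFunction.vonMangoldt_nonneg
              rw [Real.exp_le_exp, neg_le_neg_iff, ← hei]
              exact Nat.floor_le (hlog e heU)
          _ ≤ 90 * (d * Real.exp (i / T) / (T * q.totient)) * Real.exp (-i) := by
              rw [← Finset.sum_mul]
              exact mul_le_mul_of_nonneg_right (hshell i) (Real.exp_pos _).le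
          _ = 90 * (d / (T * q.totient)) * Real.exp (i / T + -i) := by rw [Real.exp_add]; ring
          _ ≤ _ := by
              refine mul_le_mul_of_nonneg_left (Real.exp_le_exp.2 ?_) (by positivity)
              have : (i : ℝ) / T ≤ i / 2 := by gcongr
              linarith
    _ ≤ 90 * (d / (T * q.totient)) * 3 := by
        rw [← Finset.mul_sum]
        exact mul_le_mul_of_nonneg_left (sum_exp_neg_half_le _) (by positivity)
    _ = _ := by ring

lemma sum_sum_le_two_mul {F : ℕ → ℕ → ℝ} (hF : ∀ d e, 0 ≤ F d e) (hsymm : ∀ d e, F d e = F e d) (q : ℕ) (D : Finset ℕ) :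
    ∑ d ∈ D, ∑ e ∈ D.filter (fun e => e ≡ d [MOD q]), F d e ≤
      2 * ∑ d ∈ D, ∑ e ∈ D.filter (fun e => e ≡ d [MOD q] ∧ d ≤ e), F d e := by
  simp only [Finset.sum_filter]
  have h1 : ∑ d ∈ D, ∑ e ∈ D, (if e ≡ d [MOD q] then F d e else 0) ≤
      ∑ d ∈ D, ∑ e ∈ D, ((if e ≡ d [MOD q] ∧ d ≤ e then F d e else 0) + if d ≡ e [MOD q] ∧ e ≤ d then F e d else 0) := by
    refine Finset.sum_le_sum fun d _ => Finset.sum_le_sum fun e _ => ?_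
    by_cases h : e ≡ d [MOD q]
    · have h' := h.symm
      rcases le_total d e with hde | hde
      · simp only [h, hde, h', and_self, if_true, true_and]
        have := hF e d
        split_ifs <;> linarith
      · simp only [h, hde, h', and_self, if_true, true_and, hsymm e d]
        have := hF d e
        split_ifs <;> linarith
    · have h' : ¬ d ≡ e [MOD q] := fun hh => h hh.symm
      simp [h, h']
  refine h1.trans (le_of_eq ?_)
  simp only [Finset.sum_add_distrib]
  rw [two_mul]
  congr 1
  exact Finset.sum_comm

/-- Mean value bound for Dirichlet polynomials supported on large primes. -/
lemma sum_integral_norm_charPoly_sq_le_sum_vonMangoldt {q : ℕ} [NeZero q] {κ ρ T : ℝ} (hρ : 0 ≤ ρ) (hT : 2 ≤ T)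
    (c : ℕ → ℂ) (D : Finset ℕ) (hD : ∀ d ∈ D, ((q : ℝ) * T) ^ 2 ≤ d)
    (hc : ∀ d ∈ D, ‖c d‖ ≤ κ * vonMangoldt d * (d : ℝ) ^ (-ρ)) :
    ∑ χ : DirichletCharacter ℂ q, ∫ t : ℝ, ‖charPoly c D χ t‖ ^ 2 * (1 / (1 + (t / T) ^ 2)) ≤
      540 * Real.pi * κ ^ 2 * ∑ d ∈ D, vonMangoldt d * (d : ℝ) ^ (1 - 2 * ρ) := by
  have hT0 : 0 < T := by linarith
  have hq : 1 ≤ q := Nat.one_le_iff_ne_zero.2 (NeZero.ne q)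
  have hq1 : (1 : ℝ) ≤ q := by exact_mod_cast hq
  have hφ : (0 : ℝ) < q.totient := by exact_mod_cast Nat.totient_pos.2 hq
  refine (sum_integral_norm_charPoly_sq_le c D hT0).trans ?_
  have h1 := sum_sum_le_two_mul (F := fun d e => ‖c d‖ * ‖c e‖ * Real.exp (-(T * |Real.log e - Real.log d|)))
    (fun _ _ => by positivity) (fun d e => by rw [abs_sub_comm, mul_comm ‖c d‖]) q D
  have h2 : ∀ d ∈ D, ∑ e ∈ D.filter (fun e => e ≡ d [MOD q] ∧ d ≤ e),
      ‖c d‖ * ‖c e‖ * Real.exp (-(T * |Real.log e - Real.log d|)) ≤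
      κ ^ 2 * 270 / (T * q.totient) * (vonMangoldt d * (d : ℝ) ^ (1 - 2 * ρ)) := by
    intro d hd
    have hd0 : (0 : ℝ) < d := lt_of_lt_of_le (by positivity) (hD d hd)
    have hΛ : ∀ n : ℕ, 0 ≤ vonMangoldt n := fun n => ArithmeticFunction.vonMangoldt_nonneg
    calc _ ≤ ∑ e ∈ D.filter (fun e => e ≡ d [MOD q] ∧ d ≤ e), (κ ^ 2 * (vonMangoldt d * (d : ℝ) ^ (-(2 * ρ)))) *
          (vonMangoldt e * Real.exp (-(T * (Real.log e - Real.log d)))) := by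
          refine Finset.sum_le_sum fun e he => ?_
          obtain ⟨heD, -, hde⟩ := Finset.mem_filter.1 he
          have hde' : (d : ℝ) ≤ e := by exact_mod_cast hde
          have hl : Real.log d ≤ Real.log e := Real.log_le_log hd0 hde'
          rw [abs_of_nonneg (by linarith)]
          have he1 : ‖c e‖ ≤ κ * vonMangoldt e * (d : ℝ) ^ (-ρ) ∨ κ * vonMangoldt e < 0 := by
            by_cases hk : κ * vonMangoldt e < 0
            · exact Or.inr hk
            · exact Or.inl ((hc e heD).trans (mul_le_mul_of_nonneg_left
                (Real.rpow_le_rpow_of_nonpos hd0 hde' (by linarith)) (not_lt.1 hk)))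
          rcases he1 with he1 | he1
          · calc _ ≤ (κ * vonMangoldt d * (d : ℝ) ^ (-ρ)) * (κ * vonMangoldt e * (d : ℝ) ^ (-ρ)) *
                  Real.exp (-(T * (Real.log e - Real.log d))) := by
                  refine mul_le_mul_of_nonneg_right ?_ (Real.exp_pos _).le
                  exact mul_le_mul (hc d hd) he1 (norm_nonneg _) ((norm_nonneg _).trans (hc d hd))
              _ = _ := by
                  rw [show -(2 * ρ) = -ρ + -ρ by ring, Real.rpow_add hd0]; ring
          · have h0 := hc e heD
            have h3 : κ * vonMangoldt e * (e : ℝ) ^ (-ρ) ≤ 0 := mul_nonpos_of_nonpos_of_nonneg he1.le (by positivity)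
            linarith [norm_nonneg (c e), mul_neg_of_neg_of_pos he1 (Real.rpow_pos_of_pos (hd0.trans_le hde') (-ρ))]
      _ ≤ (κ ^ 2 * (vonMangoldt d * (d : ℝ) ^ (-(2 * ρ)))) * (270 * (d / (T * q.totient))) := by
          rw [← Finset.mul_sum]
          have := hΛ d
          refine mul_le_mul_of_nonneg_left ?_ (by positivity)
          exact sum_vonMangoldt_mul_exp_le hq hT (hD d hd) _ fun e he => (Finset.mem_filter.1 he).2
      _ = _ := by
          rw [sub_eq_add_neg, Real.rpow_add hd0, Real.rpow_one]
          field_simp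
  calc _ ≤ q.totient * (Real.pi * T) * (2 * ∑ d ∈ D, κ ^ 2 * 270 / (T * q.totient) * (vonMangoldt d * (d : ℝ) ^ (1 - 2 * ρ))) :=
        mul_le_mul_of_nonneg_left (h1.trans (mul_le_mul_of_nonneg_left (Finset.sum_le_sum h2) (by norm_num))) (by positivity)
    _ = _ := by
        rw [← Finset.mul_sum]
        field_simp
        ring

end PrimeShells
section Perron

open LSeries

/-- The Mellin transform `e^{Ls} (e^{δs} - 1) / (δ s²)` of the smooth cutoff `weight L δ`. -/
def perronKernel (L δ : ℝ) (s : ℂ) : ℂ := cexp (L * s) * (cexp (δ * s) - 1) / (δ * s ^ 2)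

lemma norm_cexp_mul_sub_one_le {δ : ℝ} (hδ : 0 < δ) (hδ1 : δ ≤ 1) {s : ℂ} (hs : s.re ≤ 2) :
    ‖cexp (δ * s) - 1‖ ≤ 9 := by
  have h1 : ‖cexp (δ * s)‖ ≤ Real.exp 2 := by
    rw [Complex.norm_exp]
    refine Real.exp_le_exp.2 ?_
    simp only [Complex.re_ofReal_mul]
    rcases le_total s.re 0 with h | h <;> nlinarith
  have h2 : Real.exp 2 ≤ 8 := by
    have := Real.exp_one_lt_d9
    have h3 : Real.exp 2 = Real.exp 1 * Real.exp 1 := by rw [← Real.exp_add]; norm_num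
    rw [h3]; nlinarith [Real.exp_pos 1]
  calc ‖cexp (δ * s) - 1‖ ≤ ‖cexp (δ * s)‖ + ‖(1 : ℂ)‖ := norm_sub_le _ _
    _ ≤ 8 + 1 := by rw [norm_one]; linarith
    _ = 9 := by norm_num

lemma norm_cexp_mul_sub_one_le_mul {δ : ℝ} (hδ : 0 < δ) (hδ1 : δ ≤ 1) {s : ℂ} (hs : s.re ≤ 2) :
    ‖cexp (δ * s) - 1‖ ≤ 9 * (δ * ‖s‖) := by
  have h : ‖(δ : ℂ) * s‖ = δ * ‖s‖ := by
    rw [norm_mul, Complex.norm_real, Real.norm_of_nonneg hδ.le]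
  rcases le_total (δ * ‖s‖) 1 with h1 | h1
  · have := Complex.norm_exp_sub_one_le (x := (δ : ℂ) * s) (by rw [h]; exact h1)
    rw [h] at this
    have : 0 ≤ δ * ‖s‖ := by positivity
    linarith
  · have := norm_cexp_mul_sub_one_le hδ hδ1 hs
    linarith

lemma norm_perronKernel (L : ℝ) {δ : ℝ} (hδ : 0 < δ) (s : ℂ) :
    ‖perronKernel L δ s‖ = Real.exp (L * s.re) * ‖cexp (δ * s) - 1‖ / (δ * ‖s‖ ^ 2) := by
  rw [perronKernel, norm_div, norm_mul, norm_mul, norm_pow, Complex.norm_exp, Complex.re_ofReal_mul,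
    Complex.norm_real, Real.norm_of_nonneg hδ.le]

lemma norm_perronKernel_le (L : ℝ) {δ : ℝ} (hδ : 0 < δ) (hδ1 : δ ≤ 1) {s : ℂ} (hs : s.re ≤ 2) :
    ‖perronKernel L δ s‖ ≤ 9 * Real.exp (L * s.re) / (δ * ‖s‖ ^ 2) := by
  rw [norm_perronKernel L hδ, mul_comm 9]
  gcongr
  exact norm_cexp_mul_sub_one_le hδ hδ1 hs

lemma norm_perronKernel_le' (L : ℝ) {δ : ℝ} (hδ : 0 < δ) (hδ1 : δ ≤ 1) {s : ℂ} (hs : s.re ≤ 2) (hs0 : s ≠ 0) :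
    ‖perronKernel L δ s‖ ≤ 9 * Real.exp (L * s.re) / ‖s‖ := by
  have h0 : 0 < ‖s‖ := norm_pos_iff.2 hs0
  calc ‖perronKernel L δ s‖ ≤ Real.exp (L * s.re) * (9 * (δ * ‖s‖)) / (δ * ‖s‖ ^ 2) := by
        rw [norm_perronKernel L hδ]
        gcongr
        exact norm_cexp_mul_sub_one_le_mul hδ hδ1 hs
    _ = 9 * Real.exp (L * s.re) / ‖s‖ := by field_simp

lemma vertical_ne_zero {c : ℝ} (hc : 0 < c) (t : ℝ) : (c : ℂ) + t * I ≠ 0 := fun h => by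
  have := congrArg Complex.re h
  simp at this
  exact hc.ne' this

lemma continuous_perronKernel (L δ : ℝ) {c : ℝ} (hδ : 0 < δ) (hc : 0 < c) :
    Continuous fun t : ℝ => perronKernel L δ ((c : ℂ) + t * I) := by
  unfold perronKernel
  refine Continuous.div (by fun_prop) (by fun_prop) fun t => ?_
  exact mul_ne_zero (by exact_mod_cast hδ.ne') (pow_ne_zero _ (vertical_ne_zero hc t))

lemma integrable_perronKernel (L : ℝ) {δ c : ℝ} (hδ : 0 < δ) (hδ1 : δ ≤ 1) (hc : 0 < c) (hc2 : c ≤ 2) :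
    Integrable fun t : ℝ => perronKernel L δ ((c : ℂ) + t * I) := by
  refine Integrable.mono' ((integrable_one_div_sq hc).norm.const_mul (9 * Real.exp (L * c) / δ))
    (continuous_perronKernel L δ hδ hc).aestronglyMeasurable (Filter.Eventually.of_forall fun t => ?_)
  have h := norm_perronKernel_le L hδ hδ1 (s := (c : ℂ) + t * I) (by simpa using hc2)
  have hre : ((c : ℂ) + t * I).re = c := by simp
  rw [hre] at h
  refine h.trans (le_of_eq ?_)
  rw [norm_div, norm_one, norm_pow]
  have : ‖(c : ℂ) + t * I‖ ≠ 0 := norm_ne_zero_iff.2 (vertical_ne_zero hc t)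
  field_simp

lemma integral_cpow_mul_perronKernel (L : ℝ) {δ c : ℝ} (hδ : 0 < δ) (hc : 0 < c) {n : ℕ} (hn : n ≠ 0) :
    ∫ t : ℝ, (n : ℂ) ^ (-((c : ℂ) + t * I)) * perronKernel L δ ((c : ℂ) + t * I) =
      (2 * Real.pi * weight L δ n : ℝ) := by
  have hint (v : ℝ) : Integrable fun t : ℝ => cexp (((c : ℂ) + t * I) * v) / ((c : ℂ) + t * I) ^ 2 := by
    refine Integrable.mono' ((integrable_one_div_sq hc).norm.const_mul (Real.exp (c * v)))
      (Continuous.aestronglyMeasurable ?_) (Filter.Eventually.of_forall fun t => ?_)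
    · exact Continuous.div (by fun_prop) (by fun_prop) fun t => pow_ne_zero _ (vertical_ne_zero hc t)
    · rw [norm_div, norm_div, norm_one, Complex.norm_exp, mul_one_div]
      simp
  have h1 := integral_cexp_div_sq hc (L + δ - Real.log n)
  have h2 := integral_cexp_div_sq hc (L - Real.log n)
  have key (t : ℝ) : (n : ℂ) ^ (-((c : ℂ) + t * I)) * perronKernel L δ ((c : ℂ) + t * I) =
      (1 / δ : ℂ) * (cexp (((c : ℂ) + t * I) * (L + δ - Real.log n : ℝ)) / ((c : ℂ) + t * I) ^ 2
        - cexp (((c : ℂ) + t * I) * (L - Real.log n : ℝ)) / ((c : ℂ) + t * I) ^ 2) := by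
    set s : ℂ := (c : ℂ) + t * I with hs
    have hs0 : s ≠ 0 := vertical_ne_zero hc t
    clear_value s
    have e1 : cexp (s * (L + δ - Real.log n : ℝ)) = (n : ℂ) ^ (-s) * (cexp (L * s) * cexp (δ * s)) := by
      rw [Complex.cpow_def_of_ne_zero (by exact_mod_cast hn), ← Complex.natCast_log, ← Complex.exp_add,
        ← Complex.exp_add]
      congr 1
      rw [Complex.ofReal_sub, Complex.ofReal_add]; ring
    have e2 : cexp (s * (L - Real.log n : ℝ)) = (n : ℂ) ^ (-s) * cexp (L * s) := by
      rw [Complex.cpow_def_of_ne_zero (by exact_mod_cast hn), ← Complex.natCast_log, ← Complex.exp_add]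
      congr 1
      rw [Complex.ofReal_sub]; ring
    rw [e1, e2, perronKernel]
    have hδ0 : (δ : ℂ) ≠ 0 := by exact_mod_cast hδ.ne'
    field_simp
  simp_rw [key]
  rw [integral_const_mul, integral_sub (hint _) (hint _), h1, h2, ← Complex.ofReal_sub]
  rw [weight]
  push_cast
  ring

lemma sum_mul_weight_eq_integral {u : ℕ → ℂ} {L δ c : ℝ} (hδ : 0 < δ) (hδ1 : δ ≤ 1) (hc : 0 < c) (hc2 : c ≤ 2)
    (hu : LSeriesSummable u c) {X : ℕ} (hX : ∀ n : ℕ, X < n → L + δ ≤ Real.log n) :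
    ∑ n ∈ Finset.Icc 1 X, (weight L δ n : ℂ) * u n =
      (1 / (2 * Real.pi) : ℝ) * ∫ t : ℝ, LSeries u ((c : ℂ) + t * I) * perronKernel L δ ((c : ℂ) + t * I) := by
  have hK := integrable_perronKernel L hδ hδ1 hc hc2
  have hnorm (n : ℕ) (t : ℝ) : ‖term u ((c : ℂ) + t * I) n‖ = ‖term u c n‖ := by
    rw [norm_term_eq, norm_term_eq]; simp
  have hterm (n : ℕ) : Continuous fun t : ℝ => term u ((c : ℂ) + t * I) n := by
    rcases eq_or_ne n 0 with rfl | hn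
    · simp only [term_zero]; exact continuous_const
    · simp only [term_of_ne_zero hn]
      refine Continuous.div continuous_const ?_ fun t => ?_
      · exact Continuous.const_cpow (by fun_prop) (Or.inl (by exact_mod_cast hn))
      · exact Complex.cpow_ne_zero_iff.2 (Or.inl (by exact_mod_cast hn))
  have hint (n : ℕ) : Integrable fun t : ℝ => term u ((c : ℂ) + t * I) n * perronKernel L δ ((c : ℂ) + t * I) :=
    hK.bdd_mul (c := ‖term u c n‖) (hterm n).aestronglyMeasurable
      (Filter.Eventually.of_forall fun t => (hnorm n t).le)
  have hsum : Summable fun n : ℕ => ∫ t : ℝ, ‖term u ((c : ℂ) + t * I) n * perronKernel L δ ((c : ℂ) + t * I)‖ := by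
    have : (fun n : ℕ => ∫ t : ℝ, ‖term u ((c : ℂ) + t * I) n * perronKernel L δ ((c : ℂ) + t * I)‖) =
        fun n => ‖term u c n‖ * ∫ t : ℝ, ‖perronKernel L δ ((c : ℂ) + t * I)‖ := by
      funext n
      rw [← integral_const_mul]
      exact integral_congr_ae (Filter.Eventually.of_forall fun t => by
        simp only [norm_mul, hnorm])
    rw [this]
    exact hu.norm.mul_right _
  have hmain := hasSum_integral_of_summable_integral_norm hint hsum
  have hval (n : ℕ) : ∫ t : ℝ, term u ((c : ℂ) + t * I) n * perronKernel L δ ((c : ℂ) + t * I) =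
      if n = 0 then 0 else (2 * Real.pi : ℝ) * ((weight L δ n : ℂ) * u n) := by
    split_ifs with hn
    · subst hn; simp
    · simp_rw [term_of_ne_zero hn, div_eq_mul_inv, ← Complex.cpow_neg, mul_assoc]
      rw [integral_const_mul, integral_cpow_mul_perronKernel L hδ hc hn]
      push_cast; ring
  have hright : ∀ t : ℝ, ∑' n : ℕ, term u ((c : ℂ) + t * I) n * perronKernel L δ ((c : ℂ) + t * I) =
      LSeries u ((c : ℂ) + t * I) * perronKernel L δ ((c : ℂ) + t * I) := fun t => by
    rw [tsum_mul_right]; rfl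
  simp_rw [hright, hval] at hmain
  have hfin : ∀ n ∉ Finset.Icc 1 X, (if n = 0 then (0 : ℂ) else (2 * Real.pi : ℝ) * ((weight L δ n : ℂ) * u n)) = 0 := by
    intro n hn
    split_ifs with h0
    · rfl
    · rw [Finset.mem_Icc, not_and_or] at hn
      rw [weight_eq_zero hδ (hX n (by omega))]
      simp
  have huniq := hmain.unique (hasSum_sum_of_ne_finset_zero hfin)
  rw [huniq, Finset.mul_sum]
  refine Finset.sum_congr rfl fun n hn => ?_
  rw [if_neg (by have := (Finset.mem_Icc.1 hn).1; omega), ← mul_assoc, ← Complex.ofReal_mul,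
    one_div_mul_cancel (by positivity), Complex.ofReal_one, one_mul]

end Perron
section TwistedPerron

open LSeries

variable {κ : ℝ} {f Λf : ℕ → ℂ} {q : ℕ}

/-- The coefficients `Λf(d) d^{-α}`, restricted to `d ≤ X` without prime factors `≤ y`. -/
def primeCoef (Λf : ℕ → ℂ) (y X : ℕ) (α : ℝ) (d : ℕ) : ℂ :=
  if d ≤ X then largePart Λf y d * ((d : ℝ) ^ (-α) : ℝ) else 0

lemma largePart_eq_zero_of_le {y d : ℕ} (hd : d ≠ 0) (h : d ≤ y) : largePart Λf y d = 0 := by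
  unfold largePart
  rw [if_neg]
  have := Nat.minFac_le (Nat.pos_of_ne_zero hd)
  omega

lemma term_primeCoef (χ : DirichletCharacter ℂ q) (y X : ℕ) (α : ℝ) (s : ℂ) {n : ℕ}
    (hn : n ∉ Finset.Ioc y X) : term ((fun n : ℕ => χ n) * primeCoef Λf y X α) s n = 0 := by
  rcases eq_or_ne n 0 with rfl | h0
  · rw [term_zero]
  · have : primeCoef Λf y X α n = 0 := by
      unfold primeCoef
      split_ifs with h
      · rw [Finset.mem_Ioc] at hn
        rw [largePart_eq_zero_of_le h0 (by omega), zero_mul]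
      · rfl
    rw [term_of_ne_zero h0, Pi.mul_apply, this, mul_zero, zero_div]

lemma LSeriesSummable_primeCoef (χ : DirichletCharacter ℂ q) (y X : ℕ) (α : ℝ) (s : ℂ) :
    LSeriesSummable ((fun n : ℕ => χ n) * primeCoef Λf y X α) s :=
  summable_of_ne_finset_zero fun _ hn => term_primeCoef χ y X α s hn

lemma LSeries_primeCoef (χ : DirichletCharacter ℂ q) (y X : ℕ) (α c t : ℝ) :
    LSeries ((fun n : ℕ => χ n) * primeCoef Λf y X α) ((c : ℂ) + t * I) =
      charPoly (fun d => largePart Λf y d * ((d : ℝ) ^ (-(α + c)) : ℝ)) (Finset.Ioc y X) χ t := by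
  rw [LSeries, tsum_eq_sum fun n hn => term_primeCoef χ y X α _ hn, charPoly]
  refine Finset.sum_congr rfl fun n hn => ?_
  rw [Finset.mem_Ioc] at hn
  have h0 : n ≠ 0 := by omega
  have hpos : (0 : ℝ) < n := by positivity
  rw [term_of_ne_zero h0, Pi.mul_apply, primeCoef, if_pos hn.2, neg_add, Real.rpow_add hpos, div_eq_mul_inv,
    ← Complex.cpow_neg, neg_add, Complex.cpow_add _ _ (by exact_mod_cast h0)]
  have e1 : (n : ℂ) ^ (-(c : ℂ)) = ((n : ℝ) ^ (-c) : ℝ) := by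
    rw [Complex.ofReal_cpow hpos.le]; push_cast; rfl
  have e2 : (n : ℂ) ^ (-((t : ℂ) * I)) = cexp (-(t * Real.log n : ℝ) * I) := by
    rw [Complex.cpow_def_of_ne_zero (by exact_mod_cast h0), ← Complex.natCast_log]
    congr 1
    rw [Complex.ofReal_mul]; ring
  rw [e1, e2, Complex.ofReal_mul (_ ^ _)]
  ring

/-- The coefficients `f(n) χ(n)` twisted by a power of the rough part of `n`. -/
def roughCoef (f : ℕ → ℂ) (y : ℕ) (γ : ℝ) (n : ℕ) : ℂ := f n * ((rough y n : ℝ) ^ (-γ) : ℝ)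

lemma term_roughCoef (f : ℕ → ℂ) (χ : DirichletCharacter ℂ q) (y : ℕ) (γ : ℝ) (s : ℂ) (n : ℕ) :
    term ((fun n : ℕ => χ n) * roughCoef f y γ) s n = term (charCoef f χ y γ) (s + γ) n := by
  rcases eq_or_ne n 0 with rfl | h0
  · rw [term_zero, term_zero]
  · have hpos : (0 : ℝ) < n := by positivity
    have hr : (0 : ℝ) < rough y n := by exact_mod_cast rough_pos y n
    have hs : (0 : ℝ) < smooth y n := by exact_mod_cast smooth_pos y n
    rw [term_of_ne_zero h0, term_of_ne_zero h0, Pi.mul_apply, roughCoef, charCoef,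
      Complex.cpow_add _ _ (by exact_mod_cast h0)]
    have e1 : (n : ℂ) ^ (γ : ℂ) = ((n : ℝ) ^ γ : ℝ) := by
      rw [Complex.ofReal_cpow hpos.le]; push_cast; rfl
    have e2 : (n : ℝ) = smooth y n * rough y n := by
      exact_mod_cast (smooth_mul_rough y h0).symm
    have e3 : (n : ℝ) ^ γ = (smooth y n : ℝ) ^ γ * (rough y n : ℝ) ^ γ := by
      rw [e2, Real.mul_rpow hs.le hr.le]
    have e4 : ((rough y n : ℝ) ^ (-γ) : ℝ) = ((smooth y n : ℝ) ^ γ) / (n : ℝ) ^ γ := by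
      rw [e3, Real.rpow_neg hr.le]
      have := (Real.rpow_pos_of_pos hs γ).ne'
      field_simp
    rw [e1, e4]
    push_cast
    field_simp

lemma LSeriesSummable_roughCoef (hκ : 0 < κ) (hf : IsHalaszClass κ f Λf) (χ : DirichletCharacter ℂ q) {y : ℕ} {γ : ℝ}
    (hγ : 0 ≤ γ) (hγ' : γ ≤ 1 / 80) (hγy : γ * Real.log y ≤ 2) {s : ℂ} (hs : 1 < (s + γ).re) :
    LSeriesSummable ((fun n : ℕ => χ n) * roughCoef f y γ) s := by
  have h := LSeriesSummable_charCoef hκ hf χ hγ hγ' hγy hs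
  rw [LSeriesSummable] at h ⊢
  convert h using 1
  funext n
  exact term_roughCoef f χ y γ s n

lemma sum_bilinear_eq_integral (hκ : 0 < κ) (hf : IsHalaszClass κ f Λf) (χ : DirichletCharacter ℂ q) {y X : ℕ}
    {α γ c L δ : ℝ} (hγ : 0 ≤ γ) (hγ' : γ ≤ 1 / 80) (hγy : γ * Real.log y ≤ 2) (hδ : 0 < δ) (hδ1 : δ ≤ 1)
    (hc : 0 < c) (hc2 : c ≤ 2) (hcγ : 1 < c + γ) (hX : ∀ n : ℕ, X < n → L + δ ≤ Real.log n) :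
    ∑ n ∈ Finset.Icc 1 X, (weight L δ n : ℂ) * (χ n * ∑ p ∈ n.divisorsAntidiagonal, largePart Λf y p.1 *
        ((p.1 : ℝ) ^ (-α) : ℝ) * roughConv f Λf y p.2 γ γ) =
      (1 / (2 * Real.pi) : ℝ) * ∫ t : ℝ,
        charPoly (fun d => largePart Λf y d * ((d : ℝ) ^ (-(α + c)) : ℝ)) (Finset.Ioc y X) χ t *
        (charPoly (fun d => largePart Λf y d * ((d : ℝ) ^ (-(γ + c)) : ℝ)) (Finset.Ioc y X) χ t *
          LSeries (charCoef f χ y γ) ((c + γ : ℝ) + t * I)) * perronKernel L δ ((c : ℂ) + t * I) := by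
  set A := (fun n : ℕ => χ n) * primeCoef Λf y X α with hA
  set B := (fun n : ℕ => χ n) * primeCoef Λf y X γ with hB
  set G := (fun n : ℕ => χ n) * roughCoef f y γ with hG
  have hAs (s : ℂ) : LSeriesSummable A s := LSeriesSummable_primeCoef χ y X α s
  have hBs (s : ℂ) : LSeriesSummable B s := LSeriesSummable_primeCoef χ y X γ s
  have hGs {s : ℂ} (hs : 1 < (s + γ).re) : LSeriesSummable G s :=
    LSeriesSummable_roughCoef hκ hf χ hγ hγ' hγy hs
  have hre (t : ℝ) : 1 < ((c : ℂ) + t * I + γ).re := by simpa using hcγ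
  have hu : LSeriesSummable (LSeries.convolution A (LSeries.convolution B G)) c :=
    (hAs _).convolution ((hBs _).convolution (hGs (by simpa using hcγ)))
  have hmain := sum_mul_weight_eq_integral hδ hδ1 hc hc2 hu hX
  have hleft : ∀ n ∈ Finset.Icc 1 X, (LSeries.convolution A (LSeries.convolution B G)) n = χ n * ∑ p ∈ n.divisorsAntidiagonal, largePart Λf y p.1 *
        ((p.1 : ℝ) ^ (-α) : ℝ) * roughConv f Λf y p.2 γ γ := by
    intro n hn
    rw [hA, hB, hG, DirichletCharacter.mul_convolution_distrib, DirichletCharacter.mul_convolution_distrib,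
      Pi.mul_apply, LSeries.convolution_def]
    congr 1
    have hle {m : ℕ} (hm : m ≠ 0) {p : ℕ × ℕ} (hp : p ∈ m.divisorsAntidiagonal) : p.1 ≤ m ∧ p.2 ≤ m ∧ p.2 ≠ 0 := by
      have h := Nat.mem_divisorsAntidiagonal.1 hp
      have h1 : p.1 ∣ m := ⟨p.2, h.1.symm⟩
      have h2 : p.2 ∣ m := ⟨p.1, by rw [mul_comm]; exact h.1.symm⟩
      exact ⟨Nat.le_of_dvd (Nat.pos_of_ne_zero hm) h1, Nat.le_of_dvd (Nat.pos_of_ne_zero hm) h2,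
        fun h0 => by rw [h0, mul_zero] at h; exact hm h.1.symm⟩
    rw [Finset.mem_Icc] at hn
    refine Finset.sum_congr rfl fun p hp => ?_
    obtain ⟨hp1, hp2, hp0⟩ := hle (by omega) hp
    rw [primeCoef, if_pos (hp1.trans hn.2), LSeries.convolution_def, roughConv]
    congr 1
    refine Finset.sum_congr rfl fun r hr => ?_
    obtain ⟨hr1, -, -⟩ := hle hp0 hr
    rw [primeCoef, if_pos (hr1.trans (hp2.trans hn.2)), roughCoef]
  rw [Finset.sum_congr rfl fun n hn => by rw [← hleft n hn], hmain]
  congr 1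
  refine integral_congr_ae (Filter.Eventually.of_forall fun t => ?_)
  beta_reduce
  rw [LSeries_convolution' (hAs _) ((hBs _).convolution (hGs (hre t))), LSeries_convolution' (hBs _) (hGs (hre t)),
    hA, hB, LSeries_primeCoef, LSeries_primeCoef]
  have : LSeries G ((c : ℂ) + t * I) = LSeries (charCoef f χ y γ) ((c + γ : ℝ) + t * I) := by
    refine tsum_congr fun n => ?_
    rw [hG, term_roughCoef]
    congr 1
    push_cast; ring
  rw [this]

lemma norm_bilinear_le [NeZero q] (f Λf : ℕ → ℂ) (y : ℕ) (w : ℕ → ℝ) {a : ℕ} (ha : a.Coprime q) (x δ α β : ℝ) :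
    ‖bilinear f Λf y w (progr q a x δ) α β‖ ≤ 1 / q.totient * ∑ χ : DirichletCharacter ℂ q,
      ‖∑ n ∈ Finset.Icc 1 ⌊x * Real.exp δ⌋₊, (w n : ℂ) * (χ n * ∑ p ∈ n.divisorsAntidiagonal, largePart Λf y p.1 *
        ((p.1 : ℝ) ^ (-α) : ℝ) * roughConv f Λf y p.2 (α + β) (α + β))‖ := by
  have hau : IsUnit (a : ZMod q) := (ZMod.isUnit_iff_coprime a q).2 ha
  have hφ : (q.totient : ℂ) ≠ 0 := by
    exact_mod_cast (Nat.totient_pos.2 (Nat.pos_of_ne_zero (NeZero.ne q))).ne'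
  set b : ℕ → ℂ := fun n => ∑ p ∈ n.divisorsAntidiagonal, largePart Λf y p.1 *
        ((p.1 : ℝ) ^ (-α) : ℝ) * roughConv f Λf y p.2 (α + β) (α + β)
  have h1 : bilinear f Λf y w (progr q a x δ) α β = (1 / q.totient : ℂ) * ∑ χ : DirichletCharacter ℂ q,
      χ (a : ZMod q)⁻¹ * ∑ n ∈ Finset.Icc 1 ⌊x * Real.exp δ⌋₊, (w n : ℂ) * (χ n * b n) := by
    simp_rw [Finset.mul_sum]
    rw [Finset.sum_comm, bilinear, progr, Finset.sum_filter]
    refine Finset.sum_congr rfl fun n _ => ?_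
    have h2 := DirichletCharacter.sum_char_inv_mul_char_eq ℂ hau (n : ZMod q)
    have h3 : ∑ χ : DirichletCharacter ℂ q, (1 / q.totient : ℂ) * (χ (a : ZMod q)⁻¹ * ((w n : ℂ) * (χ n * b n))) =
        (1 / q.totient : ℂ) * ((w n : ℂ) * b n) * ∑ χ : DirichletCharacter ℂ q, χ (a : ZMod q)⁻¹ * χ n := by
      rw [Finset.mul_sum]
      exact Finset.sum_congr rfl fun χ _ => by ring
    rw [h3, h2]
    simp only [ZMod.natCast_eq_natCast_iff]
    by_cases h : n ≡ a [MOD q]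
    · rw [if_pos h, if_pos h.symm]
      field_simp
      rfl
    · rw [if_neg h, if_neg fun h' => h h'.symm, mul_zero]
  rw [h1, norm_mul, norm_div, norm_one, Complex.norm_natCast]
  refine mul_le_mul_of_nonneg_left ((norm_sum_le _ _).trans (Finset.sum_le_sum fun χ _ => ?_)) (by positivity)
  rw [norm_mul]
  exact mul_le_of_le_one_left (norm_nonneg _) (DirichletCharacter.norm_le_one χ _)

end TwistedPerron
section KernelBounds

open ArithmeticFunction (vonMangoldt)

variable {κ : ℝ} {f Λf : ℕ → ℂ} {q : ℕ}

lemma sum_rpow_sub_one_le {β : ℝ} (hβ : 0 < β) (hβ1 : β ≤ 1) (N : ℕ) :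
    ∑ n ∈ Finset.Icc 1 N, (n : ℝ) ^ (β - 1) ≤ (N : ℝ) ^ β / β := by
  induction N with
  | zero => simp [Real.zero_rpow hβ.ne']
  | succ N ih =>
    rw [Finset.sum_Icc_succ_top (by omega)]
    refine (add_le_add_left ih _).trans ?_
    have hN : (0 : ℝ) < (N + 1 : ℕ) := by positivity
    have h1 : (N : ℝ) = (N + 1 : ℕ) * (1 + -(1 / (N + 1 : ℕ))) := by
      push_cast; field_simp; ring
    have h2 : (-1 : ℝ) ≤ -(1 / (N + 1 : ℕ)) := by
      rw [neg_le_neg_iff, div_le_one hN]; push_cast; linarith [Nat.cast_nonneg (α := ℝ) N]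
    have h3 : (N : ℝ) ^ β ≤ ((N + 1 : ℕ) : ℝ) ^ β * (1 + β * -(1 / (N + 1 : ℕ))) := by
      conv_lhs => rw [h1]
      rw [Real.mul_rpow hN.le (by linarith)]
      gcongr
      exact rpow_one_add_le_one_add_mul_self h2 hβ.le hβ1
    have h4 : ((N + 1 : ℕ) : ℝ) ^ (β - 1) = ((N + 1 : ℕ) : ℝ) ^ β / (N + 1 : ℕ) := by
      rw [Real.rpow_sub hN, Real.rpow_one]
    rw [h4, div_add' _ _ _ hβ.ne', div_le_div_iff_of_pos_right hβ]
    have h5 : ((N + 1 : ℕ) : ℝ) ^ β * (1 + β * -(1 / (N + 1 : ℕ))) =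
      ((N + 1 : ℕ) : ℝ) ^ β - ((N + 1 : ℕ) : ℝ) ^ β / (N + 1 : ℕ) * β := by ring
    linarith

lemma sum_vonMangoldt_mul_rpow_le {β L : ℝ} (hβ : 0 ≤ β) (hβ1 : β ≤ 1) (hL : 1 ≤ L) {X : ℕ} (hX : 1 ≤ X)
    (hXL : Real.log X ≤ L + 1) :
    ∑ n ∈ Finset.Icc 1 X, vonMangoldt n * (n : ℝ) ^ (-1 - 2 / L + β) ≤ 12 * (X : ℝ) ^ β / (1 / L + β / 2) := by
  have hL0 : 0 < L := by linarith
  have hX0 : (0 : ℝ) < X := by exact_mod_cast hX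
  have hσ : 0 < 1 / L + β / 2 := by positivity
  have hXβ : 0 < (X : ℝ) ^ β := Real.rpow_pos_of_pos hX0 β
  rw [le_div_iff₀ hσ]
  rcases le_total (1 / L) β with h | h
  · have hβ0 : 0 < β := lt_of_lt_of_le (by positivity) h
    have h1 : ∑ n ∈ Finset.Icc 1 X, vonMangoldt n * (n : ℝ) ^ (-1 - 2 / L + β) ≤
        ∑ n ∈ Finset.Icc 1 X, vonMangoldt n * (n : ℝ) ^ (β - 1) := by
      refine Finset.sum_le_sum fun n hn => ?_
      have hn1 : (1 : ℝ) ≤ n := by exact_mod_cast (Finset.mem_Icc.1 hn).1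
      refine mul_le_mul_of_nonneg_left (Real.rpow_le_rpow_of_exponent_le hn1 ?_) ArithmeticFunction.vonMangoldt_nonneg
      have : 0 < 2 / L := by positivity
      linarith
    have h2 : ∑ n ∈ Finset.Icc 1 X, vonMangoldt n * (n : ℝ) ^ (β - 1) ≤ ∑ n ∈ Finset.Icc 1 X, 6 * (n : ℝ) ^ (β - 1) := by
      refine sum_mul_le_of_partial_sums (a := fun n => vonMangoldt n) (b := fun _ => 6)
        (w := fun n => (n : ℝ) ^ (β - 1)) (fun n hn => ?_) (fun n _ => by positivity) (fun N _ => ?_) X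
      · have hn0 : (0 : ℝ) < n := by exact_mod_cast hn
        exact Real.rpow_le_rpow_of_nonpos hn0 (by push_cast; linarith) (by linarith)
      · refine (sum_vonMangoldt_le N).trans (le_of_eq ?_)
        rw [Finset.sum_const, Nat.card_Icc, nsmul_eq_mul, Nat.add_sub_cancel]; ring
    rw [← Finset.mul_sum] at h2
    have h3 := sum_rpow_sub_one_le hβ0 hβ1 X
    calc (∑ n ∈ Finset.Icc 1 X, vonMangoldt n * (n : ℝ) ^ (-1 - 2 / L + β)) * (1 / L + β / 2)
        ≤ (6 * ((X : ℝ) ^ β / β)) * (β + β / 2) := by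
          gcongr
          linarith
      _ = 9 * (X : ℝ) ^ β := by field_simp; ring
      _ ≤ 12 * (X : ℝ) ^ β := by linarith
  · have h1 : ∑ n ∈ Finset.Icc 1 X, vonMangoldt n * (n : ℝ) ^ (-1 - 2 / L + β) ≤
        ∑ n ∈ Finset.Icc 1 X, (X : ℝ) ^ β * (vonMangoldt n / n) := by
      refine Finset.sum_le_sum fun n hn => ?_
      have hn1 : (1 : ℝ) ≤ n := by exact_mod_cast (Finset.mem_Icc.1 hn).1
      have hnX : (n : ℝ) ≤ X := by exact_mod_cast (Finset.mem_Icc.1 hn).2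
      have hn0 : (0 : ℝ) < n := by linarith
      have e1 : (n : ℝ) ^ (-1 - 2 / L + β) ≤ (n : ℝ) ^ (β - 1) := by
        refine Real.rpow_le_rpow_of_exponent_le hn1 ?_
        have : 0 < 2 / L := by positivity
        linarith
      have e2 : (n : ℝ) ^ (β - 1) ≤ (X : ℝ) ^ β / n := by
        rw [Real.rpow_sub hn0, Real.rpow_one]
        gcongr
      calc vonMangoldt n * (n : ℝ) ^ (-1 - 2 / L + β) ≤ vonMangoldt n * ((X : ℝ) ^ β / n) :=
            mul_le_mul_of_nonneg_left (e1.trans e2) ArithmeticFunction.vonMangoldt_nonneg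
        _ = (X : ℝ) ^ β * (vonMangoldt n / n) := by ring
    rw [← Finset.mul_sum] at h1
    have h2 := sum_vonMangoldt_div_le hX
    calc (∑ n ∈ Finset.Icc 1 X, vonMangoldt n * (n : ℝ) ^ (-1 - 2 / L + β)) * (1 / L + β / 2)
        ≤ ((X : ℝ) ^ β * (8 * L)) * (1 / L + 1 / L / 2) := by
          gcongr
          refine h1.trans ?_
          gcongr
          linarith
      _ = 12 * (X : ℝ) ^ β := by field_simp; ring

lemma exists_norm_LSeries_mul_perronKernel_le (hκ : 0 < κ) : ∃ C : ℝ, 0 < C ∧ ∀ f Λf : ℕ → ℂ, IsHalaszClass κ f Λf →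
    ∀ (q : ℕ) (χ : DirichletCharacter ℂ q) (y : ℕ) (γ c σ L : ℝ), 0 ≤ γ → γ ≤ 1 / 80 → γ * Real.log y ≤ 2 →
    1 / 2 ≤ c → 1 ≤ L → 1 ≤ L ^ κ → 1 / L ≤ σ → σ ≤ 1 / 2 → c + γ = 1 + σ → ∀ t : ℝ,
    ‖LSeries (charCoef f χ y γ) ((c + γ : ℝ) + t * I)‖ * ‖perronKernel L (1 / L ^ κ) ((c : ℂ) + t * I)‖ ≤
      C * (Real.exp (L * c) * maxF f q (L ^ κ) σ) * (1 / (1 + (t / L ^ κ) ^ 2)) := by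
  obtain ⟨C₁, hC₁, h₁⟩ := exists_norm_FserChi_le hκ
  refine ⟨Real.exp (27 * κ) * (36 + 54 * C₁ * 2 ^ κ * Real.exp (144 * κ + 1)), by positivity, ?_⟩
  intro f Λf hf q χ y γ c σ L hγ hγ' hγy hc hL hT hσL hσ hcγ t
  have hL0 : 0 < L := by linarith
  have hσ0 : 0 < σ := lt_of_lt_of_le (by positivity) hσL
  set T := L ^ κ with hTd
  have hT0 : 0 < T := by linarith
  set s : ℂ := (c : ℂ) + t * I with hs
  have hsre : s.re = c := by simp [hs]
  have hsim : s.im = t := by simp [hs]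
  have hs0 : s ≠ 0 := vertical_ne_zero (by linarith) t
  have hsn : 0 < ‖s‖ := norm_pos_iff.2 hs0
  have hcs : c ≤ ‖s‖ := hsre ▸ Complex.re_le_norm s
  have hts : |t| ≤ ‖s‖ := hsim ▸ Complex.abs_im_le_norm s
  have hz : ((c + γ : ℝ) : ℂ) + t * I = 1 + (σ : ℂ) + (t : ℂ) * I := by rw [hcγ]; push_cast; ring
  have hG : ‖LSeries (charCoef f χ y γ) ((c + γ : ℝ) + t * I)‖ ≤
      Real.exp (27 * κ) * ‖FserChi f χ (1 + (σ : ℂ) + (t : ℂ) * I)‖ := by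
    rw [hz]
    exact norm_LSeries_charCoef_le hκ hf χ hγ hγ' hγy (by rw [one_add_re]; linarith)
  have hM0 := maxF_nonneg f q T σ
  set M := maxF f q T σ with hMd
  set F := FserChi f χ (1 + (σ : ℂ) + (t : ℂ) * I) with hF
  set E := Real.exp (L * c) with hE
  have hE0 : 0 < E := Real.exp_pos _
  have hδ1 : 1 / T ≤ 1 := by rw [div_le_one hT0]; exact hT
  have hc2 : s.re ≤ 2 := by rw [hsre]; linarith
  have hden : 0 < 1 + (t / T) ^ 2 := by positivity
  have key : ‖F‖ * ‖perronKernel L (1 / T) s‖ ≤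
      (36 + 54 * C₁ * 2 ^ κ * Real.exp (144 * κ + 1)) * (E * M) * (1 / (1 + (t / T) ^ 2)) := by
    rcases le_or_gt |t| T with ht | ht
    · have h1 := norm_FserChi_div_le_maxF hκ hf χ hσ0 ht
      have hw1 := one_le_norm_one_add hσ0 t
      have hw2 : ‖1 + (σ : ℂ) + (t : ℂ) * I‖ ≤ 2 * ‖s‖ := by
        have : 1 + (σ : ℂ) + (t : ℂ) * I = s + (γ : ℂ) := by rw [← hz, hs]; push_cast; ring
        rw [this]
        refine (norm_add_le _ _).trans ?_
        rw [Complex.norm_real, Real.norm_of_nonneg hγ]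
        linarith
      rw [norm_div, div_le_iff₀ (by linarith)] at h1
      have h2 : ‖F‖ ≤ M * (2 * ‖s‖) := h1.trans (by gcongr)
      have h3 := norm_perronKernel_le' L (δ := 1 / T) (by positivity) hδ1 hc2 hs0
      rw [hsre] at h3
      have h4 : (1 : ℝ) / 2 ≤ 1 / (1 + (t / T) ^ 2) := by
        refine one_div_le_one_div_of_le hden ?_
        have : (t / T) ^ 2 ≤ 1 := by
          rw [sq_le_one_iff_abs_le_one, abs_div, abs_of_pos hT0, div_le_one hT0]; exact ht
        linarith
      calc ‖F‖ * ‖perronKernel L (1 / T) s‖ ≤ (M * (2 * ‖s‖)) * (9 * E / ‖s‖) := by gcongr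
        _ = 36 * (E * M) * (1 / 2) := by field_simp; ring
        _ ≤ (36 + 54 * C₁ * 2 ^ κ * Real.exp (144 * κ + 1)) * (E * M) * (1 / (1 + (t / T) ^ 2)) := by
          gcongr
          have : 0 ≤ 54 * C₁ * 2 ^ κ * Real.exp (144 * κ + 1) := by positivity
          linarith
    · have h1 := h₁ f Λf hf q χ (1 + (σ : ℂ) + (t : ℂ) * I) (by rw [one_add_re]; linarith)
      rw [one_add_re, add_sub_cancel_left] at h1
      have h2 : (1 + 1 / σ) ^ κ ≤ 2 ^ κ * T := by
        rw [hTd, ← Real.mul_rpow (by norm_num) hL0.le]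
        refine Real.rpow_le_rpow (by positivity) ?_ hκ.le
        have : 1 / σ ≤ L := by rw [div_le_iff₀ hσ0]; rw [div_le_iff₀ hL0] at hσL; linarith
        linarith
      have h3 := norm_perronKernel_le L (δ := 1 / T) (by positivity) hδ1 hc2
      rw [hsre] at h3
      have ht0 : 0 < |t| := lt_trans hT0 ht
      have h4 : 9 * E / (1 / T * ‖s‖ ^ 2) ≤ 9 * E * T / |t| ^ 2 := by
        calc 9 * E / (1 / T * ‖s‖ ^ 2) ≤ 9 * E / (1 / T * |t| ^ 2) := by gcongr
          _ = 9 * E * T / |t| ^ 2 := by field_simp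
      have h5 : T ^ 2 / |t| ^ 2 ≤ 2 * (1 / (1 + (t / T) ^ 2)) := by
        rw [mul_one_div, div_le_div_iff₀ (by positivity) hden]
        have e : T ^ 2 * (1 + (t / T) ^ 2) = T ^ 2 + |t| ^ 2 := by rw [sq_abs]; field_simp
        rw [e]
        have : T ^ 2 ≤ |t| ^ 2 := by gcongr
        linarith
      have h6 := exp_le_maxF hκ hf q hσ0 (by linarith) hT
      have h7 : 1 ≤ 3 * Real.exp (144 * κ + 1) * M := by
        rw [div_le_iff₀ (by norm_num), Real.exp_neg, inv_le_iff_one_le_mul₀ (Real.exp_pos _)] at h6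
        linarith
      calc ‖F‖ * ‖perronKernel L (1 / T) s‖ ≤ (C₁ * (2 ^ κ * T)) * (9 * E * T / |t| ^ 2) := by
            gcongr
            · exact h1.trans (by gcongr)
            · exact h3.trans h4
        _ = 9 * C₁ * 2 ^ κ * E * (T ^ 2 / |t| ^ 2) * 1 := by ring
        _ ≤ 9 * C₁ * 2 ^ κ * E * (2 * (1 / (1 + (t / T) ^ 2))) * (3 * Real.exp (144 * κ + 1) * M) := by
          gcongr
        _ = (54 * C₁ * 2 ^ κ * Real.exp (144 * κ + 1)) * (E * M) * (1 / (1 + (t / T) ^ 2)) := by ring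
        _ ≤ (36 + 54 * C₁ * 2 ^ κ * Real.exp (144 * κ + 1)) * (E * M) * (1 / (1 + (t / T) ^ 2)) := by
          gcongr
          linarith
  calc _ ≤ Real.exp (27 * κ) * ‖F‖ * ‖perronKernel L (1 / T) s‖ := by gcongr
    _ = Real.exp (27 * κ) * (‖F‖ * ‖perronKernel L (1 / T) s‖) := by ring
    _ ≤ Real.exp (27 * κ) * _ := mul_le_mul_of_nonneg_left key (Real.exp_pos _).le
    _ = _ := by ring

end KernelBounds
section BilinearBound

open ArithmeticFunction (vonMangoldt)

variable {κ : ℝ} {f Λf : ℕ → ℂ} {q : ℕ}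

lemma sum_norm_integral_le [NeZero q] (c₁ c₂ : ℕ → ℂ) (D : Finset ℕ) {T P S₁ S₂ l : ℝ} (hT : 0 < T) (hP : 0 ≤ P)
    (hl : 0 < l) (H : DirichletCharacter ℂ q → ℝ → ℂ) (K : ℝ → ℂ)
    (hH : ∀ χ t, ‖H χ t‖ * ‖K t‖ ≤ P * (1 / (1 + (t / T) ^ 2)))
    (h₁ : ∑ χ : DirichletCharacter ℂ q, ∫ t : ℝ, ‖charPoly c₁ D χ t‖ ^ 2 * (1 / (1 + (t / T) ^ 2)) ≤ S₁)
    (h₂ : ∑ χ : DirichletCharacter ℂ q, ∫ t : ℝ, ‖charPoly c₂ D χ t‖ ^ 2 * (1 / (1 + (t / T) ^ 2)) ≤ S₂) :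
    ∑ χ : DirichletCharacter ℂ q, ‖∫ t : ℝ, charPoly c₁ D χ t * (charPoly c₂ D χ t * H χ t) * K t‖ ≤
      P / 2 * (l * S₁ + l⁻¹ * S₂) := by
  have hi (c : ℕ → ℂ) (χ : DirichletCharacter ℂ q) := integrable_norm_charPoly_sq c D χ hT
  have hpt (χ : DirichletCharacter ℂ q) (t : ℝ) : ‖charPoly c₁ D χ t * (charPoly c₂ D χ t * H χ t) * K t‖ ≤
      P / 2 * (l * (‖charPoly c₁ D χ t‖ ^ 2 * (1 / (1 + (t / T) ^ 2))) +
        l⁻¹ * (‖charPoly c₂ D χ t‖ ^ 2 * (1 / (1 + (t / T) ^ 2)))) := by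
    rw [norm_mul, norm_mul, norm_mul]
    set A := ‖charPoly c₁ D χ t‖
    set B := ‖charPoly c₂ D χ t‖
    have hw : 0 ≤ 1 / (1 + (t / T) ^ 2) := by positivity
    set w := 1 / (1 + (t / T) ^ 2)
    have hAB : A * B ≤ (l * A ^ 2 + l⁻¹ * B ^ 2) / 2 := by
      have : 0 ≤ l⁻¹ * (l * A - B) ^ 2 := by positivity
      have e : l⁻¹ * (l * A - B) ^ 2 = l * A ^ 2 - 2 * (A * B) + l⁻¹ * B ^ 2 := by field_simp; ring
      linarith
    calc A * (B * ‖H χ t‖) * ‖K t‖ = (A * B) * (‖H χ t‖ * ‖K t‖) := by ring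
      _ ≤ ((l * A ^ 2 + l⁻¹ * B ^ 2) / 2) * (P * w) :=
        mul_le_mul hAB (hH χ t) (by positivity) (by positivity)
      _ = P / 2 * (l * (A ^ 2 * w) + l⁻¹ * (B ^ 2 * w)) := by ring
  calc ∑ χ : DirichletCharacter ℂ q, ‖∫ t : ℝ, charPoly c₁ D χ t * (charPoly c₂ D χ t * H χ t) * K t‖
      ≤ ∑ χ : DirichletCharacter ℂ q, P / 2 * (l * (∫ t : ℝ, ‖charPoly c₁ D χ t‖ ^ 2 * (1 / (1 + (t / T) ^ 2))) +
          l⁻¹ * ∫ t : ℝ, ‖charPoly c₂ D χ t‖ ^ 2 * (1 / (1 + (t / T) ^ 2))) := by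
        refine Finset.sum_le_sum fun χ _ => ?_
        have h := norm_integral_le_of_norm_le
          ((((hi c₁ χ).const_mul l).add ((hi c₂ χ).const_mul l⁻¹)).const_mul (P / 2))
          (Filter.Eventually.of_forall (hpt χ))
        refine h.trans (le_of_eq ?_)
        simp only [Pi.add_apply]
        rw [integral_const_mul, integral_add ((hi c₁ χ).const_mul l) ((hi c₂ χ).const_mul l⁻¹), integral_const_mul,
          integral_const_mul]
    _ = P / 2 * (l * (∑ χ : DirichletCharacter ℂ q, ∫ t : ℝ, ‖charPoly c₁ D χ t‖ ^ 2 * (1 / (1 + (t / T) ^ 2))) +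
          l⁻¹ * ∑ χ : DirichletCharacter ℂ q, ∫ t : ℝ, ‖charPoly c₂ D χ t‖ ^ 2 * (1 / (1 + (t / T) ^ 2))) := by
        rw [← Finset.mul_sum, Finset.sum_add_distrib, Finset.mul_sum, Finset.mul_sum]
    _ ≤ P / 2 * (l * S₁ + l⁻¹ * S₂) := by gcongr

lemma sq_le_of_thr_lt (hκ : 0 < κ) (hq : 1 ≤ q) {L : ℝ} (hL : 1 ≤ L) {d : ℕ} (hd : thr κ q L < d) :
    ((q : ℝ) * L ^ κ) ^ 2 ≤ d := by
  have hq1 : (1 : ℝ) ≤ q := by exact_mod_cast hq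
  have hqL : 1 ≤ (q : ℝ) * L := by nlinarith
  have h1 : ((q : ℝ) * L) ^ (2 * κ + 3) ≤ d :=
    (Nat.le_ceil _).trans (by exact_mod_cast hd.le)
  have h2 : ((q : ℝ) * L ^ κ) ^ 2 = (q : ℝ) ^ (2 : ℝ) * L ^ (κ * 2) := by
    rw [mul_pow, Real.rpow_mul (by linarith), Real.rpow_two, Real.rpow_two]
  rw [h2]
  refine le_trans ?_ h1
  rw [Real.mul_rpow (by linarith) (by linarith)]
  gcongr <;> linarith

set_option maxHeartbeats 1000000 in
lemma exists_norm_bilinear_le (hκ : 0 < κ) : ∃ C : ℝ, 0 < C ∧ ∀ f Λf : ℕ → ℂ, IsHalaszClass κ f Λf →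
    ∀ q a : ℕ, 1 ≤ q → a.Coprime q → ∀ x : ℝ, Real.exp 54 ≤ Real.log x → 1 ≤ x → 2 ≤ Real.log x ^ κ →
    ∀ α β : ℝ, 0 ≤ α → α ≤ 1 / Real.log (thr κ q (Real.log x)) → 0 ≤ β → β ≤ 1 / Real.log (thr κ q (Real.log x)) →
    ‖bilinear f Λf (thr κ q (Real.log x)) (weight (Real.log x) (1 / Real.log x ^ κ))
        (progr q a x (1 / Real.log x ^ κ)) α β‖ ≤
      C * (1 / q.totient) * Real.exp ((1 - α) * Real.log x) *
        (maxF f q (Real.log x ^ κ) (1 / Real.log x + β / 2) / (1 / Real.log x + β / 2)) := by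
  obtain ⟨C, hC, hK⟩ := exists_norm_LSeries_mul_perronKernel_le hκ
  refine ⟨1 / (2 * Real.pi) * (C / 2 * (21 * (540 * Real.pi * κ ^ 2)) * Real.exp 2), by positivity, ?_⟩
  intro f Λf hf q a hq ha x hL hx1 hT α β hα hαη hβ hβη
  have : NeZero q := ⟨by omega⟩
  obtain ⟨hy, -, -⟩ := log_thr_bounds hκ hq hL
  set L := Real.log x with hLd
  set y := thr κ q L with hyd
  have hL55 : 55 ≤ L := by have := Real.add_one_le_exp 54; linarith
  have hL0 : 0 < L := by linarith
  set T := L ^ κ with hTd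
  have hT0 : 0 < T := by linarith
  set δ := 1 / T with hδ
  have hδ0 : 0 < δ := by positivity
  have hδ1 : δ ≤ 1 := by rw [hδ, div_le_one hT0]; linarith
  have hlogy : 0 < Real.log y := by linarith
  have hη : 1 / Real.log y ≤ 1 / 160 := one_div_le_one_div_of_le (by norm_num) hy
  have hL' : 1 / L ≤ 1 / 55 := one_div_le_one_div_of_le (by norm_num) hL55
  have hL'0 : 0 < 1 / L := by positivity
  set σ := 1 / L + β / 2 with hσ
  have hσ0 : 0 < σ := by positivity
  set γ := α + β with hγ
  have hγ80 : γ ≤ 1 / 80 := by rw [hγ]; linarith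
  have hγ0 : 0 ≤ γ := by positivity
  have hγy : γ * Real.log y ≤ 2 := by
    have : γ ≤ 2 / Real.log y := by rw [hγ, show (2 : ℝ) / Real.log y = 1 / Real.log y + 1 / Real.log y by ring]; linarith
    rwa [le_div_iff₀ hlogy] at this
  set c := 1 + 1 / L - α - β / 2 with hc
  have hc1 : 1 / 2 ≤ c := by rw [hc]; linarith
  have hc2 : c ≤ 2 := by rw [hc]; linarith
  have hcγ : c + γ = 1 + σ := by rw [hc, hγ, hσ]; ring
  set X := ⌊x * Real.exp δ⌋₊ with hX
  have hxδ : 1 ≤ x * Real.exp δ := by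
    have := Real.one_le_exp hδ0.le
    nlinarith
  have hX1 : 1 ≤ X := Nat.le_floor (by simpa using hxδ)
  have hXL : Real.log X ≤ L + 1 := by
    have h : Real.log X ≤ Real.log (x * Real.exp δ) :=
      Real.log_le_log (by exact_mod_cast hX1) (Nat.floor_le (by linarith))
    rw [Real.log_mul (by linarith) (Real.exp_pos _).ne', Real.log_exp] at h
    linarith
  have hXn (n : ℕ) (hn : X < n) : L + δ ≤ Real.log n := by
    have h : Real.log (x * Real.exp δ) ≤ Real.log n :=
      Real.log_le_log (by linarith) (Nat.lt_of_floor_lt hn).le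
    rwa [Real.log_mul (by linarith) (Real.exp_pos _).ne', Real.log_exp] at h
  have hM0 := maxF_nonneg f q T σ
  set M := maxF f q T σ with hM
  have hX0 : (0 : ℝ) < X := by exact_mod_cast hX1
  set W := 540 * Real.pi * κ ^ 2 with hW
  have hW0 : 0 < W := by positivity
  have hcoef (ρ : ℝ) (hρ : 0 ≤ ρ) : ∑ χ : DirichletCharacter ℂ q, ∫ t : ℝ,
      ‖charPoly (fun d => largePart Λf y d * ((d : ℝ) ^ (-ρ) : ℝ)) (Finset.Ioc y X) χ t‖ ^ 2 *
        (1 / (1 + (t / T) ^ 2)) ≤ W * ∑ d ∈ Finset.Icc 1 X, vonMangoldt d * (d : ℝ) ^ (1 - 2 * ρ) := by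
    refine (sum_integral_norm_charPoly_sq_le_sum_vonMangoldt (κ := κ) (ρ := ρ) hρ hT _ _ (fun d hd => ?_)
      fun d hd => ?_).trans ?_
    · exact sq_le_of_thr_lt hκ hq (by linarith) (Finset.mem_Ioc.1 hd).1
    · have hd1 : 1 ≤ d := by have := (Finset.mem_Ioc.1 hd).1; omega
      rw [norm_mul, Complex.norm_real, Real.norm_of_nonneg (by positivity)]
      exact mul_le_mul_of_nonneg_right (norm_largePart_le hκ hf y hd1) (by positivity)
    · refine mul_le_mul_of_nonneg_left (Finset.sum_le_sum_of_subset_of_nonneg ?_ fun d _ _ => ?_) hW0.le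
      · intro d hd
        rw [Finset.mem_Ioc] at hd
        exact Finset.mem_Icc.2 ⟨by omega, hd.2⟩
      · exact mul_nonneg ArithmeticFunction.vonMangoldt_nonneg (by positivity)
  have h₁ := hcoef (α + c) (by linarith)
  have h₂ := hcoef (γ + c) (by linarith)
  have hs₁ : ∑ d ∈ Finset.Icc 1 X, vonMangoldt d * (d : ℝ) ^ (1 - 2 * (α + c)) ≤ 12 * (X : ℝ) ^ β / σ := by
    rw [show 1 - 2 * (α + c) = -1 - 2 / L + β by rw [hc]; ring]
    exact sum_vonMangoldt_mul_rpow_le hβ (by linarith) (by linarith) hX1 hXL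
  have hs₂ : ∑ d ∈ Finset.Icc 1 X, vonMangoldt d * (d : ℝ) ^ (1 - 2 * (γ + c)) ≤ 9 / σ := by
    rw [show 1 - 2 * (γ + c) = -1 - 2 * σ by rw [add_comm γ, hcγ]; ring]
    refine (sum_vonMangoldt_rpow_le (by positivity) X).trans ?_
    rw [show (8 : ℝ) + 2 / (2 * σ) = (8 * σ + 1) / σ by field_simp]
    gcongr
    rw [hσ]; linarith
  have hXβ0 : 0 < (X : ℝ) ^ (β / 2) := Real.rpow_pos_of_pos hX0 _
  have hmain := sum_norm_integral_le _ _ (Finset.Ioc y X) hT0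
    (mul_nonneg hC.le (mul_nonneg (Real.exp_pos (L * c)).le hM0)) (inv_pos.2 hXβ0)
    (fun χ t => LSeries (charCoef f χ y γ) ((c + γ : ℝ) + t * I)) (fun t => perronKernel L δ ((c : ℂ) + t * I))
    (fun χ t => hK f Λf hf q χ y γ c σ L hγ0 hγ80 hγy hc1 (by linarith) (by linarith) (by linarith) (by linarith) hcγ t)
    h₁ h₂
  have hsq : (X : ℝ) ^ β = (X : ℝ) ^ (β / 2) * (X : ℝ) ^ (β / 2) := by
    rw [← Real.rpow_add hX0]; ring_nf
  have hE : Real.exp (L * c) * (X : ℝ) ^ (β / 2) ≤ Real.exp 2 * Real.exp ((1 - α) * L) := by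
    rw [Real.rpow_def_of_pos hX0, ← Real.exp_add, ← Real.exp_add, Real.exp_le_exp]
    have e : L * c = L + 1 - L * α - L * (β / 2) := by rw [hc]; field_simp
    rw [e]
    nlinarith
  refine (norm_bilinear_le f Λf y (weight L δ) ha x δ α β).trans ?_
  have hB (χ : DirichletCharacter ℂ q) := sum_bilinear_eq_integral hκ hf χ (α := α) hγ0 hγ80 hγy hδ0 hδ1
    (by linarith) hc2 (by linarith) hXn
  calc _ = 1 / q.totient * ((1 / (2 * Real.pi)) * ∑ χ : DirichletCharacter ℂ q, ‖∫ t : ℝ,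
        charPoly (fun d => largePart Λf y d * ((d : ℝ) ^ (-(α + c)) : ℝ)) (Finset.Ioc y X) χ t *
        (charPoly (fun d => largePart Λf y d * ((d : ℝ) ^ (-(γ + c)) : ℝ)) (Finset.Ioc y X) χ t *
          LSeries (charCoef f χ y γ) ((c + γ : ℝ) + t * I)) * perronKernel L δ ((c : ℂ) + t * I)‖) := by
        congr 1
        rw [Finset.mul_sum]
        refine Finset.sum_congr rfl fun χ _ => ?_
        rw [← hX, hB χ, norm_mul, Complex.norm_real, Real.norm_of_nonneg (by positivity)]
    _ ≤ 1 / q.totient * ((1 / (2 * Real.pi)) * (C * (Real.exp (L * c) * M) / 2 *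
        (((X : ℝ) ^ (β / 2))⁻¹ * (W * (12 * (X : ℝ) ^ β / σ)) + ((X : ℝ) ^ (β / 2))⁻¹⁻¹ * (W * (9 / σ))))) := by
        refine mul_le_mul_of_nonneg_left (mul_le_mul_of_nonneg_left (hmain.trans ?_) (by positivity)) (by positivity)
        gcongr
    _ = 1 / q.totient * ((1 / (2 * Real.pi)) * (C / 2 * (21 * W) * (Real.exp (L * c) * (X : ℝ) ^ (β / 2)) * (M / σ))) := by
        rw [hsq]; field_simp; ring
    _ ≤ 1 / q.totient * ((1 / (2 * Real.pi)) * (C / 2 * (21 * W) * (Real.exp 2 * Real.exp ((1 - α) * L)) * (M / σ))) := by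
        gcongr
    _ = _ := by ring

end BilinearBound
section Integration

variable {κ : ℝ} {f Λf : ℕ → ℂ} {q : ℕ}

lemma integral_exp_one_sub_mul_le {L η : ℝ} (hL : 0 < L) :
    ∫ α in (0 : ℝ)..η, Real.exp ((1 - α) * L) ≤ Real.exp L / L := by
  have h : ∀ α ∈ Set.uIcc 0 η, HasDerivAt (fun α : ℝ => -(Real.exp ((1 - α) * L) / L)) (Real.exp ((1 - α) * L)) α := by
    intro α _
    have h1 : HasDerivAt (fun α : ℝ => (1 - α) * L) (-1 * L) α := ((hasDerivAt_id α).const_sub 1).mul_const L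
    exact ((h1.exp.div_const L).neg).congr_deriv (by field_simp)
  rw [intervalIntegral.integral_eq_sub_of_hasDerivAt h ((by fun_prop : Continuous _).intervalIntegrable _ _)]
  have : 0 < Real.exp ((1 - η) * L) / L := by positivity
  simp only [sub_zero, one_mul]
  linarith

lemma norm_integral_integral_le {b : ℝ → ℝ → ℂ} {m : ℝ → ℝ} {L η P : ℝ} (hL : 2 ≤ L) (hη : 0 ≤ η) (hη1 : η ≤ 1)
    (hP : 0 ≤ P) (hm : IntervalIntegrable m volume (1 / L) 1) (hm0 : ∀ σ, 0 < σ → 0 ≤ m σ)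
    (hb : ∀ α β, 0 ≤ α → α ≤ η → 0 ≤ β → β ≤ η → ‖b α β‖ ≤ P * Real.exp ((1 - α) * L) * m (1 / L + β / 2)) :
    ‖∫ α in (0 : ℝ)..η, ∫ β in (0 : ℝ)..η, b α β‖ ≤ P * (Real.exp L / L) * (2 * ∫ σ in (1 / L)..1, m σ) := by
  have hL0 : 0 < L := by linarith
  have hL1 : 0 < 1 / L := by positivity
  have hL2 : 1 / L ≤ 1 / 2 := one_div_le_one_div_of_le (by norm_num) hL
  have hsub : IntervalIntegrable m volume (1 / L + 0 / 2) (1 / L + η / 2) := by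
    refine hm.mono_set ?_
    rw [Set.uIcc_of_le (by linarith), Set.uIcc_of_le (by linarith)]
    exact Set.Icc_subset_Icc (by linarith) (by linarith)
  have hh : IntervalIntegrable (fun β => m (1 / L + β / 2)) volume 0 η := by
    have h := (hsub.comp_add_left (1 / L)).comp_mul_left (c := 2⁻¹)
    convert h using 2 <;> ring_nf
  set J := ∫ σ in (1 / L)..1, m σ with hJ
  have hJ0 : 0 ≤ J := intervalIntegral.integral_nonneg (by linarith) fun σ hσ => hm0 σ (lt_of_lt_of_le hL1 hσ.1)
  have hint : ∫ β in (0 : ℝ)..η, m (1 / L + β / 2) ≤ 2 * J := by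
    rw [intervalIntegral.integral_comp_add_div m two_ne_zero, smul_eq_mul]
    refine mul_le_mul_of_nonneg_left ?_ two_pos.le
    refine intervalIntegral.integral_mono_interval (by linarith) (by linarith) (by linarith) ?_ hm
    refine (ae_restrict_iff' measurableSet_Ioc).2 (Filter.Eventually.of_forall fun σ hσ => ?_)
    exact hm0 σ (hL1.trans hσ.1)
  have hinner (α : ℝ) (h0 : 0 ≤ α) (h1 : α ≤ η) :
      ‖∫ β in (0 : ℝ)..η, b α β‖ ≤ P * (2 * J) * Real.exp ((1 - α) * L) := by
    have h := intervalIntegral.norm_integral_le_of_norm_le (f := fun β => b α β)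
      (g := fun β => P * Real.exp ((1 - α) * L) * m (1 / L + β / 2)) hη
      (Filter.Eventually.of_forall fun β hβ => hb α β h0 h1 hβ.1.le hβ.2) (hh.const_mul _)
    refine h.trans ?_
    rw [intervalIntegral.integral_const_mul]
    calc _ ≤ P * Real.exp ((1 - α) * L) * (2 * J) := by gcongr
      _ = _ := by ring
  refine (intervalIntegral.norm_integral_le_of_norm_le (g := fun α => P * (2 * J) * Real.exp ((1 - α) * L)) hη
    (Filter.Eventually.of_forall fun α hα => hinner α hα.1.le hα.2)
    ((by fun_prop : Continuous _).intervalIntegrable _ _)).trans ?_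
  rw [intervalIntegral.integral_const_mul]
  calc _ ≤ P * (2 * J) * (Real.exp L / L) := by
        gcongr
        exact integral_exp_one_sub_mul_le hL0
    _ = _ := by ring

lemma exists_norm_sum_le (hκ : 0 < κ) : ∃ C : ℝ, 0 < C ∧ ∀ f Λf : ℕ → ℂ, IsHalaszClass κ f Λf →
    ∀ q a : ℕ, 1 ≤ q → a.Coprime q → ∀ x : ℝ, (q : ℝ) ^ 4 ≤ x → C ≤ x →
    ‖∑ n ∈ (Finset.Icc 1 ⌊x⌋₊).filter (fun n => n ≡ a [MOD q]), f n‖ ≤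
      C * (1 / (q.totient : ℝ)) * (x / Real.log x) *
        ((∫ σ in (1 / Real.log x)..1, maxF f q (Real.log x ^ κ) σ / σ) + Real.log (q * Real.log x) ^ κ) := by
  obtain ⟨C₁, hC₁, h₁⟩ := exists_norm_sum_le_bilinear hκ
  obtain ⟨C₂, hC₂, h₂⟩ := exists_norm_bilinear_le hκ
  obtain ⟨C₃, hC₃, h₃⟩ := exists_log_large κ
  refine ⟨C₁ + 2 * C₂ + C₃ + Real.exp (2 ^ (1 / κ)), by positivity, ?_⟩
  intro f Λf hf q a hq ha x hqx hCx
  have he : 0 < Real.exp (2 ^ (1 / κ)) := Real.exp_pos _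
  obtain ⟨hL, hLκ⟩ := h₃ x (by linarith)
  have hx : Real.exp (2 ^ (1 / κ)) ≤ x := by linarith
  have hx0 : 0 < x := by linarith
  have hT : 2 ≤ Real.log x ^ κ := by
    have h := (Real.le_log_iff_exp_le hx0).2 hx
    have h' := Real.rpow_le_rpow (by positivity) h hκ.le
    rwa [← Real.rpow_mul (by norm_num), one_div_mul_cancel hκ.ne', Real.rpow_one] at h'
  have hx1 : 1 ≤ x := le_trans (Real.one_le_exp (by positivity)) hx
  obtain ⟨hy, -, hlq⟩ := log_thr_bounds hκ hq hL
  have hL55 : 55 ≤ Real.log x := by have := Real.add_one_le_exp 54; linarith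
  have hb := h₁ f Λf hf q a hq ha x hqx hL hLκ _ rfl
  set η := 1 / Real.log (thr κ q (Real.log x)) with hη
  have hη0 : 0 ≤ η := by rw [hη]; exact one_div_nonneg.2 (by linarith)
  have hη1 : η ≤ 1 := by rw [hη, div_le_one (by linarith)]; linarith
  have h1L : 1 / Real.log x ≤ 1 := by rw [div_le_one (by linarith)]; linarith
  have h1L0 : 0 < 1 / Real.log x := by apply one_div_pos.2; linarith
  have hI := norm_integral_integral_le (b := fun α β => bilinear f Λf (thr κ q (Real.log x))
      (weight (Real.log x) (1 / Real.log x ^ κ)) (progr q a x (1 / Real.log x ^ κ)) α β)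
    (m := fun σ => maxF f q (Real.log x ^ κ) σ / σ) (L := Real.log x) (P := C₂ * (1 / q.totient)) (by linarith) hη0 hη1
    (by positivity) (intervalIntegrable_maxF_div hκ hf q h1L0 h1L (by linarith))
    (fun σ hσ => div_nonneg (maxF_nonneg ..) hσ.le)
    (fun α β hα hα' hβ hβ' => h₂ f Λf hf q a hq ha x hL hx1 hT α β hα hα' hβ hβ')
  rw [Real.exp_log hx0] at hI
  have hJ0 : 0 ≤ ∫ σ in (1 / Real.log x)..1, maxF f q (Real.log x ^ κ) σ / σ :=
    intervalIntegral.integral_nonneg h1L fun σ hσ => div_nonneg (maxF_nonneg ..) (h1L0.le.trans hσ.1)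
  have hlog0 : 0 ≤ Real.log (q * Real.log x) ^ κ := Real.rpow_nonneg (by linarith) κ
  have hP0 : 0 ≤ 1 / (q.totient : ℝ) * (x / Real.log x) := by
    have : 0 < Real.log x := by linarith
    positivity
  set J := ∫ σ in (1 / Real.log x)..1, maxF f q (Real.log x ^ κ) σ / σ
  set Q := Real.log (q * Real.log x) ^ κ
  calc _ ≤ C₁ * (1 / q.totient * (x / Real.log x) * Q) + C₂ * (1 / q.totient) * (x / Real.log x) * (2 * J) :=
        hb.trans (add_le_add_right hI _)
    _ = 1 / (q.totient : ℝ) * (x / Real.log x) * (C₁ * Q + 2 * C₂ * J) := by ring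
    _ ≤ 1 / (q.totient : ℝ) * (x / Real.log x) * ((C₁ + 2 * C₂ + C₃ + Real.exp (2 ^ (1 / κ))) * Q +
        (C₁ + 2 * C₂ + C₃ + Real.exp (2 ^ (1 / κ))) * J) := by
        gcongr <;> linarith
    _ = _ := by ring

end Integration
end Halasz

theorem halasz_arith_progressions (κ : ℝ) (hκ : 0 < κ) :
    ∃ C : ℝ, 0 < C ∧ ∀ f Λf : ℕ → ℂ, IsHalaszClass κ f Λf →
    ∀ q a : ℕ, 1 ≤ q → Nat.Coprime a q →
    ∀ x : ℝ, (q : ℝ) ^ 4 ≤ x → C ≤ x →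
    ‖∑ n ∈ (Finset.Icc 1 ⌊x⌋₊).filter (fun n : ℕ => (n : ZMod q) = (a : ZMod q)), f n‖ ≤
      C * (1 / (q.totient : ℝ)) * (x / Real.log x) *
        ((∫ σ in (1 / Real.log x)..1,
            (⨆ p : DirichletCharacter ℂ q × {t : ℝ // |t| ≤ Real.log x ^ κ},
              ‖FserChi f p.1 (1 + (σ : ℂ) + ((p.2 : ℝ) : ℂ) * Complex.I) /
                (1 + (σ : ℂ) + ((p.2 : ℝ) : ℂ) * Complex.I)‖) / σ)
          + Real.log ((q : ℝ) * Real.log x) ^ κ) := by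
  obtain ⟨C, hC, h⟩ := Halasz.exists_norm_sum_le hκ
  refine ⟨C, hC, fun f Λf hf q a hq ha x hqx hCx => ?_⟩
  simp only [ZMod.natCast_eq_natCast_iff]
  convert h f Λf hf q a hq ha x hqx hCx
  rfl
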